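/- There exists a natural number k which is a difference of two primes such that every positive multiple of k can be written as a product of two differences of primes, i.e. k ∈ ℙ − ℙ and k·ℕ ⊆ (ℙ − ℙ)·(ℙ − ℙ). -/

import Mathlib

/-- `ℙ − ℙ` : the set of positive differences of primes. -/
def primeDiff : Set ℕ :=
  { d | ∃ p q : ℕ, p.Prime ∧ q.Prime ∧ q < p ∧ d = p - q }

namespace PD

/-- The tuple statement. -/
def DHL : Prop := ∃ k L : ℕ, 0 < L ∧ ∀ h : Fin k → ℕ, Function.Injective h → (∀ i, L ∣ h i) →
  ∃ i j, h j < h i ∧ h i - h j ∈ primeDiff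

lemma fs_partial (n : ℕ) : ∀ a : Stream' ℕ+, ∃ m ∈ Hindman.FS a,
    (m : ℕ) = ∑ l ∈ Finset.range (n + 1), (a.get l : ℕ) := by
  induction n with
  | zero =>
    intro a
    exact ⟨a.head, Hindman.FS.head' a, by simp [Stream'.head]⟩
  | succ n ih =>
    intro a
    obtain ⟨m, hm, hm'⟩ := ih a.tail
    refine ⟨a.head + m, Hindman.FS.cons' a m hm, ?_⟩
    rw [Finset.sum_range_succ', PNat.add_coe, hm', add_comm]
    congr 1

lemma fs_drop (n : ℕ) (a : Stream' ℕ+) : Hindman.FS (a.drop n) ⊆ Hindman.FS a :=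
  Hindman.FS_iter_tail_sub_FS a n

lemma dhl_mult {k L : ℕ} (hL : 0 < L) (H : ∀ h : Fin k → ℕ, Function.Injective h →
    (∀ i, L ∣ h i) → ∃ i j, h j < h i ∧ h i - h j ∈ primeDiff) (n : ℕ) (hn : 0 < n) :
    ∃ a, 0 < a ∧ a < k ∧ a * L * n ∈ primeDiff := by
  obtain ⟨i, j, h1, h2⟩ := H (fun i => i.1 * L * n) (fun i j hij => by
      have : (i.1 * (L * n)) = j.1 * (L * n) := by simpa [mul_assoc] using hij
      exact Fin.ext (Nat.eq_of_mul_eq_mul_right (by positivity) this))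
      (fun i => ⟨i.1 * n, by ring⟩)
  refine ⟨i.1 - j.1, ?_, by omega, ?_⟩
  · by_contra h0
    have : i.1 ≤ j.1 := by omega
    have : i.1 * L * n ≤ j.1 * L * n := by gcongr
    omega
  · rw [Nat.sub_mul, Nat.sub_mul]; exact h2

lemma dhl_common {k L : ℕ} (hL : 0 < L) (H : ∀ h : Fin k → ℕ, Function.Injective h →
    (∀ i, L ∣ h i) → ∃ i j, h j < h i ∧ h i - h j ∈ primeDiff) (C : Finset ℕ)
    (hC : ∀ c ∈ C, 0 < c) : ∃ t, 0 < t ∧ ∀ c ∈ C, c * L * t ∈ primeDiff := by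
  by_contra hcon
  push Not at hcon
  let s : Set (Set ℕ+) := (fun c : ℕ => {t : ℕ+ | c * L * t ∉ primeDiff}) '' (C : Set ℕ)
  have sfin : s.Finite := C.finite_toSet.image _
  obtain ⟨c', hc', a, ha⟩ := Hindman.exists_FS_of_finite_cover (M := ℕ+) s sfin (by
    intro t _
    obtain ⟨c, hc, h⟩ := hcon t t.pos
    exact ⟨_, ⟨c, hc, rfl⟩, h⟩)
  obtain ⟨c, hc, rfl⟩ := hc'
  have hc0 := hC c hc
  let p : ℕ → ℕ := fun i => ∑ l ∈ Finset.range i, (a.get l : ℕ)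
  have hp : StrictMono p := by
    apply strictMono_nat_of_lt_succ
    intro n
    simp only [p, Finset.sum_range_succ]
    have := (a.get n).pos
    omega
  obtain ⟨i, j, h1, h2⟩ := H (fun i => c * L * p i.1) (fun i j hij => by
      exact Fin.ext (hp.injective (Nat.eq_of_mul_eq_mul_left (by positivity) hij)))
      (fun i => ⟨c * p i.1, by ring⟩)
  have hij : j.1 < i.1 := by
    by_contra h0
    have : p i.1 ≤ p j.1 := hp.monotone (by omega)
    have : c * L * p i.1 ≤ c * L * p j.1 := by gcongr
    exact absurd h1 (not_lt.mpr this)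
  obtain ⟨d, hd⟩ : ∃ d, i.1 = j.1 + (d + 1) := ⟨i.1 - j.1 - 1, by omega⟩
  obtain ⟨m, hm, hm'⟩ := fs_partial d (a.drop j.1)
  have h3 := ha (fs_drop _ _ hm)
  apply h3
  have : p i.1 - p j.1 = m := by
    rw [hm']
    simp only [p]
    rw [hd, Finset.sum_range_add]
    simp [Stream'.get_drop, add_comm]
  rw [← this, Nat.mul_sub]
  exact h2

theorem final_of_DHL (H : DHL) : ∃ k ∈ primeDiff, ∀ n : ℕ, 0 < n →
      ∃ a ∈ primeDiff, ∃ b ∈ primeDiff, k * n = a * b := by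
  obtain ⟨k, L, hL, H⟩ := H
  have hdvd : ∀ a, 0 < a → a < k → a ∣ k.factorial := fun a h1 h2 => Nat.dvd_factorial h1 h2.le
  have hf : 0 < k.factorial := Nat.factorial_pos k
  -- final modulus `P * L * t`
  obtain ⟨t, ht, h⟩ := dhl_common hL H
    (insert (k.factorial * L) ((Finset.Ioo 0 k).image (fun a => k.factorial / a))) (by
      intro c hc
      simp only [Finset.mem_insert, Finset.mem_image, Finset.mem_Ioo] at hc
      rcases hc with rfl | ⟨a, ⟨h1, h2⟩, rfl⟩
      · positivity
      · exact Nat.div_pos (Nat.le_of_dvd hf (hdvd a h1 h2)) h1)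
  refine ⟨k.factorial * L * L * t, h _ (by simp), ?_⟩
  intro n hn
  obtain ⟨a, ha1, ha2, ha⟩ := dhl_mult hL H n hn
  refine ⟨a * L * n, ha, k.factorial / a * L * t, h _ (by
    simp only [Finset.mem_insert, Finset.mem_image, Finset.mem_Ioo]
    exact Or.inr ⟨a, ⟨ha1, ha2⟩, rfl⟩), ?_⟩
  obtain ⟨q, hq⟩ := hdvd a ha1 ha2
  rw [hq, Nat.mul_div_cancel_left _ ha1]
  ring

end PD

namespace PD
open Finset

lemma abel_identity (f : ℕ → ℝ) (a : ℕ → ℂ) (t : ℕ) :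
    ∑ m ∈ Ioc 0 t, (f m : ℂ) * a m = f t * ∑ m ∈ Ioc 0 t, a m -
      ∑ m ∈ range t, ((f (m + 1) - f m : ℝ) : ℂ) * ∑ l ∈ Ioc 0 m, a l := by
  induction t with
  | zero => simp
  | succ t ih =>
    rw [Finset.sum_Ioc_succ_top (Nat.zero_le t), ih, Finset.sum_Ioc_succ_top (Nat.zero_le t),
      Finset.sum_range_succ]
    push_cast
    ring

lemma abel_mono {f : ℕ → ℝ} (hf : Monotone f) (h0 : 0 ≤ f 0) {a : ℕ → ℂ} {B : ℝ}
    (hB : ∀ t, ‖∑ m ∈ Ioc 0 t, a m‖ ≤ B) (t : ℕ) :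
    ‖∑ m ∈ Ioc 0 t, (f m : ℂ) * a m‖ ≤ 2 * B * f t := by
  have hB0 : 0 ≤ B := (norm_nonneg _).trans (hB 0)
  have hft : 0 ≤ f t := h0.trans (hf (Nat.zero_le t))
  rw [abel_identity]
  have h1 : ‖(f t : ℂ) * ∑ m ∈ Ioc 0 t, a m‖ ≤ f t * B := by
    rw [norm_mul, Complex.norm_real, Real.norm_of_nonneg hft]
    gcongr
    exact hB t
  have h2 : ‖∑ m ∈ range t, ((f (m + 1) - f m : ℝ) : ℂ) * ∑ l ∈ Ioc 0 m, a l‖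
      ≤ ∑ m ∈ range t, (f (m + 1) - f m) * B := by
    refine norm_sum_le_of_le _ fun m _ => ?_
    have : 0 ≤ f (m + 1) - f m := sub_nonneg.2 (hf (Nat.le_succ m))
    rw [norm_mul, Complex.norm_real, Real.norm_of_nonneg this]
    gcongr
    exact hB m
  rw [← Finset.sum_mul, Finset.sum_range_sub] at h2
  have h3 : (f t - f 0) * B ≤ f t * B := by
    gcongr
    linarith
  calc _ ≤ _ := norm_sub_le _ _
    _ ≤ f t * B + f t * B := by linarith
    _ = _ := by ring

section ls
variable {ι : Type*} [Fintype ι] [DecidableEq ι]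

lemma normSq_sum_expand (S : Finset ℕ) (b : ι → ℕ → ℂ) :
    ((∑ n ∈ S, ‖∑ i, b i n‖ ^ 2 : ℝ) : ℂ) =
      ∑ i, ∑ j, ∑ n ∈ S, b i n * (starRingEnd ℂ) (b j n) := by
  push_cast
  have : ∀ n ∈ S, ((‖∑ i, b i n‖ : ℂ)) ^ 2 = ∑ i, ∑ j, b i n * (starRingEnd ℂ) (b j n) := by
    intro n _
    rw [← Complex.mul_conj', map_sum, Finset.sum_mul_sum]
  rw [Finset.sum_congr rfl this, Finset.sum_comm]
  refine Finset.sum_congr rfl fun i _ => ?_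
  rw [Finset.sum_comm]

lemma quad_bound (S : Finset ℕ) (χ : ι → ℕ → ℂ) (b : ι → ℂ) {T B : ℝ} (hB : 0 ≤ B)
    (hT : ∀ i, ‖∑ n ∈ S, χ i n * (starRingEnd ℂ) (χ i n)‖ ≤ T)
    (hoff : ∀ i j, i ≠ j → ‖∑ n ∈ S, χ i n * (starRingEnd ℂ) (χ j n)‖ ≤ B) :
    ∑ n ∈ S, ‖∑ i, b i * χ i n‖ ^ 2 ≤ (T + Fintype.card ι * B) * ∑ i, ‖b i‖ ^ 2 := by
  have h := normSq_sum_expand S (fun i n => b i * χ i n)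
  have h0 : (0:ℝ) ≤ ∑ n ∈ S, ‖∑ i, b i * χ i n‖ ^ 2 := by positivity
  have h1 : ∑ n ∈ S, ‖∑ i, b i * χ i n‖ ^ 2 ≤
      ∑ i, ∑ j, ((if i = j then T * ‖b i‖ ^ 2 else 0) + B * (‖b i‖ * ‖b j‖)) := by
    rw [← Real.norm_of_nonneg h0, ← Complex.norm_real, h]
    refine norm_sum_le_of_le _ fun i _ => norm_sum_le_of_le _ fun j _ => ?_
    have : ∑ n ∈ S, b i * χ i n * (starRingEnd ℂ) (b j * χ j n)
        = b i * (starRingEnd ℂ) (b j) * ∑ n ∈ S, χ i n * (starRingEnd ℂ) (χ j n) := by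
      rw [Finset.mul_sum]
      refine Finset.sum_congr rfl fun n _ => ?_
      rw [map_mul]; ring
    rw [this, norm_mul, norm_mul, RCLike.norm_conj]
    split_ifs with hij
    · subst hij
      have := mul_le_mul_of_nonneg_left (hT i) (by positivity : 0 ≤ ‖b i‖ * ‖b i‖)
      have : 0 ≤ B * (‖b i‖ * ‖b i‖) := by positivity
      nlinarith
    · have := mul_le_mul_of_nonneg_left (hoff i j hij) (by positivity : 0 ≤ ‖b i‖ * ‖b j‖)
      nlinarith
  refine h1.trans ?_
  simp only [Finset.sum_add_distrib, Finset.sum_ite_eq, Finset.mem_univ, if_true,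
    ← Finset.mul_sum]
  rw [add_mul]
  have h2 : ∑ i, ∑ j, ‖b i‖ * ‖b j‖ = (∑ i, ‖b i‖) ^ 2 := by
    rw [sq, Finset.sum_mul_sum]
  have h3 : (∑ i, ‖b i‖) ^ 2 ≤ Fintype.card ι * ∑ i, ‖b i‖ ^ 2 := by
    simpa using sq_sum_le_card_mul_sum_sq (s := (Finset.univ : Finset ι)) (f := fun i => ‖b i‖)
  simp only [← Finset.mul_sum] at h2
  rw [h2]
  have := mul_le_mul_of_nonneg_left h3 hB
  nlinarith

lemma large_sieve (S : Finset ℕ) (χ : ι → ℕ → ℂ) (a : ℕ → ℂ) {T B : ℝ} (hB : 0 ≤ B)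
    (hT0 : 0 ≤ T)
    (hT : ∀ i, ‖∑ n ∈ S, χ i n * (starRingEnd ℂ) (χ i n)‖ ≤ T)
    (hoff : ∀ i j, i ≠ j → ‖∑ n ∈ S, χ i n * (starRingEnd ℂ) (χ j n)‖ ≤ B) :
    ∑ i, ‖∑ n ∈ S, a n * χ i n‖ ^ 2 ≤ (T + Fintype.card ι * B) * ∑ n ∈ S, ‖a n‖ ^ 2 := by
  set z : ι → ℂ := fun i => ∑ n ∈ S, a n * χ i n with hz
  set s := ∑ i, ‖z i‖ ^ 2 with hs
  have hs0 : 0 ≤ s := by positivity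
  have h1 : (s : ℂ) = ∑ n ∈ S, a n * ∑ i, (starRingEnd ℂ) (z i) * χ i n := by
    rw [hs]; push_cast
    simp only [Finset.mul_sum]
    rw [Finset.sum_comm]
    refine Finset.sum_congr rfl fun i _ => ?_
    rw [← Complex.mul_conj']
    conv_lhs => rw [hz]
    simp only
    rw [Finset.sum_mul]
    refine Finset.sum_congr rfl fun n _ => ?_
    ring
  have h2 : s ≤ ∑ n ∈ S, ‖a n‖ * ‖∑ i, (starRingEnd ℂ) (z i) * χ i n‖ := by
    rw [← Real.norm_of_nonneg hs0, ← Complex.norm_real, h1]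
    exact norm_sum_le_of_le _ fun n _ => by rw [norm_mul]
  have h3 := Finset.sum_mul_sq_le_sq_mul_sq S (fun n => ‖a n‖)
    (fun n => ‖∑ i, (starRingEnd ℂ) (z i) * χ i n‖)
  have h4 := quad_bound S χ (fun i => (starRingEnd ℂ) (z i)) hB hT hoff
  simp only [RCLike.norm_conj] at h4
  have h5 : s ^ 2 ≤ (∑ n ∈ S, ‖a n‖ ^ 2) * ((T + Fintype.card ι * B) * s) := by
    calc s ^ 2 ≤ _ := pow_le_pow_left₀ hs0 h2 2
      _ ≤ _ := h3
      _ ≤ _ := by gcongr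
  rcases hs0.eq_or_lt with h | h
  · rw [← h]; positivity
  · have : s * s ≤ ((T + Fintype.card ι * B) * ∑ n ∈ S, ‖a n‖ ^ 2) * s := by nlinarith
    exact le_of_mul_le_mul_right this h

end ls
end PD

namespace PD
open Finset ArithmeticFunction

/-- A finite family of completely multiplicative functions with cancellation. -/
structure Fam {ι : Type*} (χ : ι → ℕ → ℂ) (B : ℝ) : Prop where
  mul : ∀ i m n, χ i (m * n) = χ i m * χ i n
  le : ∀ i n, ‖χ i n‖ ≤ 1
  sum1 : ∀ i t, ‖∑ m ∈ Ioc 0 t, χ i m‖ ≤ B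
  sum2 : ∀ i j, i ≠ j → ∀ t, ‖∑ m ∈ Ioc 0 t, χ i m * (starRingEnd ℂ) (χ j m)‖ ≤ B

/-- low part of an arithmetic function -/
noncomputable def lowAF (f : ArithmeticFunction ℝ) (V : ℕ) : ArithmeticFunction ℝ :=
  ⟨fun n => if n ≤ V then f n else 0, by simp⟩

/-- high part of an arithmetic function -/
noncomputable def highAF (f : ArithmeticFunction ℝ) (V : ℕ) : ArithmeticFunction ℝ :=
  ⟨fun n => if n ≤ V then 0 else f n, by simp⟩

lemma lowAF_apply (f : ArithmeticFunction ℝ) (V n : ℕ) :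
    lowAF f V n = if n ≤ V then f n else 0 := rfl

lemma highAF_apply (f : ArithmeticFunction ℝ) (V n : ℕ) :
    highAF f V n = if n ≤ V then 0 else f n := rfl

lemma low_add_high (f : ArithmeticFunction ℝ) (V : ℕ) : lowAF f V + highAF f V = f := by
  ext n
  simp only [ArithmeticFunction.add_apply, lowAF_apply, highAF_apply]
  split_ifs <;> simp

/-- real Möbius function -/
noncomputable def muR : ArithmeticFunction ℝ := ((moebius : ArithmeticFunction ℤ) : ArithmeticFunction ℝ)

/-- real zeta function -/
noncomputable def zetaR : ArithmeticFunction ℝ := ((zeta : ArithmeticFunction ℕ) : ArithmeticFunction ℝ)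

lemma muR_zetaR : muR * zetaR = 1 := coe_moebius_mul_coe_zeta

lemma vaughan (U V : ℕ) : vonMangoldt = lowAF vonMangoldt V + lowAF muR U * log
    - lowAF muR U * (lowAF vonMangoldt V * zetaR)
    + (highAF muR U * zetaR) * highAF vonMangoldt V := by
  have h1 : log = vonMangoldt * zetaR := vonMangoldt_mul_zeta.symm
  have h2 := low_add_high vonMangoldt V
  have h3 := low_add_high muR U
  have h4 := muR_zetaR
  rw [h1]
  generalize lowAF vonMangoldt V = a at *
  generalize highAF vonMangoldt V = b at *
  generalize lowAF muR U = c at *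
  generalize highAF muR U = d at *
  rw [← h2]
  rw [← h3] at h4
  have : b = (c + d) * zetaR * b := by rw [h4, one_mul]
  linear_combination this

lemma muR_abs_le (n : ℕ) : |muR n| ≤ 1 := by
  unfold muR
  rw [intCoe_apply]
  exact_mod_cast abs_moebius_le_one

lemma twist_sum (f g : ArithmeticFunction ℝ) {X : ℕ → ℂ} (hX : ∀ m n, X (m * n) = X m * X n)
    (N : ℕ) : ∑ n ∈ Ioc 0 N, ((f * g) n : ℂ) * X n
      = ∑ n ∈ Ioc 0 N, (f n : ℂ) * X n * ∑ m ∈ Ioc 0 (N / n), (g m : ℂ) * X m := by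
  let tw : ArithmeticFunction ℝ → ArithmeticFunction ℂ := fun f => ⟨fun n => (f n : ℂ) * X n, by simp⟩
  have h : tw (f * g) = tw f * tw g := by
    ext n
    rw [mul_apply]
    change ((f * g) n : ℂ) * X n = _
    rw [mul_apply]
    push_cast
    rw [Finset.sum_mul]
    refine Finset.sum_congr rfl fun p hp => ?_
    have := (Nat.mem_divisorsAntidiagonal.1 hp).1
    change _ = ((f p.1 : ℂ) * X p.1) * ((g p.2 : ℂ) * X p.2)
    rw [← this, hX]
    ring
  have := sum_Ioc_mul_eq_sum_sum (tw f) (tw g) N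
  rw [← h] at this
  exact this

lemma sum_inv_le (x : ℕ) : ∑ m ∈ Ioc 0 x, (1 : ℝ) / m ≤ 1 + Real.log x := by
  have h := harmonic_le_one_add_log x
  refine le_trans (le_of_eq ?_) h
  rw [harmonic_eq_sum_Icc]
  push_cast
  refine Finset.sum_congr (by ext; simp [Nat.succ_le_iff]; ) fun _ _ => by simp

lemma sum_conv_div_le (f g : ArithmeticFunction ℝ) (hf : ∀ n, 0 ≤ f n) (hg : ∀ n, 0 ≤ g n)
    (x : ℕ) : ∑ n ∈ Ioc 0 x, (f * g) n / n ≤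
      (∑ n ∈ Ioc 0 x, f n / n) * ∑ n ∈ Ioc 0 x, g n / n := by
  let tw : ArithmeticFunction ℝ → ArithmeticFunction ℝ := fun f => ⟨fun n => f n / n, by simp⟩
  have h : tw (f * g) = tw f * tw g := by
    ext n
    rw [mul_apply]
    change (f * g) n / n = _
    rw [mul_apply, Finset.sum_div]
    refine Finset.sum_congr rfl fun p hp => ?_
    have := (Nat.mem_divisorsAntidiagonal.1 hp).1
    change _ = (f p.1 / p.1) * (g p.2 / p.2)
    rw [← this]
    push_cast
    rw [div_mul_div_comm]
  have h2 := sum_Ioc_mul_eq_sum_prod_filter (tw f) (tw g) x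
  rw [← h] at h2
  change ∑ n ∈ Ioc 0 x, (f * g) n / n = _ at h2
  rw [h2, Finset.sum_mul_sum, ← Finset.sum_product']
  refine Finset.sum_le_sum_of_subset_of_nonneg (Finset.filter_subset _ _) fun p _ _ => ?_
  exact mul_nonneg (div_nonneg (hf p.1) (Nat.cast_nonneg _)) (div_nonneg (hg p.2) (Nat.cast_nonneg _))

/-- real divisor function -/
noncomputable def tauR : ArithmeticFunction ℝ := zetaR * zetaR

lemma zetaR_apply (n : ℕ) : zetaR n = if n = 0 then 0 else 1 := by
  unfold zetaR
  rw [natCoe_apply, zeta_apply]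
  split_ifs <;> simp

lemma tauR_apply (n : ℕ) : tauR n = (n.divisors.card : ℝ) := by
  unfold tauR
  rw [mul_apply, ← Nat.map_div_right_divisors, Finset.sum_map]
  rw [Finset.card_eq_sum_ones]
  push_cast
  refine Finset.sum_congr rfl fun d hd => ?_
  have h1 := Nat.pos_of_mem_divisors hd
  have h2 := Nat.div_pos (Nat.divisor_le hd) h1
  change zetaR d * zetaR (n / d) = 1
  rw [zetaR_apply, zetaR_apply, if_neg h1.ne', if_neg h2.ne', one_mul]

lemma tauR_nonneg (n : ℕ) : 0 ≤ tauR n := by rw [tauR_apply]; positivity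

lemma tauR_mul_le (m n : ℕ) : tauR (m * n) ≤ tauR m * tauR n := by
  simp only [tauR_apply]
  rw [Nat.divisors_mul]
  exact_mod_cast Finset.card_mul_le

lemma zetaR_nonneg (n : ℕ) : 0 ≤ zetaR n := by rw [zetaR_apply]; split_ifs <;> simp

lemma sum_tau_sq_le (x : ℕ) : ∑ m ∈ Ioc 0 x, tauR m ^ 2 / m ≤ (1 + Real.log x) ^ 4 := by
  have hz : ∑ m ∈ Ioc 0 x, zetaR m / m ≤ 1 + Real.log x := by
    refine le_trans (le_of_eq ?_) (sum_inv_le x)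
    refine Finset.sum_congr rfl fun m hm => ?_
    rw [zetaR_apply, if_neg (by simp at hm; omega)]
  have hz0 : 0 ≤ ∑ m ∈ Ioc 0 x, zetaR m / m :=
    Finset.sum_nonneg fun m _ => div_nonneg (zetaR_nonneg m) (by positivity)
  have h1 : ∑ m ∈ Ioc 0 x, tauR m / m ≤ (1 + Real.log x) ^ 2 := by
    have := sum_conv_div_le zetaR zetaR zetaR_nonneg zetaR_nonneg x
    refine this.trans ?_
    rw [sq]
    gcongr
  have h10 : 0 ≤ ∑ m ∈ Ioc 0 x, tauR m / m :=
    Finset.sum_nonneg fun m _ => div_nonneg (tauR_nonneg m) (by positivity)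
  have h2 : ∀ m, tauR m ^ 2 ≤ (tauR * tauR) m := by
    intro m
    rw [mul_apply]
    calc tauR m ^ 2 = tauR m * ∑ p ∈ m.divisorsAntidiagonal, zetaR p.1 * zetaR p.2 := by
          rw [sq]; congr 1
      _ = ∑ p ∈ m.divisorsAntidiagonal, tauR m := by
          rw [Finset.mul_sum]
          refine Finset.sum_congr rfl fun p hp => ?_
          obtain ⟨hp1, hp2⟩ := Nat.mem_divisorsAntidiagonal.1 hp
          have h1 : p.1 ≠ 0 := by rintro h; simp [h] at hp1; exact hp2 hp1.symm
          have h2 : p.2 ≠ 0 := by rintro h; simp [h] at hp1; exact hp2 hp1.symm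
          simp [zetaR_apply, h1, h2]
      _ ≤ _ := by
          refine Finset.sum_le_sum fun p hp => ?_
          obtain ⟨hp1, hp2⟩ := Nat.mem_divisorsAntidiagonal.1 hp
          rw [← hp1]
          exact tauR_mul_le _ _
  calc _ ≤ ∑ m ∈ Ioc 0 x, (tauR * tauR) m / m := by
        refine Finset.sum_le_sum fun m _ => ?_
        gcongr
        exact h2 m
    _ ≤ _ := sum_conv_div_le tauR tauR tauR_nonneg tauR_nonneg x
    _ ≤ (1 + Real.log x) ^ 2 * (1 + Real.log x) ^ 2 := by gcongr
    _ = _ := by ring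

section main
variable {ι : Type*} [Fintype ι] [DecidableEq ι]

lemma min_sum_le (x Z : ℕ) : ∑ n ∈ Ioc 0 Z, ∑ n' ∈ Ioc 0 Z, ((min (x / n) (x / n') : ℕ) : ℝ)
    ≤ 2 * x * Z := by
  have h1 : ∀ n ∈ Ioc 0 Z, ∑ n' ∈ Ioc 0 Z, (if n' ≤ n then (x : ℝ) / n else 0) ≤ x := by
    intro n hn
    simp only [mem_Ioc] at hn
    rw [← Finset.sum_filter, Finset.sum_const, nsmul_eq_mul]
    have hc : #(filter (fun n' => n' ≤ n) (Ioc 0 Z)) ≤ n := by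
      calc _ ≤ #(Ioc 0 n) := Finset.card_le_card (by intro a; simp; omega)
        _ = n := by simp
    have hn0 : (0 : ℝ) < n := by exact_mod_cast hn.1
    calc _ ≤ (n : ℝ) * (x / n) := by gcongr
      _ = x := by field_simp
  have h2 : ∀ n n' : ℕ, ((min (x / n) (x / n') : ℕ) : ℝ) ≤
      (if n' ≤ n then (x : ℝ) / n else 0) + (if n ≤ n' then (x : ℝ) / n' else 0) := by
    intro n n'
    rcases le_total n n' with h | h
    · rw [if_pos h]
      have : ((min (x / n) (x / n') : ℕ) : ℝ) ≤ (x : ℝ) / n' :=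
        le_trans (by exact_mod_cast min_le_right _ _) Nat.cast_div_le
      have : 0 ≤ (if n' ≤ n then (x : ℝ) / n else 0) := by split_ifs <;> positivity
      linarith
    · rw [if_pos h]
      have : ((min (x / n) (x / n') : ℕ) : ℝ) ≤ (x : ℝ) / n :=
        le_trans (by exact_mod_cast min_le_left _ _) Nat.cast_div_le
      have : 0 ≤ (if n ≤ n' then (x : ℝ) / n' else 0) := by split_ifs <;> positivity
      linarith
  calc _ ≤ ∑ n ∈ Ioc 0 Z, ∑ n' ∈ Ioc 0 Z, ((if n' ≤ n then (x : ℝ) / n else 0) +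
        (if n ≤ n' then (x : ℝ) / n' else 0)) :=
        Finset.sum_le_sum fun n _ => Finset.sum_le_sum fun n' _ => h2 n n'
    _ = (∑ n ∈ Ioc 0 Z, ∑ n' ∈ Ioc 0 Z, (if n' ≤ n then (x : ℝ) / n else 0)) +
        ∑ n' ∈ Ioc 0 Z, ∑ n ∈ Ioc 0 Z, (if n ≤ n' then (x : ℝ) / n' else 0) := by
        simp only [Finset.sum_add_distrib]
        congr 1
        rw [Finset.sum_comm]
    _ ≤ (∑ n ∈ Ioc 0 Z, (x : ℝ)) + ∑ n ∈ Ioc 0 Z, (x : ℝ) := by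
        gcongr with n hn n hn
        · exact h1 n hn
        · exact h1 n hn
    _ = _ := by simp; ring

end main
end PD

namespace PD
open Finset ArithmeticFunction

section main
variable {ι : Type*} [Fintype ι] [DecidableEq ι]

lemma typeII_weighted {χ : ι → ℕ → ℂ} {B : ℝ} (hχ : Fam χ B) (hB : 0 ≤ B) {c : ι → ℂ} {η : ℝ}
    (hη : 0 ≤ η) (hc : ∀ i, ‖c i‖ ≤ η) (x Z V : ℕ) (β : ℕ → ℝ) {ℓ : ℝ} (hℓ : 0 ≤ ℓ)
    (hβ : ∀ n, n ≤ x → |β n| ≤ ℓ) (hβ0 : ∀ n, n ≤ V → β n = 0) (hZx : Z ≤ x)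
    (hV : Fintype.card ι * B ≤ V)
    (z : ι → ℕ → ℂ) (hz : ∀ i m, z i m = ∑ n ∈ Ioc 0 Z, if n ≤ x / m then (β n : ℂ) * χ i n else 0) :
    ∑ m ∈ Ioc 0 x, (m : ℝ) * ‖∑ i, c i * χ i m * z i m‖ ^ 2 ≤
      η ^ 2 * ℓ ^ 2 * (2 * x ^ 2 * (1 + Real.log x) + Fintype.card ι ^ 2 * B * (4 * x * Z)) := by
  have e0 : ∑ m ∈ Ioc 0 x, (m : ℝ) * ‖∑ i, c i * χ i m * z i m‖ ^ 2 =
      ∑ m ∈ Ioc 0 x, ‖∑ i, (Real.sqrt m : ℂ) * (c i * χ i m * z i m)‖ ^ 2 := by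
    refine Finset.sum_congr rfl fun m _ => ?_
    rw [← Finset.mul_sum, norm_mul, mul_pow, Complex.norm_real, Real.norm_of_nonneg (Real.sqrt_nonneg _),
      Real.sq_sqrt (Nat.cast_nonneg m)]
  have h := normSq_sum_expand (Ioc 0 x) (fun i m => (Real.sqrt m : ℂ) * (c i * χ i m * z i m))
  rw [← e0] at h
  have h0 : 0 ≤ ∑ m ∈ Ioc 0 x, (m : ℝ) * ‖∑ i, c i * χ i m * z i m‖ ^ 2 := by positivity
  have hcc : ∀ i j, ‖c i‖ * ‖c j‖ ≤ η ^ 2 := fun i j => by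
    rw [sq]; exact mul_le_mul (hc i) (hc j) (norm_nonneg _) hη
  -- diagonal
  have hdiag : ∑ i, ∑ m ∈ Ioc 0 x, (m : ℝ) * ‖c i * χ i m * z i m‖ ^ 2 ≤
      η ^ 2 * ℓ ^ 2 * (2 * x ^ 2 * (1 + Real.log x)) := by
    rw [Finset.sum_comm]
    have key : ∀ m ∈ Ioc 0 x, ∑ i, (m : ℝ) * ‖c i * χ i m * z i m‖ ^ 2 ≤
        η ^ 2 * ℓ ^ 2 * (2 * x ^ 2) * (1 / m) := by
      intro m hm
      simp only [mem_Ioc] at hm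
      have hm0 : (0 : ℝ) < m := by exact_mod_cast hm.1
      set t := min Z (x / m) with ht
      have hzt : ∀ i, z i m = ∑ n ∈ Ioc 0 t, (β n : ℂ) * χ i n := by
        intro i
        rw [hz, ← Finset.sum_filter]
        congr 1
        ext n; simp [ht]; tauto
      have htx : (t : ℝ) ≤ x / m :=
        le_trans (by exact_mod_cast min_le_right _ _) Nat.cast_div_le
      have htx' : t ≤ x := (min_le_left _ _).trans hZx
      have hls : ∑ i, ‖z i m‖ ^ 2 ≤ 2 * (x / m) ^ 2 * ℓ ^ 2 := by
        rcases le_or_gt t V with h | h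
        · have : ∀ i, z i m = 0 := by
            intro i
            rw [hzt]
            refine Finset.sum_eq_zero fun n hn => ?_
            simp only [mem_Ioc] at hn
            rw [hβ0 n (hn.2.trans h)]; simp
          simp only [this]
          simp
          positivity
        · have := large_sieve (Ioc 0 t) χ (fun n => (β n : ℂ)) (T := t) hB (by positivity)
            (fun i => by
              refine (norm_sum_le_of_le (f := fun n => χ i n * (starRingEnd ℂ) (χ i n))
                (Ioc 0 t) (n := fun _ => 1) fun n _ => ?_).trans (by simp)
              rw [norm_mul, RCLike.norm_conj]
              exact mul_le_one₀ (hχ.le i n) (norm_nonneg _) (hχ.le i n))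
            (fun i j hij => hχ.sum2 i j hij t)
          simp only [hzt]
          refine this.trans ?_
          have h1 : ∑ n ∈ Ioc 0 t, ‖(β n : ℂ)‖ ^ 2 ≤ t * ℓ ^ 2 := by
            calc _ ≤ ∑ n ∈ Ioc 0 t, ℓ ^ 2 := by
                  refine Finset.sum_le_sum fun n hn => ?_
                  simp only [mem_Ioc] at hn
                  rw [Complex.norm_real, Real.norm_eq_abs]
                  have := hβ n (hn.2.trans htx')
                  gcongr
              _ = _ := by simp
          have h2 : (V : ℝ) ≤ t := by exact_mod_cast h.le
          calc _ ≤ (t + t) * (t * ℓ ^ 2) := by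
                gcongr
                linarith
            _ = 2 * (t : ℝ) ^ 2 * ℓ ^ 2 := by ring
            _ ≤ _ := by gcongr
      calc ∑ i, (m : ℝ) * ‖c i * χ i m * z i m‖ ^ 2 ≤ ∑ i, m * (η ^ 2 * ‖z i m‖ ^ 2) := by
            refine Finset.sum_le_sum fun i _ => ?_
            rw [norm_mul, norm_mul, mul_pow]
            gcongr
            calc ‖c i‖ * ‖χ i m‖ ≤ η * 1 := by
                  gcongr
                  · exact hc i
                  · exact hχ.le i m
              _ = η := mul_one _
        _ = m * η ^ 2 * ∑ i, ‖z i m‖ ^ 2 := by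
            rw [Finset.mul_sum]
            exact Finset.sum_congr rfl fun _ _ => by ring
        _ ≤ m * η ^ 2 * (2 * (x / m) ^ 2 * ℓ ^ 2) := by gcongr
        _ = _ := by field_simp
    calc _ ≤ ∑ m ∈ Ioc 0 x, η ^ 2 * ℓ ^ 2 * (2 * x ^ 2) * (1 / (m : ℝ)) := Finset.sum_le_sum key
      _ = η ^ 2 * ℓ ^ 2 * (2 * x ^ 2) * ∑ m ∈ Ioc 0 x, (1 / (m : ℝ)) := by rw [Finset.mul_sum]
      _ ≤ η ^ 2 * ℓ ^ 2 * (2 * x ^ 2) * (1 + Real.log x) := by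
          gcongr
          exact sum_inv_le x
      _ = _ := by ring
  -- off-diagonal
  have hoff : ∀ i j, i ≠ j → ‖∑ m ∈ Ioc 0 x, (Real.sqrt m : ℂ) * (c i * χ i m * z i m) *
      (starRingEnd ℂ) ((Real.sqrt m : ℂ) * (c j * χ j m * z j m))‖ ≤
      η ^ 2 * ℓ ^ 2 * (B * (4 * x * Z)) := by
    intro i j hij
    have e1 : ∑ m ∈ Ioc 0 x, (Real.sqrt m : ℂ) * (c i * χ i m * z i m) *
      (starRingEnd ℂ) ((Real.sqrt m : ℂ) * (c j * χ j m * z j m)) =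
        ∑ n ∈ Ioc 0 Z, ∑ n' ∈ Ioc 0 Z, (c i * (starRingEnd ℂ) (c j)) * ((β n : ℂ) * (β n' : ℂ)) *
          (χ i n * (starRingEnd ℂ) (χ j n')) *
          ∑ m ∈ Ioc 0 (min (x / n) (x / n')), ((m : ℝ) : ℂ) * (χ i m * (starRingEnd ℂ) (χ j m)) := by
      have : ∀ n ∈ Ioc 0 Z, ∀ n' ∈ Ioc 0 Z,
          ∑ m ∈ Ioc 0 (min (x / n) (x / n')), ((m : ℝ) : ℂ) * (χ i m * (starRingEnd ℂ) (χ j m))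
          = ∑ m ∈ Ioc 0 x, if n ≤ x / m ∧ n' ≤ x / m then
            ((m : ℝ) : ℂ) * (χ i m * (starRingEnd ℂ) (χ j m)) else 0 := by
        intro n hn n' hn'
        simp only [mem_Ioc] at hn hn'
        rw [← Finset.sum_filter]
        congr 1
        ext m
        simp only [mem_Ioc, mem_filter, le_min_iff]
        constructor
        · rintro ⟨h1, h2, h3⟩
          rw [Nat.le_div_iff_mul_le hn.1] at h2
          rw [Nat.le_div_iff_mul_le hn'.1] at h3
          refine ⟨⟨h1, le_trans (Nat.le_mul_of_pos_right m hn.1) h2⟩, ?_, ?_⟩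
          · rw [Nat.le_div_iff_mul_le h1, mul_comm]; exact h2
          · rw [Nat.le_div_iff_mul_le h1, mul_comm]; exact h3
        · rintro ⟨⟨h1, _⟩, h2, h3⟩
          rw [Nat.le_div_iff_mul_le h1] at h2 h3
          refine ⟨h1, ?_, ?_⟩
          · rw [Nat.le_div_iff_mul_le hn.1, mul_comm]; exact h2
          · rw [Nat.le_div_iff_mul_le hn'.1, mul_comm]; exact h3
      rw [Finset.sum_congr rfl fun n hn => Finset.sum_congr rfl fun n' hn' => by
        rw [this n hn n' hn', Finset.mul_sum]]
      rw [Finset.sum_congr rfl fun n hn => Finset.sum_comm]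
      rw [Finset.sum_comm]
      refine Finset.sum_congr rfl fun m hm => ?_
      have hs : (Real.sqrt m : ℂ) * (Real.sqrt m : ℂ) = ((m : ℝ) : ℂ) := by
        rw [← Complex.ofReal_mul, Real.mul_self_sqrt (Nat.cast_nonneg m)]
      have e2 : (Real.sqrt m : ℂ) * (c i * χ i m * z i m) *
        (starRingEnd ℂ) ((Real.sqrt m : ℂ) * (c j * χ j m * z j m)) =
        (c i * (starRingEnd ℂ) (c j)) * (((m : ℝ) : ℂ) * (χ i m * (starRingEnd ℂ) (χ j m))) *
          (z i m * (starRingEnd ℂ) (z j m)) := by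
        rw [← hs]
        simp only [map_mul, Complex.conj_ofReal]
        ring
      rw [e2, hz, hz, map_sum, Finset.sum_mul_sum, Finset.mul_sum]
      refine Finset.sum_congr rfl fun n _ => ?_
      rw [Finset.mul_sum]
      refine Finset.sum_congr rfl fun n' _ => ?_
      by_cases h1 : n ≤ x / m <;> by_cases h2 : n' ≤ x / m <;> simp [h1, h2]
      ring
    rw [e1]
    have hab : ∀ y : ℕ, ‖∑ m ∈ Ioc 0 y, ((m : ℝ) : ℂ) * (χ i m * (starRingEnd ℂ) (χ j m))‖
        ≤ 2 * B * y := fun y =>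
      abel_mono (f := fun m : ℕ => (m : ℝ)) Nat.mono_cast (by simp) (hχ.sum2 i j hij) y
    calc _ ≤ ∑ n ∈ Ioc 0 Z, ∑ n' ∈ Ioc 0 Z,
          η ^ 2 * ℓ ^ 2 * (2 * B) * ((min (x / n) (x / n') : ℕ) : ℝ) := by
          refine norm_sum_le_of_le _ fun n hn => norm_sum_le_of_le _ fun n' hn' => ?_
          simp only [mem_Ioc] at hn hn'
          have hb := hβ n (hn.2.trans hZx)
          have hb' := hβ n' (hn'.2.trans hZx)
          have := hab (min (x / n) (x / n'))
          rw [norm_mul, norm_mul, norm_mul, norm_mul, norm_mul, norm_mul, RCLike.norm_conj,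
            RCLike.norm_conj, Complex.norm_real, Complex.norm_real, Real.norm_eq_abs, Real.norm_eq_abs]
          calc _ ≤ η ^ 2 * (ℓ * ℓ) * (1 * 1) * (2 * B * ((min (x / n) (x / n') : ℕ) : ℝ)) := by
                gcongr
                · exact hcc i j
                · exact hχ.le i n
                · exact hχ.le j n'
            _ = _ := by ring
      _ = η ^ 2 * ℓ ^ 2 * (2 * B) * ∑ n ∈ Ioc 0 Z, ∑ n' ∈ Ioc 0 Z,
            ((min (x / n) (x / n') : ℕ) : ℝ) := by simp only [Finset.mul_sum]
      _ ≤ η ^ 2 * ℓ ^ 2 * (2 * B) * (2 * x * Z) := by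
          gcongr
          exact min_sum_le x Z
      _ = _ := by ring
  -- combine
  have hfin : ∑ m ∈ Ioc 0 x, (m : ℝ) * ‖∑ i, c i * χ i m * z i m‖ ^ 2 ≤
      ∑ i, ∑ j, ((if i = j then ∑ m ∈ Ioc 0 x, (m : ℝ) * ‖c i * χ i m * z i m‖ ^ 2 else 0) +
        η ^ 2 * ℓ ^ 2 * (B * (4 * x * Z))) := by
    rw [← Real.norm_of_nonneg h0, ← Complex.norm_real, h]
    refine norm_sum_le_of_le _ fun i _ => norm_sum_le_of_le _ fun j _ => ?_
    have hp : 0 ≤ η ^ 2 * ℓ ^ 2 * (B * (4 * x * Z)) := by positivity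
    by_cases hij : i = j
    · subst hij
      rw [if_pos rfl]
      refine le_trans ?_ (le_add_of_nonneg_right hp)
      refine norm_sum_le_of_le _ fun m _ => ?_
      rw [norm_mul, RCLike.norm_conj, norm_mul, Complex.norm_real,
        Real.norm_of_nonneg (Real.sqrt_nonneg _)]
      have := Real.mul_self_sqrt (Nat.cast_nonneg (α := ℝ) m)
      apply le_of_eq
      calc _ = (Real.sqrt m * Real.sqrt m) * ‖c i * χ i m * z i m‖ ^ 2 := by ring
        _ = _ := by rw [this]
    · rw [if_neg hij, zero_add]
      exact hoff i j hij
  refine hfin.trans ?_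
  simp only [Finset.sum_add_distrib, Finset.sum_ite_eq, Finset.mem_univ, if_true, Finset.sum_const,
    Finset.card_univ, nsmul_eq_mul]
  nlinarith [hdiag]

lemma typeII {χ : ι → ℕ → ℂ} {B : ℝ} (hχ : Fam χ B) (hB : 0 ≤ B) {c : ι → ℂ} {η : ℝ}
    (hη : 0 ≤ η) (hc : ∀ i, ‖c i‖ ≤ η) (x U V : ℕ) (hx : 1 ≤ x) (hU1 : 1 ≤ U) (α β : ℕ → ℝ)
    (hα : ∀ m, |α m| ≤ tauR m) (hα0 : ∀ m, m ≤ U → α m = 0)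
    (hβ : ∀ n, n ≤ x → |β n| ≤ Real.log x) (hβ0 : ∀ n, n ≤ V → β n = 0)
    (hV : Fintype.card ι * B ≤ V) (hU : Fintype.card ι ^ 2 * B ≤ U) :
    ‖∑ i, c i * ∑ m ∈ Ioc 0 x, (α m : ℂ) * χ i m * ∑ n ∈ Ioc 0 (x / m), (β n : ℂ) * χ i n‖
      ≤ 3 * η * x * (1 + Real.log x) ^ 4 := by
  set z : ι → ℕ → ℂ := fun i m => ∑ n ∈ Ioc 0 (x / U), if n ≤ x / m then (β n : ℂ) * χ i n else 0
    with hz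
  have hlog : 0 ≤ Real.log x := Real.log_natCast_nonneg x
  have hw := typeII_weighted hχ hB hη hc x (x / U) V β hlog hβ hβ0 (Nat.div_le_self _ _) hV z
    (fun _ _ => rfl)
  have e1 : ∑ i, c i * ∑ m ∈ Ioc 0 x, (α m : ℂ) * χ i m * ∑ n ∈ Ioc 0 (x / m), (β n : ℂ) * χ i n
      = ∑ m ∈ Ioc 0 x, (α m : ℂ) * ∑ i, c i * χ i m * z i m := by
    simp only [Finset.mul_sum]
    rw [Finset.sum_comm]
    refine Finset.sum_congr rfl fun m hm => Finset.sum_congr rfl fun i _ => ?_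
    rcases le_or_gt m U with h | h
    · simp [hα0 m h]
    · simp only [mem_Ioc] at hm
      have : z i m = ∑ n ∈ Ioc 0 (x / m), (β n : ℂ) * χ i n := by
        simp only [hz]
        rw [← Finset.sum_filter]
        congr 1
        ext n
        simp only [mem_filter, mem_Ioc]
        have : x / m ≤ x / U := Nat.div_le_div_left h.le hU1
        constructor
        · rintro ⟨⟨h1, h2⟩, h3⟩; exact ⟨h1, h3⟩
        · rintro ⟨h1, h2⟩; exact ⟨⟨h1, h2.trans this⟩, h2⟩
      rw [this, Finset.mul_sum, Finset.mul_sum]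
      refine Finset.sum_congr rfl fun n _ => ?_
      ring
  rw [e1]
  set lx := 1 + Real.log x with hlx
  have hlx1 : 1 ≤ lx := by linarith
  set T := ‖∑ m ∈ Ioc 0 x, (α m : ℂ) * ∑ i, c i * χ i m * z i m‖
  have hT : T ≤ ∑ m ∈ Ioc 0 x, (tauR m / Real.sqrt m) * (Real.sqrt m * ‖∑ i, c i * χ i m * z i m‖) := by
    refine norm_sum_le_of_le _ fun m hm => ?_
    simp only [mem_Ioc] at hm
    have : 0 < Real.sqrt m := Real.sqrt_pos.2 (by exact_mod_cast hm.1)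
    rw [norm_mul, Complex.norm_real, Real.norm_eq_abs]
    calc _ ≤ tauR m * ‖∑ i, c i * χ i m * z i m‖ := by gcongr; exact hα m
      _ = _ := by field_simp
  have hcs := Finset.sum_mul_sq_le_sq_mul_sq (Ioc 0 x) (fun m : ℕ => tauR m / Real.sqrt m)
    (fun m => Real.sqrt m * ‖∑ i, c i * χ i m * z i m‖)
  have h1 : ∑ m ∈ Ioc 0 x, (tauR m / Real.sqrt m) ^ 2 ≤ lx ^ 4 := by
    refine le_trans (le_of_eq ?_) (sum_tau_sq_le x)
    refine Finset.sum_congr rfl fun m _ => ?_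
    rw [div_pow, Real.sq_sqrt (Nat.cast_nonneg m)]
  have h2 : ∑ m ∈ Ioc 0 x, (Real.sqrt m * ‖∑ i, c i * χ i m * z i m‖) ^ 2 ≤
      η ^ 2 * x ^ 2 * (6 * lx ^ 3) := by
    have e : ∑ m ∈ Ioc 0 x, (Real.sqrt m * ‖∑ i, c i * χ i m * z i m‖) ^ 2 =
        ∑ m ∈ Ioc 0 x, (m : ℝ) * ‖∑ i, c i * χ i m * z i m‖ ^ 2 := by
      refine Finset.sum_congr rfl fun m _ => ?_
      rw [mul_pow, Real.sq_sqrt (Nat.cast_nonneg m)]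
    rw [e]
    refine hw.trans ?_
    have hZ : (Fintype.card ι : ℝ) ^ 2 * B * (4 * x * (x / U : ℕ)) ≤ 4 * x ^ 2 := by
      have : (U : ℝ) * ((x / U : ℕ) : ℝ) ≤ x := by exact_mod_cast Nat.mul_div_le x U
      calc (Fintype.card ι : ℝ) ^ 2 * B * (4 * x * (x / U : ℕ)) ≤ U * (4 * x * (x / U : ℕ)) := by gcongr
        _ = 4 * x * (U * ((x / U : ℕ) : ℝ)) := by ring
        _ ≤ 4 * x * x := by gcongr
        _ = _ := by ring
    have hl : Real.log x ≤ lx := by linarith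
    calc _ ≤ η ^ 2 * lx ^ 2 * (2 * x ^ 2 * lx + 4 * x ^ 2) := by gcongr
      _ ≤ η ^ 2 * lx ^ 2 * (2 * x ^ 2 * lx + 4 * x ^ 2 * lx) := by
          have : (4 : ℝ) * x ^ 2 ≤ 4 * x ^ 2 * lx := le_mul_of_one_le_right (by positivity) hlx1
          exact mul_le_mul_of_nonneg_left (by linarith) (by positivity)
      _ = _ := by ring
  have hT0 : 0 ≤ T := norm_nonneg _
  have h3 : T ^ 2 ≤ (3 * η * x * lx ^ 4) ^ 2 := by
    calc T ^ 2 ≤ _ := pow_le_pow_left₀ hT0 hT 2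
      _ ≤ _ := hcs
      _ ≤ lx ^ 4 * (η ^ 2 * x ^ 2 * (6 * lx ^ 3)) := by gcongr
      _ = 6 * (η ^ 2 * x ^ 2 * lx ^ 7) * 1 := by ring
      _ ≤ 9 * (η ^ 2 * x ^ 2 * lx ^ 7) * lx := by gcongr; norm_num
      _ = _ := by ring
  exact le_of_sq_le_sq h3 (by positivity)

lemma le_tau_of_conv (U m : ℕ) : |(highAF muR U * zetaR) m| ≤ tauR m := by
  unfold tauR
  rw [mul_apply, mul_apply]
  refine (Finset.abs_sum_le_sum_abs _ _).trans (Finset.sum_le_sum fun p hp => ?_)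
  obtain ⟨hp1, hp2⟩ := Nat.mem_divisorsAntidiagonal.1 hp
  have h1 : p.1 ≠ 0 := by rintro h; simp [h] at hp1; exact hp2 hp1.symm
  rw [abs_mul, abs_of_nonneg (zetaR_nonneg _)]
  refine mul_le_mul_of_nonneg_right ?_ (zetaR_nonneg _)
  rw [highAF_apply, zetaR_apply, if_neg h1]
  split_ifs
  · simp
  · exact muR_abs_le _

lemma conv_zero (U m : ℕ) (h : m ≤ U) : (highAF muR U * zetaR) m = 0 := by
  rw [mul_apply]
  refine Finset.sum_eq_zero fun p hp => ?_
  obtain ⟨hp1, hp2⟩ := Nat.mem_divisorsAntidiagonal.1 hp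
  have : p.1 ≤ m := Nat.le_of_dvd (Nat.pos_of_ne_zero hp2) ⟨_, hp1.symm⟩
  rw [highAF_apply, if_pos (this.trans h), zero_mul]

lemma sum_low_le (f : ArithmeticFunction ℝ) {F : ℕ → ℝ} {M : ℝ} (hM : 0 ≤ M) (V x : ℕ)
    (h : ∀ n, n ≤ x → |f n| * F n ≤ M) :
    ∑ n ∈ Ioc 0 x, |lowAF f V n| * F n ≤ V * M := by
  calc ∑ n ∈ Ioc 0 x, |lowAF f V n| * F n ≤ ∑ n ∈ Ioc 0 x, if n ≤ V then M else 0 := by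
        refine Finset.sum_le_sum fun n hn => ?_
        rw [lowAF_apply]
        simp only [mem_Ioc] at hn
        split_ifs
        · exact h n hn.2
        · simp
    _ ≤ V * M := by
        rw [← Finset.sum_filter, Finset.sum_const, nsmul_eq_mul]
        gcongr
        calc _ ≤ #(Ioc 0 V) := Finset.card_le_card (by intro a; simp; omega)
          _ = V := by simp

lemma vm_le_log {n x : ℕ} (h : n ≤ x) : |vonMangoldt n| ≤ Real.log x := by
  rw [abs_of_nonneg vonMangoldt_nonneg]
  refine vonMangoldt_le_log.trans ?_
  rcases Nat.eq_zero_or_pos n with rfl | h0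
  · simpa using Real.log_natCast_nonneg x
  · exact Real.log_le_log (by exact_mod_cast h0) (by exact_mod_cast h)

theorem lemmaC {χ : ι → ℕ → ℂ} {B : ℝ} (hχ : Fam χ B) (hB : 1 ≤ B) {c : ι → ℂ} {η : ℝ}
    (hη : 0 ≤ η) (hc : ∀ i, ‖c i‖ ≤ η) (x U : ℕ) (hU1 : 1 ≤ U)
    (hU : Fintype.card ι ^ 2 * B ≤ U) (hx : Fintype.card ι * B * U ^ 2 ≤ x) :
    ‖∑ i, c i * ∑ n ∈ Ioc 0 x, (vonMangoldt n : ℂ) * χ i n‖ ≤ 7 * η * x * (1 + Real.log x) ^ 4 := by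
  rcases isEmpty_or_nonempty ι with hemp | hne
  · simp
    have : 0 ≤ Real.log x := Real.log_natCast_nonneg x
    positivity
  have hcard : (1 : ℝ) ≤ Fintype.card ι := by exact_mod_cast Fintype.card_pos
  have hU1' : (1 : ℝ) ≤ U := by exact_mod_cast hU1
  have hB0 : 0 ≤ B := by linarith
  have hx1 : 1 ≤ x := by
    have : (1 : ℝ) ≤ x := by
      refine le_trans ?_ hx
      have := mul_le_mul hcard hB (by norm_num) (by linarith)
      have h2 : (1 : ℝ) ≤ U ^ 2 := one_le_pow₀ hU1'
      nlinarith
    exact_mod_cast this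
  have hlog : 0 ≤ Real.log x := Real.log_natCast_nonneg x
  set ℓ := Real.log x with hℓ
  have hV : (Fintype.card ι : ℝ) * B ≤ U := by
    refine le_trans ?_ hU
    gcongr
    nlinarith
  have hII := typeII hχ hB0 hη hc x U U hx1 hU1 (⇑(highAF muR U * zetaR)) (highAF vonMangoldt U)
    (le_tau_of_conv U) (conv_zero U)
    (fun n hn => by
      rw [highAF_apply]
      split_ifs
      · simpa using hlog
      · exact vm_le_log hn)
    (fun n hn => by rw [highAF_apply, if_pos hn]) hV hU
  have hI : ∀ i, ‖∑ n ∈ Ioc 0 x, (vonMangoldt n : ℂ) * χ i n - ∑ m ∈ Ioc 0 x,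
      ((highAF muR U * zetaR) m : ℂ) * χ i m * ∑ n ∈ Ioc 0 (x / m), (highAF vonMangoldt U n : ℂ) * χ i n‖
      ≤ 4 * (U ^ 2 * B * ℓ) := by
    intro i
    have hX := hχ.mul i
    have e : ∑ n ∈ Ioc 0 x, (vonMangoldt n : ℂ) * χ i n =
        ∑ n ∈ Ioc 0 x, (lowAF vonMangoldt U n : ℂ) * χ i n
        + ∑ n ∈ Ioc 0 x, ((lowAF muR U * log) n : ℂ) * χ i n
        - ∑ n ∈ Ioc 0 x, ((lowAF muR U * (lowAF vonMangoldt U * zetaR)) n : ℂ) * χ i n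
        + ∑ n ∈ Ioc 0 x, (((highAF muR U * zetaR) * highAF vonMangoldt U) n : ℂ) * χ i n := by
      rw [← Finset.sum_add_distrib, ← Finset.sum_sub_distrib, ← Finset.sum_add_distrib]
      refine Finset.sum_congr rfl fun n _ => ?_
      conv_lhs => rw [vaughan U U]
      rw [ArithmeticFunction.add_apply, sub_eq_add_neg, ArithmeticFunction.add_apply,
        ArithmeticFunction.add_apply]
      change ((lowAF vonMangoldt U n + (lowAF muR U * log) n +
        -(lowAF muR U * (lowAF vonMangoldt U * zetaR)) n + _ : ℝ) : ℂ) * χ i n = _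
      push_cast
      ring
    rw [e, twist_sum (highAF muR U * zetaR) (highAF vonMangoldt U) hX, add_sub_cancel_right]
    have h1 : ‖∑ n ∈ Ioc 0 x, (lowAF vonMangoldt U n : ℂ) * χ i n‖ ≤ U * ℓ := by
      refine le_trans (norm_sum_le_of_le _ (n := fun n => |lowAF vonMangoldt U n| * ‖χ i n‖)
        fun n _ => ?_) (sum_low_le _ hlog U x fun n hn => ?_)
      · rw [norm_mul, Complex.norm_real, Real.norm_eq_abs]
      · exact (mul_le_of_le_one_right (abs_nonneg _) (hχ.le i n)).trans (vm_le_log hn)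
    have h2 : ‖∑ n ∈ Ioc 0 x, ((lowAF muR U * log) n : ℂ) * χ i n‖ ≤ U * (2 * B * ℓ) := by
      rw [twist_sum _ _ hX]
      refine le_trans (norm_sum_le_of_le _ (n := fun n => |lowAF muR U n| *
        ‖χ i n * ∑ m ∈ Ioc 0 (x / n), (log m : ℂ) * χ i m‖)
        fun n _ => ?_) (sum_low_le _ (by positivity) U x fun n hn => ?_)
      · rw [mul_assoc, norm_mul, Complex.norm_real, Real.norm_eq_abs]
      · have hmono : Monotone (fun m : ℕ => Real.log m) := by
          intro a b hab
          rcases Nat.eq_zero_or_pos a with rfl | h0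
          · simpa using Real.log_natCast_nonneg b
          · exact Real.log_le_log (by exact_mod_cast h0) (by exact_mod_cast hab)
        have := abel_mono hmono (by simp) (hχ.sum1 i) (x / n)
        simp only [log_apply]
        have h3 : Real.log ((x / n : ℕ) : ℝ) ≤ ℓ := hmono (Nat.div_le_self x n)
        rw [norm_mul]
        calc _ ≤ 1 * (1 * (2 * B * ℓ)) := by
              refine mul_le_mul (muR_abs_le n) ?_ (by positivity) (by norm_num)
              refine mul_le_mul (hχ.le i n) (this.trans ?_) (by positivity) (by norm_num)
              gcongr
          _ = _ := by ring
    have h3 : ‖∑ n ∈ Ioc 0 x, ((lowAF muR U * (lowAF vonMangoldt U * zetaR)) n : ℂ) * χ i n‖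
        ≤ U * (U * (ℓ * B)) := by
      rw [twist_sum _ _ hX]
      refine le_trans (norm_sum_le_of_le _ (n := fun n => |lowAF muR U n| *
        ‖χ i n * ∑ m ∈ Ioc 0 (x / n), ((lowAF vonMangoldt U * zetaR) m : ℂ) * χ i m‖)
        fun n _ => ?_) (sum_low_le _ (by positivity) U x fun n hn => ?_)
      · rw [mul_assoc, norm_mul, Complex.norm_real, Real.norm_eq_abs]
      · rw [norm_mul]
        calc _ ≤ 1 * (1 * (U * (ℓ * B))) := by
              refine mul_le_mul (muR_abs_le n) ?_ (by positivity) (by norm_num)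
              refine mul_le_mul (hχ.le i n) ?_ (by positivity) (by norm_num)
              rw [twist_sum _ _ hX]
              refine le_trans (norm_sum_le_of_le _ (n := fun e => |lowAF vonMangoldt U e| *
                ‖χ i e * ∑ m ∈ Ioc 0 (x / n / e), (zetaR m : ℂ) * χ i m‖)
                fun e _ => ?_) (sum_low_le _ (by positivity) U (x / n) fun e he => ?_)
              · rw [mul_assoc, norm_mul, Complex.norm_real, Real.norm_eq_abs]
              · refine mul_le_mul (vm_le_log (he.trans (Nat.div_le_self x n))) ?_ (by positivity) hlog
                have : ∑ m ∈ Ioc 0 (x / n / e), (zetaR m : ℂ) * χ i m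
                    = ∑ m ∈ Ioc 0 (x / n / e), χ i m := by
                  refine Finset.sum_congr rfl fun m hm => ?_
                  simp only [mem_Ioc] at hm
                  rw [zetaR_apply, if_neg hm.1.ne']
                  simp
                rw [this, norm_mul]
                calc _ ≤ 1 * B := mul_le_mul (hχ.le i e) (hχ.sum1 i _) (by positivity) (by norm_num)
                  _ = B := one_mul B
          _ = _ := by ring
    have hUB : (U : ℝ) * ℓ ≤ U ^ 2 * B * ℓ := by
      gcongr
      calc (U : ℝ) = U * 1 := by ring
        _ ≤ U * (U * B) := by gcongr; nlinarith
        _ = _ := by ring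
    have hUB2 : (U : ℝ) * (2 * B * ℓ) ≤ 2 * (U ^ 2 * B * ℓ) := by
      have : (U : ℝ) ≤ U ^ 2 := by nlinarith
      calc (U : ℝ) * (2 * B * ℓ) ≤ U ^ 2 * (2 * B * ℓ) := by gcongr
        _ = _ := by ring
    have hUB3 : (U : ℝ) * (U * (ℓ * B)) = U ^ 2 * B * ℓ := by ring
    calc _ ≤ _ := norm_sub_le _ _
      _ ≤ _ := add_le_add_left (norm_add_le _ _) _
      _ ≤ _ := by linarith
  have e : ∑ i, c i * ∑ n ∈ Ioc 0 x, (vonMangoldt n : ℂ) * χ i n =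
      ∑ i, c i * (∑ n ∈ Ioc 0 x, (vonMangoldt n : ℂ) * χ i n - ∑ m ∈ Ioc 0 x,
      ((highAF muR U * zetaR) m : ℂ) * χ i m * ∑ n ∈ Ioc 0 (x / m), (highAF vonMangoldt U n : ℂ) * χ i n)
      + ∑ i, c i * ∑ m ∈ Ioc 0 x,
      ((highAF muR U * zetaR) m : ℂ) * χ i m * ∑ n ∈ Ioc 0 (x / m), (highAF vonMangoldt U n : ℂ) * χ i n := by
    rw [← Finset.sum_add_distrib]
    exact Finset.sum_congr rfl fun i _ => by ring
  rw [e]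
  have hIs : ‖∑ i, c i * (∑ n ∈ Ioc 0 x, (vonMangoldt n : ℂ) * χ i n - ∑ m ∈ Ioc 0 x,
      ((highAF muR U * zetaR) m : ℂ) * χ i m * ∑ n ∈ Ioc 0 (x / m), (highAF vonMangoldt U n : ℂ) * χ i n)‖
      ≤ 4 * η * x * (1 + ℓ) ^ 4 := by
    calc _ ≤ ∑ i : ι, η * (4 * (U ^ 2 * B * ℓ)) := by
          refine norm_sum_le_of_le _ fun i _ => ?_
          rw [norm_mul]
          exact mul_le_mul (hc i) (hI i) (norm_nonneg _) hη
      _ = 4 * η * (Fintype.card ι * B * U ^ 2) * ℓ := by simp; ring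
      _ ≤ 4 * η * x * ℓ := by gcongr
      _ ≤ 4 * η * x * (1 + ℓ) ^ 4 := by
          gcongr
          calc ℓ ≤ (1 + ℓ) ^ 1 := by linarith
            _ ≤ (1 + ℓ) ^ 4 := pow_le_pow_right₀ (by linarith) (by norm_num)
  calc _ ≤ _ := norm_add_le _ _
    _ ≤ 4 * η * x * (1 + ℓ) ^ 4 + 3 * η * x * (1 + ℓ) ^ 4 := add_le_add hIs hII
    _ = _ := by ring

end main
end PD

namespace PD
open Finset

lemma periodic_range_le (f : ℕ → ℂ) (q : ℕ) (hq : 0 < q) (hf : ∀ n, f (q + n) = f n)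
    (h0 : ∑ n ∈ range q, f n = 0) (h1 : ∀ n, ‖f n‖ ≤ 1) (n : ℕ) :
    ‖∑ m ∈ range n, f m‖ ≤ q := by
  induction n using Nat.strong_induction_on with
  | _ n ih =>
    rcases lt_or_ge n q with h | h
    · refine (norm_sum_le_of_le _ fun m _ => h1 m).trans ?_
      simp
      exact_mod_cast h.le
    · obtain ⟨k, rfl⟩ := Nat.exists_eq_add_of_le h
      rw [Finset.sum_range_add, h0, zero_add]
      simp only [hf]
      exact ih k (by omega)

lemma periodic_Ioc_le (f : ℕ → ℂ) (q : ℕ) (hq : 0 < q) (hf : ∀ n, f (q + n) = f n)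
    (h0 : ∑ n ∈ range q, f n = 0) (h1 : ∀ n, ‖f n‖ ≤ 1) (h2 : f 0 = 0) (n : ℕ) :
    ‖∑ m ∈ Ioc 0 n, f m‖ ≤ q := by
  have : ∑ m ∈ Ioc 0 n, f m = ∑ m ∈ range (n + 1), f m := by
    rw [Finset.range_eq_Ico, Finset.sum_eq_sum_Ico_succ_bot (by omega), h2, zero_add]
    rfl
  rw [this]
  exact periodic_range_le f q hq hf h0 h1 _

section chars
variable {q : ℕ} [NeZero q] (χ : DirichletCharacter ℂ q)

lemma char_sum_range (hχ : χ ≠ 1) : ∑ n ∈ range q, χ n = 0 := by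
  have := MulChar.sum_eq_zero_of_ne_one hχ
  rw [← this]
  refine Finset.sum_bij' (fun n _ => (n : ZMod q)) (fun a _ => a.val) ?_ ?_ ?_ ?_ ?_
  · simp
  · intro a _; simpa using ZMod.val_lt a
  · intro n hn; simp at hn; exact ZMod.val_cast_of_lt hn
  · intro a _; simp
  · simp

lemma char_zero (hχ : χ ≠ 1) : χ (0 : ZMod q) = 0 := by
  apply MulChar.map_nonunit
  intro h
  have h1 : q = 1 := by
    by_contra hne
    have : 1 < q := lt_of_le_of_ne (NeZero.pos q) (Ne.symm hne)
    haveI : Fact (1 < q) := ⟨this⟩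
    exact not_isUnit_zero h
  subst h1
  exact hχ (DirichletCharacter.level_one χ)

lemma char_Ioc_le (hχ : χ ≠ 1) (n : ℕ) : ‖∑ m ∈ Ioc 0 n, χ m‖ ≤ q :=
  periodic_Ioc_le (fun m => χ m) q (NeZero.pos q) (fun n => by simp) (char_sum_range χ hχ)
    (fun n => χ.norm_le_one _) (by simpa using char_zero χ hχ) n

/-- partial sums -/
noncomputable def pS (n : ℕ) : ℂ := ∑ m ∈ Ioc 0 n, χ m

lemma pS_le (hχ : χ ≠ 1) (n : ℕ) : ‖pS χ n‖ ≤ min (n : ℝ) q := by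
  refine le_min ?_ (char_Ioc_le χ hχ n)
  refine (norm_sum_le_of_le _ fun m _ => χ.norm_le_one _).trans ?_
  simp

/-- Abel-summed terms -/
noncomputable def aT (s : ℂ) (n : ℕ) : ℂ := pS χ n * ((n : ℂ) ^ (-s) - ((n + 1 : ℕ) : ℂ) ^ (-s))

lemma cpow_diff_le {s : ℂ} (hs : 0 < s.re) {n : ℕ} (hn : 0 < n) :
    ‖(n : ℂ) ^ (-s) - ((n + 1 : ℕ) : ℂ) ^ (-s)‖ ≤ ‖s‖ * (n : ℝ) ^ (-s.re - 1) := by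
  have hn' : (0 : ℝ) < n := by exact_mod_cast hn
  have h := Convex.norm_image_sub_le_of_norm_hasDerivWithin_le (𝕜 := ℝ) (f := fun x : ℝ => (x : ℂ) ^ (-s))
    (f' := fun x : ℝ => -s * (x : ℂ) ^ (-s - 1)) (s := Set.Icc (n : ℝ) (n + 1))
    (C := ‖s‖ * (n : ℝ) ^ (-s.re - 1)) (x := (n + 1 : ℝ)) (y := n) ?_ ?_ (convex_Icc _ _) (by simp) (by simp)
  · simpa using h
  · intro x hx
    have hx0 : 0 < x := lt_of_lt_of_le hn' hx.1
    have hs0 : -s ≠ 0 := by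
      intro h
      have : s = 0 := by simpa using h
      simp [this] at hs
    exact (hasDerivAt_ofReal_cpow_const hx0.ne' hs0).hasDerivWithinAt
  · intro x hx
    have hx0 : 0 < x := lt_of_lt_of_le hn' hx.1
    rw [norm_mul, norm_neg, Complex.norm_cpow_eq_rpow_re_of_pos hx0]
    gcongr
    simp only [Complex.sub_re, Complex.neg_re, Complex.one_re]
    exact Real.rpow_le_rpow_of_nonpos hn' hx.1 (by linarith)


lemma aT_le (hχ : χ ≠ 1) {s : ℂ} (hs : 0 < s.re) (n : ℕ) :
    ‖aT χ s n‖ ≤ min (n : ℝ) q * (‖s‖ * (n : ℝ) ^ (-s.re - 1)) := by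
  rcases Nat.eq_zero_or_pos n with rfl | hn
  · simp [aT, pS]
  · rw [aT, norm_mul]
    exact mul_le_mul (pS_le χ hχ n) (cpow_diff_le hs hn) (norm_nonneg _) (by positivity)

/-- the region used for continuation -/
def regU : Set ℂ := {s | 1 / 2 < s.re} ∩ Metric.ball 0 3

lemma regU_open : IsOpen regU :=
  (isOpen_lt continuous_const Complex.continuous_re).inter Metric.isOpen_ball

lemma regU_conv : Convex ℝ regU :=
  (convex_halfSpace_re_gt _).inter (convex_ball _ _)

lemma aT_le' (hχ : χ ≠ 1) {s : ℂ} (hs : s ∈ regU) (n : ℕ) :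
    ‖aT χ s n‖ ≤ q * 3 * (n : ℝ) ^ (-(3 / 2) : ℝ) := by
  obtain ⟨h1, h2⟩ := hs
  simp only [Set.mem_ofPred_eq] at h1
  simp only [Metric.mem_ball, dist_zero_right] at h2
  rcases Nat.eq_zero_or_pos n with rfl | hn
  · simp [aT, pS]
  · refine (aT_le χ hχ (by linarith) n).trans ?_
    have hn1 : (1 : ℝ) ≤ n := by exact_mod_cast hn
    rw [mul_assoc]
    gcongr
    · exact min_le_right _ _
    · linarith

lemma aT_sum_bound : Summable fun n : ℕ => (q : ℝ) * 3 * (n : ℝ) ^ (-(3 / 2) : ℝ) := by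
  apply Summable.mul_left
  rw [Real.summable_nat_rpow]; norm_num

lemma aT_diff : DifferentiableOn ℂ (fun s => ∑' n, aT χ s n) regU ∨ χ = 1 := by
  by_cases hχ : χ = 1
  · right; exact hχ
  left
  refine Complex.differentiableOn_tsum_of_summable_norm (aT_sum_bound (q := q)) ?_ regU_open ?_
  · intro n
    rcases Nat.eq_zero_or_pos n with rfl | hn
    · simp [aT, pS]
      
    · unfold aT
      apply DifferentiableOn.const_mul
      apply DifferentiableOn.sub
      · intro s _
        apply DifferentiableAt.differentiableWithinAt
        exact (differentiableAt_id.neg).const_cpow (Or.inl (by exact_mod_cast hn.ne'))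
      · intro s _
        apply DifferentiableAt.differentiableWithinAt
        exact (differentiableAt_id.neg).const_cpow (Or.inl (by exact_mod_cast (Nat.succ_ne_zero n)))
  · intro n s hs
    exact aT_le' χ hχ hs n

lemma aT_finite (s : ℂ) (N : ℕ) :
    ∑ n ∈ Ioc 0 N, χ n * (n : ℂ) ^ (-s) =
      pS χ N * ((N + 1 : ℕ) : ℂ) ^ (-s) + ∑ n ∈ range (N + 1), aT χ s n := by
  induction N with
  | zero => simp [pS, aT]
  | succ N ih =>
    rw [Finset.sum_Ioc_succ_top (by omega), ih, Finset.sum_range_succ _ (N + 1)]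
    have : pS χ (N + 1) = pS χ N + χ ((N + 1 : ℕ)) := by
      unfold pS; rw [Finset.sum_Ioc_succ_top (by omega)]
    rw [aT, this]
    ring

lemma aT_tsum_eq (hχ : χ ≠ 1) {s : ℂ} (hs : 1 < s.re) (hs' : s ∈ regU) :
    ∑' n, aT χ s n = χ.LFunction s := by
  rw [χ.LFunction_eq_LSeries hs]
  have h1 : Filter.Tendsto (fun N => ∑ n ∈ range (N + 1), aT χ s n) Filter.atTop
      (nhds (∑' n, aT χ s n)) := by
    have : Summable (aT χ s) := Summable.of_norm_bounded (aT_sum_bound (q := q)) (fun n => aT_le' χ hχ hs' n)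
    exact (Filter.tendsto_add_atTop_iff_nat 1).2 this.hasSum.tendsto_sum_nat
  have h2 : Filter.Tendsto (fun N => ∑ n ∈ range (N + 1), LSeries.term (fun n => χ n) s n) Filter.atTop
      (nhds (LSeries (fun n => χ n) s)) := by
    have := (DirichletCharacter.LSeriesSummable_of_one_lt_re χ hs).hasSum.tendsto_sum_nat
    exact (Filter.tendsto_add_atTop_iff_nat 1).2 this
  have h3 : Filter.Tendsto (fun N : ℕ => pS χ N * ((N + 1 : ℕ) : ℂ) ^ (-s)) Filter.atTop (nhds 0) := by
    rw [tendsto_zero_iff_norm_tendsto_zero]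
    have h4 : Filter.Tendsto (fun N : ℕ => (q : ℝ) * ((N + 1 : ℕ) : ℝ) ^ (-s.re)) Filter.atTop (nhds ((q : ℝ) * 0)) := by
      apply Filter.Tendsto.const_mul
      exact ((tendsto_rpow_neg_atTop (by linarith)).comp tendsto_natCast_atTop_atTop).comp (Filter.tendsto_add_atTop_nat 1)
    rw [mul_zero] at h4
    refine squeeze_zero (fun _ => norm_nonneg _) (fun N => ?_) h4
    rw [norm_mul, Complex.norm_natCast_cpow_of_pos (by omega)]
    gcongr
    · exact (pS_le χ hχ N).trans (min_le_right _ _)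
    · simp
    · simp
  have h5 : ∀ N, ∑ n ∈ range (N + 1), LSeries.term (fun n => χ n) s n =
      pS χ N * ((N + 1 : ℕ) : ℂ) ^ (-s) + ∑ n ∈ range (N + 1), aT χ s n := by
    intro N
    rw [← aT_finite, Finset.range_eq_Ico, Finset.sum_eq_sum_Ico_succ_bot (by omega), LSeries.term_zero, zero_add]
    refine Finset.sum_congr rfl fun n hn => ?_
    have : n ≠ 0 := by simp at hn; omega
    rw [LSeries.term_of_ne_zero this, Complex.cpow_neg, div_eq_mul_inv]
  simp only [h5] at h2
  have h6 := h3.add h1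
  rw [zero_add] at h6
  exact tendsto_nhds_unique h6 h2

lemma LF_eq_aT (hχ : χ ≠ 1) {s : ℂ} (hs : s ∈ regU) : χ.LFunction s = ∑' n, aT χ s n := by
  have h1 : AnalyticOnNhd ℂ χ.LFunction regU :=
    (DirichletCharacter.differentiable_LFunction hχ).differentiableOn.analyticOnNhd regU_open
  have h2 : AnalyticOnNhd ℂ (fun s => ∑' n, aT χ s n) regU :=
    ((aT_diff χ).resolve_right hχ).analyticOnNhd regU_open
  have h2U : (2 : ℂ) ∈ regU := by
    constructor
    · simp; norm_num
    · simp; norm_num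
  refine h1.eqOn_of_preconnected_of_eventuallyEq h2 regU_conv.isPreconnected h2U ?_ hs
  have hV : {s : ℂ | 1 < s.re} ∈ nhds (2 : ℂ) :=
    (isOpen_lt continuous_const Complex.continuous_re).mem_nhds (by simp)
  filter_upwards [hV, regU_open.mem_nhds h2U] with t ht htU
  exact (aT_tsum_eq χ hχ ht htU).symm

lemma tail_rpow {a : ℝ} (ha : 0 < a) {n : ℕ} (hn : 1 ≤ n) :
    a * ((n + 1 : ℕ) : ℝ) ^ (-a - 1) ≤ (n : ℝ) ^ (-a) - ((n + 1 : ℕ) : ℝ) ^ (-a) := by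
  have hn0 : (0 : ℝ) < n := by exact_mod_cast hn
  have hn1 : (0 : ℝ) < ((n + 1 : ℕ) : ℝ) := by positivity
  set m : ℝ := ((n + 1 : ℕ) : ℝ) with hm
  have hmn : (n : ℝ) = m * (1 - 1 / m) := by
    rw [hm]; push_cast; field_simp; ring
  have h1 : (n : ℝ) ≤ m * Real.exp (-(1 / m)) := by
    rw [hmn]
    have := Real.add_one_le_exp (-(1 / m))
    gcongr
    linarith
  have h2 : (m * Real.exp (-(1 / m))) ^ (-a) ≤ (n : ℝ) ^ (-a) :=
    Real.rpow_le_rpow_of_nonpos hn0 h1 (by linarith)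
  rw [Real.mul_rpow hn1.le (Real.exp_pos _).le, ← Real.exp_mul] at h2
  have h3 := Real.add_one_le_exp (-(1 / m) * -a)
  have h4 : m ^ (-a - 1) = m ^ (-a) * (1 / m) := by
    rw [Real.rpow_sub hn1, Real.rpow_one]; ring
  have h5 : 0 < m ^ (-a) := Real.rpow_pos_of_pos hn1 _
  rw [h4]
  nlinarith

lemma tail_sum {a : ℝ} (ha : 0 < a) {n : ℕ} (hn : 1 ≤ n) (N : ℕ) :
    ∑ m ∈ range N, a * ((n + m + 1 : ℕ) : ℝ) ^ (-a - 1) ≤ (n : ℝ) ^ (-a) := by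
  have : ∑ m ∈ range N, a * ((n + m + 1 : ℕ) : ℝ) ^ (-a - 1) ≤ (n : ℝ) ^ (-a) - ((n + N : ℕ) : ℝ) ^ (-a) := by
    induction N with
    | zero => simp
    | succ N ih =>
      rw [Finset.sum_range_succ]
      have := tail_rpow ha (n := n + N) (by omega)
      rw [show n + (N + 1) = n + N + 1 by ring]
      linarith
  have h : 0 ≤ ((n + N : ℕ) : ℝ) ^ (-a) := by positivity
  linarith

/-- The only size bound on `L` we need: near `1`. -/
theorem LF_bound (hχ : χ ≠ 1) {s : ℂ} (hs : ‖s - 1‖ ≤ 1 / (2 * Real.log (q + 2))) :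
    ‖χ.LFunction s‖ ≤ 32 * Real.log (q + 2) := by
  have hq1 : 1 ≤ q := NeZero.pos q
  have hq1' : (1 : ℝ) ≤ q := by exact_mod_cast hq1
  have hl : 1 ≤ Real.log (q + 2) := by
    rw [Real.le_log_iff_exp_le (by positivity)]
    have := Real.exp_one_lt_d9
    linarith
  set l := Real.log (q + 2) with hldef
  have hd : 1 / (2 * l) ≤ 1 / 2 := by
    apply one_div_le_one_div_of_le <;> linarith
  have hre : |s.re - 1| ≤ 1 / (2 * l) := by
    have := Complex.abs_re_le_norm (s - 1)
    simp only [Complex.sub_re, Complex.one_re] at this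
    linarith
  have hre1 := (abs_le.1 hre).1
  have hre2 := (abs_le.1 hre).2
  have hns : ‖s‖ ≤ 3 / 2 := by
    have : ‖s‖ ≤ ‖s - 1‖ + ‖(1 : ℂ)‖ := by
      have := norm_add_le (s - 1) 1
      simpa using this
    rw [norm_one] at this
    linarith
  -- strict positivity of the real part
  have hq2 : 1 < l ∨ l = 1 := (lt_or_eq_of_le hl).imp id Eq.symm
  have hl' : 1 < l := by
    rw [hldef, Real.lt_log_iff_exp_lt (by positivity)]
    have := Real.exp_one_lt_d9
    linarith
  have hd' : 1 / (2 * l) < 1 / 2 := by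
    apply one_div_lt_one_div_of_lt <;> linarith
  have hsr : 1 / 2 < s.re := by linarith
  have hsU : s ∈ regU := ⟨hsr, by simp; linarith⟩
  rw [LF_eq_aT χ hχ hsU]
  have hsum : Summable (aT χ s) := Summable.of_norm_bounded (aT_sum_bound (q := q)) (fun n => aT_le' χ hχ hsU n)
  have hqd : (q : ℝ) ^ (1 / (2 * l)) ≤ 2 := by
    have h1 : (q : ℝ) ^ (1 / (2 * l)) ≤ Real.exp (1 / 2) := by
      rw [Real.rpow_def_of_pos (by linarith)]
      apply Real.exp_le_exp.2
      have : Real.log q ≤ l := Real.log_le_log (by linarith) (by linarith)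
      calc Real.log q * (1 / (2 * l)) ≤ l * (1 / (2 * l)) := by gcongr
        _ = 1 / 2 := by field_simp
    have h2 : Real.exp (1 / 2) ≤ 2 := by
      have h3 : Real.exp (1 / 2) ^ 2 = Real.exp 1 := by
        rw [← Real.exp_nat_mul]; norm_num
      have := Real.exp_one_lt_d9
      nlinarith [Real.exp_pos (1 / 2)]
    linarith
  have hfirst : ∑ n ∈ range (q + 1), ‖aT χ s n‖ ≤ 3 * (1 + l) := by
    have h1 : ∀ n ∈ Ioc 0 q, ‖aT χ s n‖ ≤ 3 * ((1 : ℝ) / n) := by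
      intro n hn
      simp only [mem_Ioc] at hn
      have hn0 : (0 : ℝ) < n := by exact_mod_cast hn.1
      have hn1 : (1 : ℝ) ≤ n := by exact_mod_cast hn.1
      have hnq : (n : ℝ) ≤ q := by exact_mod_cast hn.2
      refine (aT_le χ hχ (by linarith) n).trans ?_
      have h2 : (n : ℝ) ^ (-s.re - 1) ≤ 2 * (1 / n) * (1 / n) := by
        calc (n : ℝ) ^ (-s.re - 1) ≤ (n : ℝ) ^ (1 / (2 * l) + (-1) + (-1)) := by
              apply Real.rpow_le_rpow_of_exponent_le hn1; linarith
          _ = (n : ℝ) ^ (1 / (2 * l)) * (1 / n) * (1 / n) := by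
              rw [Real.rpow_add hn0, Real.rpow_add hn0, Real.rpow_neg_one]; ring
          _ ≤ 2 * (1 / n) * (1 / n) := by
              gcongr
              exact (Real.rpow_le_rpow hn0.le hnq (by positivity)).trans hqd
      calc min (n : ℝ) q * (‖s‖ * (n : ℝ) ^ (-s.re - 1)) ≤ n * (3 / 2 * (2 * (1 / n) * (1 / n))) := by
            gcongr
            exact min_le_left _ _
        _ = 3 * ((1 : ℝ) / n) := by field_simp
    rw [Finset.range_eq_Ico, Finset.sum_eq_sum_Ico_succ_bot (by omega)]
    have h0 : ‖aT χ s 0‖ = 0 := by simp [aT, pS]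
    rw [h0, zero_add]
    have h3 : ∑ n ∈ Ioc 0 q, (1 : ℝ) / n ≤ 1 + Real.log q := sum_inv_le q
    have h4 : Real.log q ≤ l := Real.log_le_log (by linarith) (by linarith)
    calc ∑ n ∈ Ico (0 + 1) (q + 1), ‖aT χ s n‖ = ∑ n ∈ Ioc 0 q, ‖aT χ s n‖ := rfl
      _ ≤ ∑ n ∈ Ioc 0 q, 3 * ((1 : ℝ) / n) := Finset.sum_le_sum h1
      _ ≤ 3 * (1 + l) := by rw [← Finset.mul_sum]; linarith
  have hsecond : ∀ N, ∑ m ∈ range N, ‖aT χ s (m + (q + 1))‖ ≤ 6 := by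
    intro N
    have h1 : ∀ m ∈ range N, ‖aT χ s (m + (q + 1))‖ ≤ 3 * q * (s.re * ((q + m + 1 : ℕ) : ℝ) ^ (-s.re - 1)) := by
      intro m _
      refine (aT_le χ hχ (by linarith) _).trans ?_
      rw [show m + (q + 1) = q + m + 1 by ring]
      calc min ((q + m + 1 : ℕ) : ℝ) q * (‖s‖ * ((q + m + 1 : ℕ) : ℝ) ^ (-s.re - 1))
          ≤ q * (3 / 2 * ((q + m + 1 : ℕ) : ℝ) ^ (-s.re - 1)) := by
            gcongr; exact min_le_right _ _
        _ ≤ q * ((3 * s.re) * ((q + m + 1 : ℕ) : ℝ) ^ (-s.re - 1)) := by gcongr; linarith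
        _ = _ := by ring
    refine (Finset.sum_le_sum h1).trans ?_
    rw [← Finset.mul_sum]
    have h2 := tail_sum (a := s.re) (by linarith) hq1 N
    have h3 : (q : ℝ) ^ (-s.re) ≤ 2 * (1 / q) := by
      calc (q : ℝ) ^ (-s.re) ≤ (q : ℝ) ^ (1 / (2 * l) + (-1)) := by
            apply Real.rpow_le_rpow_of_exponent_le hq1'; linarith
        _ = (q : ℝ) ^ (1 / (2 * l)) * (1 / q) := by
            rw [Real.rpow_add (by linarith), Real.rpow_neg_one]; ring
        _ ≤ _ := by gcongr
    calc 3 * (q : ℝ) * ∑ m ∈ range N, s.re * ((q + m + 1 : ℕ) : ℝ) ^ (-s.re - 1) ≤ 3 * q * (2 * (1 / q)) := by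
          gcongr; exact h2.trans h3
      _ = 6 := by field_simp; norm_num
  rw [← hsum.sum_add_tsum_nat_add (q + 1)]
  refine (norm_add_le _ _).trans ?_
  have h1 : ‖∑ n ∈ range (q + 1), aT χ s n‖ ≤ 3 * (1 + l) := (norm_sum_le _ _).trans hfirst
  have h2 : ‖∑' m, aT χ s (m + (q + 1))‖ ≤ 6 := by
    have hs2 : Summable fun m => aT χ s (m + (q + 1)) := (summable_nat_add_iff (q + 1)).2 hsum
    refine le_of_tendsto (hs2.hasSum.tendsto_sum_nat.norm) (Filter.Eventually.of_forall fun N => ?_)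
    exact (norm_sum_le _ _).trans (hsecond N)
  linarith

end chars
end PD

namespace PD
open Finset

lemma zeta_sum_le {e : ℝ} (he : 0 < e) (N : ℕ) :
    ∑ n ∈ range N, (n : ℝ) ^ (-(1 + e)) ≤ 1 + 1 / e := by
  rcases N with _ | _ | N
  · simp; positivity
  · simp; rw [Real.zero_rpow (by linarith)]; positivity
  · rw [Finset.sum_range_succ', Finset.sum_range_succ']
    have h := tail_sum he (n := 1) le_rfl N
    rw [← Finset.mul_sum] at h
    have h1 : ∑ m ∈ range N, ((m + 1 + 1 : ℕ) : ℝ) ^ (-(1 + e)) ≤ 1 / e := by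
      rw [le_div_iff₀ he]
      rw [mul_comm]
      rw [Nat.cast_one, Real.one_rpow] at h
      refine le_trans (le_of_eq ?_) h
      congr 1
      apply Finset.sum_congr rfl
      intro m _
      congr 1
      · push_cast; ring
      · ring
    have h2 : ((0 : ℕ) : ℝ) ^ (-(1 + e)) = 0 := by
      rw [Nat.cast_zero, Real.zero_rpow (by linarith)]
    rw [h2]
    simp only [zero_add, Nat.cast_one, Real.one_rpow]
    linarith

lemma summable_zeta {e : ℝ} (he : 0 < e) : Summable fun n : ℕ => (n : ℝ) ^ (-(1 + e)) := by
  rw [Real.summable_nat_rpow]; linarith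

lemma tsum_zeta_le {e : ℝ} (he : 0 < e) : ∑' n : ℕ, (n : ℝ) ^ (-(1 + e)) ≤ 1 + 1 / e :=
  (summable_zeta he).tsum_le_of_sum_range_le (zeta_sum_le he)

lemma LSeries_norm_le (f : ℕ → ℂ) (hf : ∀ n, ‖f n‖ ≤ 1) {e : ℝ} (he : 0 < e) :
    ‖LSeries f (1 + e : ℝ)‖ ≤ 1 + 1 / e := by
  refine le_trans ?_ (tsum_zeta_le he)
  unfold LSeries
  refine tsum_of_norm_bounded (summable_zeta he).hasSum fun n => ?_
  rw [LSeries.norm_term_eq]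
  split_ifs with h
  · positivity
  · rw [Real.rpow_neg (by positivity), div_eq_mul_inv]
    rw [Complex.ofReal_re]
    have := hf n
    have h2 : 0 ≤ ((n : ℝ) ^ (1 + e))⁻¹ := by positivity
    nlinarith

lemma LF_upper {q : ℕ} [NeZero q] (χ : DirichletCharacter ℂ q) {e : ℝ} (he : 0 < e) :
    ‖χ.LFunction (1 + e : ℝ)‖ ≤ 1 + 1 / e := by
  rw [χ.LFunction_eq_LSeries (by simp [he])]
  exact LSeries_norm_le _ (fun n => χ.norm_le_one _) he

lemma LF_lower {q : ℕ} [NeZero q] (χ : DirichletCharacter ℂ q) {e : ℝ} (he : 0 < e) :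
    1 ≤ ‖χ.LFunction (1 + e : ℝ)‖ * (1 + 1 / e) := by
  have hs : 1 < (((1 + e : ℝ) : ℂ)).re := by simp [he]
  rw [χ.LFunction_eq_LSeries hs]
  have h1 := DirichletCharacter.LSeries.mul_mu_eq_one χ hs
  have h2 := congrArg norm h1
  rw [norm_mul, norm_one] at h2
  refine h2.symm.le.trans (mul_le_mul_of_nonneg_left ?_ (norm_nonneg _))
  apply LSeries_norm_le _ _ he
  intro n
  rw [Pi.mul_apply, norm_mul]
  have h3 := χ.norm_le_one (n : ZMod q)
  have h4 : ‖((ArithmeticFunction.moebius n : ℤ) : ℂ)‖ ≤ 1 := by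
    rw [Complex.norm_intCast]
    have := ArithmeticFunction.abs_moebius_le_one (n := n)
    exact_mod_cast this
  have := norm_nonneg (χ (n : ZMod q))
  have := norm_nonneg (((ArithmeticFunction.moebius n : ℤ) : ℂ))
  nlinarith

/-- Borel-Caratheodory for derivatives of the logarithmic derivative. -/
lemma logDeriv_bound (f : ℂ → ℂ) (c : ℂ) (R M : ℝ) (hR : 0 < R) (hM : 0 < M)
    (hf : DifferentiableOn ℂ f (Metric.ball c R)) (h0 : ∀ z ∈ Metric.ball c R, f z ≠ 0)
    (hb : ∀ z ∈ Metric.ball c R, ‖f z‖ ≤ Real.exp M * ‖f c‖) (j : ℕ) :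
    ‖iteratedDeriv j (fun z => deriv f z / f z) c‖ ≤
      6 * M * (j + 1) * (j + 1).factorial / R ^ (j + 1) := by
  have hball : IsOpen (Metric.ball c R) := Metric.isOpen_ball
  have hcm : c ∈ Metric.ball c R := Metric.mem_ball_self hR
  have hd : DifferentiableOn ℂ (fun z => deriv f z / f z) (Metric.ball c R) :=
    (hf.deriv hball).div hf h0
  obtain ⟨g, hg0, hg⟩ := Complex.IsExactOn.with_val_at (DifferentiableOn.isExactOn_ball hd) c 0
  have hgd : DifferentiableOn ℂ g (Metric.ball c R) :=
    fun z hz => (hg z hz).differentiableAt.differentiableWithinAt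
  -- exp g * f c = f
  have hexp : ∀ z ∈ Metric.ball c R, f z * Complex.exp (-g z) = f c := by
    have hder : ∀ z ∈ Metric.ball c R, HasDerivWithinAt (fun z => f z * Complex.exp (-g z)) 0 (Metric.ball c R) z := by
      intro z hz
      have h1 : HasDerivAt f (deriv f z) z := (hf.differentiableAt (hball.mem_nhds hz)).hasDerivAt
      have h2 : HasDerivAt (fun z => Complex.exp (-g z)) (Complex.exp (-g z) * -(deriv f z / f z)) z :=
        (hg z hz).neg.cexp
      have h3 := h1.mul h2
      refine HasDerivAt.hasDerivWithinAt ?_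
      have := h0 z hz
      have h6 : deriv f z * Complex.exp (-g z) + f z * (Complex.exp (-g z) * -(deriv f z / f z)) = 0 := by
        field_simp
        ring
      rw [h6] at h3
      exact h3
    intro z hz
    have h4 := (convex_ball c R).norm_image_sub_le_of_norm_hasDerivWithin_le (C := 0) hder (by simp) hcm hz
    rw [zero_mul] at h4
    have h5 := norm_le_zero_iff.1 h4
    rw [sub_eq_zero] at h5
    rw [h5, hg0]; simp
  have hre : ∀ z ∈ Metric.ball c R, (g z).re ≤ M := by
    intro z hz
    have h1 := congrArg norm (hexp z hz)
    rw [norm_mul, Complex.norm_exp, Complex.neg_re] at h1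
    have h2 := hb z hz
    have hc0 : 0 < ‖f c‖ := norm_pos_iff.2 (h0 c hcm)
    have h3 : ‖f z‖ = ‖f c‖ * Real.exp (g z).re := by
      rw [← h1, mul_assoc, ← Real.exp_add]; simp
    rw [h3, mul_comm] at h2
    exact Real.exp_le_exp.1 (le_of_mul_le_mul_right h2 hc0)
  set r : ℝ := R * ((j + 1) / (j + 2)) with hr
  have hj2 : ((j : ℝ) + 1) / (j + 2) < 1 := by rw [div_lt_one (by positivity)]; linarith
  have hr0 : 0 < r := by positivity
  have hrR : r < R := by rw [hr]; nlinarith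
  have hsph : ∀ z ∈ Metric.sphere c r, ‖g z‖ ≤ 2 * M * (j + 1) := by
    intro z hz
    have hz' : ‖z - c‖ = r := by simpa [dist_eq_norm] using hz
    have h := Complex.borelCaratheodory_zero (f := fun u => g (c + u)) (R := R) (z := z - c) hM ?_ ?_ hR ?_ ?_
    · simp only [add_sub_cancel] at h
      refine h.trans (le_of_eq ?_)
      rw [hz']
      have : R - r = R / (j + 2) := by rw [hr]; field_simp; ring
      rw [this, hr]
      field_simp
    · refine hgd.comp ((differentiableOn_const c).add differentiableOn_id) ?_
      intro u hu
      simpa [dist_eq_norm] using hu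
    · intro u hu
      apply hre
      simpa [dist_eq_norm] using hu
    · simp only [Metric.mem_ball, dist_zero_right]; linarith
    · simpa using hg0
  have hdc : DiffContOnCl ℂ g (Metric.ball c r) := by
    apply DifferentiableOn.diffContOnCl
    refine hgd.mono ?_
    refine (Metric.closure_ball_subset_closedBall).trans ?_
    exact Metric.closedBall_subset_ball hrR
  have hC := Complex.norm_iteratedDeriv_le_of_forall_mem_sphere_norm_le (j + 1) hr0 hdc hsph
  have heq : iteratedDeriv (j + 1) g c = iteratedDeriv j (fun z => deriv f z / f z) c := by
    rw [iteratedDeriv_succ']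
    apply Filter.EventuallyEq.iteratedDeriv_eq
    filter_upwards [hball.mem_nhds hcm] with z hz
    exact (hg z hz).deriv
  rw [heq] at hC
  refine hC.trans ?_
  have he : ((j + 2 : ℝ) / (j + 1)) ^ (j + 1) ≤ 3 := by
    have h1 : (j + 2 : ℝ) / (j + 1) ≤ Real.exp (1 / (j + 1)) := by
      have := Real.add_one_le_exp (1 / ((j : ℝ) + 1))
      refine le_trans (le_of_eq ?_) this
      field_simp; ring
    calc ((j + 2 : ℝ) / (j + 1)) ^ (j + 1) ≤ Real.exp (1 / (j + 1)) ^ (j + 1) := by gcongr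
      _ = Real.exp 1 := by
        rw [← Real.exp_nat_mul]; congr 1; push_cast; field_simp
      _ ≤ 3 := by have := Real.exp_one_lt_d9; linarith
  have hr' : r ^ (j + 1) = R ^ (j + 1) / ((j + 2 : ℝ) / (j + 1)) ^ (j + 1) := by
    rw [hr, ← div_pow]; congr 1; field_simp
  rw [hr']
  have hp : 0 < R ^ (j + 1) := by positivity
  rw [div_div_eq_mul_div]
  rw [div_le_div_iff_of_pos_right hp]
  calc ((j + 1).factorial : ℝ) * (2 * M * (j + 1)) * ((j + 2 : ℝ) / (j + 1)) ^ (j + 1)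
      ≤ ((j + 1).factorial : ℝ) * (2 * M * (j + 1)) * 3 := by gcongr
    _ = _ := by ring

/-- the weighted prime sum twisted by a character -/
noncomputable def vS {q : ℕ} (χ : DirichletCharacter ℂ q) (j : ℕ) (e : ℝ) : ℂ :=
  ∑' n : ℕ, ((ArithmeticFunction.vonMangoldt n * (Real.log n ^ j * (n : ℝ) ^ (-(1 + e))) : ℝ) : ℂ) * χ n

lemma logMul_iter (f : ℕ → ℂ) (j n : ℕ) : (LSeries.logMul^[j] f) n = Complex.log n ^ j * f n := by
  induction j generalizing f with
  | zero => simp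
  | succ j ih => rw [Function.iterate_succ, Function.comp, ih]; unfold LSeries.logMul; ring

lemma vS_eq {q : ℕ} [NeZero q] (χ : DirichletCharacter ℂ q) (hχ : χ ≠ 1) (j : ℕ) {e : ℝ} (he : 0 < e) :
    ‖vS χ j e‖ = ‖iteratedDeriv j (fun z => deriv χ.LFunction z / χ.LFunction z) (1 + e : ℝ)‖ := by
  have hs : 1 < (((1 + e : ℝ) : ℂ)).re := by simp [he]
  set F : ℕ → ℂ := (fun n : ℕ => χ n) * fun n : ℕ => ((ArithmeticFunction.vonMangoldt n : ℝ) : ℂ) with hF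
  have hab : LSeries.abscissaOfAbsConv F < (((1 + e : ℝ) : ℂ)).re := by
    refine lt_of_le_of_lt (LSeries.abscissaOfAbsConv_le_of_forall_lt_LSeriesSummable (x := 1) ?_)
      (by exact_mod_cast hs)
    intro y hy
    exact DirichletCharacter.LSeriesSummable_twist_vonMangoldt χ (by simpa using hy)
  have h1 := LSeries_iteratedDeriv j hab
  have h2 : iteratedDeriv j (LSeries F) (1 + e : ℝ) =
      iteratedDeriv j (fun z => -(deriv χ.LFunction z / χ.LFunction z)) (1 + e : ℝ) := by
    apply Filter.EventuallyEq.iteratedDeriv_eq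
    have hV : {s : ℂ | 1 < s.re} ∈ nhds (((1 + e : ℝ) : ℂ)) :=
      (isOpen_lt continuous_const Complex.continuous_re).mem_nhds hs
    filter_upwards [hV] with z hz
    rw [hF, DirichletCharacter.LSeries_twist_vonMangoldt_eq χ hz, χ.LFunction_eq_LSeries hz, χ.deriv_LFunction_eq_deriv_LSeries hz]
    ring
  have h3 : LSeries (LSeries.logMul^[j] F) (1 + e : ℝ) = vS χ j e := by
    unfold LSeries vS
    congr 1
    ext n
    rcases Nat.eq_zero_or_pos n with rfl | hn
    · simp
    · rw [LSeries.term_of_ne_zero hn.ne', logMul_iter, hF]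
      simp only [Pi.mul_apply]
      push_cast
      rw [Complex.ofReal_cpow (by positivity), ← Complex.natCast_log, Complex.ofReal_neg, Complex.cpow_neg]
      push_cast
      ring
  have h4 : iteratedDeriv j (fun z => -(deriv χ.LFunction z / χ.LFunction z)) (1 + e : ℝ) =
      -iteratedDeriv j (fun z => (deriv χ.LFunction z / χ.LFunction z)) (1 + e : ℝ) := by
    exact iteratedDeriv_fun_neg j _ _
  rw [← h3]
  rw [h2, h4] at h1
  have h5 := congrArg norm h1
  rw [norm_neg, norm_mul, norm_pow, norm_neg, norm_one, one_pow, one_mul] at h5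
  exact h5.symm

/-- D2: zero-free disc gives a bound. -/
theorem vS_bound {q : ℕ} [NeZero q] (χ : DirichletCharacter ℂ q) (hχ : χ ≠ 1) (j : ℕ) {e : ℝ} (he : 0 < e)
    (he2 : 3 * e ≤ 1 / (2 * Real.log (q + 2)))
    (h0 : ∀ z, ‖z - 1‖ < 3 * e → χ.LFunction z ≠ 0) :
    ‖vS χ j e‖ ≤ 6 * Real.log (64 * Real.log (q + 2) / e) * (j + 1) * (j + 1).factorial / (2 * e) ^ (j + 1) := by
  rw [vS_eq χ hχ j he]
  have hl' : 1 < Real.log (q + 2) := by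
    rw [Real.lt_log_iff_exp_lt (by positivity)]
    have := Real.exp_one_lt_d9
    have hq1' : (1 : ℝ) ≤ q := by exact_mod_cast (NeZero.pos q)
    linarith
  have he1 : e ≤ 1 := by
    have : 1 / (2 * Real.log (q + 2)) ≤ 1 := by
      rw [div_le_one (by positivity)]; linarith
    linarith
  have hsub : ∀ z ∈ Metric.ball (((1 + e : ℝ) : ℂ)) (2 * e), ‖z - 1‖ < 3 * e := by
    intro z hz
    rw [Metric.mem_ball, dist_eq_norm] at hz
    have : z - 1 = (z - (1 + e : ℝ)) + (e : ℝ) := by push_cast; ring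
    rw [this]
    refine (norm_add_le _ _).trans_lt ?_
    rw [Complex.norm_of_nonneg he.le]
    linarith
  have h64 : 64 < 64 * Real.log (q + 2) / e := by
    rw [lt_div_iff₀ he]; nlinarith
  refine logDeriv_bound _ _ _ _ (by positivity) (Real.log_pos (by linarith))
    (DirichletCharacter.differentiable_LFunction hχ).differentiableOn (fun z hz => h0 z (hsub z hz)) ?_ j
  intro z hz
  rw [Real.exp_log (by linarith)]
  refine (LF_bound χ hχ ((hsub z hz).le.trans he2)).trans ?_
  have h1 := LF_lower χ he
  have h2 : 1 + 1 / e ≤ 2 / e := by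
    rw [le_div_iff₀ he]; field_simp; linarith
  have h3 : 1 ≤ ‖χ.LFunction (1 + e : ℝ)‖ * (2 / e) := h1.trans (by gcongr)
  calc 32 * Real.log (q + 2) ≤ 32 * Real.log (q + 2) * (‖χ.LFunction (1 + e : ℝ)‖ * (2 / e)) := by
        apply le_mul_of_one_le_right (by linarith) h3
    _ = _ := by ring

end PD

namespace PD
open Finset

lemma LF_exp {q : ℕ} [NeZero q] (χ : DirichletCharacter ℂ q) {e : ℝ} (he : 0 < e) :
    ∃ S : ℕ → ℝ, (∀ n, S n = (ArithmeticFunction.vonMangoldt n / Real.log n * (n : ℝ) ^ (-(1 + e))) * (χ n).re) ∧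
      Summable S ∧ ‖χ.LFunction (1 + e : ℝ)‖ = Real.exp (∑' n, S n) := by
  have hs : 1 < (((1 + e : ℝ) : ℂ)).re := by simp [he]
  have h := DirichletCharacter.LSeries_eq_exp_LSeries χ hs
  have hsum : LSeriesSummable (fun n : ℕ => χ n * (ArithmeticFunction.vonMangoldt n : ℂ) / (Real.log n : ℂ)) (((1 + e : ℝ) : ℂ)) := by
    apply LSeriesSummable_of_bounded_of_one_lt_re (m := 1) _ hs
    intro n _
    rw [norm_div, norm_mul, Complex.norm_real, Complex.norm_real]
    have h1 := χ.norm_le_one (n : ZMod q)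
    have h2 : ‖ArithmeticFunction.vonMangoldt n‖ ≤ ‖Real.log n‖ := by
      rw [Real.norm_of_nonneg ArithmeticFunction.vonMangoldt_nonneg, Real.norm_of_nonneg (Real.log_natCast_nonneg n)]
      exact ArithmeticFunction.vonMangoldt_le_log
    apply div_le_one_of_le₀ _ (norm_nonneg _)
    have := norm_nonneg (ArithmeticFunction.vonMangoldt n)
    have := norm_nonneg (χ (n : ZMod q))
    nlinarith
  refine ⟨fun n => (LSeries.term (fun n : ℕ => χ n * (ArithmeticFunction.vonMangoldt n : ℂ) / (Real.log n : ℂ)) (((1 + e : ℝ) : ℂ)) n).re, ?_, ?_, ?_⟩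
  · intro n
    rcases Nat.eq_zero_or_pos n with rfl | hn
    · simp
    · simp only [LSeries.term_of_ne_zero hn.ne']
      rw [show ((n : ℂ) ^ (((1 + e : ℝ) : ℂ))) = (((n : ℝ) ^ (1 + e) : ℝ) : ℂ) by
        rw [Complex.ofReal_cpow (by positivity)]; simp]
      rw [Real.rpow_neg (by positivity)]
      rw [show χ n * (ArithmeticFunction.vonMangoldt n : ℂ) / (Real.log n : ℂ) / (((n : ℝ) ^ (1 + e) : ℝ) : ℂ) =
        ((ArithmeticFunction.vonMangoldt n / Real.log n * ((n : ℝ) ^ (1 + e))⁻¹ : ℝ) : ℂ) * χ n by push_cast; ring]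
      rw [Complex.re_ofReal_mul]
  · exact (Complex.hasSum_re hsum.hasSum).summable
  · rw [χ.LFunction_eq_LSeries hs, ← h, Complex.norm_exp]
    congr 1
    exact Complex.re_tsum hsum

lemma three_pos {q : ℕ} [NeZero q] (χ₁ χ₂ : DirichletCharacter ℂ q) (n : ℕ) :
    0 ≤ 3 * ((1 : DirichletCharacter ℂ q) n).re + 2 * (χ₁ n).re + 2 * (χ₂ n).re + 2 * ((χ₁ * χ₂⁻¹) n).re := by
  by_cases hn : IsUnit (n : ZMod q)
  · have h1 : ‖χ₁ n‖ = 1 := by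
      have := DirichletCharacter.unit_norm_eq_one χ₁ hn.unit
      simpa using this
    have h2 : ‖χ₂ n‖ = 1 := by
      have := DirichletCharacter.unit_norm_eq_one χ₂ hn.unit
      simpa using this
    rw [MulChar.one_apply hn, MulChar.mul_apply, MulChar.inv_apply_eq_inv', Complex.inv_def]
    rw [Complex.normSq_eq_norm_sq, h2]
    have h3 : (χ₁ n).re ^ 2 + (χ₁ n).im ^ 2 = 1 := by
      have := Complex.sq_norm (χ₁ n)
      rw [h1, Complex.normSq_apply] at this; linarith
    have h4 : (χ₂ n).re ^ 2 + (χ₂ n).im ^ 2 = 1 := by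
      have := Complex.sq_norm (χ₂ n)
      rw [h2, Complex.normSq_apply] at this; linarith
    simp
    nlinarith [sq_nonneg (1 + (χ₁ n).re + (χ₂ n).re), sq_nonneg ((χ₁ n).im + (χ₂ n).im)]
  · simp [MulChar.map_nonunit _ hn]

lemma three_prod {q : ℕ} [NeZero q] (χ₁ χ₂ : DirichletCharacter ℂ q) {e : ℝ} (he : 0 < e) :
    1 ≤ ‖(1 : DirichletCharacter ℂ q).LFunction (1 + e : ℝ)‖ ^ 3 * ‖χ₁.LFunction (1 + e : ℝ)‖ ^ 2 *
      ‖χ₂.LFunction (1 + e : ℝ)‖ ^ 2 * ‖(χ₁ * χ₂⁻¹).LFunction (1 + e : ℝ)‖ ^ 2 := by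
  obtain ⟨S0, h0, s0, e0⟩ := LF_exp (1 : DirichletCharacter ℂ q) he
  obtain ⟨S1, h1, s1, e1⟩ := LF_exp χ₁ he
  obtain ⟨S2, h2, s2, e2⟩ := LF_exp χ₂ he
  obtain ⟨S3, h3, s3, e3⟩ := LF_exp (χ₁ * χ₂⁻¹) he
  rw [e0, e1, e2, e3, ← Real.exp_nat_mul, ← Real.exp_nat_mul, ← Real.exp_nat_mul, ← Real.exp_nat_mul,
    ← Real.exp_add, ← Real.exp_add, ← Real.exp_add]
  apply Real.one_le_exp
  have hsum := (((s0.hasSum.mul_left 3).add (s1.hasSum.mul_left 2)).add (s2.hasSum.mul_left 2)).add (s3.hasSum.mul_left 2)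
  push_cast
  rw [← hsum.tsum_eq]
  refine tsum_nonneg fun n => ?_
  rw [h0, h1, h2, h3]
  have := three_pos χ₁ χ₂ n
  have hw : 0 ≤ ArithmeticFunction.vonMangoldt n / Real.log n * (n : ℝ) ^ (-(1 + e)) :=
    mul_nonneg (div_nonneg ArithmeticFunction.vonMangoldt_nonneg (Real.log_natCast_nonneg n)) (by positivity)
  nlinarith

lemma LF_near_zero {q : ℕ} [NeZero q] (χ : DirichletCharacter ℂ q) (hχ : χ ≠ 1) {e : ℝ} (he : 0 < e)
    (he2 : e ≤ 1 / (4 * Real.log (q + 2))) {r : ℂ} (hr : ‖r - 1‖ ≤ e) (h0 : χ.LFunction r = 0) :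
    ‖χ.LFunction (1 + e : ℝ)‖ ≤ 256 * e * Real.log (q + 2) ^ 2 := by
  have hl : 0 < Real.log (q + 2) := Real.log_pos (by have : (0:ℝ) ≤ q := by positivity
                                                     linarith)
  set l := Real.log (q + 2) with hl'
  have hdiff := DirichletCharacter.differentiable_LFunction hχ
  have hder : ∀ z ∈ Metric.closedBall (1 : ℂ) e, ‖deriv χ.LFunction z‖ ≤ 128 * l ^ 2 := by
    intro z hz
    have := Complex.norm_deriv_le_of_forall_mem_sphere_norm_le (c := z) (R := 1 / (4 * l)) (C := 32 * l)
      (f := χ.LFunction) (by positivity) hdiff.diffContOnCl ?_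
    · refine this.trans (le_of_eq ?_)
      field_simp; norm_num
    · intro w hw
      apply LF_bound χ hχ
      rw [mem_sphere_iff_norm] at hw
      rw [mem_closedBall_iff_norm] at hz
      have h1 : w - 1 = (w - z) + (z - 1) := by ring
      rw [h1]
      refine (norm_add_le _ _).trans ?_
      rw [hw, ← hl']
      have : 1 / (4 * l) + 1 / (4 * l) = 1 / (2 * l) := by field_simp; norm_num
      linarith
  have h1 := (convex_closedBall (1 : ℂ) e).norm_image_sub_le_of_norm_deriv_le (𝕜 := ℂ) (f := χ.LFunction)
    (fun z _ => hdiff z) hder (x := r) (y := ((1 + e : ℝ) : ℂ)) (by rwa [mem_closedBall_iff_norm])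
    (by rw [mem_closedBall_iff_norm]; push_cast; simp [abs_of_pos he])
  rw [h0, sub_zero] at h1
  refine h1.trans ?_
  have h2 : ‖((1 + e : ℝ) : ℂ) - r‖ ≤ 2 * e := by
    have : ((1 + e : ℝ) : ℂ) - r = (e : ℂ) - (r - 1) := by push_cast; ring
    rw [this]
    refine (norm_sub_le _ _).trans ?_
    rw [Complex.norm_of_nonneg he.le]; linarith
  calc 128 * l ^ 2 * ‖((1 + e : ℝ) : ℂ) - r‖ ≤ 128 * l ^ 2 * (2 * e) := by gcongr
    _ = _ := by ring

lemma repulsion_same {q : ℕ} [NeZero q] (χ₁ χ₂ : DirichletCharacter ℂ q) (hχ₁ : χ₁ ≠ 1) (hχ₂ : χ₂ ≠ 1)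
    (hne : χ₁ ≠ χ₂) {e : ℝ} (he : 0 < e)
    (he2 : e ≤ 1 / (4 * Real.log (q + 2))) {r₁ r₂ : ℂ} (hr₁ : ‖r₁ - 1‖ ≤ e) (hr₂ : ‖r₂ - 1‖ ≤ e)
    (h₁ : χ₁.LFunction r₁ = 0) (h₂ : χ₂.LFunction r₂ = 0) :
    1 ≤ 2 ^ 45 * e * Real.log (q + 2) ^ 10 := by
  have hl : 1 ≤ Real.log (q + 2) := by
    rw [Real.le_log_iff_exp_le (by positivity)]
    have := Real.exp_one_lt_d9
    have hq1' : (1 : ℝ) ≤ q := by exact_mod_cast (NeZero.pos q)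
    linarith
  have hne' : χ₁ * χ₂⁻¹ ≠ 1 := by rwa [Ne, mul_inv_eq_one]
  have a0 : ‖(1 : DirichletCharacter ℂ q).LFunction (1 + e : ℝ)‖ ≤ 2 / e := by
    refine (LF_upper _ he).trans ?_
    rw [le_div_iff₀ he]; field_simp
    have : 1 / (4 * Real.log (q + 2)) ≤ 1 := by
      rw [div_le_one (by positivity)]; linarith
    linarith
  have a1 := LF_near_zero χ₁ hχ₁ he he2 hr₁ h₁
  have a2 := LF_near_zero χ₂ hχ₂ he he2 hr₂ h₂
  have a3 : ‖(χ₁ * χ₂⁻¹).LFunction (1 + e : ℝ)‖ ≤ 32 * Real.log (q + 2) := by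
    apply LF_bound _ hne'
    have h1 : ((1 + e : ℝ) : ℂ) - 1 = (e : ℂ) := by push_cast; ring
    rw [h1, Complex.norm_of_nonneg he.le]
    refine he2.trans ?_
    apply one_div_le_one_div_of_le (by positivity)
    linarith
  calc 1 ≤ _ := three_prod χ₁ χ₂ he
    _ ≤ (2 / e) ^ 3 * (256 * e * Real.log (q + 2) ^ 2) ^ 2 * (256 * e * Real.log (q + 2) ^ 2) ^ 2 * (32 * Real.log (q + 2)) ^ 2 := by
        gcongr
    _ = _ := by field_simp; norm_num

/-- D3. Either nearby zeros are impossible or the characters have the same zeros. -/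
theorem repulsion {q₁ q₂ : ℕ} [NeZero q₁] [NeZero q₂] (χ₁ : DirichletCharacter ℂ q₁) (χ₂ : DirichletCharacter ℂ q₂)
    (hχ₁ : χ₁ ≠ 1) (hχ₂ : χ₂ ≠ 1) {e : ℝ} (he : 0 < e)
    (he2 : e ≤ 1 / (4 * Real.log ((q₁ * q₂ : ℕ) + 2))) {r₁ r₂ : ℂ} (hr₁ : ‖r₁ - 1‖ ≤ e) (hr₂ : ‖r₂ - 1‖ ≤ e)
    (h₁ : χ₁.LFunction r₁ = 0) (h₂ : χ₂.LFunction r₂ = 0) :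
    1 ≤ 2 ^ 45 * e * Real.log ((q₁ * q₂ : ℕ) + 2) ^ 10 ∨ χ₁.LFunction r₂ = 0 := by
  haveI : NeZero (q₁ * q₂) := ⟨mul_ne_zero (NeZero.ne q₁) (NeZero.ne q₂)⟩
  set ψ₁ := DirichletCharacter.changeLevel (Dvd.intro q₂ rfl : q₁ ∣ q₁ * q₂) χ₁ with hψ₁
  set ψ₂ := DirichletCharacter.changeLevel (Dvd.intro_left q₁ rfl : q₂ ∣ q₁ * q₂) χ₂ with hψ₂
  have z1 : ∀ s, ψ₁.LFunction s = χ₁.LFunction s * ∏ p ∈ (q₁ * q₂).primeFactors, (1 - χ₁ p * (p : ℂ) ^ (-s)) :=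
    fun s => DirichletCharacter.LFunction_changeLevel _ χ₁ (Or.inl hχ₁)
  have z2 : ∀ s, ψ₂.LFunction s = χ₂.LFunction s * ∏ p ∈ (q₁ * q₂).primeFactors, (1 - χ₂ p * (p : ℂ) ^ (-s)) :=
    fun s => DirichletCharacter.LFunction_changeLevel _ χ₂ (Or.inl hχ₂)
  have n1 : ψ₁ ≠ 1 := by
    rw [hψ₁, Ne, DirichletCharacter.changeLevel_eq_one_iff]; exact hχ₁
  have n2 : ψ₂ ≠ 1 := by
    rw [hψ₂, Ne, DirichletCharacter.changeLevel_eq_one_iff]; exact hχ₂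
  by_cases heq : ψ₁ = ψ₂
  · right
    have h3 : ψ₁.LFunction r₂ = 0 := by rw [heq, z2, h₂, zero_mul]
    rw [z1] at h3
    rcases mul_eq_zero.1 h3 with h | h
    · exact h
    · exfalso
      obtain ⟨p, hp, hp0⟩ := Finset.prod_eq_zero_iff.1 h
      have hpp := Nat.prime_of_mem_primeFactors hp
      have h4 : χ₁ p * (p : ℂ) ^ (-r₂) = 1 := by linear_combination -hp0
      have h5 := congrArg norm h4
      rw [norm_mul, norm_one, Complex.norm_natCast_cpow_of_pos hpp.pos] at h5
      have hre : 0 < r₂.re := by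
        have h6 := Complex.abs_re_le_norm (r₂ - 1)
        simp only [Complex.sub_re, Complex.one_re] at h6
        have hl : 1 ≤ Real.log ((q₁ * q₂ : ℕ) + 2) := by
          rw [Real.le_log_iff_exp_le (by positivity)]
          have := Real.exp_one_lt_d9
          have hq1' : (1 : ℝ) ≤ (q₁ * q₂ : ℕ) := by exact_mod_cast (NeZero.pos (q₁ * q₂))
          linarith
        have h7 : 1 / (4 * Real.log ((q₁ * q₂ : ℕ) + 2)) ≤ 1 / 4 := by
          apply one_div_le_one_div_of_le <;> linarith
        have := (abs_le.1 (h6.trans hr₂)).1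
        linarith
      have h8 : (p : ℝ) ^ (-r₂).re < 1 := by
        apply Real.rpow_lt_one_of_one_lt_of_neg
        · exact_mod_cast hpp.one_lt
        · simpa using hre
      have h9 := χ₁.norm_le_one (p : ZMod q₁)
      have h10 : 0 ≤ (p : ℝ) ^ (-r₂).re := by positivity
      nlinarith [norm_nonneg (χ₁ (p : ZMod q₁))]
  · left
    exact repulsion_same ψ₁ ψ₂ n1 n2 heq he he2 hr₁ hr₂ (by rw [z1, h₁, zero_mul]) (by rw [z2, h₂, zero_mul])

end PD

namespace PD
open Finset

/-- the scale `𝓛` -/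
noncomputable def sL (α : ℝ) (j : ℕ) : ℝ := Real.exp (j / α)
/-- the shift `ε` -/
noncomputable def sE (α : ℝ) (j : ℕ) : ℝ := j / sL α j

lemma sL_pos (α : ℝ) (j : ℕ) : 0 < sL α j := Real.exp_pos _

lemma sE_pos (α : ℝ) {j : ℕ} (hj : 0 < j) : 0 < sE α j := by
  unfold sE
  have := sL_pos α j
  positivity

/-- polynomials in `j` are beaten by `𝓛` -/
lemma poly_le_sL {α : ℝ} (hα : 0 < α) (C : ℝ) (d : ℕ) :
    ∀ᶠ j : ℕ in Filter.atTop, C * (j : ℝ) ^ d ≤ sL α j := by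
  have h1 := Real.tendsto_pow_mul_exp_neg_atTop_nhds_zero d
  have h2 : Filter.Tendsto (fun j : ℕ => (j : ℝ) / α) Filter.atTop Filter.atTop :=
    tendsto_natCast_atTop_atTop.atTop_div_const hα
  have h3 := h1.comp h2
  have h4 : (0 : ℝ) < 1 / ((|C| + 1) * α ^ d) := by positivity
  filter_upwards [h3.eventually (gt_mem_nhds h4)] with j hj
  simp only [Function.comp] at hj
  rw [div_pow, Real.exp_neg, lt_div_iff₀ (by positivity)] at hj
  have h5 : (j : ℝ) ^ d / α ^ d * (Real.exp (j / α))⁻¹ * ((|C| + 1) * α ^ d) =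
      (|C| + 1) * (j : ℝ) ^ d * (Real.exp (j / α))⁻¹ := by field_simp
  rw [h5, ← div_eq_mul_inv, div_lt_one (Real.exp_pos _)] at hj
  unfold sL
  have h6 : C * (j : ℝ) ^ d ≤ (|C| + 1) * (j : ℝ) ^ d := by
    gcongr
    linarith [le_abs_self C]
  linarith

lemma sE_anti {α : ℝ} (hα : 0 < α) {j : ℕ} (hj : α ≤ j) : sE α (j + 1) ≤ sE α j := by
  unfold sE sL
  have hj0 : (0 : ℝ) < j := by linarith
  rw [div_le_div_iff₀ (Real.exp_pos _) (Real.exp_pos _)]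
  have h1 : ((j + 1 : ℕ) : ℝ) / α = j / α + 1 / α := by push_cast; ring
  rw [h1, Real.exp_add]
  have h2 := Real.add_one_le_exp (1 / α)
  have h3 : ((j + 1 : ℕ) : ℝ) ≤ j * Real.exp (1 / α) := by
    have h4 : (1 : ℝ) ≤ j * (1 / α) := by
      rw [mul_one_div, le_div_iff₀ hα]; linarith
    push_cast
    nlinarith
  nlinarith [Real.exp_pos ((j : ℝ) / α)]

lemma sE_tendsto {α : ℝ} (hα : 0 < α) {d : ℝ} (hd : 0 < d) :
    ∀ᶠ j : ℕ in Filter.atTop, 3 * sE α j ≤ d := by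
  filter_upwards [poly_le_sL hα (3 / d) 1] with j hj
  unfold sE
  rw [pow_one] at hj
  have := sL_pos α j
  rw [mul_div_assoc', div_le_iff₀ this]
  rw [div_mul_eq_mul_div, div_le_iff₀ hd] at hj
  linarith

lemma log_bd {α : ℝ} (hα : 0 < α) (B : ℕ) {j : ℕ} (hj : 1 ≤ j) {q : ℕ} (hq : (q : ℝ) ≤ sL α j ^ B) :
    Real.log (q + 2) ≤ (B / α + 2) * j := by
  have h1 : (1 : ℝ) ≤ sL α j ^ B := by
    apply one_le_pow₀
    unfold sL
    apply Real.one_le_exp; positivity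
  have hj' : (1 : ℝ) ≤ j := by exact_mod_cast hj
  calc Real.log (q + 2) ≤ Real.log (3 * sL α j ^ B) := by
        apply Real.log_le_log (by positivity); linarith
    _ = Real.log 3 + B * (j / α) := by
        rw [Real.log_mul (by norm_num) (by positivity), Real.log_pow]
        unfold sL
        rw [Real.log_exp]
    _ ≤ 2 * j + B * (j / α) := by
        have := Real.log_le_sub_one_of_pos (show (0 : ℝ) < 3 by norm_num)
        linarith
    _ = _ := by ring

/-- The scale `j` is good. -/
def GoodAt (α : ℝ) (B j : ℕ) : Prop :=
  ∀ (q : ℕ) [NeZero q] (χ : DirichletCharacter ℂ q), χ ≠ 1 → (q : ℝ) ≤ sL α j ^ B →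
    ‖vS χ j (sE α j)‖ ≤ j.factorial / sE α j ^ (j + 1) * (1 / 2) ^ j * sL α j

lemma bad_zero {α : ℝ} (hα : 0 < α) (B : ℕ) : ∀ᶠ j : ℕ in Filter.atTop,
    ∀ (q : ℕ) [NeZero q] (χ : DirichletCharacter ℂ q), χ ≠ 1 → (q : ℝ) ≤ sL α j ^ B →
    (∀ z, ‖z - 1‖ < 3 * sE α j → χ.LFunction z ≠ 0) →
    ‖vS χ j (sE α j)‖ ≤ j.factorial / sE α j ^ (j + 1) * (1 / 2) ^ j * sL α j := by
  set c : ℝ := B / α + 2 with hc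
  have hc0 : 0 < c := by positivity
  filter_upwards [poly_le_sL hα (6 * c) 2, poly_le_sL hα (3 * (64 * c + 1 / α) * 4) 3, Filter.eventually_ge_atTop 1]
    with j h1 h2 hj q _ χ hχ hq hz
  have hj' : (1 : ℝ) ≤ j := by exact_mod_cast hj
  have hl := log_bd hα B hj hq
  have hL := sL_pos α j
  have hE := sE_pos α (j := j) hj
  rw [← hc] at hl
  have hl' : 1 < Real.log (q + 2) := by
    rw [Real.lt_log_iff_exp_lt (by positivity)]
    have := Real.exp_one_lt_d9
    have hq1' : (1 : ℝ) ≤ q := by exact_mod_cast (NeZero.pos q)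
    linarith
  have he2 : 3 * sE α j ≤ 1 / (2 * Real.log (q + 2)) := by
    rw [le_div_iff₀ (by positivity)]
    calc 3 * sE α j * (2 * Real.log (q + 2)) ≤ 3 * sE α j * (2 * (c * j)) := by gcongr
      _ = (6 * c * (j : ℝ) ^ 2) / sL α j := by unfold sE; ring
      _ ≤ 1 := by rw [div_le_one hL]; exact h1
  refine (vS_bound χ hχ j hE he2 hz).trans ?_
  have h3 : Real.log (64 * Real.log (q + 2) / sE α j) ≤ (64 * c + 1 / α) * j := by
    calc Real.log (64 * Real.log (q + 2) / sE α j) ≤ Real.log (64 * (c * j) / sE α j) := by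
          apply Real.log_le_log (by positivity); gcongr
      _ = Real.log (64 * c * sL α j) := by
          congr 1; unfold sE; field_simp
      _ = Real.log (64 * c) + j / α := by
          rw [Real.log_mul (by positivity) hL.ne']
          unfold sL; rw [Real.log_exp]
      _ ≤ 64 * c + j / α := by
          have := Real.log_le_self (show 0 ≤ 64 * c by positivity)
          linarith
      _ ≤ _ := by
          have : 64 * c ≤ 64 * c * j := by nlinarith
          have h5 : (j : ℝ) / α = 1 / α * j := by ring
          rw [h5]; linarith
  have h4 : 6 * Real.log (64 * Real.log (q + 2) / sE α j) * (j + 1) * (j + 1) ≤ 2 * sL α j := by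
    calc 6 * Real.log (64 * Real.log (q + 2) / sE α j) * (j + 1) * (j + 1)
        ≤ 6 * ((64 * c + 1 / α) * j) * (j + j) * (j + j) := by gcongr
      _ = 2 * (3 * (64 * c + 1 / α) * 4 * (j : ℝ) ^ 3) := by ring
      _ ≤ _ := by linarith
  have hfac : (((j + 1).factorial : ℕ) : ℝ) = (j + 1) * j.factorial := by
    rw [Nat.factorial_succ]; push_cast; ring
  rw [hfac]
  calc 6 * Real.log (64 * Real.log (q + 2) / sE α j) * (j + 1) * ((j + 1) * j.factorial) / (2 * sE α j) ^ (j + 1)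
      = (6 * Real.log (64 * Real.log (q + 2) / sE α j) * (j + 1) * (j + 1)) * (j.factorial / (2 * sE α j) ^ (j + 1)) := by ring
    _ ≤ (2 * sL α j) * (j.factorial / (2 * sE α j) ^ (j + 1)) := by gcongr
    _ = _ := by
      rw [mul_pow, one_div, inv_pow, pow_succ 2]; field_simp

theorem goodScale {α : ℝ} (hα : 0 < α) (B J : ℕ) : ∃ j, J ≤ j ∧ GoodAt α B j := by
  set c : ℝ := 2 * B / α + 2 with hc
  have hc0 : 0 < c := by positivity
  set D : ℝ := 3 * Real.exp (1 / α) with hD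
  have hD0 : 0 < D := by positivity
  have hev : ∀ᶠ j : ℕ in Filter.atTop, (∀ (q : ℕ) [NeZero q] (χ : DirichletCharacter ℂ q), χ ≠ 1 → (q : ℝ) ≤ sL α j ^ B →
    (∀ z, ‖z - 1‖ < 3 * sE α j → χ.LFunction z ≠ 0) →
    ‖vS χ j (sE α j)‖ ≤ j.factorial / sE α j ^ (j + 1) * (1 / 2) ^ j * sL α j) ∧
    D * (4 * c) * (j : ℝ) ^ 2 ≤ sL α j ∧ (2 ^ 46 * D * c ^ 10) * (j : ℝ) ^ 11 ≤ sL α j ∧ α ≤ j ∧ J ≤ j ∧ 1 ≤ j := by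
    filter_upwards [bad_zero hα B, poly_le_sL hα (D * (4 * c)) 2, poly_le_sL hα (2 ^ 46 * D * c ^ 10) 11,
      tendsto_natCast_atTop_atTop.eventually (Filter.eventually_ge_atTop α), Filter.eventually_ge_atTop J,
      Filter.eventually_ge_atTop 1] with j h1 h2 h3 h4 h5 h6
    exact ⟨h1, h2, h3, h4, h5, h6⟩
  obtain ⟨J1, hJ1⟩ := Filter.eventually_atTop.1 hev
  by_cases hgood : GoodAt α B J1
  · exact ⟨J1, (hJ1 J1 le_rfl).2.2.2.2.1, hgood⟩
  unfold GoodAt at hgood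
  push Not at hgood
  obtain ⟨q₁, inst₁, χ₁, hχ₁, hq₁, hbad₁⟩ := hgood
  -- eventually no zero
  have hex : ∃ m, J1 ≤ m ∧ ∀ z, ‖z - 1‖ < 3 * sE α m → χ₁.LFunction z ≠ 0 := by
    have h1 : χ₁.LFunction 1 ≠ 0 := DirichletCharacter.LFunction_apply_one_ne_zero hχ₁
    have h2 := (DirichletCharacter.differentiable_LFunction hχ₁).continuous.continuousAt (x := (1 : ℂ))
    obtain ⟨d, hd, hd'⟩ := Metric.eventually_nhds_iff.1 (h2.eventually_ne h1)
    obtain ⟨m, hm1, hm2⟩ := ((sE_tendsto hα hd).and (Filter.eventually_ge_atTop J1)).exists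
    exact ⟨m, hm2, fun z hz => hd' (by rw [dist_eq_norm]; linarith)⟩
  classical
  set m := Nat.find hex with hm
  obtain ⟨hm1, hm2⟩ := Nat.find_spec hex
  rw [← hm] at hm1 hm2
  have hmne : m ≠ J1 := by
    intro h
    have := (hJ1 J1 le_rfl).1 q₁ χ₁ hχ₁ hq₁ (by rw [← h]; exact hm2)
    linarith
  obtain ⟨i, hi⟩ : ∃ i, m = i + 1 := ⟨m - 1, by omega⟩
  have hiJ : J1 ≤ i := by omega
  have hnot := Nat.find_min hex (m := i) (by omega)
  push Not at hnot
  obtain ⟨r₁, hr₁, hz₁⟩ := hnot hiJ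
  refine ⟨m, (hJ1 m hm1).2.2.2.2.1, ?_⟩
  intro q₂ inst₂ χ₂ hχ₂ hq₂
  apply (hJ1 m hm1).1 q₂ χ₂ hχ₂ hq₂
  intro r₂ hr₂ hz₂
  obtain ⟨_, e2, e3, e4, _, e6⟩ := hJ1 m hm1
  have hmon : sE α m ≤ sE α i := by rw [hi]; exact sE_anti hα (hJ1 i hiJ).2.2.2.1
  have hLm : sL α J1 ≤ sL α m := by
    unfold sL
    apply Real.exp_le_exp.2
    gcongr
  have hq12 : ((q₁ * q₂ : ℕ) : ℝ) ≤ sL α m ^ (2 * B) := by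
    push_cast
    rw [two_mul, pow_add]
    have : (q₁ : ℝ) ≤ sL α m ^ B := hq₁.trans (by gcongr; exact (sL_pos α J1).le)
    exact mul_le_mul this hq₂ (by positivity) (pow_nonneg (sL_pos α m).le _)
  have hlog := log_bd hα (2 * B) e6 hq12
  have hc' : ((2 * B : ℕ) : ℝ) / α + 2 = c := by rw [hc]; push_cast; ring
  rw [hc'] at hlog
  have hLp := sL_pos α m
  have hei : 3 * sE α i ≤ D * m / sL α m := by
    have h1 : sL α m = sL α i * Real.exp (1 / α) := by
      unfold sL; rw [← Real.exp_add, hi]; congr 1; push_cast; ring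
    rw [h1, hD]
    unfold sE
    have h2 : (i : ℝ) ≤ m := by rw [hi]; push_cast; linarith
    have h3 := sL_pos α i
    have h4 := Real.exp_pos (1 / α)
    calc 3 * ((i : ℝ) / sL α i) ≤ 3 * ((m : ℝ) / sL α i) := by gcongr
      _ = _ := by field_simp
  have hEi : 0 < sE α i := sE_pos α (hJ1 i hiJ).2.2.2.2.2
  have hl' : 1 < Real.log ((q₁ * q₂ : ℕ) + 2) := by
    rw [Real.lt_log_iff_exp_lt (by positivity)]
    have := Real.exp_one_lt_d9
    have hq1' : (1 : ℝ) ≤ (q₁ * q₂ : ℕ) := by exact_mod_cast (Nat.mul_pos (NeZero.pos q₁) (NeZero.pos q₂))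
    linarith
  have hlast : 3 * sE α i ≤ 1 / (4 * Real.log ((q₁ * q₂ : ℕ) + 2)) := by
    rw [le_div_iff₀ (by positivity)]
    calc 3 * sE α i * (4 * Real.log ((q₁ * q₂ : ℕ) + 2)) ≤ D * m / sL α m * (4 * (c * m)) := by gcongr
      _ = (D * (4 * c) * (m : ℝ) ^ 2) / sL α m := by ring
      _ ≤ 1 := by rw [div_le_one hLp]; exact e2
  rcases repulsion χ₁ χ₂ hχ₁ hχ₂ (e := 3 * sE α i) (by positivity) hlast hr₁.le (by linarith) hz₁ hz₂ with h | h
  · have : 2 ^ 45 * (3 * sE α i) * Real.log ((q₁ * q₂ : ℕ) + 2) ^ 10 < 1 := by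
      calc 2 ^ 45 * (3 * sE α i) * Real.log ((q₁ * q₂ : ℕ) + 2) ^ 10 ≤ 2 ^ 45 * (D * m / sL α m) * (c * m) ^ 10 := by
            gcongr
        _ = (2 ^ 46 * D * c ^ 10 * (m : ℝ) ^ 11) / sL α m / 2 := by ring
        _ ≤ 1 / 2 := by
            gcongr
            rw [div_le_one hLp]; exact e3
        _ < 1 := by norm_num
    linarith
  · exact hm2 r₂ hr₂ h

end PD

namespace PD
open Finset

/-- sums of squares of rank one kernels -/
def PSD {Ω : Type} (K : Ω → Ω → ℝ) : Prop :=
  ∃ (Z : Type) (_ : Fintype Z) (f : Z → Ω → ℝ), ∀ x y, K x y = ∑ z, f z x * f z y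

lemma PSD.congr {Ω : Type} {K L : Ω → Ω → ℝ} (h : PSD K) (e : ∀ x y, L x y = K x y) : PSD L := by
  obtain ⟨Z, i, f, hf⟩ := h
  exact ⟨Z, i, f, fun x y => by rw [e, hf]⟩

lemma PSD.add {Ω : Type} {K L : Ω → Ω → ℝ} (h : PSD K) (h' : PSD L) :
    PSD (fun x y => K x y + L x y) := by
  obtain ⟨Z, i, f, hf⟩ := h
  obtain ⟨Z', i', f', hf'⟩ := h'
  refine ⟨Z ⊕ Z', inferInstance, Sum.elim f f', fun x y => ?_⟩
  show K x y + L x y = _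
  rw [hf, hf', Fintype.sum_sum_type]; rfl

lemma PSD.mul {Ω : Type} {K L : Ω → Ω → ℝ} (h : PSD K) (h' : PSD L) :
    PSD (fun x y => K x y * L x y) := by
  obtain ⟨Z, i, f, hf⟩ := h
  obtain ⟨Z', i', f', hf'⟩ := h'
  refine ⟨Z × Z', inferInstance, fun z x => f z.1 x * f' z.2 x, fun x y => ?_⟩
  show K x y * L x y = _
  rw [hf, hf', Finset.sum_mul_sum, Fintype.sum_prod_type]
  refine Finset.sum_congr rfl fun a _ => Finset.sum_congr rfl fun b _ => by ring

lemma PSD.rank {Ω : Type} (f : Ω → ℝ) : PSD (fun x y => f x * f y) :=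
  ⟨Unit, inferInstance, fun _ => f, fun x y => by simp⟩

lemma PSD.smul {Ω : Type} {K : Ω → Ω → ℝ} (h : PSD K) {c : ℝ} (hc : 0 ≤ c) :
    PSD (fun x y => c * K x y) := by
  refine ((PSD.rank (Ω := Ω) (fun _ => Real.sqrt c)).mul h).congr fun x y => ?_
  rw [Real.mul_self_sqrt hc]

lemma PSD.pull {Ω Ω' : Type} {K : Ω → Ω → ℝ} (h : PSD K) (φ : Ω' → Ω) :
    PSD (fun x y => K (φ x) (φ y)) := by
  obtain ⟨Z, i, f, hf⟩ := h
  exact ⟨Z, i, fun z x => f z (φ x), fun x y => hf _ _⟩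

lemma PSD.sumrank {Ω Z : Type} [Fintype Z] (f : Z → Ω → ℝ) :
    PSD (fun x y => ∑ z, f z x * f z y) := ⟨Z, inferInstance, f, fun _ _ => rfl⟩

lemma PSD.nonneg {Ω : Type} [Fintype Ω] {K : Ω → Ω → ℝ} (h : PSD K) (x : Ω → ℝ) :
    0 ≤ ∑ a, ∑ b, x a * x b * K a b := by
  obtain ⟨Z, i, f, hf⟩ := h
  have : ∑ a, ∑ b, x a * x b * K a b = ∑ z, (∑ a, x a * f z a) ^ 2 := by
    simp_rw [hf, Finset.mul_sum, sq, Finset.sum_mul_sum]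
    rw [Finset.sum_comm' (t' := univ) (s' := fun _ => univ) (by simp)]
    symm
    rw [Finset.sum_comm]
    simp_rw [fun a : Ω => Finset.sum_comm (s := (univ : Finset Z)) (t := (univ : Finset Ω))
      (f := fun z b => x a * f z a * (x b * f z b))]
    rw [Finset.sum_comm]
    refine Finset.sum_congr rfl fun a _ => Finset.sum_congr rfl fun b _ =>
      Finset.sum_congr rfl fun z _ => by ring
  rw [this]
  exact Finset.sum_nonneg fun _ _ => sq_nonneg _

/-- products of ordered kernels are ordered -/
lemma PSD.prod_le {ι Ω : Type} [DecidableEq ι] (K K' : ι → Ω → Ω → ℝ) (s : Finset ι)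
    (h : ∀ p ∈ s, PSD (K p)) (h' : ∀ p ∈ s, PSD (fun x y => K' p x y - K p x y)) :
    PSD (fun x y => ∏ p ∈ s, K' p x y) ∧
    PSD (fun x y => ∏ p ∈ s, K' p x y - ∏ p ∈ s, K p x y) := by
  induction s using Finset.induction_on with
  | empty =>
    refine ⟨(PSD.rank fun _ => 1).congr fun x y => by simp,
      (PSD.rank fun _ => 0).congr fun x y => by simp⟩
  | insert p s hp ih =>
    obtain ⟨i1, i2⟩ := ih (fun q hq => h q (mem_insert_of_mem hq))
      (fun q hq => h' q (mem_insert_of_mem hq))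
    have a := h p (mem_insert_self _ _)
    have b := h' p (mem_insert_self _ _)
    refine ⟨((a.add b).mul i1).congr fun x y => ?_, ((b.mul i1).add (a.mul i2)).congr fun x y => ?_⟩
    · rw [Finset.prod_insert hp]; ring
    · rw [Finset.prod_insert hp, Finset.prod_insert hp]; ring

section loc
variable {κ : Type} [Fintype κ] [DecidableEq κ]

/-- local kernel -/
def Kl (v : ℝ) (x y : Option κ) : ℝ :=
  if x = none then (if y = none then 1 else v) else if y = none then v else if x = y then v else 0

/-- modified local kernel -/
def Km (v c : ℝ) (x y : Option κ) : ℝ :=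
  if x = none then (if y = none then 1 else v) else if y = none then v
  else if x = y then v ^ 2 + c else v ^ 2

lemma Kl_psd {v : ℝ} (hv : 0 ≤ v) (hk : Fintype.card κ * v ≤ 1) : PSD (Kl (κ := κ) v) := by
  have h1 := (PSD.rank (fun x : Option κ => if x = none then (1:ℝ) else 0)).smul
    (sub_nonneg.2 hk)
  have h2 := (PSD.sumrank (fun (i : κ) (x : Option κ) =>
    if x = none then (1:ℝ) else if x = some i then 1 else 0)).smul hv
  refine (h1.add h2).congr fun x y => ?_
  rcases x with _ | i <;> rcases y with _ | j
  · simp [Kl]; ring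
  · simp [Kl]
  · simp [Kl]
  · simp [Kl]

lemma Km_sub_psd1 (v : ℝ) : PSD (fun x y : Option κ => Km v v x y - Kl v x y) := by
  refine (PSD.rank (fun x : Option κ => if x = none then (0:ℝ) else v)).congr fun x y => ?_
  rcases x with _ | i <;> rcases y with _ | j
  · simp [Kl, Km]
  · simp [Kl, Km]
  · simp [Kl, Km]
  · by_cases h : i = j <;> simp [Kl, Km, h] <;> ring

lemma Km_psd {v c : ℝ} (hc : 0 ≤ c) : PSD (Km (κ := κ) v c) := by
  have h1 := PSD.rank (fun x : Option κ => if x = none then (1:ℝ) else v)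
  have h2 := (PSD.sumrank (fun (i : κ) (x : Option κ) =>
    if x = some i then (1:ℝ) else 0)).smul hc
  refine (h1.add h2).congr fun x y => ?_
  rcases x with _ | i <;> rcases y with _ | j
  · simp [Km]
  · simp [Km]
  · simp [Km]
  · by_cases h : i = j
    · subst h; simp [Km]; ring
    · simp [Km, h]; ring

lemma Km_sub_psd2 (v : ℝ) :
    PSD (fun x y : Option κ => Kl v x y - Km v (v * (1 - Fintype.card κ * v)) x y) := by
  have h2 := (PSD.sumrank (fun (z : κ × κ) (x : Option κ) =>
    (if x = some z.1 then (1:ℝ) else 0) - (if x = some z.2 then (1:ℝ) else 0))).smul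
    (show 0 ≤ v ^ 2 / 2 by positivity)
  refine h2.congr fun x y => ?_
  rcases x with _ | i <;> rcases y with _ | j
  · simp [Kl, Km]
  · simp [Kl, Km]
  · simp [Kl, Km]
  · by_cases h : i = j
    · subst h
      simp [Kl, Km, Fintype.sum_prod_type, sub_mul, mul_sub, Finset.sum_sub_distrib]
      ring
    · simp [Kl, Km, h, Fintype.sum_prod_type, sub_mul, mul_sub, Finset.sum_sub_distrib]
      have h' : ¬ j = i := fun e => h e.symm
      try simp [h']
      try ring

/-- the local order -/
def ol (r d : Option κ) : ℝ := if r = none ∨ r = d then 1 else 0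
/-- local weights -/
def tl (t : ℝ) (r : Option κ) : ℝ := if r = none then 1 else t

lemma Km_expand {v c : ℝ} (hv : v ≠ 0) (x y : Option κ) :
    Km v c x y = ∑ r : Option κ, tl (c / v ^ 2) r * (ol r x * tl v x) * (ol r y * tl v y) := by
  rw [Fintype.sum_option]
  rcases x with _ | i <;> rcases y with _ | j
  · simp [Km, tl, ol]
  · simp [Km, tl, ol]
  · simp [Km, tl, ol]
  · by_cases h : i = j
    · subst h; simp [Km, tl, ol]; field_simp
    · have h' : ¬ j = i := fun e => h e.symm
      simp [Km, tl, ol, h, h']; ring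

end loc

section glob
variable {ι κ : Type} [Fintype ι] [DecidableEq ι] [Fintype κ] [DecidableEq κ]

lemma sum_prod_swap {α β : Type} [Fintype α] [Fintype β] (a : ι → α → ℝ)
    (b : ι → α → β → ℝ) (G : (ι → β) → ℝ) :
    ∑ D : ι → α, (∏ p, a p (D p)) * ∑ s : ι → β, (∏ p, b p (D p) (s p)) * G s =
    ∑ s : ι → β, (∏ p, ∑ d, a p d * b p d (s p)) * G s := by
  simp_rw [Finset.mul_sum]
  rw [Finset.sum_comm]
  refine Finset.sum_congr rfl fun s _ => ?_
  rw [Finset.prod_univ_sum, Finset.sum_mul, Fintype.piFinset_univ]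
  refine Finset.sum_congr rfl fun D _ => ?_
  rw [Finset.prod_mul_distrib]; ring

lemma Km_form (v c : ι → ℝ) (hv : ∀ p, v p ≠ 0) (x : (ι → Option κ) → ℝ) :
    ∑ D, ∑ E, x D * x E * ∏ p, Km (v p) (c p) (D p) (E p) =
    ∑ r : ι → Option κ, (∏ p, tl (c p / v p ^ 2) (r p)) *
      (∑ D : ι → Option κ, (∏ p, ol (r p) (D p) * tl (v p) (D p)) * x D) ^ 2 := by
  have h1 : ∀ D E : ι → Option κ, ∏ p, Km (v p) (c p) (D p) (E p) = ∑ r : ι → Option κ,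
      (∏ p, tl (c p / v p ^ 2) (r p)) * (∏ p, ol (r p) (D p) * tl (v p) (D p)) *
      (∏ p, ol (r p) (E p) * tl (v p) (E p)) := by
    intro D E
    simp_rw [fun p => Km_expand (c := c p) (hv p) (D p) (E p)]
    rw [Finset.prod_univ_sum, Fintype.piFinset_univ]
    refine Finset.sum_congr rfl fun r _ => ?_
    rw [Finset.prod_mul_distrib, Finset.prod_mul_distrib]
  simp_rw [h1, sq, Finset.sum_mul_sum, Finset.mul_sum]
  rw [Finset.sum_comm' (t' := univ) (s' := fun _ => univ) (by simp)]
  conv_rhs => rw [Finset.sum_comm]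
  rw [Finset.sum_comm]
  refine Finset.sum_congr rfl fun D _ => ?_
  rw [Finset.sum_comm]
  refine Finset.sum_congr rfl fun r _ => Finset.sum_congr rfl fun E _ => ?_
  ring

/-- upper bound for the first quadratic form -/
lemma form_upper (v : ι → ℝ) (hv : ∀ p, 0 < v p) (hk : ∀ p, Fintype.card κ * v p ≤ 1)
    (x : (ι → Option κ) → ℝ) :
    ∑ D, ∑ E, x D * x E * ∏ p, Kl (v p) (D p) (E p) ≤
    ∑ r : ι → Option κ, (∏ p, tl (1 / v p) (r p)) *
      (∑ D : ι → Option κ, (∏ p, ol (r p) (D p) * tl (v p) (D p)) * x D) ^ 2 := by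
  have h := (PSD.prod_le (ι := ι) (Ω := ι → Option κ) (fun p x y => Kl (v p) (x p) (y p))
    (fun p x y => Km (v p) (v p) (x p) (y p)) univ
    (fun p _ => (Kl_psd (hv p).le (hk p)).pull (fun x : ι → Option κ => x p))
    (fun p _ => (Km_sub_psd1 (v p)).pull (fun x : ι → Option κ => x p))).2.nonneg x
  have e := Km_form v v (fun p => (hv p).ne') x
  have e2 : ∀ p, v p / v p ^ 2 = 1 / v p := fun p => by have := (hv p).ne'; field_simp
  simp_rw [e2] at e
  rw [← e]
  simp_rw [mul_sub, Finset.sum_sub_distrib] at h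
  linarith

/-- lower bound for the second quadratic form -/
lemma form_lower (v : ι → ℝ) (hv : ∀ p, 0 < v p) (hk : ∀ p, Fintype.card κ * v p ≤ 1)
    (x : (ι → Option κ) → ℝ) :
    ∑ r : ι → Option κ, (∏ p, tl ((1 - Fintype.card κ * v p) / v p) (r p)) *
      (∑ D : ι → Option κ, (∏ p, ol (r p) (D p) * tl (v p) (D p)) * x D) ^ 2 ≤
    ∑ D, ∑ E, x D * x E * ∏ p, Kl (v p) (D p) (E p) := by
  have h := (PSD.prod_le (ι := ι) (Ω := ι → Option κ)
    (fun p x y => Km (v p) (v p * (1 - Fintype.card κ * v p)) (x p) (y p))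
    (fun p x y => Kl (v p) (x p) (y p)) univ
    (fun p _ => (Km_psd (mul_nonneg (hv p).le (sub_nonneg.2 (hk p)))).pull (fun x : ι → Option κ => x p))
    (fun p _ => (Km_sub_psd2 (v p)).pull (fun x : ι → Option κ => x p))).2.nonneg x
  have e := Km_form v (fun p => v p * (1 - Fintype.card κ * v p)) (fun p => (hv p).ne') x
  have e2 : ∀ p, v p * (1 - Fintype.card κ * v p) / v p ^ 2 = (1 - Fintype.card κ * v p) / v p :=
    fun p => by have := (hv p).ne'; field_simp
  simp_rw [e2] at e
  rw [← e]
  simp_rw [fun D E : ι → Option κ => mul_sub (x D * x E), Finset.sum_sub_distrib] at h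
  linarith

end glob
end PD

namespace PD
open Finset

section glob
variable {ι κ : Type} [Fintype ι] [DecidableEq ι] [Fintype κ] [DecidableEq κ]

/-- norm of a coloured set of primes -/
def Nm (pr : ι → ℝ) (x : ι → Option κ) : ℝ := ∏ p, tl (pr p) (x p)

/-- sieve weights -/
def lam (pr : ι → ℝ) (G : (ι → Option κ) → ℝ) (D : ι → Option κ) : ℝ :=
  Nm pr D * ((∏ p, tl (-1) (D p)) * ∑ s : ι → Option κ, (∏ p, ol (D p) (s p)) * G s)

/-- local indicator -/
def nol (i0 : κ) (d : Option κ) : ℝ := if d = some i0 then 0 else 1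

lemma tl_mul (a b : ℝ) (d : Option κ) : tl a d * tl b d = tl (a * b) d := by
  rcases d with _ | i <;> simp [tl]

lemma prod_delta (r s : ι → Option κ) :
    (∏ p, if r p = s p then (1:ℝ) else 0) = if r = s then 1 else 0 := by
  rw [Finset.prod_ite_zero]
  simp [funext_iff]

lemma mob (pr : ι → ℝ) (hpr : ∀ p, 1 < pr p) (G : (ι → Option κ) → ℝ) (r : ι → Option κ) :
    ∑ D : ι → Option κ, (∏ p, ol (r p) (D p) * tl (1 / pr p) (D p)) * lam pr G D =
      (∏ p, tl (-1) (r p)) * G r := by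
  have h1 : ∀ D : ι → Option κ, (∏ p, ol (r p) (D p) * tl (1 / pr p) (D p)) * lam pr G D =
      (∏ p, ol (r p) (D p) * tl (-1) (D p)) *
        ∑ s : ι → Option κ, (∏ p, ol (D p) (s p)) * G s := by
    intro D
    rw [lam, Nm, ← mul_assoc, ← mul_assoc, ← Finset.prod_mul_distrib, ← Finset.prod_mul_distrib]
    congr 1
    refine Finset.prod_congr rfl fun p _ => ?_
    rw [mul_assoc, mul_assoc, tl_mul, tl_mul]
    have : pr p ≠ 0 := by linarith [hpr p]
    congr 2
    field_simp
  simp_rw [h1]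
  rw [sum_prod_swap (fun p d => ol (r p) d * tl (-1) d) (fun _ d s => ol d s) G]
  have h2 : ∀ s : ι → Option κ, (∏ p, ∑ d, ol (r p) d * tl (-1) d * ol d (s p)) =
      (∏ p, tl (-1) (r p)) * if r = s then 1 else 0 := by
    intro s
    rw [← prod_delta, ← Finset.prod_mul_distrib]
    refine Finset.prod_congr rfl fun p _ => ?_
    rw [Fintype.sum_option]
    rcases r p with _ | i <;> rcases s p with _ | j
    · simp [ol, tl]
    · simp [ol, tl]
    · simp [ol, tl]
    · by_cases h : i = j <;> simp [ol, tl, h]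
  simp_rw [h2]
  simp

lemma T1_upper (pr : ι → ℝ) (hpr : ∀ p, 1 < pr p) (hk : ∀ p, (Fintype.card κ : ℝ) ≤ pr p)
    (G : (ι → Option κ) → ℝ) :
    ∑ D, ∑ E, lam pr G D * lam pr G E * ∏ p, Kl (1 / pr p) (D p) (E p) ≤
      ∑ r, Nm pr r * G r ^ 2 := by
  have h := form_upper (κ := κ) (fun p => 1 / pr p)
    (fun p => by have := hpr p; positivity) (fun p => by
      have := hpr p
      rw [mul_one_div, div_le_one (by linarith)]; exact hk p) (lam pr G)
  refine h.trans (le_of_eq ?_)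
  refine Finset.sum_congr rfl fun r _ => ?_
  rw [mob pr hpr, mul_pow, ← Finset.prod_pow]
  have : ∏ p, (tl (-1) (r p) : ℝ) ^ 2 = 1 := Finset.prod_eq_one fun p _ => by
    rcases r p with _ | i <;> simp [tl]
  rw [this, Nm]
  simp

/-- local main indicator -/
def mul0 (i0 : κ) (r s : Option κ) : ℝ :=
  if r = none then (if s = none ∨ s = some i0 then 1 else 0) else if r = s then 1 else 0

/-- local signed factor -/
noncomputable def nul0 (i0 : κ) (p : ℝ) (r s : Option κ) : ℝ :=
  if r = none then (if s = none ∨ s = some i0 then 1 else -1 / (p - 1)) else if r = s then 1 else 0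

/-- the main inner sum -/
def Mr (i0 : κ) (G : (ι → Option κ) → ℝ) (r : ι → Option κ) : ℝ :=
  ∑ s : ι → Option κ, (∏ p, mul0 i0 (r p) (s p)) * G s

lemma mul0_nonneg (i0 : κ) (r s : Option κ) : 0 ≤ mul0 i0 r s := by
  unfold mul0; split_ifs <;> norm_num

lemma inner_eq (pr : ι → ℝ) (hpr : ∀ p, 1 < pr p) (i0 : κ) (G : (ι → Option κ) → ℝ)
    (r : ι → Option κ) (hr : ∀ p, r p ≠ some i0) :
    ∑ D : ι → Option κ, (∏ p, ol (r p) (D p) * tl (1 / (pr p - 1)) (D p)) *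
      (lam pr G D * ∏ p, nol i0 (D p)) =
      (∏ p, tl (-(pr p / (pr p - 1))) (r p)) *
        ∑ s : ι → Option κ, (∏ p, nul0 i0 (pr p) (r p) (s p)) * G s := by
  have h1 : ∀ D : ι → Option κ, (∏ p, ol (r p) (D p) * tl (1 / (pr p - 1)) (D p)) *
      (lam pr G D * ∏ p, nol i0 (D p)) =
      (∏ p, ol (r p) (D p) * tl (-(pr p / (pr p - 1))) (D p) * nol i0 (D p)) *
        ∑ s : ι → Option κ, (∏ p, ol (D p) (s p)) * G s := by
    intro D
    rw [lam, Nm]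
    have : ∏ p, ol (r p) (D p) * tl (-(pr p / (pr p - 1))) (D p) * nol i0 (D p) =
      (∏ p, ol (r p) (D p) * tl (1 / (pr p - 1)) (D p)) * (∏ p, tl (pr p) (D p)) *
        (∏ p, tl (-1) (D p)) * ∏ p, nol i0 (D p) := by
      rw [← Finset.prod_mul_distrib, ← Finset.prod_mul_distrib, ← Finset.prod_mul_distrib]
      refine Finset.prod_congr rfl fun p _ => ?_
      have e : tl (-(pr p / (pr p - 1))) (D p) =
          tl (1 / (pr p - 1)) (D p) * tl (pr p) (D p) * tl (-1) (D p) := by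
        rw [tl_mul, tl_mul]; congr 1; ring
      rw [e]; ring
    rw [this]; ring
  simp_rw [h1]
  rw [sum_prod_swap (fun p d => ol (r p) d * tl (-(pr p / (pr p - 1))) d * nol i0 d)
    (fun _ d s => ol d s) G, Finset.mul_sum]
  refine Finset.sum_congr rfl fun s _ => ?_
  rw [← mul_assoc, ← Finset.prod_mul_distrib]
  congr 1
  refine Finset.prod_congr rfl fun p _ => ?_
  rw [Fintype.sum_option]
  have hp := hr p
  have hq : pr p - 1 ≠ 0 := by linarith [hpr p]
  generalize r p = rp at hp ⊢
  rcases rp with _ | i <;> rcases s p with _ | j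
  · simp [ol, tl, nol, nul0]
  · by_cases h : j = i0
    · simp [ol, tl, nol, nul0, h]
    · simp [ol, tl, nol, nul0, h]; field_simp; ring
  · simp [ol, tl, nol, nul0]
  · have hi : i ≠ i0 := fun e => hp (by rw [e])
    by_cases h : i = j
    · subst h; simp [ol, tl, nol, nul0, hi]
    · simp [ol, tl, nol, nul0, h]

lemma prod_sign_aux (s : Finset ι) (a b : ι → ℝ) (h : ∀ p, b p = a p ∧ 0 ≤ a p ∨ b p = 0) :
    2 * ∏ p ∈ s, b p - ∏ p ∈ s, |a p| ≤ ∏ p ∈ s, a p := by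
  by_cases hb : ∃ p ∈ s, b p = 0
  · obtain ⟨p, hp, h0⟩ := hb
    rw [Finset.prod_eq_zero hp h0, ← Finset.abs_prod]
    have := neg_abs_le (∏ p ∈ s, a p); linarith
  · push Not at hb
    have e : ∏ p ∈ s, b p = ∏ p ∈ s, a p := Finset.prod_congr rfl fun p hp => by
      rcases h p with h | h
      · exact h.1
      · exact absurd h (hb p hp)
    have e2 : ∏ p ∈ s, |a p| = ∏ p ∈ s, a p := Finset.prod_congr rfl fun p hp => by
      rcases h p with h | h
      · exact abs_of_nonneg h.2
      · exact absurd h (hb p hp)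
    rw [e, e2]; linarith

/-- projection -/
def pil (i0 : κ) (r d : Option κ) : Option κ := if r = none ∧ d ≠ some i0 then none else d

lemma abs_sum_le (pr : ι → ℝ) (hpr : ∀ p, 1 < pr p) (i0 : κ) (G : (ι → Option κ) → ℝ)
    (hG0 : ∀ s, 0 ≤ G s)
    (hG : ∀ s s' : ι → Option κ, (∀ p, s' p = none ∨ s' p = s p) → Nm pr s * G s ≤ Nm pr s' * G s')
    (r : ι → Option κ) :
    ∑ s : ι → Option κ, (∏ p, |nul0 i0 (pr p) (r p) (s p)|) * G s ≤
      (∏ p, (1 + Fintype.card κ / (pr p * (pr p - 1)))) * Mr i0 G r := by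
  set ρ : ι → Option κ → Option κ → ℝ := fun p r d =>
    if r = none ∧ d ≠ some i0 then tl (1 / pr p) d else 1 with hρ
  have hstep : ∀ s : ι → Option κ, (∏ p, |nul0 i0 (pr p) (r p) (s p)|) * G s ≤
      (∏ p, |nul0 i0 (pr p) (r p) (s p)| * ρ p (r p) (s p)) *
        ∑ s' : ι → Option κ, (∏ p, if s' p = pil i0 (r p) (s p) then (1:ℝ) else 0) * G s' := by
    intro s
    have e : ∑ s' : ι → Option κ, (∏ p, if s' p = pil i0 (r p) (s p) then (1:ℝ) else 0) * G s' =
        G (fun p => pil i0 (r p) (s p)) := by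
      simp_rw [fun s' : ι → Option κ => prod_delta s' (fun p => pil i0 (r p) (s p))]
      simp
    rw [e, Finset.prod_mul_distrib, mul_assoc]
    refine mul_le_mul_of_nonneg_left ?_ (Finset.prod_nonneg fun _ _ => abs_nonneg _)
    have h := hG s (fun p => pil i0 (r p) (s p)) (fun p => by unfold pil; split_ifs <;> simp)
    have hN : 0 < Nm pr s := Finset.prod_pos fun p _ => by
      have := hpr p
      unfold tl; split_ifs <;> linarith
    have e2 : ∏ p, ρ p (r p) (s p) = Nm pr (fun p => pil i0 (r p) (s p)) / Nm pr s := by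
      rw [Nm, Nm, ← Finset.prod_div_distrib]
      refine Finset.prod_congr rfl fun p _ => ?_
      have hq : pr p ≠ 0 := by linarith [hpr p]
      simp only [hρ, pil]
      by_cases hc : r p = none ∧ s p ≠ some i0
      · rw [if_pos hc, if_pos hc]
        rcases s p with _ | j <;> simp [tl]
      · rw [if_neg hc, if_neg hc]
        rcases s p with _ | j <;> simp [tl, hq]
    rw [e2, div_mul_eq_mul_div, le_div_iff₀ hN]
    linarith
  refine (Finset.sum_le_sum fun s _ => hstep s).trans ?_
  rw [sum_prod_swap (fun p d => |nul0 i0 (pr p) (r p) d| * ρ p (r p) d)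
    (fun p d s' => if s' = pil i0 (r p) d then (1:ℝ) else 0) G, Mr, Finset.mul_sum]
  refine Finset.sum_le_sum fun s _ => ?_
  rw [← mul_assoc, ← Finset.prod_mul_distrib]
  refine mul_le_mul_of_nonneg_right ?_ (hG0 s)
  refine Finset.prod_le_prod (fun p _ => Finset.sum_nonneg fun d _ => ?_) fun p _ => ?_
  · have := hpr p
    refine mul_nonneg (mul_nonneg (abs_nonneg _) ?_) (by split_ifs <;> norm_num)
    simp only [hρ, tl]
    split_ifs <;> first | positivity | norm_num
  · have h1 := hpr p
    have hq : 0 < pr p - 1 := by linarith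
    have hq' : 0 < pr p := by linarith
    have hpos : 0 ≤ (Fintype.card κ : ℝ) / (pr p * (pr p - 1)) := by positivity
    rw [Fintype.sum_option]
    simp only [hρ]
    rcases r p with _ | i
    · rcases s p with _ | j
      · have : ∀ x : κ, |nul0 i0 (pr p) none (some x)| *
            (if (none : Option κ) = none ∧ some x ≠ some i0 then tl (1 / pr p) (some x) else 1) *
            (if none = pil i0 none (some x) then 1 else 0) ≤ 1 / (pr p * (pr p - 1)) := by
          intro x
          by_cases hx : x = i0
          · simp [nul0, pil, hx]; positivity
          · simp [nul0, pil, hx, tl, abs_div, abs_of_pos hq]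
        have h2 := Finset.sum_le_sum fun x (_ : x ∈ (univ : Finset κ)) => this x
        rw [Finset.sum_const, Finset.card_univ, nsmul_eq_mul, mul_one_div] at h2
        have e3 : |nul0 i0 (pr p) none none| *
          (if (none : Option κ) = none ∧ none ≠ some i0 then tl (1 / pr p) (none : Option κ) else 1) *
            (if none = pil i0 none none then 1 else 0) = 1 := by simp [nul0, pil, tl]
        have e4 : mul0 i0 none none = 1 := by simp [mul0]
        rw [e3, e4]; linarith
      · by_cases hj : j = i0
        · subst hj
          have : ∀ x : κ, |nul0 j (pr p) none (some x)| *
            (if (none : Option κ) = none ∧ some x ≠ some j then tl (1 / pr p) (some x) else 1) *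
            (if some j = pil j none (some x) then 1 else 0) = if x = j then 1 else 0 := by
            intro x
            by_cases hx : x = j
            · simp [nul0, pil, hx]
            · simp [pil, hx]
          rw [Finset.sum_congr rfl (fun x _ => this x)]
          simp [pil, mul0]
          exact hpos
        · have : ∀ x : κ, |nul0 i0 (pr p) none (some x)| *
            (if (none : Option κ) = none ∧ some x ≠ some i0 then tl (1 / pr p) (some x) else 1) *
            (if some j = pil i0 none (some x) then 1 else 0) = 0 := by
            intro x
            by_cases hx : x = i0
            · simp [pil, hx, hj]
            · simp [pil, hx]
          rw [Finset.sum_congr rfl (fun x _ => this x)]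
          simp [pil, mul0, hj]
    · rcases s p with _ | j
      · simp [nul0, pil, mul0]
      · by_cases hj : i = j
        · subst hj
          have : ∀ x : κ, |nul0 i0 (pr p) (some i) (some x)| *
            (if (some i : Option κ) = none ∧ some x ≠ some i0 then tl (1 / pr p) (some x) else 1) *
            (if some i = pil i0 (some i) (some x) then 1 else 0) = if x = i then 1 else 0 := by
            intro x
            by_cases hx : x = i
            · simp [nul0, pil, hx]
            · have hx' : ¬ i = x := fun e => hx e.symm
              simp [pil, hx, hx']
          rw [Finset.sum_congr rfl (fun x _ => this x)]
          simp [pil, mul0, hpos]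
        · have : ∀ x : κ, |nul0 i0 (pr p) (some i) (some x)| *
            (if (some i : Option κ) = none ∧ some x ≠ some i0 then tl (1 / pr p) (some x) else 1) *
            (if some j = pil i0 (some i) (some x) then 1 else 0) = 0 := by
            intro x
            by_cases hx : j = x
            · subst hx; simp [nul0, hj]
            · simp [pil, hx]
          rw [Finset.sum_congr rfl (fun x _ => this x)]
          simp [pil, mul0, hj]

lemma T2_lower (pr : ι → ℝ) (hpr : ∀ p, (Fintype.card κ : ℝ) + 1 < pr p) (i0 : κ)
    (G : (ι → Option κ) → ℝ) (hG0 : ∀ s, 0 ≤ G s)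
    (hG : ∀ s s' : ι → Option κ, (∀ p, s' p = none ∨ s' p = s p) → Nm pr s * G s ≤ Nm pr s' * G s')
    (hP : ∏ p, (1 + Fintype.card κ / (pr p * (pr p - 1))) ≤ 3 / 2) :
    ∑ r : ι → Option κ, (∏ p, nol i0 (r p)) * (∏ p, tl (pr p - 1 - Fintype.card κ) (r p)) *
      (Mr i0 G r ^ 2 / 4) ≤
    ∑ D, ∑ E, (lam pr G D * ∏ p, nol i0 (D p)) * (lam pr G E * ∏ p, nol i0 (E p)) *
      ∏ p, Kl (1 / (pr p - 1)) (D p) (E p) := by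
  have hc : (0:ℝ) ≤ Fintype.card κ := by positivity
  have hpr1 : ∀ p, 1 < pr p := fun p => by linarith [hpr p]
  have h := form_lower (κ := κ) (fun p => 1 / (pr p - 1))
    (fun p => by have := hpr1 p; exact one_div_pos.2 (by linarith)) (fun p => by
      have := hpr p
      rw [mul_one_div, div_le_one (by linarith)]; linarith) (fun D => lam pr G D * ∏ p, nol i0 (D p))
  refine le_trans (Finset.sum_le_sum fun r _ => ?_) h
  have e1 : ∀ p, (1 - (Fintype.card κ : ℝ) * (1 / (pr p - 1))) / (1 / (pr p - 1)) =
      pr p - 1 - Fintype.card κ := fun p => by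
    have : pr p - 1 ≠ 0 := by linarith [hpr1 p]
    field_simp
  simp_rw [e1]
  have ht : 0 ≤ ∏ p, tl (pr p - 1 - (Fintype.card κ : ℝ)) (r p) := Finset.prod_nonneg fun p _ => by
    have := hpr p
    unfold tl; split_ifs <;> linarith
  by_cases hr : ∃ p, r p = some i0
  · obtain ⟨p, hp⟩ := hr
    have : ∏ p, nol i0 (r p) = 0 := Finset.prod_eq_zero (mem_univ p) (by simp [nol, hp])
    rw [this, zero_mul, zero_mul]
    positivity
  · push Not at hr
    have : ∏ p, nol i0 (r p) = 1 := Finset.prod_eq_one fun p _ => by simp [nol, hr p]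
    rw [this, one_mul]
    refine mul_le_mul_of_nonneg_left ?_ ht
    rw [inner_eq pr hpr1 i0 G r hr, mul_pow, ← Finset.prod_pow]
    have hA : 1 ≤ ∏ p, tl (-(pr p / (pr p - 1))) (r p) ^ 2 := by
      refine le_trans (le_of_eq (Finset.prod_const_one (s := (univ : Finset ι))).symm) ?_
      refine Finset.prod_le_prod (fun _ _ => zero_le_one) fun p _ => ?_
      unfold tl
      split_ifs
      · norm_num
      · have := hpr1 p
        have h2 : 1 ≤ pr p / (pr p - 1) := by rw [le_div_iff₀ (by linarith)]; linarith
        rw [neg_sq]; exact one_le_pow₀ h2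
    have hM : 0 ≤ Mr i0 G r := Finset.sum_nonneg fun s _ =>
      mul_nonneg (Finset.prod_nonneg fun p _ => mul0_nonneg _ _ _) (hG0 s)
    have hB : Mr i0 G r / 2 ≤ ∑ s : ι → Option κ, (∏ p, nul0 i0 (pr p) (r p) (s p)) * G s := by
      have h3 := abs_sum_le pr hpr1 i0 G hG0 hG r
      have h4 := mul_le_mul_of_nonneg_right hP hM
      have h5 : 2 * Mr i0 G r - ∑ s : ι → Option κ, (∏ p, |nul0 i0 (pr p) (r p) (s p)|) * G s ≤
          ∑ s : ι → Option κ, (∏ p, nul0 i0 (pr p) (r p) (s p)) * G s := by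
        rw [Mr, Finset.mul_sum, ← Finset.sum_sub_distrib]
        refine Finset.sum_le_sum fun s _ => ?_
        rw [← mul_assoc, ← sub_mul]
        refine mul_le_mul_of_nonneg_right (prod_sign_aux _ _ _ fun p => ?_) (hG0 s)
        unfold mul0 nul0
        split_ifs <;> norm_num
      linarith
    have : (Mr i0 G r / 2) ^ 2 ≤ (∑ s : ι → Option κ, (∏ p, nul0 i0 (pr p) (r p) (s p)) * G s) ^ 2 :=
      pow_le_pow_left₀ (by linarith) hB 2
    nlinarith [sq_nonneg (∑ s : ι → Option κ, (∏ p, nul0 i0 (pr p) (r p) (s p)) * G s)]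

end glob
end PD

namespace PD
open Finset

section glob
variable {ι κ : Type} [Fintype ι] [DecidableEq ι] [Fintype κ] [DecidableEq κ]

/-- product of a set of primes -/
def nm (prn : ι → ℕ) (a : Finset ι) : ℕ := ∏ p ∈ a, prn p
/-- colour classes -/
def cs (s : ι → Option κ) (j : κ) : Finset ι := univ.filter (fun p => s p = some j)
/-- total product -/
def nN (prn : ι → ℕ) (s : ι → Option κ) : ℕ := ∏ j, nm prn (cs s j)

/-- the smooth weights -/
noncomputable def GF (prn : ι → ℕ) (g : ℕ → ℝ) (R : ℕ) (s : ι → Option κ) : ℝ :=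
  (if nN prn s ≤ R then ∏ j, g (nm prn (cs s j)) else 0) / nN prn s

lemma Nm_eq (prn : ι → ℕ) (s : ι → Option κ) :
    Nm (fun p => (prn p : ℝ)) s = (nN prn s : ℝ) := by
  unfold Nm nN nm cs
  push_cast
  simp_rw [Finset.prod_filter]
  rw [Finset.prod_comm]
  refine Finset.prod_congr rfl fun p _ => ?_
  rcases s p with _ | i <;> simp [tl]

lemma nm_pos {prn : ι → ℕ} (h : ∀ p, 0 < prn p) (a : Finset ι) : 0 < nm prn a :=
  Finset.prod_pos fun p _ => h p

lemma nN_pos {prn : ι → ℕ} (h : ∀ p, 0 < prn p) (s : ι → Option κ) : 0 < nN prn s :=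
  Finset.prod_pos fun _ _ => nm_pos h _

lemma nm_mono {prn : ι → ℕ} (h : ∀ p, 0 < prn p) {a b : Finset ι} (hab : a ⊆ b) :
    nm prn a ≤ nm prn b :=
  Finset.prod_le_prod_of_subset_of_one_le' hab fun p _ _ => h p

lemma cs_mono {s s' : ι → Option κ} (h : ∀ p, s' p = none ∨ s' p = s p) (j : κ) :
    cs s' j ⊆ cs s j := by
  intro p hp
  simp only [cs, mem_filter, mem_univ, true_and] at hp ⊢
  rcases h p with h | h
  · rw [h] at hp; simp at hp
  · rw [← h]; exact hp

lemma GF_nonneg {prn : ι → ℕ} {g : ℕ → ℝ} (hg : ∀ n, 0 ≤ g n) (R : ℕ) (s : ι → Option κ) :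
    0 ≤ GF prn g R s := by
  unfold GF
  refine div_nonneg ?_ (Nat.cast_nonneg _)
  split_ifs
  · exact Finset.prod_nonneg fun _ _ => hg _
  · exact le_rfl

lemma GF_mono {prn : ι → ℕ} (hp : ∀ p, 0 < prn p) {g : ℕ → ℝ} (hg : ∀ n, 0 ≤ g n)
    (ga : Antitone g) (R : ℕ) (s s' : ι → Option κ) (h : ∀ p, s' p = none ∨ s' p = s p) :
    Nm (fun p => (prn p : ℝ)) s * GF prn g R s ≤ Nm (fun p => (prn p : ℝ)) s' * GF prn g R s' := by
  rw [Nm_eq, Nm_eq, GF, GF, mul_div_cancel₀ _ (by exact_mod_cast (nN_pos hp s).ne'),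
    mul_div_cancel₀ _ (by exact_mod_cast (nN_pos hp s').ne')]
  have h1 : ∀ j, nm prn (cs s' j) ≤ nm prn (cs s j) := fun j => nm_mono hp (cs_mono h j)
  have h2 : nN prn s' ≤ nN prn s := Finset.prod_le_prod' fun j _ => h1 j
  by_cases hR : nN prn s ≤ R
  · rw [if_pos hR, if_pos (h2.trans hR)]
    exact Finset.prod_le_prod (fun _ _ => hg _) fun j _ => ga (h1 j)
  · rw [if_neg hR]
    split_ifs
    · exact Finset.prod_nonneg fun _ _ => hg _
    · exact le_rfl

lemma hit (prn : ι → ℕ) (hp : ∀ p, 0 < prn p) {φ : ℕ → ℝ} (hφ : ∀ n, 0 ≤ φ n)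
    (φa : Antitone φ) (p : ι) :
    ∑ a : Finset ι, (if p ∈ a then φ (nm prn a) / nm prn a else 0) ≤
      1 / prn p * ∑ a : Finset ι, φ (nm prn a) / nm prn a := by
  rw [← Finset.sum_filter]
  have hpos : ∀ a : Finset ι, 0 ≤ φ (nm prn a) / nm prn a := fun a =>
    div_nonneg (hφ _) (Nat.cast_nonneg _)
  have h1 : ∀ a ∈ univ.filter (fun a : Finset ι => p ∈ a), φ (nm prn a) / nm prn a ≤
      1 / prn p * (φ (nm prn (a.erase p)) / nm prn (a.erase p)) := by
    intro a ha
    have ha : p ∈ a := by simpa using ha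
    have e : nm prn a = prn p * nm prn (a.erase p) := (Finset.mul_prod_erase a prn ha).symm
    have e2 : (nm prn a : ℝ) = prn p * nm prn (a.erase p) := by exact_mod_cast e
    rw [one_div_mul_eq_div, div_div, e2, mul_comm (prn p : ℝ)]
    refine div_le_div_of_nonneg_right (φa (nm_mono hp (Finset.erase_subset _ _))) ?_
    positivity
  refine (Finset.sum_le_sum h1).trans ?_
  rw [← Finset.mul_sum]
  refine mul_le_mul_of_nonneg_left ?_ (by positivity)
  have inj : Set.InjOn (fun a : Finset ι => a.erase p)
      (univ.filter (fun a : Finset ι => p ∈ a) : Finset (Finset ι)) := by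
    intro a ha b hb hab
    have ha : p ∈ a := by simpa using ha
    have hb : p ∈ b := by simpa using hb
    rw [← Finset.insert_erase ha, ← Finset.insert_erase hb]
    exact congrArg (insert p) hab
  rw [← Finset.sum_image (f := fun a => φ (nm prn a) / nm prn a) inj]
  exact Finset.sum_le_sum_of_subset_of_nonneg (Finset.subset_univ _) fun a _ _ => hpos a

/-- extend `r` by the colour `i0` on `a` -/
def ext0 (i0 : κ) (r : ι → Option κ) (a : Finset ι) : ι → Option κ :=
  fun p => if p ∈ a then some i0 else r p

/-- support -/
def supp (r : ι → Option κ) : Finset ι := univ.filter (fun p => r p ≠ none)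

lemma Mr_lower (prn : ι → ℕ) (hp : ∀ p, 0 < prn p) {g : ℕ → ℝ} (hg : ∀ n, 0 ≤ g n)
    (ga : Antitone g) {R R' : ℕ} (hR : R' * R' ≤ R) (hgR : ∀ n, R' < n → g n = 0)
    (i0 : κ) (r : ι → Option κ) (hr : ∀ p, r p ≠ some i0) (hrR : nN prn r ≤ R') :
    (∏ j ∈ univ.erase i0, g (nm prn (cs r j))) / nN prn r *
      ((∑ a : Finset ι, g (nm prn a) / nm prn a) * (1 - ∑ p ∈ supp r, 1 / (prn p : ℝ))) ≤
    Mr i0 (GF prn g R) r := by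
  set S : Finset (Finset ι) := univ.filter (fun a => ∀ p ∈ supp r, p ∉ a) with hS
  have hPi : 0 ≤ (∏ j ∈ univ.erase i0, g (nm prn (cs r j))) / (nN prn r : ℝ) :=
    div_nonneg (Finset.prod_nonneg fun _ _ => hg _) (Nat.cast_nonneg _)
  have inj : Set.InjOn (ext0 i0 r) (S : Set (Finset ι)) := by
    intro a ha b hb hab
    ext p
    have h := congrFun hab p
    simp only [ext0] at h
    by_cases h1 : p ∈ a <;> by_cases h2 : p ∈ b
    · simp [h1, h2]
    · simp only [h1, h2, if_true, if_false] at h; exact absurd h.symm (hr p)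
    · simp only [h1, h2, if_true, if_false] at h; exact absurd h (hr p)
    · simp [h1, h2]
  have hval : ∀ a ∈ S, (∏ j ∈ univ.erase i0, g (nm prn (cs r j))) / (nN prn r : ℝ) *
      (g (nm prn a) / nm prn a) ≤
      (∏ p, mul0 i0 (r p) (ext0 i0 r a p)) * GF prn g R (ext0 i0 r a) := by
    intro a ha
    have ha' : ∀ p, p ∈ a → r p = none := by
      intro p hpa
      by_contra hne
      have : p ∈ supp r := by simp [supp, hne]
      exact (mem_filter.1 ha).2 p this hpa
    have e1 : ∏ p, mul0 i0 (r p) (ext0 i0 r a p) = 1 := Finset.prod_eq_one fun p _ => by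
      unfold ext0 mul0
      by_cases h1 : p ∈ a
      · simp [ha' p h1, h1]
      · by_cases h2 : r p = none <;> simp [h1, h2]
    have e2 : cs (ext0 i0 r a) i0 = a := by
      ext p
      simp only [cs, ext0, mem_filter, mem_univ, true_and]
      by_cases h1 : p ∈ a
      · simp [h1]
      · simp [h1, hr p]
    have e3 : ∀ j ∈ univ.erase i0, cs (ext0 i0 r a) j = cs r j := by
      intro j hj
      have hj : j ≠ i0 := (mem_erase.1 hj).1
      refine Finset.filter_congr fun p _ => ?_
      simp only [ext0]
      by_cases h1 : p ∈ a
      · simp [h1, ha' p h1, hj.symm]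
      · simp [h1]
    have e4 : cs r i0 = ∅ := by
      ext p; simp [cs, hr p]
    have e5 : nN prn r = ∏ j ∈ univ.erase i0, nm prn (cs r j) := by
      rw [nN, ← Finset.mul_prod_erase univ _ (mem_univ i0), e4]; simp [nm]
    have e6 : nN prn (ext0 i0 r a) = nm prn a * nN prn r := by
      rw [nN, ← Finset.mul_prod_erase univ _ (mem_univ i0), e2, e5]
      congr 1
      exact Finset.prod_congr rfl fun j hj => by rw [e3 j hj]
    have e7 : ∏ j, g (nm prn (cs (ext0 i0 r a) j)) =
        g (nm prn a) * ∏ j ∈ univ.erase i0, g (nm prn (cs r j)) := by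
      rw [← Finset.mul_prod_erase univ _ (mem_univ i0), e2]
      congr 1
      exact Finset.prod_congr rfl fun j hj => by rw [e3 j hj]
    by_cases hbig : R' < nm prn a
    · rw [hgR _ hbig]
      simp only [zero_div, mul_zero]
      rw [e1, one_mul]; exact GF_nonneg hg _ _
    · push Not at hbig
      rw [e1, one_mul, GF, e6, e7, if_pos ((Nat.mul_le_mul hbig hrR).trans hR)]
      push_cast
      rw [div_mul_div_comm, mul_comm, mul_comm (nN prn r : ℝ)]
  have h1 : ∑ a ∈ S, (∏ j ∈ univ.erase i0, g (nm prn (cs r j))) / (nN prn r : ℝ) *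
      (g (nm prn a) / nm prn a) ≤ Mr i0 (GF prn g R) r := by
    refine (Finset.sum_le_sum hval).trans ?_
    rw [← Finset.sum_image (f := fun s => (∏ p, mul0 i0 (r p) (s p)) * GF prn g R s) inj]
    exact Finset.sum_le_sum_of_subset_of_nonneg (Finset.subset_univ _) fun s _ _ =>
      mul_nonneg (Finset.prod_nonneg fun p _ => mul0_nonneg _ _ _) (GF_nonneg hg _ _)
  refine le_trans ?_ h1
  rw [← Finset.mul_sum]
  refine mul_le_mul_of_nonneg_left ?_ hPi
  -- inclusion-exclusion
  have hpos : ∀ a : Finset ι, 0 ≤ g (nm prn a) / (nm prn a : ℝ) := fun a =>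
    div_nonneg (hg _) (Nat.cast_nonneg _)
  have h2 : ∑ a : Finset ι, g (nm prn a) / (nm prn a : ℝ) ≤
      ∑ a ∈ S, g (nm prn a) / (nm prn a : ℝ) +
      ∑ p ∈ supp r, ∑ a : Finset ι, (if p ∈ a then g (nm prn a) / (nm prn a : ℝ) else 0) := by
    rw [Finset.sum_comm, hS, Finset.sum_filter, ← Finset.sum_add_distrib]
    refine Finset.sum_le_sum fun a _ => ?_
    have hnn : ∀ p ∈ supp r, 0 ≤ (if p ∈ a then g (nm prn a) / (nm prn a : ℝ) else 0) := by
      intro p _; split_ifs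
      · exact hpos a
      · exact le_rfl
    by_cases hc : ∀ p ∈ supp r, p ∉ a
    · rw [if_pos hc]
      have := Finset.sum_nonneg hnn
      linarith
    · rw [if_neg hc, zero_add]
      push Not at hc
      obtain ⟨p, hp1, hp2⟩ := hc
      refine le_trans ?_ (Finset.single_le_sum hnn hp1)
      rw [if_pos hp2]
  have h3 := Finset.sum_le_sum fun p (_ : p ∈ supp r) => hit prn hp hg ga p
  rw [← Finset.sum_mul] at h3
  linarith

end glob
end PD

namespace PD
open Finset

section glob
variable {ι κ : Type} [Fintype ι] [DecidableEq ι] [Fintype κ] [DecidableEq κ]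

lemma cs_inj : Function.Injective (cs : (ι → Option κ) → κ → Finset ι) := by
  intro r s h
  funext p
  have h1 : ∀ j, r p = some j ↔ s p = some j := by
    intro j
    have := congrArg (fun a : Finset ι => p ∈ a) (congrFun h j)
    simpa [cs] using this
  rcases hr : r p with _ | i
  · rcases hs : s p with _ | j
    · rfl
    · have := (h1 j).2 hs; rw [hr] at this; exact this
  · exact ((h1 i).1 hr).symm

lemma cs_surj (a : κ → Finset ι) (h : ∀ p i j, p ∈ a i → p ∈ a j → i = j) :
    ∃ r : ι → Option κ, cs r = a := by
  classical
  refine ⟨fun p => if hp : ∃ j, p ∈ a j then some hp.choose else none, ?_⟩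
  funext j
  ext p
  simp only [cs, mem_filter, mem_univ, true_and]
  by_cases hp : ∃ j, p ∈ a j
  · rw [dif_pos hp]
    constructor
    · intro e
      have := hp.choose_spec
      rw [Option.some.inj e] at this; exact this
    · intro hj
      rw [h p _ _ hp.choose_spec hj]
  · rw [dif_neg hp]
    constructor
    · intro e; simp at e
    · intro hj; exact absurd ⟨j, hj⟩ hp

lemma tup (γ φ : κ → Finset ι → ℝ) :
    ∑ a : κ → Finset ι, (∏ j, γ j (a j)) * ∏ j, φ j (a j) = ∏ j, ∑ b, γ j b * φ j b := by
  rw [Finset.prod_univ_sum, Fintype.piFinset_univ]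
  exact Finset.sum_congr rfl fun a _ => by rw [Finset.prod_mul_distrib]

lemma tup_le (γ φ : κ → Finset ι → ℝ) (hγ : ∀ j b, 0 ≤ γ j b) (hφ : ∀ j b, 0 ≤ φ j b) (c : κ → ℝ)
    (h : ∀ j, ∑ b, γ j b * φ j b ≤ c j * ∑ b, γ j b) :
    ∑ a : κ → Finset ι, (∏ j, γ j (a j)) * ∏ j, φ j (a j) ≤ (∏ j, c j) * ∏ j, ∑ b, γ j b := by
  rw [tup, ← Finset.prod_mul_distrib]
  exact Finset.prod_le_prod (fun j _ => Finset.sum_nonneg fun b _ => mul_nonneg (hγ _ _) (hφ _ _))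
    fun j _ => h j

lemma tup_single (γ : κ → Finset ι → ℝ) (hγ : ∀ j b, 0 ≤ γ j b) (f : Finset ι → ℝ)
    (hf : ∀ b, 0 ≤ f b) (c : ℝ) (i : κ) (h : ∑ b, γ i b * f b ≤ c * ∑ b, γ i b) :
    ∑ a : κ → Finset ι, (∏ j, γ j (a j)) * f (a i) ≤ c * ∏ j, ∑ b, γ j b := by
  have := tup_le γ (fun j b => if j = i then f b else 1) hγ
    (fun j b => by split_ifs <;> simp [hf]) (fun j => if j = i then c else 1) (fun j => by
      by_cases hj : j = i
      · subst hj; simpa using h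
      · simp [hj])
  simpa using this

lemma tup_pair (γ : κ → Finset ι → ℝ) (hγ : ∀ j b, 0 ≤ γ j b) (f : Finset ι → ℝ)
    (hf : ∀ b, 0 ≤ f b) (c : ℝ) (h : ∀ i, ∑ b, γ i b * f b ≤ c * ∑ b, γ i b) (i i' : κ)
    (hne : i ≠ i') :
    ∑ a : κ → Finset ι, (∏ j, γ j (a j)) * (f (a i) * f (a i')) ≤ c * c * ∏ j, ∑ b, γ j b := by
  have := tup_le γ (fun j b => (if j = i then f b else 1) * (if j = i' then f b else 1)) hγ
    (fun j b => by split_ifs <;> simp [hf, mul_nonneg])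
    (fun j => (if j = i then c else 1) * (if j = i' then c else 1)) (fun j => by
      by_cases hj : j = i
      · subst hj; simpa [hne] using h j
      · by_cases hj' : j = i'
        · subst hj'; simpa [hj] using h j
        · simp [hj, hj'])
  simp only [Finset.prod_mul_distrib, Finset.prod_ite_eq', Finset.mem_univ, if_true] at this
  exact this

lemma T1_final (prn : ι → ℕ) (hp : ∀ p, 0 < prn p) {g : ℕ → ℝ} (hg : ∀ n, 0 ≤ g n) (R : ℕ) :
    ∑ r : ι → Option κ, Nm (fun p => (prn p : ℝ)) r * GF prn g R r ^ 2 ≤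
      (∑ a : Finset ι, g (nm prn a) ^ 2 / nm prn a) ^ Fintype.card κ := by
  have h0 : (∑ a : Finset ι, g (nm prn a) ^ 2 / nm prn a) ^ Fintype.card κ =
      ∑ a : κ → Finset ι, ∏ j, g (nm prn (a j)) ^ 2 / (nm prn (a j) : ℝ) := by
    have := tup (fun (_ : κ) (a : Finset ι) => g (nm prn a) ^ 2 / (nm prn a : ℝ)) (fun _ _ => 1)
    simp only [Finset.prod_const_one, mul_one, Finset.prod_const, Finset.card_univ] at this
    rw [this]
  have h1 : ∀ r : ι → Option κ, Nm (fun p => (prn p : ℝ)) r * GF prn g R r ^ 2 ≤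
      ∏ j, g (nm prn (cs r j)) ^ 2 / (nm prn (cs r j) : ℝ) := by
    intro r
    have hN : (nN prn r : ℝ) ≠ 0 := by exact_mod_cast (nN_pos hp r).ne'
    have hprod : 0 ≤ ∏ j, g (nm prn (cs r j)) ^ 2 / (nm prn (cs r j) : ℝ) :=
      Finset.prod_nonneg fun j _ => div_nonneg (sq_nonneg _) (Nat.cast_nonneg _)
    rw [Nm_eq, GF]
    split_ifs
    · rw [Finset.prod_div_distrib, Finset.prod_pow]
      have : (∏ j, (nm prn (cs r j) : ℝ)) = nN prn r := by rw [nN]; push_cast; rfl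
      rw [this]
      apply le_of_eq
      field_simp
    · simpa using hprod
  refine (Finset.sum_le_sum fun r _ => h1 r).trans ?_
  rw [h0, ← Finset.sum_image (f := fun a : κ → Finset ι =>
    ∏ j, g (nm prn (a j)) ^ 2 / (nm prn (a j) : ℝ)) (cs_inj.injOn)]
  exact Finset.sum_le_sum_of_subset_of_nonneg (Finset.subset_univ _) fun a _ _ =>
    Finset.prod_nonneg fun j _ => div_nonneg (sq_nonneg _) (Nat.cast_nonneg _)

lemma weier (s : Finset ι) (x : ι → ℝ) (h0 : ∀ p, 0 ≤ x p) (h1 : ∀ p, x p ≤ 1) :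
    1 - ∑ p ∈ s, x p ≤ ∏ p ∈ s, (1 - x p) ∧ ∏ p ∈ s, (1 - x p) ≤ 1 ∧ 0 ≤ ∏ p ∈ s, (1 - x p) := by
  induction s using Finset.induction_on with
  | empty => simp
  | insert p s hp ih =>
    rw [Finset.sum_insert hp, Finset.prod_insert hp]
    have a := h0 p
    have b := h1 p
    obtain ⟨i1, i2, i3⟩ := ih
    refine ⟨by nlinarith, by nlinarith, mul_nonneg (by linarith) i3⟩

lemma T2_term (prn : ι → ℕ) (hp : ∀ p, (Fintype.card κ : ℝ) + 1 < prn p) {g : ℕ → ℝ}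
    (hg : ∀ n, 0 ≤ g n)
    (ga : Antitone g) {R R' : ℕ} (hR : R' * R' ≤ R) (hgR : ∀ n, R' < n → g n = 0)
    (i0 : κ) (r : ι → Option κ) (hr : ∀ p, r p ≠ some i0) (hrR : nN prn r ≤ R') :
    (∑ a : Finset ι, g (nm prn a) / nm prn a) ^ 2 *
      ((∏ j ∈ univ.erase i0, g (nm prn (cs r j)) ^ 2 / (nm prn (cs r j) : ℝ)) *
      (1 - (Fintype.card κ + 3) * ∑ p ∈ supp r, 1 / (prn p : ℝ))) ≤
    (∏ p, tl ((prn p : ℝ) - 1 - Fintype.card κ) (r p)) * Mr i0 (GF prn g R) r ^ 2 := by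
  have hk : (0:ℝ) ≤ Fintype.card κ := Nat.cast_nonneg _
  have hpp : ∀ p, 0 < prn p := fun p => by
    have := hp p
    have h : (0:ℝ) < prn p := by linarith
    exact_mod_cast h
  set k : ℝ := (Fintype.card κ : ℝ)
  set σ := ∑ p ∈ supp r, 1 / (prn p : ℝ) with hσ
  set B := ∑ a : Finset ι, g (nm prn a) / (nm prn a : ℝ)
  have hB : 0 ≤ B := Finset.sum_nonneg fun a _ => div_nonneg (hg _) (Nat.cast_nonneg _)
  have hσ0 : 0 ≤ σ := Finset.sum_nonneg fun a _ => by positivity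
  have hM := Mr_lower prn hpp hg ga hR hgR i0 r hr hrR
  have hN : (0:ℝ) < nN prn r := by exact_mod_cast nN_pos hpp r
  set N : ℝ := (nN prn r : ℝ) with hNdef
  set P := ∏ j ∈ univ.erase i0, g (nm prn (cs r j)) with hP
  have hP0 : 0 ≤ P := Finset.prod_nonneg fun _ _ => hg _
  have e4 : cs r i0 = ∅ := by
    ext p; simp [cs, hr p]
  have e5 : N = ∏ j ∈ univ.erase i0, (nm prn (cs r j) : ℝ) := by
    rw [hNdef, nN, ← Finset.mul_prod_erase univ _ (mem_univ i0), e4]; simp [nm]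
  have e6 : (∏ j ∈ univ.erase i0, g (nm prn (cs r j)) ^ 2 / (nm prn (cs r j) : ℝ)) = P ^ 2 / N := by
    rw [Finset.prod_div_distrib, Finset.prod_pow, e5]
  rw [e6]
  have htl : ∏ p, tl ((prn p : ℝ) - 1 - k) (r p) = N * ∏ p ∈ supp r, (1 - (k + 1) / prn p) := by
    rw [hNdef, ← Nm_eq, Nm, supp, Finset.prod_filter, ← Finset.prod_mul_distrib]
    refine Finset.prod_congr rfl fun p _ => ?_
    have : (prn p : ℝ) ≠ 0 := by exact_mod_cast (hpp p).ne'
    by_cases h : r p = none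
    · simp [tl, h]
    · simp only [tl, h, if_false, ne_eq, not_false_eq_true, if_true]
      field_simp; ring
  have hw := weier (supp r) (fun p => (k + 1) / prn p) (fun p => by positivity) (fun p => by
    have := hp p
    rw [div_le_one (by linarith)]; linarith)
  have hs : ∑ p ∈ supp r, (k + 1) / (prn p : ℝ) = (k + 1) * σ := by
    rw [hσ, Finset.mul_sum]; exact Finset.sum_congr rfl fun p _ => by ring
  simp only [hs] at hw
  rw [htl]
  by_cases hσ1 : 1 - (k + 3) * σ ≤ 0
  · refine le_trans (mul_nonpos_of_nonneg_of_nonpos (sq_nonneg _)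
      (mul_nonpos_of_nonneg_of_nonpos (by positivity) hσ1)) ?_
    exact mul_nonneg (mul_nonneg hN.le hw.2.2) (sq_nonneg _)
  · push Not at hσ1
    have hσ2 : 0 ≤ 1 - σ := by nlinarith
    have h1 : (P / N * (B * (1 - σ))) ^ 2 ≤ Mr i0 (GF prn g R) r ^ 2 :=
      pow_le_pow_left₀ (by positivity) hM 2
    have h2 : 0 ≤ 1 - (k + 1) * σ := by nlinarith
    calc B ^ 2 * (P ^ 2 / N * (1 - (k + 3) * σ))
        ≤ B ^ 2 * (P ^ 2 / N * ((1 - (k + 1) * σ) * (1 - σ) ^ 2)) := by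
          refine mul_le_mul_of_nonneg_left (mul_le_mul_of_nonneg_left ?_ (by positivity)) (sq_nonneg _)
          nlinarith [mul_nonneg (mul_nonneg hk hσ0) hσ0, mul_nonneg hσ0 hσ0, mul_nonneg h2 (sq_nonneg σ)]
      _ = N * (1 - (k + 1) * σ) * (P / N * (B * (1 - σ))) ^ 2 := by
          field_simp
      _ ≤ _ := mul_le_mul (mul_le_mul_of_nonneg_left hw.1 hN.le) h1 (sq_nonneg _)
          (mul_nonneg hN.le hw.2.2)

end glob
end PD

namespace PD
open Finset

section glob
variable {ι κ : Type} [Fintype ι] [DecidableEq ι] [Fintype κ] [DecidableEq κ]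

lemma supp_sum (r : ι → Option κ) (x : ι → ℝ) :
    ∑ p ∈ supp r, x p = ∑ j, ∑ p, if p ∈ cs r j then x p else 0 := by
  rw [Finset.sum_comm, supp, Finset.sum_filter]
  refine Finset.sum_congr rfl fun p _ => ?_
  simp only [cs, mem_filter, mem_univ, true_and]
  rcases r p with _ | i <;> simp

/-- weights per colour -/
noncomputable def gam (prn : ι → ℕ) (g : ℕ → ℝ) (i0 : κ) (l : κ) (b : Finset ι) : ℝ :=
  if l = i0 then (if b = ∅ then 1 else 0) else g (nm prn b) ^ 2 / nm prn b

/-- the penalty -/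
noncomputable def pen (prn : ι → ℕ) (L : ℝ) (a : κ → Finset ι) : ℝ :=
  1 - (∑ i, ∑ j, ∑ p, if i = j then 0 else (if p ∈ a i then (1:ℝ) else 0) * (if p ∈ a j then 1 else 0))
    - (Fintype.card κ + 3) * (∑ j, ∑ p, 1 / (prn p : ℝ) * if p ∈ a j then 1 else 0)
    - 1 / L * (∑ j, Real.log (nm prn (a j)))

lemma gam_nonneg (prn : ι → ℕ) (g : ℕ → ℝ) (i0 l : κ) (b : Finset ι) : 0 ≤ gam prn g i0 l b := by
  unfold gam; split_ifs <;> positivity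

lemma gam_sum (prn : ι → ℕ) (g : ℕ → ℝ) (i0 : κ) :
    ∏ l, ∑ b, gam prn g i0 l b = (∑ a : Finset ι, g (nm prn a) ^ 2 / nm prn a) ^ (Fintype.card κ - 1) := by
  rw [← Finset.mul_prod_erase univ _ (mem_univ i0)]
  have h1 : ∑ b : Finset ι, gam prn g i0 i0 b = 1 := by simp [gam]
  rw [h1, one_mul, ← Finset.card_univ, ← Finset.card_erase_of_mem (mem_univ i0), ← Finset.prod_const]
  refine Finset.prod_congr rfl fun l hl => Finset.sum_congr rfl fun b _ => ?_
  simp [gam, (mem_erase.1 hl).1]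

lemma pen_sum (prn : ι → ℕ) (hp : ∀ p, 0 < prn p) {g : ℕ → ℝ} (hg : ∀ n, 0 ≤ g n)
    (ga : Antitone g) (i0 : κ) {L : ℝ} (hL : 0 < L)
    (hs : (2 * (Fintype.card κ : ℝ) ^ 2 + 3 * Fintype.card κ) * ∑ p, 1 / (prn p : ℝ) ^ 2 ≤ 1 / 4)
    (hXl : Fintype.card κ * ∑ a : Finset ι, g (nm prn a) ^ 2 / nm prn a * Real.log (nm prn a) ≤
      1 / 4 * L * ∑ a : Finset ι, g (nm prn a) ^ 2 / nm prn a)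
    (hX : 0 < ∑ a : Finset ι, g (nm prn a) ^ 2 / nm prn a) :
    1 / 2 * (∑ a : Finset ι, g (nm prn a) ^ 2 / nm prn a) ^ (Fintype.card κ - 1) ≤
    ∑ a : κ → Finset ι, (∏ j, gam prn g i0 j (a j)) * pen prn L a := by
  have hγ := gam_nonneg prn g i0
  have hkpos : (0:ℝ) < Fintype.card κ := by
    have : 0 < Fintype.card κ := Fintype.card_pos_iff.2 ⟨i0⟩
    exact_mod_cast this
  rw [← gam_sum prn g i0]
  set Γ := ∏ l, ∑ b, gam prn g i0 l b with hΓ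
  have hΓ0 : 0 ≤ Γ := Finset.prod_nonneg fun l _ => Finset.sum_nonneg fun b _ => hγ l b
  set X := ∑ a : Finset ι, g (nm prn a) ^ 2 / (nm prn a : ℝ) with hXd
  set s2 := ∑ p, 1 / (prn p : ℝ) ^ 2 with hs2
  have hind : ∀ p (l : κ), ∑ b, gam prn g i0 l b * (if p ∈ b then (1:ℝ) else 0) ≤
      1 / prn p * ∑ b, gam prn g i0 l b := by
    intro p l
    by_cases hl : l = i0
    · have : ∀ b : Finset ι, gam prn g i0 l b * (if p ∈ b then (1:ℝ) else 0) = 0 := by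
        intro b
        by_cases hb : b = ∅
        · simp [hb]
        · simp [gam, hl, hb]
      simp_rw [this]
      simp only [Finset.sum_const_zero]
      exact mul_nonneg (by positivity) (Finset.sum_nonneg fun b _ => hγ l b)
    · have h := hit prn hp (φ := fun n => g n ^ 2) (fun n => sq_nonneg _)
        (fun a b hab => pow_le_pow_left₀ (hg _) (ga hab) 2) p
      simp only [gam, hl, if_false, mul_ite, mul_one, mul_zero]
      exact h
  have hlog : ∀ l : κ, ∑ b, gam prn g i0 l b * Real.log (nm prn b) ≤
      (L / (4 * Fintype.card κ)) * ∑ b, gam prn g i0 l b := by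
    intro l
    by_cases hl : l = i0
    · have : ∀ b : Finset ι, gam prn g i0 l b * Real.log (nm prn b) = 0 := by
        intro b
        by_cases hb : b = ∅
        · simp [hb, nm]
        · simp [gam, hl, hb]
      simp_rw [this]
      simp only [Finset.sum_const_zero]
      exact mul_nonneg (by positivity) (Finset.sum_nonneg fun b _ => hγ l b)
    · simp only [gam, hl, if_false]
      rw [div_mul_eq_mul_div, le_div_iff₀ (by positivity)]
      linarith
  -- expand
  have e : ∑ a : κ → Finset ι, (∏ j, gam prn g i0 j (a j)) * pen prn L a =
      ∑ a : κ → Finset ι, (∏ j, gam prn g i0 j (a j))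
      - (∑ i, ∑ j, ∑ p, ∑ a : κ → Finset ι, (∏ j, gam prn g i0 j (a j)) *
          (if i = j then 0 else (if p ∈ a i then (1:ℝ) else 0) * (if p ∈ a j then 1 else 0)))
      - (Fintype.card κ + 3) * (∑ j, ∑ p, 1 / (prn p : ℝ) * ∑ a : κ → Finset ι,
          (∏ j, gam prn g i0 j (a j)) * if p ∈ a j then 1 else 0)
      - 1 / L * (∑ j, ∑ a : κ → Finset ι, (∏ j, gam prn g i0 j (a j)) * Real.log (nm prn (a j))) := by
    have c1 : ∑ i, ∑ j, ∑ p, ∑ a : κ → Finset ι, (∏ j, gam prn g i0 j (a j)) *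
          (if i = j then 0 else (if p ∈ a i then (1:ℝ) else 0) * (if p ∈ a j then 1 else 0)) =
        ∑ a : κ → Finset ι, (∏ j, gam prn g i0 j (a j)) * ∑ i, ∑ j, ∑ p,
          (if i = j then 0 else (if p ∈ a i then (1:ℝ) else 0) * (if p ∈ a j then 1 else 0)) := by
      simp_rw [Finset.mul_sum]
      rw [Finset.sum_comm' (t' := univ) (s' := fun _ => univ) (by simp)]
      conv_rhs => rw [Finset.sum_comm]
      rw [Finset.sum_comm]
      refine Finset.sum_congr rfl fun i _ => ?_
      conv_rhs => rw [Finset.sum_comm]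
      refine Finset.sum_congr rfl fun j _ => ?_
      rw [Finset.sum_comm]
    have c2 : ∑ j, ∑ p, 1 / (prn p : ℝ) * ∑ a : κ → Finset ι,
          (∏ j, gam prn g i0 j (a j)) * (if p ∈ a j then 1 else 0) =
        ∑ a : κ → Finset ι, (∏ j, gam prn g i0 j (a j)) *
          ∑ j, ∑ p, 1 / (prn p : ℝ) * if p ∈ a j then 1 else 0 := by
      simp_rw [Finset.mul_sum]
      conv_rhs => rw [Finset.sum_comm]
      refine Finset.sum_congr rfl fun j _ => ?_
      rw [Finset.sum_comm]
      refine Finset.sum_congr rfl fun a _ => Finset.sum_congr rfl fun p _ => by ring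
    have c3 : ∑ j, ∑ a : κ → Finset ι, (∏ j, gam prn g i0 j (a j)) * Real.log (nm prn (a j)) =
        ∑ a : κ → Finset ι, (∏ j, gam prn g i0 j (a j)) * ∑ j, Real.log (nm prn (a j)) := by
      simp_rw [Finset.mul_sum]
      rw [Finset.sum_comm]
    rw [c1, c2, c3]
    rw [Finset.mul_sum, Finset.mul_sum, ← Finset.sum_sub_distrib, ← Finset.sum_sub_distrib,
      ← Finset.sum_sub_distrib]
    refine Finset.sum_congr rfl fun a _ => ?_
    unfold pen
    ring
  have b0 : ∑ a : κ → Finset ι, (∏ j, gam prn g i0 j (a j)) = Γ := by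
    rw [hΓ, Finset.prod_univ_sum, Fintype.piFinset_univ]
  have b1 : ∑ i : κ, ∑ j : κ, ∑ p, ∑ a : κ → Finset ι, (∏ j, gam prn g i0 j (a j)) *
          (if i = j then 0 else (if p ∈ a i then (1:ℝ) else 0) * (if p ∈ a j then 1 else 0)) ≤
          (Fintype.card κ : ℝ) ^ 2 * (s2 * Γ) := by
    have : ∀ i j : κ, ∀ p, ∑ a : κ → Finset ι, (∏ j, gam prn g i0 j (a j)) *
          (if i = j then 0 else (if p ∈ a i then (1:ℝ) else 0) * (if p ∈ a j then 1 else 0)) ≤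
          1 / (prn p : ℝ) ^ 2 * Γ := by
      intro i j p
      by_cases hij : i = j
      · simp only [hij, if_true, mul_zero, Finset.sum_const_zero]
        positivity
      · simp only [hij, if_false]
        have := tup_pair (gam prn g i0) hγ (fun b => if p ∈ b then (1:ℝ) else 0)
          (fun b => by split_ifs <;> norm_num) (1 / prn p) (hind p) i j hij
        refine this.trans (le_of_eq ?_)
        rw [hΓ]; ring
    have h2 : ∀ i j : κ, ∑ p, ∑ a : κ → Finset ι, (∏ j, gam prn g i0 j (a j)) *
          (if i = j then 0 else (if p ∈ a i then (1:ℝ) else 0) * (if p ∈ a j then 1 else 0)) ≤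
          s2 * Γ := fun i j => by
      rw [hs2, Finset.sum_mul]; exact Finset.sum_le_sum fun p _ => this i j p
    refine (Finset.sum_le_sum fun i _ => Finset.sum_le_sum fun j _ => h2 i j).trans (le_of_eq ?_)
    simp; ring
  have b2 : ∑ j : κ, ∑ p, 1 / (prn p : ℝ) * ∑ a : κ → Finset ι,
          (∏ j, gam prn g i0 j (a j)) * (if p ∈ a j then 1 else 0) ≤ Fintype.card κ * (s2 * Γ) := by
    have h2 : ∀ j : κ, ∑ p, 1 / (prn p : ℝ) * ∑ a : κ → Finset ι,
          (∏ j, gam prn g i0 j (a j)) * (if p ∈ a j then 1 else 0) ≤ s2 * Γ := fun j => by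
      rw [hs2, Finset.sum_mul]
      refine Finset.sum_le_sum fun p _ => ?_
      have := tup_single (gam prn g i0) hγ (fun b => if p ∈ b then (1:ℝ) else 0)
          (fun b => by split_ifs <;> norm_num) (1 / prn p) j (hind p j)
      refine (mul_le_mul_of_nonneg_left this (by positivity)).trans (le_of_eq ?_)
      rw [hΓ]; ring
    refine (Finset.sum_le_sum fun j _ => h2 j).trans (le_of_eq ?_)
    simp
  have b3 : ∑ j : κ, ∑ a : κ → Finset ι, (∏ j, gam prn g i0 j (a j)) * Real.log (nm prn (a j)) ≤
      L / 4 * Γ := by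
    refine (Finset.sum_le_sum fun j _ => tup_single (gam prn g i0) hγ
      (fun b => Real.log (nm prn b)) (fun b => Real.log_natCast_nonneg _) _ j (hlog j)).trans
      (le_of_eq ?_)
    rw [← hΓ]
    simp
    field_simp
  rw [e, b0]
  have c2 := mul_le_mul_of_nonneg_left b2 (show (0:ℝ) ≤ Fintype.card κ + 3 by positivity)
  have c3 := mul_le_mul_of_nonneg_left b3 (show (0:ℝ) ≤ 1 / L by positivity)
  have c4 : 1 / L * (L / 4 * Γ) = Γ / 4 := by field_simp
  have c5 := mul_le_mul_of_nonneg_right hs hΓ0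
  rw [c4] at c3
  nlinarith

lemma T2_final (prn : ι → ℕ) (hp : ∀ p, (Fintype.card κ : ℝ) + 1 < prn p) {g : ℕ → ℝ}
    (hg : ∀ n, 0 ≤ g n) (ga : Antitone g) {R R' : ℕ} (hR : R' * R' ≤ R)
    (hgR : ∀ n, R' < n → g n = 0) (hR' : 2 ≤ R')
    (hP : ∏ p, (1 + Fintype.card κ / ((prn p : ℝ) * (prn p - 1))) ≤ 3 / 2) (i0 : κ)
    (hs : (2 * (Fintype.card κ : ℝ) ^ 2 + 3 * Fintype.card κ) * ∑ p, 1 / (prn p : ℝ) ^ 2 ≤ 1 / 4)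
    (hXl : Fintype.card κ * ∑ a : Finset ι, g (nm prn a) ^ 2 / nm prn a * Real.log (nm prn a) ≤
      1 / 4 * Real.log R' * ∑ a : Finset ι, g (nm prn a) ^ 2 / nm prn a)
    (hX : 0 < ∑ a : Finset ι, g (nm prn a) ^ 2 / nm prn a) :
    1 / 8 * (∑ a : Finset ι, g (nm prn a) / nm prn a) ^ 2 *
      (∑ a : Finset ι, g (nm prn a) ^ 2 / nm prn a) ^ (Fintype.card κ - 1) ≤
    ∑ D, ∑ E, (lam (fun p => (prn p : ℝ)) (GF prn g R) D * ∏ p, nol i0 (D p)) *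
      (lam (fun p => (prn p : ℝ)) (GF prn g R) E * ∏ p, nol i0 (E p)) *
      ∏ p, Kl (1 / ((prn p : ℝ) - 1)) (D p) (E p) := by
  have hk : (0:ℝ) ≤ Fintype.card κ := Nat.cast_nonneg _
  have hpp : ∀ p, 0 < prn p := fun p => by
    have := hp p
    have h : (0:ℝ) < prn p := by linarith
    exact_mod_cast h
  have hL : 0 < Real.log R' := Real.log_pos (by exact_mod_cast hR')
  have h2 := T2_lower (fun p => (prn p : ℝ)) hp i0 (GF prn g R) (GF_nonneg hg R)
    (GF_mono hpp hg ga R) hP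
  refine le_trans ?_ h2
  have h3 := pen_sum prn hpp hg ga i0 hL hs hXl hX
  set B := ∑ a : Finset ι, g (nm prn a) / (nm prn a : ℝ)
  have key : ∑ a : κ → Finset ι, (∏ j, gam prn g i0 j (a j)) * pen prn (Real.log R') a ≤
      ∑ r : ι → Option κ, (if nN prn r ≤ R' then (∏ j, gam prn g i0 j (cs r j)) *
        max 0 (1 - (Fintype.card κ + 3) * ∑ p ∈ supp r, 1 / (prn p : ℝ)) else 0) := by
    set h : (κ → Finset ι) → ℝ := fun a => if (∏ j, nm prn (a j)) ≤ R' then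
      (∏ j, gam prn g i0 j (a j)) * max 0 (1 - (Fintype.card κ + 3) *
        ∑ j, ∑ p, if p ∈ a j then 1 / (prn p : ℝ) else 0) else 0 with hh
    have e1 : ∀ r : ι → Option κ, (if nN prn r ≤ R' then (∏ j, gam prn g i0 j (cs r j)) *
        max 0 (1 - (Fintype.card κ + 3) * ∑ p ∈ supp r, 1 / (prn p : ℝ)) else 0) = h (cs r) := by
      intro r
      rw [supp_sum]; rfl
    simp_rw [e1]
    rw [← Finset.sum_image (f := h) (cs_inj.injOn)]
    rw [← Finset.sum_filter_add_sum_filter_not univ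
      (fun a => a ∈ univ.image (cs : (ι → Option κ) → κ → Finset ι))]
    have hPi0 : ∀ a : κ → Finset ι, 0 ≤ ∏ j, gam prn g i0 j (a j) := fun a =>
      Finset.prod_nonneg fun j _ => gam_nonneg _ _ _ _ _
    have hlog : ∀ a : κ → Finset ι, 0 ≤ 1 / Real.log R' * ∑ j, Real.log (nm prn (a j)) := fun a =>
      mul_nonneg (by positivity) (Finset.sum_nonneg fun j _ => Real.log_natCast_nonneg _)
    have hpq : ∀ a : κ → Finset ι, 0 ≤ ∑ i, ∑ j, ∑ p,
        (if i = j then 0 else (if p ∈ a i then (1:ℝ) else 0) * (if p ∈ a j then 1 else 0)) :=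
      fun a => Finset.sum_nonneg fun i _ => Finset.sum_nonneg fun j _ => Finset.sum_nonneg fun p _ => by
        split_ifs <;> norm_num
    have hsi : ∀ a : κ → Finset ι, 0 ≤ ((Fintype.card κ : ℝ) + 3) *
        ∑ j, ∑ p, 1 / (prn p : ℝ) * if p ∈ a j then 1 else 0 := fun a =>
      mul_nonneg (by positivity) (Finset.sum_nonneg fun i _ => Finset.sum_nonneg fun j _ => by
        split_ifs <;> simp)
    have hneg : ∑ a ∈ univ.filter (fun a => ¬ a ∈ univ.image (cs : (ι → Option κ) → κ → Finset ι)),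
        (∏ j, gam prn g i0 j (a j)) * pen prn (Real.log R') a ≤ 0 := by
      refine Finset.sum_nonpos fun a ha => mul_nonpos_of_nonneg_of_nonpos (hPi0 a) ?_
      have ha : ¬ ∃ r : ι → Option κ, cs r = a := by simpa using ha
      have : ∃ p i j, p ∈ a i ∧ p ∈ a j ∧ i ≠ j := by
        by_contra hcon
        push Not at hcon
        exact ha (cs_surj a hcon)
      obtain ⟨p, i, j, h1, h2, hij⟩ := this
      have hnn : ∀ i j p, 0 ≤ (if i = j then 0 else (if p ∈ a i then (1:ℝ) else 0) *
          (if p ∈ a j then 1 else 0)) := by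
        intro i j p
        split_ifs <;> norm_num
      have : 1 ≤ ∑ i, ∑ j, ∑ p,
        (if i = j then 0 else (if p ∈ a i then (1:ℝ) else 0) * (if p ∈ a j then 1 else 0)) := by
        calc (1:ℝ) = (if i = j then 0 else (if p ∈ a i then (1:ℝ) else 0) * (if p ∈ a j then 1 else 0)) := by
              simp [hij, h1, h2]
          _ ≤ ∑ p, (if i = j then 0 else (if p ∈ a i then (1:ℝ) else 0) * (if p ∈ a j then 1 else 0)) :=
              Finset.single_le_sum (fun p _ => hnn i j p) (mem_univ p)
          _ ≤ ∑ j, ∑ p, (if i = j then 0 else (if p ∈ a i then (1:ℝ) else 0) * (if p ∈ a j then 1 else 0)) :=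
              Finset.single_le_sum (f := fun j => ∑ p, (if i = j then 0 else (if p ∈ a i then (1:ℝ) else 0) * (if p ∈ a j then 1 else 0)))
                (fun j _ => Finset.sum_nonneg fun p _ => hnn i j p) (mem_univ j)
          _ ≤ _ := Finset.single_le_sum (f := fun i => ∑ j, ∑ p, (if i = j then 0 else (if p ∈ a i then (1:ℝ) else 0) * (if p ∈ a j then 1 else 0)))
                (fun i _ => Finset.sum_nonneg fun j _ => Finset.sum_nonneg fun p _ => hnn i j p) (mem_univ i)
      have := hsi a
      have := hlog a
      unfold pen
      linarith
    have hposi : ∑ a ∈ univ.filter (fun a => a ∈ univ.image (cs : (ι → Option κ) → κ → Finset ι)),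
        (∏ j, gam prn g i0 j (a j)) * pen prn (Real.log R') a ≤
        ∑ a ∈ univ.image (cs : (ι → Option κ) → κ → Finset ι), h a := by
      rw [Finset.filter_mem_eq_inter, Finset.univ_inter]
      refine Finset.sum_le_sum fun a _ => ?_
      simp only [hh]
      have e2 : ∑ j, ∑ p, (if p ∈ a j then 1 / (prn p : ℝ) else 0) =
          ∑ j, ∑ p, 1 / (prn p : ℝ) * if p ∈ a j then 1 else 0 := by simp
      split_ifs with hc
      · refine mul_le_mul_of_nonneg_left (le_trans ?_ (le_max_right _ _)) (hPi0 a)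
        rw [e2]
        unfold pen
        linarith [hpq a, hlog a]
      · refine mul_nonpos_of_nonneg_of_nonpos (hPi0 a) ?_
        push Not at hc
        have : 1 ≤ 1 / Real.log R' * ∑ j, Real.log (nm prn (a j)) := by
          rw [← Real.log_prod (fun j _ => by exact_mod_cast (nm_pos hpp _).ne'),
            one_div_mul_eq_div, le_div_iff₀ hL, one_mul]
          refine Real.log_le_log (by positivity) ?_
          exact_mod_cast hc.le
        unfold pen
        linarith [hpq a, hsi a]
    linarith
  have step : ∀ r : ι → Option κ, B ^ 2 / 4 * (if nN prn r ≤ R' then (∏ j, gam prn g i0 j (cs r j)) *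
        max 0 (1 - (Fintype.card κ + 3) * ∑ p ∈ supp r, 1 / (prn p : ℝ)) else 0) ≤
      (∏ p, nol i0 (r p)) * (∏ p, tl ((prn p : ℝ) - 1 - Fintype.card κ) (r p)) *
      (Mr i0 (GF prn g R) r ^ 2 / 4) := by
    intro r
    have ht : 0 ≤ ∏ p, tl ((prn p : ℝ) - 1 - (Fintype.card κ : ℝ)) (r p) :=
      Finset.prod_nonneg fun p _ => by
        have := hp p
        unfold tl; split_ifs <;> linarith
    have hn : 0 ≤ ∏ p, nol i0 (r p) := Finset.prod_nonneg fun p _ => by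
      unfold nol; split_ifs <;> norm_num
    have hRHS : 0 ≤ (∏ p, nol i0 (r p)) * (∏ p, tl ((prn p : ℝ) - 1 - Fintype.card κ) (r p)) *
      (Mr i0 (GF prn g R) r ^ 2 / 4) := by positivity
    split_ifs with hc
    · by_cases hr : ∃ p, r p = some i0
      · obtain ⟨p, hp0⟩ := hr
        have : ∏ j, gam prn g i0 j (cs r j) = 0 := by
          refine Finset.prod_eq_zero (mem_univ i0) ?_
          have : cs r i0 ≠ ∅ := Finset.ne_empty_of_mem (a := p) (by simp [cs, hp0])
          simp [gam, this]
        rw [this, zero_mul, mul_zero]; exact hRHS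
      · push Not at hr
        rcases le_total (1 - (Fintype.card κ + 3) * ∑ p ∈ supp r, 1 / (prn p : ℝ)) 0 with hm | hm
        · rw [max_eq_left hm, mul_zero, mul_zero]; exact hRHS
        · rw [max_eq_right hm]
          have e4 : cs r i0 = ∅ := by
            ext p; simp [cs, hr p]
          have e5 : ∏ j, gam prn g i0 j (cs r j) =
              ∏ j ∈ univ.erase i0, g (nm prn (cs r j)) ^ 2 / (nm prn (cs r j) : ℝ) := by
            rw [← Finset.mul_prod_erase univ _ (mem_univ i0), e4]
            have : gam prn g i0 i0 ∅ = 1 := by simp [gam]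
            rw [this, one_mul]
            exact Finset.prod_congr rfl fun j hj => by simp [gam, (mem_erase.1 hj).1]
          have e6 : ∏ p, nol i0 (r p) = 1 := Finset.prod_eq_one fun p _ => by simp [nol, hr p]
          have := T2_term prn hp hg ga hR hgR i0 r hr hc
          rw [e5, e6, one_mul]
          linarith
    · rw [mul_zero]; exact hRHS
  have h5 := Finset.sum_le_sum fun r (_ : r ∈ univ) => step r
  rw [← Finset.mul_sum] at h5
  refine le_trans ?_ h5
  have h6 := mul_le_mul_of_nonneg_left (h3.trans key) (show 0 ≤ B ^ 2 / 4 by positivity)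
  linarith

end glob
end PD

namespace PD
open Finset

lemma abel_anti_id {E : Type*} [NormedAddCommGroup E] [NormedSpace ℝ E] (f : ℕ → ℝ) (c : ℕ → E)
    (a b : ℕ) (hab : a ≤ b) :
    ∑ n ∈ Ico a b, f n • c n = f b • ∑ n ∈ Ico a b, c n +
      ∑ n ∈ Ico a b, (f n - f (n + 1)) • ∑ m ∈ Ico a (n + 1), c m := by
  induction b, hab using Nat.le_induction with
  | base => simp
  | succ b hb ih =>
    rw [Finset.sum_Ico_succ_top hb, ih, Finset.sum_Ico_succ_top hb c, Finset.sum_Ico_succ_top hb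
      (fun n => (f n - f (n + 1)) • ∑ m ∈ Ico a (n + 1), c m), Finset.sum_Ico_succ_top hb c]
    module

lemma abel_anti {E : Type*} [NormedAddCommGroup E] [NormedSpace ℝ E] {f : ℕ → ℝ} {c : ℕ → E}
    {a b : ℕ} {C : ℝ} (hf0 : ∀ n, a ≤ n → 0 ≤ f n) (hf : ∀ n, a ≤ n → f (n + 1) ≤ f n)
    (hC : ∀ b, ‖∑ n ∈ Ico a b, c n‖ ≤ C) :
    ‖∑ n ∈ Ico a b, f n • c n‖ ≤ C * f a := by
  have hC0 : 0 ≤ C := (norm_nonneg _).trans (hC 0)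
  rcases le_total a b with hab | hab
  · rw [abel_anti_id f c a b hab]
    have h1 : ‖f b • ∑ n ∈ Ico a b, c n‖ ≤ f b * C := by
      rw [norm_smul, Real.norm_of_nonneg (hf0 b hab)]
      exact mul_le_mul_of_nonneg_left (hC b) (hf0 b hab)
    have h2 : ‖∑ n ∈ Ico a b, (f n - f (n + 1)) • ∑ m ∈ Ico a (n + 1), c m‖ ≤
        ∑ n ∈ Ico a b, (f n - f (n + 1)) * C := by
      refine norm_sum_le_of_le _ fun n hn => ?_
      have := hf n (mem_Ico.1 hn).1
      rw [norm_smul, Real.norm_of_nonneg (by linarith)]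
      exact mul_le_mul_of_nonneg_left (hC _) (by linarith)
    have h3 : ∑ n ∈ Ico a b, (f n - f (n + 1)) = f a - f b := by
      rw [Finset.sum_Ico_eq_sub _ hab, Finset.sum_range_sub', Finset.sum_range_sub']; ring
    rw [← Finset.sum_mul, h3] at h2
    refine (norm_add_le _ _).trans ?_
    nlinarith
  · rw [Finset.Ico_eq_empty_of_le hab]; simp; exact mul_nonneg hC0 (hf0 a le_rfl)

lemma periodic_Ico_le (f : ℕ → ℂ) (q : ℕ) (hq : 0 < q) (hf : ∀ n, f (q + n) = f n)
    (h0 : ∑ n ∈ range q, f n = 0) (h1 : ∀ n, ‖f n‖ ≤ 1) (a b : ℕ) :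
    ‖∑ m ∈ Ico a b, f m‖ ≤ 2 * q := by
  rcases le_total a b with hab | hab
  · rw [Finset.sum_Ico_eq_sub _ hab]
    refine (norm_sub_le _ _).trans ?_
    have := periodic_range_le f q hq hf h0 h1 a
    have := periodic_range_le f q hq hf h0 h1 b
    linarith
  · rw [Finset.Ico_eq_empty_of_le hab]; simp

/-- sums of a decreasing weight over a periodic set -/
lemma periodic_weight (s : ℕ → Prop) [DecidablePred s] (q c : ℕ) (hq : 0 < q)
    (hs : ∀ n, s (q + n) ↔ s n) (hc : ((range q).filter s).card = c)
    {f : ℕ → ℝ} {a b : ℕ} (hf0 : ∀ n, a ≤ n → 0 ≤ f n) (hf : ∀ n, a ≤ n → f (n + 1) ≤ f n) :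
    |∑ n ∈ Ico a b, (if s n then f n else 0) - (c : ℝ) / q * ∑ n ∈ Ico a b, f n| ≤ 2 * q * f a := by
  have hcq : c ≤ q := by rw [← hc]; exact (card_filter_le _ _).trans (by simp)
  have hq' : (0:ℝ) < q := by exact_mod_cast hq
  have h1 : (0:ℝ) ≤ (c : ℝ) / q ∧ (c : ℝ) / q ≤ 1 :=
    ⟨by positivity, by rw [div_le_one hq']; exact_mod_cast hcq⟩
  have key := abel_anti (E := ℂ) (f := f) (c := fun n => (((if s n then (1:ℝ) else 0) - (c:ℝ) / q : ℝ) : ℂ))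
    (a := a) (b := b) (C := 2 * q) hf0 hf (fun b => by
      refine periodic_Ico_le _ q hq (fun n => by simp only [hs]) ?_ (fun n => ?_) a b
      · rw [← Complex.ofReal_sum, Finset.sum_sub_distrib, Finset.sum_const, ← Finset.sum_filter,
          Finset.sum_const, hc]
        have : c • (1:ℝ) - (range q).card • ((c:ℝ) / q) = 0 := by
          simp; field_simp; simp
        rw [this]; simp
      · rw [Complex.norm_real, Real.norm_eq_abs, abs_le]
        split_ifs <;> constructor <;> linarith)
  have e : ∑ n ∈ Ico a b, f n • ((((if s n then (1:ℝ) else 0) - (c:ℝ) / q : ℝ)) : ℂ) =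
      ((∑ n ∈ Ico a b, (if s n then f n else 0) - (c : ℝ) / q * ∑ n ∈ Ico a b, f n : ℝ) : ℂ) := by
    rw [Finset.mul_sum, ← Finset.sum_sub_distrib, Complex.ofReal_sum]
    refine Finset.sum_congr rfl fun n _ => ?_
    rw [Complex.real_smul, ← Complex.ofReal_mul]
    congr 1
    split_ifs <;> ring
  rw [e, Complex.norm_real, Real.norm_eq_abs] at key
  exact key

lemma harm_block {a b : ℕ} (ha : 1 ≤ a) (hab : a ≤ b) :
    Real.log b - Real.log a ≤ ∑ n ∈ Ico a b, 1 / (n : ℝ) ∧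
    ∑ n ∈ Ico a b, 1 / (n : ℝ) ≤ Real.log b - Real.log a + (1 / a - 1 / b) := by
  induction b, hab using Nat.le_induction with
  | base => simp
  | succ b hb ih =>
    rw [Finset.sum_Ico_succ_top hb]
    have hb0 : (0:ℝ) < b := by exact_mod_cast (by omega : 0 < b)
    have e : Real.log ((b + 1 : ℕ) : ℝ) - Real.log b = Real.log (1 + 1 / b) := by
      rw [← Real.log_div (by positivity) hb0.ne']
      congr 1
      push_cast; field_simp
    have h1 := Real.log_le_sub_one_of_pos (show (0:ℝ) < 1 + 1 / b by positivity)
    have h2 := Real.one_sub_inv_le_log_of_pos (show (0:ℝ) < 1 + 1 / b by positivity)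
    have h3 : 1 - (1 + 1 / (b:ℝ))⁻¹ = 1 / ((b + 1 : ℕ) : ℝ) := by
      push_cast; field_simp; ring
    rw [h3] at h2
    constructor <;> linarith [ih.1, ih.2]

/-- one block of the coprime harmonic sum -/
lemma cop_block {W z : ℕ} (hW : 0 < W) (hz : 2 ≤ z) (l : ℕ) :
    |∑ n ∈ Ico (z ^ l) (z ^ (l + 1)), (if W.Coprime n then 1 / (n : ℝ) else 0) -
      (W.totient : ℝ) / W * Real.log z| ≤ 2 * W + 1 := by
  have h1 : 1 ≤ z ^ l := Nat.one_le_pow _ _ (by omega)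
  have h1' : (1:ℝ) ≤ (z:ℝ) ^ l := by exact_mod_cast h1
  have hp := periodic_weight (fun n => W.Coprime n) W W.totient hW (fun n => by
    simp [Nat.coprime_self_add_right]) (by rw [Nat.totient]) (f := fun n => 1 / (n : ℝ))
    (a := z ^ l) (b := z ^ (l + 1)) (fun n _ => by positivity) (fun n hn => by
      have : (0:ℝ) < n := by exact_mod_cast (by omega : 0 < n)
      apply one_div_le_one_div_of_le this
      push_cast; linarith)
  have hh := harm_block h1 (Nat.pow_le_pow_right (by omega) (Nat.le_succ l))
  have hlog : Real.log ((z ^ (l + 1) : ℕ) : ℝ) - Real.log ((z ^ l : ℕ) : ℝ) = Real.log z := by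
    push_cast
    rw [Real.log_pow, Real.log_pow]; push_cast; ring
  rw [hlog] at hh
  have hW' : (0:ℝ) < W := by exact_mod_cast hW
  have hϖ : 0 ≤ (W.totient : ℝ) / W ∧ (W.totient : ℝ) / W ≤ 1 :=
    ⟨by positivity, by rw [div_le_one hW']; exact_mod_cast Nat.totient_le W⟩
  have hb1 : 1 / ((z ^ l : ℕ) : ℝ) ≤ 1 := by
    push_cast; rw [div_le_one (by positivity)]; exact h1'
  have hb2 : 0 ≤ 1 / ((z ^ (l + 1) : ℕ) : ℝ) := by positivity
  have h3 : 2 * (W:ℝ) * (1 / ((z ^ l : ℕ) : ℝ)) ≤ 2 * W := by nlinarith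
  rw [abs_le] at hp ⊢
  set S := ∑ n ∈ Ico (z ^ l) (z ^ (l + 1)), 1 / (n : ℝ)
  have h4 : (W.totient : ℝ) / W * (S - Real.log z) ≤ 1 := by
    have : S - Real.log z ≤ 1 := by linarith
    nlinarith
  have h5 : 0 ≤ (W.totient : ℝ) / W * (S - Real.log z) := mul_nonneg hϖ.1 (by linarith)
  constructor <;> nlinarith [hp.1, hp.2]

end PD

namespace PD
open Finset

/-- the step function used for the sieve weights -/
noncomputable def gz (z k : ℕ) (n : ℕ) : ℝ := if Nat.log z n < k then 1 / (1 + (Nat.log z n : ℝ)) else 0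

lemma gz_nonneg (z k n : ℕ) : 0 ≤ gz z k n := by unfold gz; split_ifs <;> positivity

lemma gz_le_one (z k n : ℕ) : gz z k n ≤ 1 := by
  unfold gz; split_ifs
  · rw [div_le_one (by positivity)]; linarith [(Nat.log z n).cast_nonneg (α := ℝ)]
  · norm_num

lemma gz_anti (z k : ℕ) : Antitone (gz z k) := by
  intro m n hmn
  have h := Nat.log_mono_right (b := z) hmn
  unfold gz
  split_ifs with h1 h2 h2
  · apply one_div_le_one_div_of_le (by positivity)
    have : (Nat.log z m : ℝ) ≤ Nat.log z n := by exact_mod_cast h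
    linarith
  · omega
  · positivity
  · exact le_rfl

lemma gz_zero {z k n : ℕ} (hz : 2 ≤ z) (h : z ^ k ≤ n) : gz z k n = 0 := by
  unfold gz
  rw [if_neg]
  have := Nat.le_log_of_pow_le (by omega : 1 < z) h
  omega

lemma nm_sum (P : Finset ℕ) (W N : ℕ) (hP : ∀ p ∈ P, p.Prime ∧ ¬ p ∣ W)
    (hP2 : ∀ p, p.Prime → p < N → ¬ p ∣ W → p ∈ P) (f : ℕ → ℝ) (hf : ∀ n, N ≤ n → f n = 0) :
    ∑ a : Finset ↥P, f (nm (fun p : ↥P => (p : ℕ)) a) =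
      ∑ n ∈ Ico 1 N, if Squarefree n ∧ W.Coprime n then f n else 0 := by
  classical
  rw [← Finset.sum_filter]
  have e1 : ∀ a : Finset ↥P, nm (fun p : ↥P => (p : ℕ)) a = ∏ p ∈ a.map (Function.Embedding.subtype _), p := by
    intro a; simp [nm]
  have hpm : ∀ a : Finset ↥P, ∀ p ∈ a.map (Function.Embedding.subtype (· ∈ P)), p.Prime ∧ ¬ p ∣ W := by
    intro a p hp
    simp only [mem_map, Function.Embedding.subtype_apply] at hp
    obtain ⟨q, _, rfl⟩ := hp
    exact hP q.1 q.2
  rw [← Finset.sum_filter_of_ne (p := fun a => nm (fun p : ↥P => (p : ℕ)) a < N)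
    (fun a _ h => by by_contra h2; exact h (hf _ (by omega)))]
  refine Finset.sum_bij (fun a _ => nm (fun p : ↥P => (p : ℕ)) a) ?_ ?_ ?_ ?_
  · intro a ha
    simp only [mem_filter, mem_univ, true_and] at ha
    simp only [mem_filter, mem_Ico]
    rw [e1] at ha ⊢
    refine ⟨⟨Finset.prod_pos fun p hp => (hpm a p hp).1.pos, ha⟩, ?_, ?_⟩
    · refine Finset.squarefree_prod_of_pairwise_isCoprime ?_ ?_
      · intro p hp q hq hpq
        exact Nat.coprime_iff_isRelPrime.1 ((Nat.coprime_primes (hpm a p hp).1 (hpm a q hq).1).2 hpq)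
      · intro p hp; exact (hpm a p hp).1.prime.squarefree
    · exact Nat.Coprime.prod_right fun p hp =>
        (((hpm a p hp).1.coprime_iff_not_dvd).2 (hpm a p hp).2).symm
  · intro a _ b _ hab
    simp only [e1] at hab
    have := congrArg Nat.primeFactors hab
    rw [Nat.primeFactors_prod (fun p hp => (hpm a p hp).1),
      Nat.primeFactors_prod (fun p hp => (hpm b p hp).1)] at this
    exact Finset.map_injective _ this
  · intro n hn
    simp only [mem_filter, mem_Ico] at hn
    obtain ⟨⟨h1, h2⟩, h3, h4⟩ := hn
    have e : nm (fun p : ↥P => (p : ℕ)) (n.primeFactors.subtype (· ∈ P)) = n := by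
      rw [e1, Finset.subtype_map, Finset.filter_true_of_mem]
      · exact Nat.prod_primeFactors_of_squarefree h3
      · intro p hp
        have hpp := Nat.prime_of_mem_primeFactors hp
        have hpd := Nat.dvd_of_mem_primeFactors hp
        refine hP2 p hpp ((Nat.le_of_dvd (by omega) hpd).trans_lt h2) fun h => ?_
        have := Nat.dvd_gcd h hpd
        rw [h4] at this
        exact hpp.one_lt.ne' (Nat.dvd_one.1 this)
    refine ⟨_, ?_, e⟩
    simp only [mem_filter, mem_univ, true_and]
    rw [e]; exact h2
  · intro a _; rfl

lemma sum_blocks (z : ℕ) (hz : 2 ≤ z) (k : ℕ) (f : ℕ → ℝ) :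
    ∑ n ∈ Ico 1 (z ^ k), f n = ∑ l ∈ range k, ∑ n ∈ Ico (z ^ l) (z ^ (l + 1)), f n := by
  induction k with
  | zero => simp
  | succ k ih =>
    rw [Finset.sum_range_succ, ← ih, Finset.sum_Ico_consecutive _ (Nat.one_le_pow _ _ (by omega))
      (Nat.pow_le_pow_right (by omega) (Nat.le_succ k))]

lemma log_block {z l n : ℕ} (hn : n ∈ Ico (z ^ l) (z ^ (l + 1))) : Nat.log z n = l := by
  rw [mem_Ico] at hn
  exact Nat.log_eq_of_pow_le_of_lt_pow hn.1 hn.2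

lemma nonsq_le (W N D0 : ℕ) (hD0 : 1 ≤ D0) (hW : ∀ p, p.Prime → ¬ p ∣ W → D0 < p) :
    ∑ n ∈ Ico 1 N, ((if W.Coprime n then 1 / (n : ℝ) else 0) -
      (if Squarefree n ∧ W.Coprime n then 1 / (n : ℝ) else 0)) ≤
    1 / D0 * ∑ n ∈ Ico 1 N, (if W.Coprime n then 1 / (n : ℝ) else 0) := by
  classical
  set U := ∑ n ∈ Ico 1 N, (if W.Coprime n then 1 / (n : ℝ) else 0) with hU
  have hU0 : 0 ≤ U := Finset.sum_nonneg fun n _ => by split_ifs <;> positivity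
  have h1 : ∀ n ∈ Ico 1 N, ((if W.Coprime n then 1 / (n : ℝ) else 0) -
      (if Squarefree n ∧ W.Coprime n then 1 / (n : ℝ) else 0)) ≤
      ∑ d ∈ Ioc D0 (D0 + N), if d ^ 2 ∣ n ∧ W.Coprime n then 1 / (n : ℝ) else 0 := by
    intro n hn
    rw [mem_Ico] at hn
    have hnn : 0 ≤ ∑ d ∈ Ioc D0 (D0 + N), if d ^ 2 ∣ n ∧ W.Coprime n then 1 / (n : ℝ) else 0 :=
      Finset.sum_nonneg fun d _ => by split_ifs <;> positivity
    by_cases hc : W.Coprime n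
    · by_cases hs : Squarefree n
      · simpa [hc, hs] using hnn
      · rw [Nat.squarefree_iff_prime_squarefree] at hs
        push Not at hs
        obtain ⟨p, hp, hpn⟩ := hs
        have hpd : p ∣ n := (Dvd.intro _ rfl).trans hpn
        have hpW : ¬ p ∣ W := fun h => by
          have := Nat.dvd_gcd h hpd
          rw [hc] at this
          exact hp.one_lt.ne' (Nat.dvd_one.1 this)
        have hs : ¬ Squarefree n := by
          rw [Nat.squarefree_iff_prime_squarefree]; push Not; exact ⟨p, hp, hpn⟩
        have hpN : p ≤ n := Nat.le_of_dvd (by omega) hpd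
        have hm : p ∈ Ioc D0 (D0 + N) := mem_Ioc.2 ⟨hW p hp hpW, by omega⟩
        have := Finset.single_le_sum (f := fun d => if d ^ 2 ∣ n ∧ W.Coprime n then 1 / (n : ℝ) else 0)
          (fun d _ => by split_ifs <;> positivity) hm
        simpa [hc, hs, pow_two, hpn] using this
    · simpa [hc] using hnn
  refine (Finset.sum_le_sum h1).trans ?_
  rw [Finset.sum_comm]
  have h2 : ∀ d ∈ Ioc D0 (D0 + N), ∑ n ∈ Ico 1 N, (if d ^ 2 ∣ n ∧ W.Coprime n then 1 / (n : ℝ) else 0) ≤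
      ((d : ℝ) ^ 2)⁻¹ * U := by
    intro d hd
    have hd0 : 0 < d := by have := (mem_Ioc.1 hd).1; omega
    rw [hU, Finset.mul_sum, ← Finset.sum_filter]
    have e : ∑ m ∈ (Ico 1 N).filter (fun n => d ^ 2 ∣ n ∧ W.Coprime n), 1 / (m : ℝ) =
        ∑ m ∈ ((Ico 1 N).filter (fun n => d ^ 2 ∣ n ∧ W.Coprime n)).image (fun n => n / d ^ 2),
          ((d : ℝ) ^ 2)⁻¹ * (if W.Coprime m then 1 / (m : ℝ) else 0) := by
      rw [Finset.sum_image]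
      · refine Finset.sum_congr rfl fun n hn => ?_
        simp only [mem_filter, mem_Ico] at hn
        obtain ⟨⟨_, _⟩, ⟨m, rfl⟩, hc⟩ := hn
        rw [Nat.mul_div_cancel_left _ (by positivity), if_pos (hc.of_dvd_right (Dvd.intro_left _ rfl))]
        push_cast; rw [one_div, mul_inv, one_div]
      · intro a ha b hb hab
        simp only [coe_filter, Set.mem_ofPred_eq] at ha hb
        obtain ⟨_, ⟨m, rfl⟩, _⟩ := ha
        obtain ⟨_, ⟨m', rfl⟩, _⟩ := hb
        simp only [Nat.mul_div_cancel_left _ (show 0 < d ^ 2 by positivity)] at hab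
        rw [hab]
    rw [e]
    refine Finset.sum_le_sum_of_subset_of_nonneg ?_ (fun m _ _ => by split_ifs <;> positivity)
    intro m hm
    simp only [mem_image, mem_filter, mem_Ico] at hm
    obtain ⟨n, ⟨⟨h3, h4⟩, h5, _⟩, rfl⟩ := hm
    rw [mem_Ico]
    exact ⟨Nat.div_pos (Nat.le_of_dvd (by omega) h5) (by positivity), (Nat.div_le_self _ _).trans_lt h4⟩
  refine (Finset.sum_le_sum h2).trans ?_
  rw [← Finset.sum_mul]
  refine mul_le_mul_of_nonneg_right ?_ hU0
  refine (sum_Ioc_inv_sq_le_sub (by omega) (by omega)).trans ?_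
  rw [one_div]; linarith [show (0:ℝ) ≤ ((D0 + N : ℕ) : ℝ)⁻¹ by positivity]

end PD

namespace PD
open Finset

/-- primes up to `R` not dividing `W` -/
def Pset (W R : ℕ) : Finset ℕ := (range (R + 1)).filter (fun p => p.Prime ∧ ¬ p ∣ W)

lemma mem_Pset {W R p : ℕ} : p ∈ Pset W R ↔ p ≤ R ∧ p.Prime ∧ ¬ p ∣ W := by
  simp [Pset, Nat.lt_succ_iff]

noncomputable def harm (k : ℕ) : ℝ := ∑ l ∈ range k, 1 / (1 + (l : ℝ))

noncomputable def lamS (k W z R : ℕ) (D : ↥(Pset W R) → Option (Fin k)) : ℝ :=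
  lam (fun p : ↥(Pset W R) => ((p : ℕ) : ℝ)) (GF (fun p : ↥(Pset W R) => (p : ℕ)) (gz z k) R) D

lemma sum_gz (z : ℕ) (hz : 2 ≤ z) (k W : ℕ) (φ : ℕ → ℝ) (s : ℕ → Prop) [DecidablePred s] :
    ∑ n ∈ Ico 1 (z ^ k), (if s n then gz z k n * φ n else 0) =
    ∑ l ∈ range k, 1 / (1 + (l : ℝ)) * ∑ n ∈ Ico (z ^ l) (z ^ (l + 1)), if s n then φ n else 0 := by
  rw [sum_blocks z hz]
  refine Finset.sum_congr rfl fun l hl => ?_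
  rw [Finset.mul_sum]
  refine Finset.sum_congr rfl fun n hn => ?_
  have : gz z k n = 1 / (1 + (l : ℝ)) := by
    unfold gz; rw [log_block hn, if_pos (mem_range.1 hl)]
  rw [this]; split_ifs <;> ring

lemma sum_gz2 (z : ℕ) (hz : 2 ≤ z) (k W : ℕ) (φ : ℕ → ℝ) (s : ℕ → Prop) [DecidablePred s] :
    ∑ n ∈ Ico 1 (z ^ k), (if s n then gz z k n ^ 2 * φ n else 0) =
    ∑ l ∈ range k, (1 / (1 + (l : ℝ))) ^ 2 * ∑ n ∈ Ico (z ^ l) (z ^ (l + 1)), if s n then φ n else 0 := by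
  rw [sum_blocks z hz]
  refine Finset.sum_congr rfl fun l hl => ?_
  rw [Finset.mul_sum]
  refine Finset.sum_congr rfl fun n hn => ?_
  have : gz z k n = 1 / (1 + (l : ℝ)) := by
    unfold gz; rw [log_block hn, if_pos (mem_range.1 hl)]
  rw [this]; split_ifs <;> ring

lemma harm_ge_one {k : ℕ} (hk : 1 ≤ k) : 1 ≤ harm k := by
  have := Finset.single_le_sum (f := fun l : ℕ => 1 / (1 + (l : ℝ))) (s := range k)
    (fun l _ => by positivity) (mem_range.2 hk)
  simpa [harm] using this

lemma harm_sq_le (k : ℕ) : ∑ l ∈ range k, (1 / (1 + (l : ℝ))) ^ 2 ≤ 2 := by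
  suffices h : ∑ l ∈ range k, (1 / (1 + (l : ℝ))) ^ 2 ≤ 2 - 1 / (k : ℝ) by
    linarith [show (0:ℝ) ≤ 1 / (k : ℝ) by positivity]
  induction k with
  | zero => simp
  | succ k ih =>
    rw [Finset.sum_range_succ]
    rcases Nat.eq_zero_or_pos k with rfl | hk
    · simp; norm_num
    have hk' : (0:ℝ) < k := by exact_mod_cast hk
    have : (1 / (1 + (k:ℝ))) ^ 2 ≤ 1 / (k : ℝ) - 1 / ((k + 1 : ℕ) : ℝ) := by
      push_cast
      rw [div_sub_div _ _ hk'.ne' (by positivity), div_pow, div_le_div_iff₀ (by positivity) (by positivity)]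
      nlinarith
    linarith

set_option maxHeartbeats 1600000 in
/-- Numerical form of the sieve. -/
theorem sieve_main {k W z D0 E : ℕ} (hk : 1 ≤ k) (hW : 0 < W) (hz : 2 ≤ z)
    (hD0 : 64 * (k + 1) ^ 2 ≤ D0) (hWp : ∀ p, p.Prime → ¬ p ∣ W → D0 < p)
    (hE : 10 * k * harm k ≤ E) (hΛ : 4 * (2 * (W : ℝ) + 1) ≤ (W.totient : ℝ) / W * Real.log z) :
    ∃ V : ℝ, 1 ≤ V ∧
      ∑ D, ∑ E', lamS k W z (z ^ (2 * E)) D * lamS k W z (z ^ (2 * E)) E' *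
        ∏ p : ↥(Pset W (z ^ (2 * E))), Kl (1 / ((p : ℕ) : ℝ)) (D p) (E' p) ≤ V ∧
      ∀ i0 : Fin k, (W.totient : ℝ) / W * Real.log z * harm k ^ 2 / 128 * V ≤
        ∑ D, ∑ E', (lamS k W z (z ^ (2 * E)) D * ∏ p, nol i0 (D p)) *
          (lamS k W z (z ^ (2 * E)) E' * ∏ p, nol i0 (E' p)) *
          ∏ p : ↥(Pset W (z ^ (2 * E))), Kl (1 / (((p : ℕ) : ℝ) - 1)) (D p) (E' p) := by
  classical
  set R := z ^ (2 * E) with hRdef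
  set Λ := (W.totient : ℝ) / W * Real.log z with hΛdef
  clear_value R Λ
  set prn : ↥(Pset W R) → ℕ := fun p => (p : ℕ) with hprn
  set H := harm k with hH
  clear_value H
  have hH1 : 1 ≤ H := hH ▸ harm_ge_one hk
  have hk1 : (1:ℝ) ≤ k := by exact_mod_cast hk
  have hkE : k ≤ E := by
    have : (k:ℝ) ≤ E := by nlinarith
    exact_mod_cast this
  have hPm : ∀ p : ↥(Pset W R), (p : ℕ).Prime ∧ ¬ (p : ℕ) ∣ W := fun p => (mem_Pset.1 p.2).2
  have hPD : ∀ p : ↥(Pset W R), D0 < prn p := fun p => hWp p (hPm p).1 (hPm p).2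
  have hD0r : 64 * ((k:ℝ) + 1) ^ 2 ≤ D0 := by exact_mod_cast hD0
  have hD0pos : (0:ℝ) < D0 := by nlinarith
  have hPDr : ∀ p : ↥(Pset W R), (D0:ℝ) < prn p := fun p => by exact_mod_cast hPD p
  have hzk : z ^ k ≤ R := hRdef ▸ Nat.pow_le_pow_right (by omega) (by omega)
  have hns := fun (f : ℕ → ℝ) (hf : ∀ n, z ^ k ≤ n → f n = 0) =>
    nm_sum (Pset W R) W (z ^ k) (fun p hp => (mem_Pset.1 hp).2) (fun p hp h1 h2 =>
      mem_Pset.2 ⟨(h1.trans_le hzk).le, hp, h2⟩) f hf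
  -- block sums
  set U : ℕ → ℝ := fun l => ∑ n ∈ Ico (z ^ l) (z ^ (l + 1)), (if W.Coprime n then 1 / (n : ℝ) else 0) with hU
  set S : ℕ → ℝ := fun l => ∑ n ∈ Ico (z ^ l) (z ^ (l + 1)),
    (if Squarefree n ∧ W.Coprime n then 1 / (n : ℝ) else 0) with hS
  clear_value U S
  have hSU : ∀ l, S l ≤ U l := fun l => by
   rw [hS, hU]
   exact Finset.sum_le_sum fun n _ => by
    by_cases h1 : W.Coprime n
    · by_cases h2 : Squarefree n
      · rw [if_pos ⟨h2, h1⟩, if_pos h1]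
      · rw [if_neg (fun h => h2 h.1), if_pos h1]; positivity
    · rw [if_neg (fun h => h1 h.2), if_neg h1]
  have hS0 : ∀ l, 0 ≤ S l := fun l => by
   rw [hS]
   exact Finset.sum_nonneg fun n _ => by split_ifs <;> positivity
  have hW1 : (1:ℝ) ≤ W := by exact_mod_cast hW
  have hΛ0 : 0 < Λ := by linarith
  have hUb : ∀ l, 3 / 4 * Λ ≤ U l ∧ U l ≤ 5 / 4 * Λ := fun l => by
    have := abs_le.1 (cop_block hW hz l)
    rw [hU]
    simp only
    rw [← hΛdef] at this
    constructor <;> linarith [this.1, this.2]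
  have hUS : ∑ l ∈ range k, (U l - S l) ≤ 1 / 8 * Λ := by
    have h1 := nonsq_le W (z ^ k) D0 (by nlinarith) hWp
    rw [sum_blocks z hz, sum_blocks z hz] at h1
    simp only [Finset.sum_sub_distrib] at h1
    simp only [hU] at hUb
    rw [Finset.sum_sub_distrib, hU, hS]
    refine h1.trans ?_
    have h2 : ∑ l ∈ range k, ∑ n ∈ Ico (z ^ l) (z ^ (l + 1)), (if W.Coprime n then 1 / (n : ℝ) else 0) ≤ k * (5 / 4 * Λ) := by
      refine (Finset.sum_le_sum fun l _ => (hUb l).2).trans ?_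
      simp
    calc _ ≤ 1 / (D0:ℝ) * (k * (5 / 4 * Λ)) := mul_le_mul_of_nonneg_left h2 (by positivity)
      _ = (k * (5 / 4) / D0) * Λ := by ring
      _ ≤ 1 / 8 * Λ := by
        refine mul_le_mul_of_nonneg_right ?_ hΛ0.le
        rw [div_le_iff₀ hD0pos]; nlinarith
  have eX : ∑ a : Finset ↥(Pset W R), gz z k (nm prn a) ^ 2 / nm prn a =
      ∑ l ∈ range k, (1 / (1 + (l : ℝ))) ^ 2 * S l := by
    rw [hns (fun n => gz z k n ^ 2 / n) (fun n hn => by simp [gz_zero hz hn]), hS]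
    simp only
    rw [← sum_gz2 z hz k W]
    refine Finset.sum_congr rfl fun n _ => ?_
    simp only [div_eq_mul_one_div (gz z k n ^ 2)]
  have eB : ∑ a : Finset ↥(Pset W R), gz z k (nm prn a) / nm prn a =
      ∑ l ∈ range k, 1 / (1 + (l : ℝ)) * S l := by
    rw [hns (fun n => gz z k n / n) (fun n hn => by simp [gz_zero hz hn]), hS]
    simp only
    rw [← sum_gz z hz k W]
    refine Finset.sum_congr rfl fun n _ => ?_
    simp only [div_eq_mul_one_div (gz z k n)]
  have eXl : ∑ a : Finset ↥(Pset W R), gz z k (nm prn a) ^ 2 / nm prn a * Real.log (nm prn a) =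
      ∑ l ∈ range k, (1 / (1 + (l : ℝ))) ^ 2 * ∑ n ∈ Ico (z ^ l) (z ^ (l + 1)),
    (if Squarefree n ∧ W.Coprime n then 1 / (n : ℝ) * Real.log n else 0) := by
    rw [hns (fun n => gz z k n ^ 2 / n * Real.log n) (fun n hn => by simp [gz_zero hz hn])]
    rw [← sum_gz2 z hz k W]
    refine Finset.sum_congr rfl fun n _ => ?_
    simp only [div_eq_mul_one_div (gz z k n ^ 2), mul_assoc]
  set X := ∑ a : Finset ↥(Pset W R), gz z k (nm prn a) ^ 2 / nm prn a with hX
  set B := ∑ a : Finset ↥(Pset W R), gz z k (nm prn a) / nm prn a with hB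
  clear_value X B
  have hXup : X ≤ 4 * Λ := by
    rw [eX]
    calc _ ≤ ∑ l ∈ range k, (1 / (1 + (l : ℝ))) ^ 2 * (5 / 4 * Λ) :=
          Finset.sum_le_sum fun l _ => mul_le_mul_of_nonneg_left ((hSU l).trans (hUb l).2) (by positivity)
      _ ≤ 2 * (5 / 4 * Λ) := by
        rw [← Finset.sum_mul]
        exact mul_le_mul_of_nonneg_right (harm_sq_le k) (by positivity)
      _ ≤ _ := by linarith
  have hUS0 : U 0 - S 0 ≤ 1 / 8 * Λ := (Finset.single_le_sum (f := fun l => U l - S l)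
    (fun l _ => by linarith [hSU l]) (mem_range.2 hk)).trans hUS
  have hXlo : 1 / 2 * Λ ≤ X := by
    rw [eX]
    have := Finset.single_le_sum (f := fun l : ℕ => (1 / (1 + (l : ℝ))) ^ 2 * S l) (s := range k)
      (fun l _ => mul_nonneg (by positivity) (hS0 l)) (mem_range.2 hk)
    have h4 : S 0 ≤ ∑ l ∈ range k, (1 / (1 + (l : ℝ))) ^ 2 * S l := by
      refine le_trans (le_of_eq ?_) this
      norm_num
    have h3 := (hUb 0).1
    linarith only [h3, h4, hUS0, hΛ0]
  have hBlo : 1 / 2 * Λ * H ≤ B := by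
    rw [eB]
    have h1 : ∑ l ∈ range k, 1 / (1 + (l : ℝ)) * (U l - S l) ≤ 1 / 8 * Λ := by
      refine (Finset.sum_le_sum fun l _ => ?_).trans hUS
      refine mul_le_of_le_one_left (by linarith [hSU l]) ?_
      rw [div_le_one (by positivity)]; linarith [l.cast_nonneg (α := ℝ)]
    have h2 : 3 / 4 * Λ * H ≤ ∑ l ∈ range k, 1 / (1 + (l : ℝ)) * U l := by
      rw [hH, harm, Finset.mul_sum]
      refine Finset.sum_le_sum fun l _ => ?_
      rw [mul_comm]
      exact mul_le_mul_of_nonneg_left (hUb l).1 (by positivity)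
    simp only [mul_sub, Finset.sum_sub_distrib] at h1
    nlinarith
  have hlz : 0 < Real.log z := Real.log_pos (by exact_mod_cast (by omega : 1 < z))
  have hXl : ∑ a : Finset ↥(Pset W R), gz z k (nm prn a) ^ 2 / nm prn a * Real.log (nm prn a) ≤
      5 / 4 * Λ * Real.log z * H := by
    rw [eXl, hH, harm, Finset.mul_sum]
    refine Finset.sum_le_sum fun l _ => ?_
    have h1 : ∑ n ∈ Ico (z ^ l) (z ^ (l + 1)),
        (if Squarefree n ∧ W.Coprime n then 1 / (n : ℝ) * Real.log n else 0) ≤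
        S l * ((1 + l) * Real.log z) := by
      rw [hS, Finset.sum_mul]
      refine Finset.sum_le_sum fun n hn => ?_
      split_ifs
      · refine mul_le_mul_of_nonneg_left ?_ (by positivity)
        rw [mem_Ico] at hn
        have h0 : 0 < n := lt_of_lt_of_le (Nat.pow_pos (by omega)) hn.1
        have := Real.log_le_log (by exact_mod_cast h0) (show (n:ℝ) ≤ (z:ℝ) ^ (l + 1) by exact_mod_cast hn.2.le)
        rw [Real.log_pow] at this
        push_cast at this; linarith
      · simp
    have h2 : S l * ((1 + l) * Real.log z) ≤ 5 / 4 * Λ * ((1 + l) * Real.log z) :=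
      mul_le_mul_of_nonneg_right ((hSU l).trans (hUb l).2) (by positivity)
    calc _ ≤ (1 / (1 + (l : ℝ))) ^ 2 * (5 / 4 * Λ * ((1 + l) * Real.log z)) :=
          mul_le_mul_of_nonneg_left (h1.trans h2) (by positivity)
      _ = _ := by field_simp
  have hX0 : 0 < X := by linarith
  have hpgt : ∀ p, (Fintype.card (Fin k) : ℝ) + 1 < prn p := fun p => by
    have := hPDr p
    simp only [Fintype.card_fin]
    nlinarith
  -- sum of 1/p^2
  have hsq : ∑ p : ↥(Pset W R), (1:ℝ) / (prn p : ℝ) ^ 2 ≤ (1:ℝ) / (D0:ℝ) := by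
    have : ∑ p : ↥(Pset W R), (1:ℝ) / (prn p : ℝ) ^ 2 = ∑ p ∈ Pset W R, ((p : ℝ) ^ 2)⁻¹ := by
      rw [← Finset.sum_coe_sort (Pset W R) (fun p : ℕ => ((p : ℝ) ^ 2)⁻¹)]
      exact Finset.sum_congr rfl fun p _ => one_div _
    rw [this]
    calc _ ≤ ∑ p ∈ Ioc D0 (D0 + R), ((p : ℝ) ^ 2)⁻¹ := by
          refine Finset.sum_le_sum_of_subset_of_nonneg (fun p hp => ?_) (fun _ _ _ => by positivity)
          have := mem_Pset.1 hp
          exact mem_Ioc.2 ⟨hWp p this.2.1 this.2.2, by omega⟩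
      _ ≤ (D0:ℝ)⁻¹ - ((D0 + R : ℕ) : ℝ)⁻¹ := sum_Ioc_inv_sq_le_sub (by intro h; simp [h] at hD0pos) (by omega)
      _ ≤ _ := by rw [one_div]; linarith [show (0:ℝ) ≤ ((D0 + R : ℕ) : ℝ)⁻¹ by positivity]
  have hPr : ∏ p, (1 + Fintype.card (Fin k) / ((prn p : ℝ) * (prn p - 1))) ≤ 3 / 2 := by
    have h1 : ∏ p, (1 + Fintype.card (Fin k) / ((prn p : ℝ) * (prn p - 1))) ≤
        ∏ p : ↥(Pset W R), Real.exp (2 * k * (1 / (prn p : ℝ) ^ 2)) := by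
      refine Finset.prod_le_prod (fun p _ => ?_) (fun p _ => ?_)
      · have := hpgt p
        simp only [Fintype.card_fin] at *
        have : 0 < (prn p : ℝ) - 1 := by linarith
        have : 0 < (prn p : ℝ) := by linarith
        positivity
      · have := hpgt p
        simp only [Fintype.card_fin] at *
        have h2 : 0 < (prn p : ℝ) - 1 := by linarith
        have h3 : 0 < (prn p : ℝ) := by linarith
        have : (k:ℝ) / ((prn p : ℝ) * (prn p - 1)) ≤ 2 * k * (1 / (prn p : ℝ) ^ 2) := by
          rw [mul_one_div, div_le_div_iff₀ (by positivity) (by positivity)]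
          have : (prn p : ℝ) ^ 2 ≤ 2 * (prn p * (prn p - 1)) := by nlinarith
          nlinarith
        linarith [Real.add_one_le_exp (2 * k * (1 / (prn p : ℝ) ^ 2))]
    refine h1.trans ?_
    rw [← Real.exp_sum, ← Finset.mul_sum]
    have h2 : 2 * (k:ℝ) * ∑ p : ↥(Pset W R), (1:ℝ) / (prn p : ℝ) ^ 2 ≤ (1:ℝ) / 4 := by
      calc _ ≤ 2 * k * (1 / (D0:ℝ)) := mul_le_mul_of_nonneg_left hsq (by positivity)
        _ ≤ _ := by rw [mul_one_div, div_le_div_iff₀ hD0pos (by norm_num)]; nlinarith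
    have h3 : (0:ℝ) ≤ 2 * (k:ℝ) * ∑ p : ↥(Pset W R), (1:ℝ) / (prn p : ℝ) ^ 2 := by positivity
    refine (Real.exp_bound_div_one_sub_of_interval h3 (by linarith)).trans ?_
    rw [div_le_div_iff₀ (by linarith) (by norm_num)]
    linarith
  refine ⟨X ^ k, one_le_pow₀ (by linarith), ?_, fun i0 => ?_⟩
  · refine (T1_upper (fun p : ↥(Pset W R) => (prn p : ℝ)) (fun p => ?_) (fun p => ?_) _).trans ?_
    · exact_mod_cast (hPm p).1.one_lt
    · linarith [hpgt p]
    · have := T1_final (κ := Fin k) prn (fun p => (hPm p).1.pos) (gz_nonneg z k) R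
      rw [← hX, Fintype.card_fin] at this
      exact this
  · have hT := T2_final (κ := Fin k) prn hpgt (gz_nonneg z k) (gz_anti z k) (R := R) (R' := z ^ E)
      (by rw [hRdef, two_mul, pow_add]) (fun n hn => gz_zero hz
        ((Nat.pow_le_pow_right (by omega) hkE).trans hn.le))
      (hz.trans (Nat.le_self_pow (by omega) z)) hPr i0 ?_ ?_ (hX ▸ hX0)
    · rw [← hX, ← hB] at hT
      refine le_trans ?_ hT
      rw [Fintype.card_fin]
      obtain ⟨m, rfl⟩ : ∃ m, k = m + 1 := ⟨k - 1, by omega⟩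
      rw [Nat.add_sub_cancel, pow_succ]
      have h1 : Λ * H ^ 2 / 128 * X ≤ 1 / 8 * B ^ 2 := by
        have : (1 / 2 * Λ * H) ^ 2 ≤ B ^ 2 := pow_le_pow_left₀ (by positivity) hBlo 2
        have h3 : Λ * H ^ 2 / 128 * X ≤ Λ * H ^ 2 / 128 * (4 * Λ) :=
          mul_le_mul_of_nonneg_left hXup (by positivity)
        nlinarith
      have := mul_le_mul_of_nonneg_right h1 (show 0 ≤ X ^ m by positivity)
      calc _ = Λ * H ^ 2 / 128 * X * X ^ m := by ring
        _ ≤ _ := this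
    · rw [Fintype.card_fin]
      calc _ ≤ (2 * (k:ℝ) ^ 2 + 3 * k) * (1 / D0) := mul_le_mul_of_nonneg_left hsq (by positivity)
        _ ≤ _ := by rw [mul_one_div, div_le_div_iff₀ hD0pos (by norm_num)]; nlinarith
    · rw [Fintype.card_fin, ← hX]
      push_cast
      rw [Real.log_pow]
      calc (k:ℝ) * _ ≤ k * (5 / 4 * Λ * Real.log z * H) := mul_le_mul_of_nonneg_left hXl (by positivity)
        _ = 1 / 8 * (10 * k * H) * Real.log z * Λ := by ring
        _ ≤ 1 / 8 * E * Real.log z * Λ := by gcongr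
        _ = 1 / 4 * (E * Real.log z) * (1 / 2 * Λ) := by ring
        _ ≤ _ := mul_le_mul_of_nonneg_left hXlo (by positivity)

end PD

namespace PD
open Finset

noncomputable def wt (ε : ℝ) (a : ℕ) (x : ℝ) : ℝ := Real.log x ^ a * x ^ (-(1 + ε))

lemma wt_nonneg {ε x : ℝ} (a : ℕ) (hx : 1 ≤ x) : 0 ≤ wt ε a x :=
  mul_nonneg (pow_nonneg (Real.log_nonneg hx) _) (Real.rpow_nonneg (by linarith) _)

lemma log_pow_le {a : ℕ} {δ x y : ℝ} (hx : 1 < x) (hxy : x ≤ y) (ha : a ≤ δ * Real.log x) :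
    Real.log y ^ a ≤ Real.log x ^ a * (y / x) ^ δ := by
  have hlx : 0 < Real.log x := Real.log_pos hx
  have hx0 : 0 < x := by linarith
  have hyx : 1 ≤ y / x := (one_le_div hx0).2 hxy
  have hl : 0 ≤ Real.log (y / x) := Real.log_nonneg hyx
  have e : Real.log y = Real.log x * (1 + Real.log (y / x) / Real.log x) := by
    rw [Real.log_div (by linarith) hx0.ne']; field_simp; ring
  rw [e, mul_pow]
  refine mul_le_mul_of_nonneg_left ?_ (by positivity)
  calc (1 + Real.log (y / x) / Real.log x) ^ a ≤ (Real.exp (Real.log (y / x) / Real.log x)) ^ a := by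
        refine pow_le_pow_left₀ (by positivity) ?_ a
        linarith [Real.add_one_le_exp (Real.log (y / x) / Real.log x)]
    _ = Real.exp (a / Real.log x * Real.log (y / x)) := by
        rw [← Real.exp_nat_mul]; congr 1; field_simp
    _ ≤ Real.exp (δ * Real.log (y / x)) := by
        apply Real.exp_le_exp.2
        refine mul_le_mul_of_nonneg_right ?_ hl
        rw [div_le_iff₀ hlx]; exact ha
    _ = (y / x) ^ δ := by rw [Real.rpow_def_of_pos (by linarith), mul_comm]

lemma wt_anti {ε : ℝ} (hε : 0 < ε) {a : ℕ} {x y : ℝ} (hx : 1 < x) (hxy : x ≤ y) (ha : a ≤ Real.log x) :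
    wt ε a y ≤ wt ε a x := by
  have hx0 : 0 < x := by linarith
  have h := log_pow_le (δ := 1 + ε) hx hxy (by nlinarith [Real.log_pos hx])
  unfold wt
  calc _ ≤ Real.log x ^ a * (y / x) ^ (1 + ε) * y ^ (-(1 + ε)) :=
        mul_le_mul_of_nonneg_right h (Real.rpow_nonneg (by linarith) _)
    _ = _ := by
        rw [Real.div_rpow (by linarith) hx0.le, Real.rpow_neg (by linarith), Real.rpow_neg hx0.le]
        have : 0 < y ^ (1 + ε) := Real.rpow_pos_of_pos (by linarith) _
        have : 0 < x ^ (1 + ε) := Real.rpow_pos_of_pos hx0 _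
        field_simp

lemma wt_diff {ε : ℝ} (hε : 0 < ε) (hε1 : ε ≤ 1) {a n : ℕ} (hn : 1 ≤ n) :
    wt ε a n - wt ε a ((n + 1 : ℕ) : ℝ) ≤ 2 * wt ε a n / n := by
  have hn' : (1:ℝ) ≤ n := by exact_mod_cast hn
  have hn0 : (0:ℝ) < n := by linarith
  have h1 : wt ε a n * (1 - 2 / n) ≤ wt ε a ((n + 1 : ℕ) : ℝ) := by
    rcases le_total (1 - 2 / (n:ℝ)) 0 with h | h
    · exact (mul_nonpos_of_nonneg_of_nonpos (wt_nonneg a hn') h).trans (wt_nonneg a (by push_cast; linarith))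
    unfold wt
    rw [mul_assoc]
    push_cast
    refine mul_le_mul ?_ ?_ ?_ ?_
    · exact pow_le_pow_left₀ (Real.log_nonneg hn') (Real.log_le_log hn0 (by linarith)) a
    · have e : ((n:ℝ) + 1) ^ (-(1 + ε)) = (n:ℝ) ^ (-(1 + ε)) * ((n:ℝ) / (n + 1)) ^ (1 + ε) := by
        rw [Real.div_rpow hn0.le (by linarith), Real.rpow_neg (by linarith), Real.rpow_neg hn0.le]
        have : 0 < ((n:ℝ) + 1) ^ (1 + ε) := Real.rpow_pos_of_pos (by linarith) _
        have : 0 < (n:ℝ) ^ (1 + ε) := Real.rpow_pos_of_pos hn0 _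
        field_simp
      rw [e]
      refine mul_le_mul_of_nonneg_left ?_ (Real.rpow_nonneg hn0.le _)
      have h2 : ((n:ℝ) / (n + 1)) ^ (2:ℝ) ≤ ((n:ℝ) / (n + 1)) ^ (1 + ε) :=
        Real.rpow_le_rpow_of_exponent_ge (by positivity) ((div_le_one (by positivity)).2 (by linarith)) (by linarith)
      refine le_trans ?_ h2
      rw [Real.rpow_two]
      have : 1 - 1 / (n:ℝ) ≤ (n:ℝ) / (n + 1) := by
        rw [sub_le_iff_le_add, ← sub_le_iff_le_add', le_div_iff₀ hn0]
        rw [sub_mul, div_mul_eq_mul_div, sub_le_iff_le_add, ]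
        rw [one_mul]
        have : (n:ℝ) * n / (n + 1) = n - n / (n + 1) := by field_simp; ring
        rw [this]
        have : (n:ℝ) / (n + 1) ≤ 1 := (div_le_one (by positivity)).2 (by linarith)
        linarith
      have h4 : 0 ≤ 1 - 1 / (n:ℝ) := by
        rw [sub_nonneg, div_le_one hn0]; exact hn'
      have h5 := pow_le_pow_left₀ h4 this 2
      refine le_trans ?_ h5
      have : (2:ℝ) / n = 2 * (1 / n) := by ring
      rw [this]
      nlinarith [sq_nonneg (1 / (n:ℝ))]
    · exact mul_nonneg (Real.rpow_nonneg hn0.le _) h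
    · exact pow_nonneg (Real.log_nonneg (by linarith)) _
  have : 2 * wt ε a n / n = wt ε a n * (2 / n) := by ring
  rw [this]; linarith

/-- antiderivative in logarithmic coordinates -/
noncomputable def Psi (ε : ℝ) : ℕ → ℝ → ℝ
  | 0, u => Real.exp (-ε * u) / ε
  | a + 1, u => (u ^ (a + 1) * Real.exp (-ε * u) + (a + 1) * Psi ε a u) / ε

lemma Psi_nonneg {ε u : ℝ} (hε : 0 < ε) (hu : 0 ≤ u) (a : ℕ) : 0 ≤ Psi ε a u := by
  induction a with
  | zero => unfold Psi; positivity
  | succ a ih => unfold Psi; positivity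

lemma Psi_zero {ε : ℝ} (hε : 0 < ε) (a : ℕ) : Psi ε a 0 = a.factorial / ε ^ (a + 1) := by
  induction a with
  | zero => simp [Psi]
  | succ a ih =>
    rw [Psi, ih, Nat.factorial_succ]; push_cast; simp; field_simp; ring

lemma Psi_deriv {ε : ℝ} (hε : 0 < ε) (a : ℕ) (u : ℝ) :
    HasDerivAt (Psi ε a) (-(u ^ a * Real.exp (-ε * u))) u := by
  have he : HasDerivAt (fun u => Real.exp (-ε * u)) (Real.exp (-ε * u) * (-ε * 1)) u :=
    ((hasDerivAt_id u).const_mul (-ε)).exp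
  induction a with
  | zero =>
    have := he.div_const ε
    refine HasDerivAt.congr_deriv this ?_
    field_simp
  | succ a ih =>
    have := (((hasDerivAt_pow (a + 1) u).mul he).add (ih.const_mul ((a:ℝ) + 1))).div_const ε
    refine HasDerivAt.congr_deriv this ?_
    push_cast
    field_simp
    ring

lemma Psi_anti {ε : ℝ} (hε : 0 < ε) (a : ℕ) : AntitoneOn (Psi ε a) (Set.Ici 0) := by
  apply antitoneOn_of_deriv_nonpos (convex_Ici 0)
  · exact fun u _ => (Psi_deriv hε a u).continuousAt.continuousWithinAt
  · exact fun u _ => (Psi_deriv hε a u).differentiableAt.differentiableWithinAt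
  · intro u hu
    rw [interior_Ici, Set.mem_Ioi] at hu
    rw [(Psi_deriv hε a u).deriv]
    have : 0 ≤ u ^ a * Real.exp (-ε * u) := by positivity
    linarith

lemma Psi_lower {ε U : ℝ} (hε : 0 < ε) (hU : 0 < U) (a : ℕ) :
    a.factorial / ε ^ (a + 1) - U ^ (a + 1) ≤ Psi ε a U := by
  obtain ⟨c, hc, h⟩ := exists_hasDerivAt_eq_slope (Psi ε a) (fun u => -(u ^ a * Real.exp (-ε * u))) hU
    (fun u _ => (Psi_deriv hε a u).continuousAt.continuousWithinAt) (fun u _ => Psi_deriv hε a u)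
  rw [← Psi_zero hε a, sub_zero] at *
  rw [eq_div_iff hU.ne'] at h
  have h1 : c ^ a * Real.exp (-ε * c) ≤ U ^ a * 1 := by
    refine mul_le_mul (pow_le_pow_left₀ hc.1.le hc.2.le a) ?_ (Real.exp_pos _).le (by positivity)
    rw [Real.exp_le_one_iff]; nlinarith [hc.1]
  have h2 := mul_le_mul_of_nonneg_right h1 hU.le
  rw [pow_succ]
  linarith

lemma Psi_step {ε : ℝ} (hε : 0 < ε) (a : ℕ) {x : ℝ} (hx : 1 < x) (ha : a ≤ Real.log x) :
    wt ε a (x + 1) ≤ Psi ε a (Real.log x) - Psi ε a (Real.log (x + 1)) ∧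
    Psi ε a (Real.log x) - Psi ε a (Real.log (x + 1)) ≤ wt ε a x := by
  have hd : ∀ y : ℝ, 0 < y → HasDerivAt (fun y => Psi ε a (Real.log y)) (- wt ε a y) y := by
    intro y hy
    have := (Psi_deriv hε a (Real.log y)).comp y (Real.hasDerivAt_log hy.ne')
    refine HasDerivAt.congr_deriv this ?_
    unfold wt
    rw [Real.rpow_def_of_pos hy]
    have : Real.log y * -(1 + ε) = -ε * Real.log y + -Real.log y := by ring
    rw [this, Real.exp_add, Real.exp_neg (Real.log y), Real.exp_log hy]; ring
  obtain ⟨c, hc, h⟩ := exists_hasDerivAt_eq_slope (fun y => Psi ε a (Real.log y)) (fun y => - wt ε a y)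
    (show x < x + 1 by linarith)
    (fun y hy => (hd y (by linarith [hy.1])).continuousAt.continuousWithinAt) (fun y hy => hd y (by linarith [hy.1]))
  have e : Psi ε a (Real.log x) - Psi ε a (Real.log (x + 1)) = wt ε a c := by
    simp at h; linarith
  rw [e]
  exact ⟨wt_anti hε (by linarith [hc.1]) hc.2.le (ha.trans (Real.log_le_log (by linarith) hc.1.le)),
    wt_anti hε hx hc.1.le ha⟩

lemma wt_sum_le {ε : ℝ} (hε : 0 < ε) (a : ℕ) {Y T : ℕ} (hY : 2 < Y) (ha : a ≤ Real.log ((Y - 1 : ℕ) : ℝ)) :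
    ∑ n ∈ Ico Y T, wt ε a n ≤ a.factorial / ε ^ (a + 1) := by
  have h1 : (1:ℝ) < ((Y - 1 : ℕ) : ℝ) := by exact_mod_cast (by omega : 1 < Y - 1)
  rcases le_total Y T with hT | hT
  · have key : ∑ n ∈ Ico Y T, wt ε a n ≤ Psi ε a (Real.log ((Y - 1 : ℕ) : ℝ)) - Psi ε a (Real.log ((T - 1 : ℕ) : ℝ)) := by
      induction T, hT using Nat.le_induction with
      | base => simp
      | succ T hT ih =>
        rw [Finset.sum_Ico_succ_top hT]
        have h3 : ((Y - 1 : ℕ) : ℝ) ≤ ((T - 1 : ℕ) : ℝ) := by exact_mod_cast (by omega)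
        have := (Psi_step hε a (x := ((T - 1 : ℕ) : ℝ)) (by linarith)
          (ha.trans (Real.log_le_log (by linarith) h3))).1
        have e : ((T - 1 : ℕ) : ℝ) + 1 = T := by
          have : T - 1 + 1 = T := by omega
          exact_mod_cast this
        rw [e] at this
        rw [Nat.add_sub_cancel]
        linarith
    have h4 : 0 ≤ Psi ε a (Real.log ((T - 1 : ℕ) : ℝ)) :=
      Psi_nonneg hε (Real.log_natCast_nonneg _) a
    have h5 := Psi_anti hε a (Set.mem_Ici.2 le_rfl) (Set.mem_Ici.2 (Real.log_natCast_nonneg (Y - 1)))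
      (Real.log_natCast_nonneg (Y - 1))
    rw [Psi_zero hε] at h5
    linarith
  · rw [Finset.Ico_eq_empty_of_le hT]; simp; positivity

lemma wt_sum_ge {ε : ℝ} (hε : 0 < ε) (a : ℕ) {Y T : ℕ} (hY : 2 < Y) (hT : Y ≤ T) (ha : a ≤ Real.log Y) :
    Psi ε a (Real.log Y) - Psi ε a (Real.log T) ≤ ∑ n ∈ Ico Y T, wt ε a n := by
  have h1 : (1:ℝ) < Y := by exact_mod_cast (by omega : 1 < Y)
  induction T, hT using Nat.le_induction with
  | base => simp
  | succ T hT ih =>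
    rw [Finset.sum_Ico_succ_top hT]
    have h3 : (Y : ℝ) ≤ (T : ℝ) := by exact_mod_cast hT
    have := (Psi_step hε a (x := (T : ℝ)) (by linarith) (ha.trans (Real.log_le_log (by linarith) h3))).2
    push_cast
    linarith

end PD

namespace PD
open Finset
open ArithmeticFunction (vonMangoldt)

lemma sqrt_log_le {x : ℝ} (hx : 1 ≤ x) : 2 * √x * Real.log x ≤ 8 * x ^ ((3:ℝ) / 4) := by
  have h := Real.log_le_rpow_div (by linarith : 0 ≤ x) (show (0:ℝ) < 1 / 4 by norm_num)
  have hs : √x * x ^ ((1:ℝ) / 4) = x ^ ((3:ℝ) / 4) := by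
    rw [Real.sqrt_eq_rpow, ← Real.rpow_add (by linarith)]; norm_num
  have := mul_le_mul_of_nonneg_left h (Real.sqrt_nonneg x)
  have e : √x * (x ^ ((1:ℝ) / 4) / (1 / 4)) = 4 * x ^ ((3:ℝ) / 4) := by rw [← hs]; ring
  rw [e] at this
  linarith

lemma theta_half {n : ℕ} (hn : 10 ^ 8 ≤ n) : (n:ℝ) / 2 ≤ Chebyshev.theta n := by
  have hn' : ((10:ℝ) ^ 8) ≤ n := by exact_mod_cast hn
  have h1 := Chebyshev.theta_ge n
  have h2 := sqrt_log_le (x := n) (by linarith)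
  have h3 : Real.log (n + 1) ≤ 2 * √n * Real.log n := by
    have h4 : Real.log ((n:ℝ) + 1) ≤ Real.log ((n:ℝ) ^ 2) := Real.log_le_log (by positivity) (by nlinarith)
    rw [Real.log_pow] at h4
    have : 1 ≤ √(n:ℝ) := Real.one_le_sqrt.2 (by linarith)
    have := Real.log_nonneg (show (1:ℝ) ≤ n by linarith)
    push_cast at h4
    nlinarith
  have h5 : 16 * (n:ℝ) ^ ((3:ℝ) / 4) ≤ 0.16 * n := by
    have e : (n:ℝ) ^ ((3:ℝ) / 4) * (n:ℝ) ^ ((1:ℝ) / 4) = n := by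
      rw [← Real.rpow_add (by linarith)]; norm_num
    have h6 : (100:ℝ) ≤ (n:ℝ) ^ ((1:ℝ) / 4) := by
      calc (100:ℝ) = ((10:ℝ) ^ 8) ^ ((1:ℝ) / 4) := by
            rw [show ((10:ℝ) ^ 8) = 100 ^ (4:ℝ) by norm_num, ← Real.rpow_mul (by norm_num)]; norm_num
        _ ≤ _ := Real.rpow_le_rpow (by positivity) hn' (by norm_num)
    have : 0 ≤ (n:ℝ) ^ ((3:ℝ) / 4) := by positivity
    nlinarith
  have := Real.log_two_gt_d9
  nlinarith

/-- Abel summation against the weights. -/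
lemma abel_wt {ε : ℝ} (hε : 0 < ε) (hε1 : ε ≤ 1) {a : ℕ} {Y T : ℕ} (hY : 2 ≤ Y) (hT : Y < T)
    (ha : a ≤ Real.log Y) (c : ℕ → ℂ) (G : ℕ → ℝ)
    (hc : ∀ x, Y ≤ x → ‖∑ n ∈ Ico Y (x + 1), c n‖ ≤ G x) :
    ‖∑ n ∈ Ico Y T, wt ε a n • c n‖ ≤ wt ε a T * G (T - 1) + ∑ n ∈ Ico Y T, 2 * wt ε a n / n * G n := by
  rw [abel_anti_id (fun n : ℕ => wt ε a n) c Y T hT.le]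
  have hY1 : (1:ℝ) < Y := by exact_mod_cast hY
  have hn1 : ∀ n : ℕ, Y ≤ n → (Y:ℝ) ≤ n := fun n hn => by exact_mod_cast hn
  refine (norm_add_le _ _).trans (add_le_add ?_ ?_)
  · have h1 : 0 ≤ wt ε a T := wt_nonneg a (by linarith [hn1 T hT.le])
    rw [norm_smul, Real.norm_of_nonneg h1]
    refine mul_le_mul_of_nonneg_left ?_ h1
    have := hc (T - 1) (by omega)
    rwa [show T - 1 + 1 = T by omega] at this
  · refine norm_sum_le_of_le _ fun n hn => ?_
    have hn := (mem_Ico.1 hn).1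
    have h2 : wt ε a ((n + 1 : ℕ) : ℝ) ≤ wt ε a n := wt_anti hε (by linarith [hn1 n hn])
      (by push_cast; linarith) (ha.trans (Real.log_le_log (by linarith) (hn1 n hn)))
    rw [norm_smul, Real.norm_of_nonneg (by linarith)]
    refine mul_le_mul (wt_diff hε hε1 (by omega)) (hc n hn) (norm_nonneg _) ?_
    have := wt_nonneg (ε := ε) a (show (1:ℝ) ≤ n by linarith [hn1 n hn])
    positivity

lemma abel_wt_lower {ε : ℝ} (hε : 0 < ε) {a : ℕ} {Y T : ℕ} (hY : 2 ≤ Y) (hT : Y ≤ T)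
    (ha : a ≤ Real.log Y) (c : ℕ → ℝ) {C : ℝ} (hC0 : 0 ≤ C)
    (hc : ∀ x, Y ≤ x → -C ≤ ∑ n ∈ Ico Y x, c n) :
    -(C * wt ε a Y) ≤ ∑ n ∈ Ico Y T, wt ε a n * c n := by
  have e := abel_anti_id (fun n : ℕ => wt ε a n) c Y T hT
  simp only [smul_eq_mul] at e
  rw [e]
  have hY1 : (1:ℝ) < Y := by exact_mod_cast hY
  have hn1 : ∀ n : ℕ, Y ≤ n → (Y:ℝ) ≤ n := fun n hn => by exact_mod_cast hn
  have h1 : 0 ≤ wt ε a T := wt_nonneg a (by linarith [hn1 T hT])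
  have h2 : ∑ n ∈ Ico Y T, (wt ε a n - wt ε a ((n + 1 : ℕ) : ℝ)) * (-C) ≤
      ∑ n ∈ Ico Y T, (wt ε a n - wt ε a ((n + 1 : ℕ) : ℝ)) * ∑ m ∈ Ico Y (n + 1), c m := by
    refine Finset.sum_le_sum fun n hn => ?_
    have hn := (mem_Ico.1 hn).1
    have h2 : wt ε a ((n + 1 : ℕ) : ℝ) ≤ wt ε a n := wt_anti hε (by linarith [hn1 n hn])
      (by push_cast; linarith) (ha.trans (Real.log_le_log (by linarith) (hn1 n hn)))
    exact mul_le_mul_of_nonneg_left (hc _ (by omega)) (by linarith)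
  have h3 : ∑ n ∈ Ico Y T, (wt ε a n - wt ε a ((n + 1 : ℕ) : ℝ)) = wt ε a Y - wt ε a T := by
    rw [Finset.sum_Ico_eq_sub _ hT, Finset.sum_range_sub' (fun n : ℕ => wt ε a n),
      Finset.sum_range_sub' (fun n : ℕ => wt ε a n)]; ring
  rw [← Finset.sum_mul, h3] at h2
  have h4 := mul_le_mul_of_nonneg_left (hc T hT) h1
  nlinarith

lemma Theta_lower {ε : ℝ} (hε : 0 < ε) {a : ℕ} {Y T : ℕ} (hY : 10 ^ 8 ≤ Y) (hT : Y ≤ T)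
    (ha : a ≤ Real.log Y) :
    1 / 2 * ∑ n ∈ Ico Y T, wt ε a n - 2 * Y * wt ε a Y ≤
      ∑ n ∈ Ico Y T, if n.Prime then Real.log n * wt ε a n else 0 := by
  have hlow := abel_wt_lower hε (T := T) (by omega : 2 ≤ Y) hT ha
    (fun n => (if n.Prime then Real.log n else 0) - 1 / 2) (C := 2 * Y) (by positivity) (by
      intro x hx
      rw [Finset.sum_sub_distrib]
      have e : ∀ m : ℕ, 1 ≤ m → ∑ n ∈ range m, (if n.Prime then Real.log n else 0) = Chebyshev.theta ((m - 1 : ℕ) : ℝ) := by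
        intro m hm
        rw [Chebyshev.theta_eq_sum_Icc, Nat.floor_natCast, ← Finset.sum_filter]
        congr 1
        ext p; simp only [mem_filter, mem_range, mem_Icc]
        constructor
        · rintro ⟨h1, h2⟩; exact ⟨⟨by omega, by omega⟩, h2⟩
        · rintro ⟨h1, h2⟩; exact ⟨by omega, h2⟩
      rw [Finset.sum_Ico_eq_sub _ hx, e x (by omega), e Y (by omega)]
      have h1 := Chebyshev.theta_le_log4_mul_x (x := ((Y - 1 : ℕ) : ℝ)) (by positivity)
      have h4 : Real.log 4 ≤ 1.4 := by
        rw [show (4:ℝ) = 2 ^ 2 by norm_num, Real.log_pow]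
        have := Real.log_two_lt_d9
        push_cast; linarith
      have hY1 : ((Y - 1 : ℕ) : ℝ) = Y - 1 := by push_cast [Nat.cast_sub (show 1 ≤ Y by omega)]; ring
      have hx1 : ((x - 1 : ℕ) : ℝ) = x - 1 := by push_cast [Nat.cast_sub (show 1 ≤ x by omega)]; ring
      have hYr : (10:ℝ) ^ 8 ≤ Y := by exact_mod_cast hY
      have h6 : Real.log 4 * (Y - 1 : ℝ) ≤ 1.4 * (Y - 1) := mul_le_mul_of_nonneg_right h4 (by linarith)
      have h5 : ((x - 1 : ℕ) : ℝ) / 2 - 1 ≤ Chebyshev.theta ((x - 1 : ℕ) : ℝ) := by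
        rcases eq_or_lt_of_le (show 10 ^ 8 ≤ x by omega) with h | h
        · have h7 := theta_half (n := x) (by omega)
          subst h
          have : Chebyshev.theta ((10 ^ 8 : ℕ) : ℝ) = Chebyshev.theta ((10 ^ 8 - 1 : ℕ) : ℝ) := by
            rw [← e (10 ^ 8) (by norm_num), ← Nat.add_sub_cancel (n := 10 ^ 8) (m := 1), ← e (10 ^ 8 + 1) (by norm_num),
              Finset.sum_range_succ, Nat.add_sub_cancel, if_neg, add_zero]
            norm_num
          rw [← this]
          rw [hx1]; linarith
        · linarith [theta_half (n := x - 1) (by omega)]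
      rw [hY1] at h1
      rw [hx1] at h5 ⊢
      rw [hY1]
      simp only [Finset.sum_const, Nat.card_Ico, nsmul_eq_mul]
      rw [Nat.cast_sub hx]
      linarith)
  have e2 : ∑ n ∈ Ico Y T, wt ε a n * ((if n.Prime then Real.log n else 0) - 1 / 2) =
      (∑ n ∈ Ico Y T, if n.Prime then Real.log n * wt ε a n else 0) - 1 / 2 * ∑ n ∈ Ico Y T, wt ε a n := by
    rw [Finset.mul_sum, ← Finset.sum_sub_distrib]
    refine Finset.sum_congr rfl fun n _ => ?_
    split_ifs <;> ring
  rw [e2] at hlow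
  linarith

lemma PP_le {ε : ℝ} (hε : 0 < ε) (hε1 : ε ≤ 1) {a : ℕ} {Y T : ℕ} (hY : 3 ≤ Y) (hT : Y < T)
    (ha : a ≤ Real.log ((Y - 1 : ℕ) : ℝ)) :
    ∑ n ∈ Ico Y T, (if n.Prime then 0 else vonMangoldt n * wt ε a n) ≤
      (Y:ℝ) ^ (-(1:ℝ) / 4) * (16 * (a.factorial / ε ^ (a + 1)) + 8 * (T * wt ε a T)) := by
  have hYr : (3:ℝ) ≤ Y := by exact_mod_cast hY
  have hn1 : ∀ n : ℕ, Y ≤ n → (Y:ℝ) ≤ n := fun n hn => by exact_mod_cast hn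
  have ha' : (a:ℝ) ≤ Real.log Y := ha.trans (Real.log_le_log (by exact_mod_cast (by omega : 0 < Y - 1))
    (by exact_mod_cast (by omega)))
  have key := abel_wt hε hε1 (by omega : 2 ≤ Y) hT ha' (fun n => (((if n.Prime then 0 else vonMangoldt n : ℝ)) : ℂ))
    (fun x => 8 * (x:ℝ) ^ ((3:ℝ) / 4)) (by
      intro x hx
      rw [← Complex.ofReal_sum, Complex.norm_real, Real.norm_of_nonneg (Finset.sum_nonneg fun n _ => by
        split_ifs <;> simp)]
      have h1 := Chebyshev.psi_sub_theta_le (x := (x:ℝ)) (by linarith [hn1 x hx])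
      rw [Chebyshev.psi_sub_theta_eq_sum_not_prime, Nat.floor_natCast, Finset.sum_filter] at h1
      refine le_trans ?_ (h1.trans (sqrt_log_le (by linarith [hn1 x hx])))
      have : ∀ n : ℕ, (if n.Prime then (0:ℝ) else vonMangoldt n) = if ¬ n.Prime then vonMangoldt n else 0 := by
        intro n; by_cases h : n.Prime <;> simp [h]
      simp only [this]
      refine Finset.sum_le_sum_of_subset_of_nonneg ?_ (fun n _ _ => by split_ifs <;> simp)
      intro n hn
      simp only [mem_Ico, mem_Ioc] at *
      omega)
  have e : ∑ n ∈ Ico Y T, wt ε a n • (((if n.Prime then 0 else vonMangoldt n : ℝ)) : ℂ) =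
      ((∑ n ∈ Ico Y T, (if n.Prime then 0 else vonMangoldt n * wt ε a n) : ℝ) : ℂ) := by
    rw [Complex.ofReal_sum]
    refine Finset.sum_congr rfl fun n _ => ?_
    rw [Complex.real_smul, ← Complex.ofReal_mul]
    congr 1
    split_ifs <;> ring
  rw [e, Complex.norm_real] at key
  refine (le_abs_self _).trans (key.trans ?_)
  have hpow : ∀ n : ℕ, Y ≤ n → (n:ℝ) ^ ((3:ℝ) / 4) ≤ n * (Y:ℝ) ^ (-(1:ℝ) / 4) := by
    intro n hn
    have h1 := hn1 n hn
    have : (n:ℝ) ^ ((3:ℝ) / 4) = n * (n:ℝ) ^ (-(1:ℝ) / 4) := by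
      nth_rewrite 2 [← Real.rpow_one (n:ℝ)]
      rw [← Real.rpow_add (by linarith)]; norm_num
    rw [this]
    refine mul_le_mul_of_nonneg_left ?_ (by linarith)
    exact Real.rpow_le_rpow_of_nonpos (by linarith) h1 (by norm_num)
  have hw : ∀ n : ℕ, Y ≤ n → 0 ≤ wt ε a n := fun n hn => wt_nonneg a (by linarith [hn1 n hn])
  have h1 : ((T - 1 : ℕ) : ℝ) ^ ((3:ℝ) / 4) ≤ T * (Y:ℝ) ^ (-(1:ℝ) / 4) :=
    (Real.rpow_le_rpow (by positivity) (by exact_mod_cast (Nat.sub_le T 1)) (by norm_num)).trans (hpow T hT.le)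
  have h2 : ∑ n ∈ Ico Y T, 2 * wt ε a n / n * (8 * (n:ℝ) ^ ((3:ℝ) / 4)) ≤
      16 * (Y:ℝ) ^ (-(1:ℝ) / 4) * ∑ n ∈ Ico Y T, wt ε a n := by
    rw [Finset.mul_sum]
    refine Finset.sum_le_sum fun n hn => ?_
    have hn := (mem_Ico.1 hn).1
    have h0 : (0:ℝ) < n := by linarith [hn1 n hn]
    have h3 := hw n hn
    calc 2 * wt ε a n / n * (8 * (n:ℝ) ^ ((3:ℝ) / 4)) ≤ 2 * wt ε a n / n * (8 * (n * (Y:ℝ) ^ (-(1:ℝ) / 4))) := by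
          refine mul_le_mul_of_nonneg_left ?_ (by positivity)
          linarith [hpow n hn]
      _ = _ := by field_simp; ring
  have h3 := wt_sum_le hε a (T := T) hY ha
  have h4 := mul_le_mul_of_nonneg_left h1 (hw T hT.le)
  have hY4 : 0 ≤ (Y:ℝ) ^ (-(1:ℝ) / 4) := by positivity
  have h5 := mul_le_mul_of_nonneg_left h3 (show 0 ≤ 16 * (Y:ℝ) ^ (-(1:ℝ) / 4) by positivity)
  linarith

lemma small_le {ε U : ℝ} (hε : 0 < ε) {a : ℕ} {Y : ℕ} (hY : 1 ≤ Y) (hU : Real.log Y ≤ U) :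
    ∑ n ∈ range Y, vonMangoldt n * wt ε a n ≤ U ^ (a + 1) * (1 + U) := by
  have hU0 : 0 ≤ U := (Real.log_natCast_nonneg Y).trans hU
  have h1 : ∀ n ∈ range Y, vonMangoldt n * wt ε a n ≤ if n ∈ Ioc 0 Y then U ^ (a + 1) * (1 / n) else 0 := by
    intro n hn
    rw [mem_range] at hn
    rcases Nat.eq_zero_or_pos n with rfl | h0
    · simp
    rw [if_pos (mem_Ioc.2 ⟨h0, hn.le⟩)]
    have hn1 : (1:ℝ) ≤ n := by exact_mod_cast h0
    have hl : Real.log n ≤ U := (Real.log_le_log (by linarith) (by exact_mod_cast hn.le)).trans hU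
    have hl0 := Real.log_nonneg hn1
    have hw : wt ε a n ≤ U ^ a * (1 / n) := by
      unfold wt
      refine mul_le_mul (pow_le_pow_left₀ hl0 hl a) ?_ (by positivity) (by positivity)
      rw [one_div, ← Real.rpow_neg_one]
      exact Real.rpow_le_rpow_of_exponent_le hn1 (by linarith)
    calc _ ≤ U * (U ^ a * (1 / n)) := mul_le_mul
            (ArithmeticFunction.vonMangoldt_le_log.trans hl) hw (wt_nonneg a hn1) hU0
      _ = _ := by ring
  refine (Finset.sum_le_sum h1).trans ?_
  rw [← Finset.sum_filter]
  have h2 : ∑ n ∈ (range Y).filter (· ∈ Ioc 0 Y), U ^ (a + 1) * (1 / (n:ℝ)) ≤ ∑ n ∈ Ioc 0 Y, U ^ (a + 1) * (1 / (n:ℝ)) :=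
    Finset.sum_le_sum_of_subset_of_nonneg (fun n hn => (mem_filter.1 hn).2) (fun n _ _ => by positivity)
  refine h2.trans ?_
  rw [← Finset.mul_sum]
  refine mul_le_mul_of_nonneg_left ?_ (by positivity)
  linarith [sum_inv_le Y]

end PD

namespace PD
open Finset

section glob
variable {ι κ : Type} [Fintype ι] [DecidableEq ι] [Fintype κ] [DecidableEq κ]

lemma Nm_inv (prn : ι → ℕ) (s : ι → Option κ) :
    (1:ℝ) / (nN prn s : ℝ) = ∏ p, tl (1 / (prn p : ℝ)) (s p) := by
  rw [← Nm_eq, Nm, one_div, ← Finset.prod_inv_distrib]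
  refine Finset.prod_congr rfl fun p _ => ?_
  rcases s p with _ | i <;> simp [tl]

lemma tl_sum (t : ℝ) : ∑ x : Option κ, tl t x = 1 + Fintype.card κ * t := by
  rw [Fintype.sum_option]; simp [tl]

lemma lam_abs_le (prn : ι → ℕ) (hp : ∀ p, 0 < prn p) {g : ℕ → ℝ} (hg : ∀ n, 0 ≤ g n)
    (hg1 : ∀ n, g n ≤ 1) (R : ℕ) (D : ι → Option κ) :
    |lam (fun p => (prn p : ℝ)) (GF prn g R) D| ≤ ∏ p, (1 + Fintype.card κ * (1 / (prn p : ℝ))) := by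
  have hG : ∀ s : ι → Option κ, GF prn g R s ≤ ∏ p, tl (1 / (prn p : ℝ)) (s p) := by
    intro s
    rw [← Nm_inv, GF]
    gcongr
    split_ifs
    · exact Finset.prod_le_one (fun _ _ => hg _) fun _ _ => hg1 _
    · norm_num
  have h1 : |∏ p, tl (-1) (D p)| = 1 := by
    rw [Finset.abs_prod]
    refine Finset.prod_eq_one fun p _ => ?_
    rcases D p with _ | i <;> simp [tl]
  have hol : ∀ x y : Option κ, 0 ≤ ol x y := fun x y => by unfold ol; split_ifs <;> norm_num
  have hN : 0 ≤ Nm (fun p => (prn p : ℝ)) D := by rw [Nm_eq]; positivity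
  rw [lam, abs_mul, abs_mul, h1, one_mul, abs_of_nonneg hN, abs_of_nonneg
    (Finset.sum_nonneg fun s _ => mul_nonneg (Finset.prod_nonneg fun _ _ => hol _ _) (GF_nonneg hg R s))]
  calc _ ≤ Nm (fun p => (prn p : ℝ)) D * ∑ s : ι → Option κ, (∏ p, ol (D p) (s p)) *
        ∏ p, tl (1 / (prn p : ℝ)) (s p) := by
        gcongr with s
        · exact Finset.prod_nonneg fun _ _ => hol _ _
        · exact hG s
    _ = ∑ s : ι → Option κ, ∏ p, (tl (prn p : ℝ) (D p) * (ol (D p) (s p) * tl (1 / (prn p : ℝ)) (s p))) := by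
        rw [Finset.mul_sum]
        refine Finset.sum_congr rfl fun s _ => ?_
        rw [Nm, Finset.prod_mul_distrib, Finset.prod_mul_distrib]
    _ = ∏ p, ∑ x : Option κ, (tl (prn p : ℝ) (D p) * (ol (D p) x * tl (1 / (prn p : ℝ)) x)) := by
        rw [Fintype.prod_sum]
    _ ≤ _ := by
        refine Finset.prod_le_prod (fun p _ => Finset.sum_nonneg fun x _ => ?_) fun p _ => ?_
        · refine mul_nonneg ?_ (mul_nonneg (hol _ _) ?_) <;> unfold tl <;> split_ifs <;> positivity
        · have hpp : (0:ℝ) < prn p := by exact_mod_cast hp p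
          rcases h : D p with _ | i
          · have : ∀ x : Option κ, tl (prn p : ℝ) (none : Option κ) * (ol none x * tl (1 / (prn p : ℝ)) x) =
              tl (1 / (prn p : ℝ)) x := by intro x; simp [tl, ol]
            simp_rw [this]
            rw [tl_sum]
          · rw [Finset.sum_eq_single (some i)]
            · simp [tl, ol]
              rw [mul_inv_cancel₀ hpp.ne']
              have : (0:ℝ) ≤ Fintype.card κ * (prn p : ℝ)⁻¹ := by positivity
              linarith
            · intro b _ hb
              simp [ol, Ne.symm hb]
            · simp

lemma lam_zero (prn : ι → ℕ) (hp : ∀ p, 0 < prn p) (g : ℕ → ℝ)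
    (R : ℕ) (D : ι → Option κ) (hD : R < nN prn D) :
    lam (fun p => (prn p : ℝ)) (GF prn g R) D = 0 := by
  rw [lam, Finset.sum_eq_zero, mul_zero, mul_zero]
  intro s _
  by_cases h : ∀ p, D p = none ∨ D p = s p
  · have h1 : ∀ j, nm prn (cs D j) ≤ nm prn (cs s j) := fun j => nm_mono hp (cs_mono h j)
    have h2 : nN prn D ≤ nN prn s := Finset.prod_le_prod' fun j _ => h1 j
    rw [GF, if_neg (by omega), zero_div, mul_zero]
  · push Not at h
    obtain ⟨p, hp1, hp2⟩ := h
    rw [Finset.prod_eq_zero (mem_univ p), zero_mul]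
    simp [ol, hp1, hp2]

lemma lam_sum (prn : ι → ℕ) (hp : ∀ p, 0 < prn p) {R : ℕ} {Z : ℝ} (l : (ι → Option κ) → ℝ)
    (h0 : ∀ D, R < nN prn D → l D = 0) (h1 : ∀ D, |l D| ≤ Z)
    (hZ : ∏ p, (1 + Fintype.card κ * (1 / (prn p : ℝ))) ≤ Z) :
    ∑ D, |l D| ≤ R * Z ^ 2 := by
  have hZ0 : 0 ≤ Z := (abs_nonneg _).trans (h1 (fun _ => none))
  calc ∑ D, |l D| ≤ ∑ D : ι → Option κ, Z * R * ∏ p, tl (1 / (prn p : ℝ)) (D p) := by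
        refine Finset.sum_le_sum fun D _ => ?_
        rw [← Nm_inv]
        have hpos : (0:ℝ) < nN prn D := by exact_mod_cast nN_pos hp D
        rcases lt_or_ge R (nN prn D) with h | h
        · rw [h0 D h, abs_zero]; positivity
        · refine (h1 D).trans ?_
          rw [mul_one_div, le_div_iff₀ hpos]
          gcongr
    _ = Z * R * ∏ p, (1 + Fintype.card κ * (1 / (prn p : ℝ))) := by
        rw [← Finset.mul_sum, ← Fintype.prod_sum]
        simp_rw [tl_sum]
    _ ≤ Z * R * Z := by gcongr
    _ = _ := by ring

end glob

lemma dyad (i : ℕ) (hi : 1 ≤ i) :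
    ∑ p ∈ (Ioc (2 ^ i) (2 ^ (i + 1))).filter Nat.Prime, (1:ℝ) / p ≤ 4 / i := by
  have hl2 : 0 < Real.log 2 := Real.log_pos (by norm_num)
  have hi0 : (0:ℝ) < i := by exact_mod_cast hi
  have h1 : ∑ p ∈ (Ioc (2 ^ i) (2 ^ (i + 1))).filter Nat.Prime, Real.log p ≤ Real.log 4 * 2 ^ (i + 1) := by
    have := Chebyshev.theta_le_log4_mul_x (x := ((2 ^ (i + 1) : ℕ) : ℝ)) (by positivity)
    rw [Chebyshev.theta_eq_sum_Icc, Nat.floor_natCast] at this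
    push_cast at this
    refine le_trans ?_ this
    refine Finset.sum_le_sum_of_subset_of_nonneg ?_ fun p hp _ => ?_
    · intro p hp
      simp only [mem_filter, mem_Ioc, mem_Icc] at hp ⊢
      exact ⟨⟨by omega, hp.1.2⟩, hp.2⟩
    · exact Real.log_natCast_nonneg p
  have h4 : Real.log 4 = 2 * Real.log 2 := by
    rw [show (4:ℝ) = 2 ^ 2 by norm_num, Real.log_pow]; norm_num
  calc _ ≤ ∑ p ∈ (Ioc (2 ^ i) (2 ^ (i + 1))).filter Nat.Prime, Real.log p * (1 / (2 ^ i * (i * Real.log 2))) := by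
        refine Finset.sum_le_sum fun p hp => ?_
        simp only [mem_filter, mem_Ioc] at hp
        have hp0 : ((2:ℝ) ^ i) ≤ p := by exact_mod_cast hp.1.1.le
        have hlog : i * Real.log 2 ≤ Real.log p := by
          rw [← Real.log_pow]; exact Real.log_le_log (by positivity) hp0
        rw [mul_one_div, div_le_div_iff₀ (lt_of_lt_of_le (by positivity) hp0) (by positivity), one_mul, mul_comm]
        gcongr
    _ ≤ Real.log 4 * 2 ^ (i + 1) * (1 / (2 ^ i * (i * Real.log 2))) := by
        rw [← Finset.sum_mul]; gcongr
    _ = 4 / i := by rw [h4]; field_simp; ring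

lemma prime_recip (m : ℕ) (hm : 1 ≤ m) :
    ∑ p ∈ (Ioc 0 (2 ^ m)).filter Nat.Prime, (1:ℝ) / p ≤ 5 + 4 * Real.log m := by
  have key : ∀ m : ℕ, 1 ≤ m → ∑ p ∈ (Ioc 0 (2 ^ m)).filter Nat.Prime, (1:ℝ) / p ≤
      1 / 2 + 4 * ∑ i ∈ Ioc 0 (m - 1), (1:ℝ) / i := by
    intro m hm
    induction m, hm using Nat.le_induction with
    | base =>
      have : (Ioc 0 (2 ^ 1)).filter Nat.Prime = {2} := by decide
      rw [this]; simp
    | succ m hm ih =>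
      have hs : (Ioc 0 (2 ^ (m + 1))).filter Nat.Prime =
          (Ioc 0 (2 ^ m)).filter Nat.Prime ∪ (Ioc (2 ^ m) (2 ^ (m + 1))).filter Nat.Prime := by
        rw [← Finset.filter_union, Finset.Ioc_union_Ioc_eq_Ioc (by positivity)
          (Nat.pow_le_pow_right (by norm_num) (by omega))]
      rw [hs, Finset.sum_union]
      · have h2 := dyad m hm
        have h3 : ∑ i ∈ Ioc 0 (m + 1 - 1), (1:ℝ) / i = ∑ i ∈ Ioc 0 (m - 1), (1:ℝ) / i + 1 / m := by
          obtain ⟨n, rfl⟩ : ∃ n, m = n + 1 := ⟨m - 1, by omega⟩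
          simp only [Nat.add_sub_cancel]
          rw [Finset.sum_Ioc_succ_top (by omega)]
        rw [h3]
        have : (4:ℝ) / m = 4 * (1 / m) := by ring
        linarith
      · refine Finset.disjoint_filter_filter ?_
        rw [Finset.disjoint_left]
        intro a ha hb
        simp only [mem_Ioc] at ha hb
        omega
  refine (key m hm).trans ?_
  have h1 := sum_inv_le (m - 1)
  have h2 : Real.log (m - 1 : ℕ) ≤ Real.log m := by
    rcases Nat.eq_zero_or_pos (m - 1) with h | h
    · rw [h]; simp; exact Real.log_natCast_nonneg m
    · exact Real.log_le_log (by exact_mod_cast h) (by exact_mod_cast Nat.sub_le m 1)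
  linarith

lemma Z_polylog (W R m K : ℕ) (hm : 1 ≤ m) (hR : R ≤ 2 ^ m) :
    ∏ p : ↥(Pset W R), (1 + (K:ℝ) * (1 / (((p : ℕ) : ℝ) - 1))) ≤ Real.exp (10 * K) * (m:ℝ) ^ (8 * K) := by
  rw [Finset.prod_coe_sort (Pset W R) (fun p : ℕ => (1 + (K:ℝ) * (1 / ((p : ℝ) - 1))))]
  have hm0 : (0:ℝ) < m := by exact_mod_cast hm
  calc _ ≤ ∏ p ∈ Pset W R, Real.exp (2 * K * ((1:ℝ) / p)) := by
        refine Finset.prod_le_prod (fun p hp => ?_) fun p hp => ?_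
        · have hp2 : (2:ℝ) ≤ p := by exact_mod_cast (mem_Pset.1 hp).2.1.two_le
          have : (0:ℝ) ≤ 1 / ((p:ℝ) - 1) := by apply div_nonneg <;> linarith
          positivity
        · have hp2 : (2:ℝ) ≤ p := by exact_mod_cast (mem_Pset.1 hp).2.1.two_le
          have h1 : 1 / ((p:ℝ) - 1) ≤ 2 * ((1:ℝ) / p) := by
            rw [mul_one_div, div_le_div_iff₀ (by linarith) (by linarith)]; linarith
          have h2 := Real.add_one_le_exp (2 * K * ((1:ℝ) / p))
          have h3 : (K:ℝ) * (1 / ((p:ℝ) - 1)) ≤ K * (2 * ((1:ℝ) / p)) := by gcongr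
          linarith
    _ = Real.exp (2 * K * ∑ p ∈ Pset W R, (1:ℝ) / p) := by
        rw [← Real.exp_sum, Finset.mul_sum]
    _ ≤ Real.exp (2 * K * (5 + 4 * Real.log m)) := by
        gcongr
        refine le_trans ?_ (prime_recip m hm)
        refine Finset.sum_le_sum_of_subset_of_nonneg ?_ fun p _ _ => by positivity
        intro p hp
        have := mem_Pset.1 hp
        simp only [mem_filter, mem_Ioc]
        exact ⟨⟨this.2.1.pos, this.1.trans hR⟩, this.2.1⟩
    _ = _ := by
        rw [show (2 * K * (5 + 4 * Real.log m) : ℝ) = 10 * K + (8 * K : ℕ) * Real.log m by push_cast; ring,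
          Real.exp_add, Real.exp_nat_mul, Real.exp_log hm0]

end PD

namespace PD
open Finset

section glob
variable {ι κ : Type} [Fintype ι] [DecidableEq ι] [Fintype κ] [DecidableEq κ]

/-- local divisibility indicator -/
def al (h : κ → ℕ) (q m : ℕ) (d : Option κ) : ℝ :=
  d.elim 1 (fun i => if q ∣ m + h i then 1 else 0)

/-- the sieve sum -/
def Asum (prn : ι → ℕ) (h : κ → ℕ) (l : (ι → Option κ) → ℝ) (m : ℕ) : ℝ :=
  ∑ D, l D * ∏ p, al h (prn p) m (D p)

lemma nN_supp (prn : ι → ℕ) (D : ι → Option κ) : nN prn D = ∏ p ∈ supp D, prn p := by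
  have h := Nm_eq prn D
  have h2 : Nm (fun p => (prn p : ℝ)) D = ((∏ p ∈ supp D, prn p : ℕ) : ℝ) := by
    unfold Nm supp
    rw [Finset.prod_filter]
    push_cast
    refine Finset.prod_congr rfl fun p _ => ?_
    rcases D p with _ | i <;> simp [tl]
  rw [h2] at h
  exact_mod_cast h.symm

lemma supp_union_le (prn : ι → ℕ) (hp : ∀ p, 0 < prn p) (D E : ι → Option κ) :
    ∏ p ∈ supp D ∪ supp E, prn p ≤ nN prn D * nN prn E := by
  rw [nN_supp, nN_supp, ← Finset.prod_union_inter]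
  exact Nat.le_mul_of_pos_right _ (Finset.prod_pos fun p _ => hp p)

lemma crt_res (prn : ι → ℕ) (hpr : ∀ p, (prn p).Prime) (hinj : Function.Injective prn) (W : ℕ)
    (hW : ∀ p, ¬ prn p ∣ W) (b : ℕ) (a : ι → ℕ) (S : Finset ι) :
    ∃ x, ∀ m, (m ≡ b [MOD W] ∧ ∀ p ∈ S, m ≡ a p [MOD prn p]) ↔ m ≡ x [MOD W * ∏ p ∈ S, prn p] := by
  induction S using Finset.induction_on with
  | empty => exact ⟨b, fun m => by simp⟩
  | insert q S hq ih =>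
    obtain ⟨x, hx⟩ := ih
    have hc : (W * ∏ p ∈ S, prn p).Coprime (prn q) := by
      refine Nat.Coprime.symm ((Nat.Prime.coprime_iff_not_dvd (hpr q)).2 ?_)
      rw [(hpr q).dvd_mul, Prime.dvd_finsetProd_iff (hpr q).prime]
      rintro (h | ⟨p, hp, h⟩)
      · exact hW q h
      · rw [(Nat.prime_dvd_prime_iff_eq (hpr q) (hpr p))] at h
        exact hq (hinj h ▸ hp)
    obtain ⟨y, hy1, hy2⟩ := Nat.chineseRemainder hc x (a q)
    refine ⟨y, fun m => ?_⟩
    rw [Finset.prod_insert hq, mul_comm (prn q), ← mul_assoc, ← Nat.modEq_and_modEq_iff_modEq_mul hc]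
    have e1 : m ≡ y [MOD W * ∏ p ∈ S, prn p] ↔ m ≡ x [MOD W * ∏ p ∈ S, prn p] :=
      ⟨fun h => h.trans hy1, fun h => h.trans hy1.symm⟩
    have e2 : m ≡ y [MOD prn q] ↔ m ≡ a q [MOD prn q] :=
      ⟨fun h => h.trans hy2, fun h => h.trans hy2.symm⟩
    rw [e1, e2, ← hx]
    simp only [Finset.forall_mem_insert]
    tauto

lemma al_prod (h : κ → ℕ) {q : ℕ} (hq : 0 < q) (hh : ∀ i i', i ≠ i' → ¬ h i ≡ h i' [MOD q])
    (x y : Option κ) (hxy : ¬ (x ≠ none ∧ y ≠ none ∧ x ≠ y)) :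
    ∃ a, ∀ m, al h q m x * al h q m y = if (x ≠ none ∨ y ≠ none) → m ≡ a [MOD q] then 1 else 0 := by
  have key : ∀ i m, q ∣ m + h i ↔ m ≡ h i * (q - 1) [MOD q] := by
    intro i m
    have e : h i * (q - 1) + h i = q * h i := by
      obtain ⟨r, rfl⟩ : ∃ r, q = r + 1 := ⟨q - 1, by omega⟩
      simp; ring
    constructor
    · intro hd
      have : m + h i ≡ h i * (q - 1) + h i [MOD q] := by
        rw [e]; exact ((Nat.modEq_zero_iff_dvd.2 hd)).trans (Nat.modEq_zero_iff_dvd.2 (dvd_mul_right _ _)).symm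
      exact Nat.ModEq.add_right_cancel' _ this
    · intro hd
      have : m + h i ≡ h i * (q - 1) + h i [MOD q] := hd.add_right _
      rw [e] at this
      exact Nat.modEq_zero_iff_dvd.1 (this.trans (Nat.modEq_zero_iff_dvd.2 (dvd_mul_right _ _)))
  rcases x with _ | i <;> rcases y with _ | i'
  · exact ⟨0, fun m => by simp [al]⟩
  · exact ⟨h i' * (q - 1), fun m => by simp [al, key]⟩
  · exact ⟨h i * (q - 1), fun m => by simp [al, key]⟩
  · have : i = i' := by
      by_contra hne; exact hxy ⟨by simp, by simp, by simpa using hne⟩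
    subst this
    refine ⟨h i * (q - 1), fun m => ?_⟩
    simp only [al, Option.elim, key]
    by_cases hm : m ≡ h i * (q - 1) [MOD q] <;> simp [hm]

lemma al_prod_zero (h : κ → ℕ) {q : ℕ} (hh : ∀ i i', i ≠ i' → ¬ h i ≡ h i' [MOD q])
    (x y : Option κ) (hxy : (x ≠ none ∧ y ≠ none ∧ x ≠ y)) (m : ℕ) :
    al h q m x * al h q m y = 0 := by
  rcases x with _ | i <;> rcases y with _ | i'
  · simp at hxy
  · simp at hxy
  · simp at hxy
  · have hne : i ≠ i' := by simpa using hxy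
    simp only [al, Option.elim]
    by_cases h1 : q ∣ m + h i
    · by_cases h2 : q ∣ m + h i'
      · exfalso
        apply hh i i' hne
        have : m + h i ≡ m + h i' [MOD q] :=
          (Nat.modEq_zero_iff_dvd.2 h1).trans (Nat.modEq_zero_iff_dvd.2 h2).symm
        exact Nat.ModEq.add_left_cancel' _ this
      · simp [h2]
    · simp [h1]

lemma S1_pair (prn : ι → ℕ) (hpr : ∀ p, (prn p).Prime) (hinj : Function.Injective prn) {W : ℕ}
    (hW0 : 0 < W) (hW : ∀ p, ¬ prn p ∣ W) (b : ℕ) (h : κ → ℕ)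
    (hh : ∀ p i i', i ≠ i' → ¬ h i ≡ h i' [MOD prn p]) {f : ℕ → ℝ} {Y T : ℕ}
    (hf0 : ∀ n, Y ≤ n → 0 ≤ f n) (hf : ∀ n, Y ≤ n → f (n + 1) ≤ f n) (D E : ι → Option κ) :
    |∑ m ∈ Ico Y T, (if m ≡ b [MOD W] then f m * ((∏ p, al h (prn p) m (D p)) * ∏ p, al h (prn p) m (E p)) else 0)
      - 1 / W * (∏ p, Kl (1 / (prn p : ℝ)) (D p) (E p)) * ∑ m ∈ Ico Y T, f m|
      ≤ 2 * (W * (nN prn D * nN prn E) : ℕ) * f Y := by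
  have hY0 := hf0 Y le_rfl
  simp_rw [← Finset.prod_mul_distrib]
  by_cases hex : ∃ p, (D p ≠ none ∧ E p ≠ none ∧ D p ≠ E p)
  · obtain ⟨p, hp⟩ := hex
    have e1 : ∀ m, ∏ p, al h (prn p) m (D p) * al h (prn p) m (E p) = 0 := fun m =>
      Finset.prod_eq_zero (mem_univ p) (al_prod_zero h (hh p) _ _ hp m)
    have e2 : (∏ p, Kl (1 / (prn p : ℝ)) (D p) (E p)) = 0 :=
      Finset.prod_eq_zero (mem_univ p) (by simp [Kl, hp.1, hp.2.1, hp.2.2])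
    simp only [e1, e2, mul_zero, ite_self, Finset.sum_const_zero, zero_mul, sub_zero, abs_zero]
    positivity
  · push Not at hex
    choose a ha using fun p => al_prod h (hpr p).pos (hh p) (D p) (E p)
      (fun hc => hc.2.2 (hex p hc.1 hc.2.1))
    obtain ⟨x, hx⟩ := crt_res prn hpr hinj W hW b a (supp D ∪ supp E)
    set q := W * ∏ p ∈ supp D ∪ supp E, prn p with hq
    have hq0 : 0 < q := Nat.mul_pos hW0 (Finset.prod_pos fun p _ => (hpr p).pos)
    have e1 : ∀ m, (if m ≡ b [MOD W] then f m * (∏ p, al h (prn p) m (D p) * al h (prn p) m (E p)) else 0) =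
        if m ≡ x [MOD q] then f m else 0 := by
      intro m
      simp_rw [ha]
      rw [Finset.prod_boole]
      have : (∀ i ∈ (univ : Finset ι), D i ≠ none ∨ E i ≠ none → m ≡ a i [MOD prn i]) ↔
          ∀ p ∈ supp D ∪ supp E, m ≡ a p [MOD prn p] := by
        simp [supp]
      by_cases h1 : m ≡ x [MOD q]
      · have h4 := (hx m).2 h1
        rw [if_pos h1, if_pos h4.1, if_pos (this.2 h4.2), mul_one]
      · rw [if_neg h1]
        by_cases h2 : m ≡ b [MOD W]
        · rw [if_pos h2, if_neg (fun h3 => h1 ((hx m).1 ⟨h2, this.1 h3⟩)), mul_zero]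
        · rw [if_neg h2]
    have e2 : (∏ p, Kl (1 / (prn p : ℝ)) (D p) (E p)) = 1 / (∏ p ∈ supp D ∪ supp E, prn p : ℕ) := by
      have : supp D ∪ supp E = univ.filter (fun p => D p ≠ none ∨ E p ≠ none) := by
        ext p; simp [supp]
      rw [this, Finset.prod_filter]
      push_cast
      rw [one_div, ← Finset.prod_inv_distrib]
      refine Finset.prod_congr rfl fun p _ => ?_
      have := hex p
      by_cases h1 : D p = none <;> by_cases h2 : E p = none <;> simp [Kl, h1, h2]
      intro h3; exact absurd (this h1 h2) h3
    simp_rw [e1]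
    rw [e2]
    have hcard : ((range q).filter (fun m => m ≡ x [MOD q])).card = 1 := by
      rw [Finset.card_eq_one]
      refine ⟨x % q, ?_⟩
      ext m
      rw [mem_filter, mem_range, mem_singleton]
      constructor
      · rintro ⟨h1, h2⟩
        have h2' : m % q = x % q := h2
        rw [← h2', Nat.mod_eq_of_lt h1]
      · rintro rfl; exact ⟨Nat.mod_lt _ hq0, Nat.mod_mod _ _⟩
    have := periodic_weight (fun m => m ≡ x [MOD q]) q 1 hq0 (fun n => by
      simp [Nat.ModEq]) hcard hf0 hf (b := T)
    have e3 : (1:ℝ) / W * (1 / (∏ p ∈ supp D ∪ supp E, prn p : ℕ)) = ((1:ℕ):ℝ) / (q:ℝ) := by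
      rw [hq]; push_cast; rw [div_mul_div_comm, one_mul]
    rw [e3]
    refine this.trans ?_
    have : q ≤ W * (nN prn D * nN prn E) :=
      Nat.mul_le_mul_left _ (supp_union_le prn (fun p => (hpr p).pos) D E)
    have : (q:ℝ) ≤ (W * (nN prn D * nN prn E) : ℕ) := by exact_mod_cast this
    gcongr

lemma S1_upper (prn : ι → ℕ) (hpr : ∀ p, (prn p).Prime) (hinj : Function.Injective prn) {W : ℕ}
    (hW0 : 0 < W) (hW : ∀ p, ¬ prn p ∣ W) (b : ℕ) (h : κ → ℕ)
    (hh : ∀ p i i', i ≠ i' → ¬ h i ≡ h i' [MOD prn p]) {f : ℕ → ℝ} {Y T : ℕ}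
    (hf0 : ∀ n, Y ≤ n → 0 ≤ f n) (hf : ∀ n, Y ≤ n → f (n + 1) ≤ f n) {R : ℕ} (l : (ι → Option κ) → ℝ)
    (h0 : ∀ D, R < nN prn D → l D = 0) :
    ∑ m ∈ Ico Y T, (if m ≡ b [MOD W] then f m * Asum prn h l m ^ 2 else 0) ≤
      1 / W * (∑ m ∈ Ico Y T, f m) * (∑ D, ∑ E, l D * l E * ∏ p, Kl (1 / (prn p : ℝ)) (D p) (E p))
      + 2 * (W * R ^ 2) * f Y * (∑ D, |l D|) ^ 2 := by
  have hY0 := hf0 Y le_rfl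
  have e1 : ∑ m ∈ Ico Y T, (if m ≡ b [MOD W] then f m * Asum prn h l m ^ 2 else 0) =
      ∑ D, ∑ E, l D * l E * ∑ m ∈ Ico Y T, (if m ≡ b [MOD W] then f m * ((∏ p, al h (prn p) m (D p)) * ∏ p, al h (prn p) m (E p)) else 0) := by
    simp_rw [Finset.mul_sum]
    rw [Finset.sum_congr rfl fun D _ => Finset.sum_comm, Finset.sum_comm]
    refine Finset.sum_congr rfl fun m _ => ?_
    split_ifs
    · rw [Asum, sq, Finset.sum_mul_sum, Finset.mul_sum]
      refine Finset.sum_congr rfl fun D _ => ?_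
      rw [Finset.mul_sum]
      refine Finset.sum_congr rfl fun E _ => by ring
    · simp
  rw [e1]
  generalize hM : ∑ m ∈ Ico Y T, f m = M
  rw [sq (∑ D, |l D|), Finset.sum_mul_sum, Finset.mul_sum, Finset.mul_sum, ← Finset.sum_add_distrib]
  refine Finset.sum_le_sum fun D _ => ?_
  rw [Finset.mul_sum, Finset.mul_sum, ← Finset.sum_add_distrib]
  refine Finset.sum_le_sum fun E _ => ?_
  by_cases hD : R < nN prn D
  · simp [h0 D hD]
  by_cases hE : R < nN prn E
  · simp [h0 E hE]
  push Not at hD hE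
  have key := S1_pair prn hpr hinj hW0 hW b h hh (T := T) hf0 hf D E
  set X := ∑ m ∈ Ico Y T, (if m ≡ b [MOD W] then f m * ((∏ p, al h (prn p) m (D p)) * ∏ p, al h (prn p) m (E p)) else 0)
  set P := ∏ p, Kl (1 / (prn p : ℝ)) (D p) (E p)
  rw [hM] at key
  clear_value X P
  have hq : ((W * (nN prn D * nN prn E) : ℕ) : ℝ) ≤ W * R ^ 2 := by
    push_cast
    rw [sq]
    have : (nN prn D : ℝ) ≤ R := by exact_mod_cast hD
    have : (nN prn E : ℝ) ≤ R := by exact_mod_cast hE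
    gcongr
  have k2 : |X - 1 / W * P * M| ≤ 2 * (W * R ^ 2) * f Y := key.trans (by gcongr)
  have k3 : l D * l E * (X - 1 / W * P * M) ≤ |l D| * |l E| * (2 * (W * R ^ 2) * f Y) := by
    refine (le_abs_self _).trans ?_
    rw [abs_mul, abs_mul]
    gcongr
  linarith

end glob

end PD

namespace PD
open Finset
section glob
variable {ι : Type} [Fintype ι]

/-- tuples of characters -/
abbrev ChT (W : ℕ) (prn : ι → ℕ) : Type :=
  DirichletCharacter ℂ W × (∀ p, DirichletCharacter ℂ (prn p))

/-- nontrivial places -/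
noncomputable def Sc {W : ℕ} {prn : ι → ℕ} (ψ : ChT W prn) : Finset ι :=
  letI := Classical.decPred (fun p => ψ.2 p ≠ 1)
  univ.filter (fun p => ψ.2 p ≠ 1)

lemma mem_Sc {W : ℕ} {prn : ι → ℕ} {ψ : ChT W prn} {p : ι} : p ∈ Sc ψ ↔ ψ.2 p ≠ 1 := by
  simp [Sc]

/-- attached character as a function -/
noncomputable def chi {W : ℕ} {prn : ι → ℕ} (ψ : ChT W prn) (n : ℕ) : ℂ :=
  ψ.1 n * ∏ p ∈ Sc ψ, ψ.2 p n

/-- conductor-like modulus -/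
noncomputable def qc {W : ℕ} {prn : ι → ℕ} (ψ : ChT W prn) : ℕ := W * ∏ p ∈ Sc ψ, prn p

/-- combined Dirichlet character -/
noncomputable def TC {W : ℕ} {prn : ι → ℕ} (S : Finset ι) (ξ : DirichletCharacter ℂ W)
    (η : ∀ p, DirichletCharacter ℂ (prn p)) : DirichletCharacter ℂ (W * ∏ p ∈ S, prn p) :=
  DirichletCharacter.changeLevel (dvd_mul_right W _) ξ *
    ∏ p ∈ S.attach, DirichletCharacter.changeLevel
      ((Finset.dvd_prod_of_mem prn p.2).trans (dvd_mul_left _ W)) (η p)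

lemma changeLevel_nat {n m : ℕ} (hd : n ∣ m) (χ : DirichletCharacter ℂ n) {a : ℕ} (ha : a.Coprime m) :
    DirichletCharacter.changeLevel hd χ (a : ZMod m) = χ (a : ZMod n) := by
  have := DirichletCharacter.changeLevel_eq_cast_of_dvd χ hd (ZMod.unitOfCoprime a ha)
  rw [ZMod.coe_unitOfCoprime] at this
  rw [this, ZMod.cast_natCast hd]

lemma char_nat_zero {n : ℕ} (χ : DirichletCharacter ℂ n) {a : ℕ} (ha : ¬ a.Coprime n) :
    χ (a : ZMod n) = 0 := by
  apply MulChar.map_nonunit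
  rwa [ZMod.isUnit_iff_coprime]

lemma TC_apply {W : ℕ} {prn : ι → ℕ} (S : Finset ι) (ξ : DirichletCharacter ℂ W)
    (η : ∀ p, DirichletCharacter ℂ (prn p)) (n : ℕ) :
    TC S ξ η (n : ZMod (W * ∏ p ∈ S, prn p)) = ξ n * ∏ p ∈ S, η p n := by
  by_cases hn : n.Coprime (W * ∏ p ∈ S, prn p)
  · unfold TC
    rw [MulChar.mul_apply, changeLevel_nat _ _ hn]
    congr 1
    have : ∀ T : Finset {p // p ∈ S}, (∏ p ∈ T, DirichletCharacter.changeLevel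
      ((Finset.dvd_prod_of_mem prn p.2).trans (dvd_mul_left _ W)) (η p)) (n : ZMod (W * ∏ p ∈ S, prn p))
      = ∏ p ∈ T, η p n := by
      intro T
      classical
      induction T using Finset.induction_on with
      | empty =>
        rw [Finset.prod_empty, Finset.prod_empty, MulChar.one_apply]
        rwa [ZMod.isUnit_iff_coprime]
      | insert a T ha ih =>
        rw [Finset.prod_insert ha, Finset.prod_insert ha, MulChar.mul_apply, ih, changeLevel_nat _ _ hn]
    rw [this, Finset.prod_attach S (fun p => η p n)]
  · rw [char_nat_zero _ hn]
    rw [Nat.coprime_mul_iff_right] at hn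
    by_cases h1 : n.Coprime W
    · have : ¬ n.Coprime (∏ p ∈ S, prn p) := fun h => hn ⟨h1, h⟩
      have : ∃ p ∈ S, ¬ n.Coprime (prn p) := by
        by_contra hc; push Not at hc
        exact this (Nat.Coprime.prod_right hc)
      obtain ⟨p, hp, hc⟩ := this
      rw [Finset.prod_eq_zero hp (char_nat_zero _ hc), mul_zero]
    · rw [char_nat_zero _ h1, zero_mul]

lemma char_ext_nat {n : ℕ} [NeZero n] (χ : DirichletCharacter ℂ n)
    (h : ∀ a : ℕ, a.Coprime n → χ (a : ZMod n) = 1) : χ = 1 := by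
  ext u
  rw [MulChar.one_apply u.isUnit]
  have := h (u : ZMod n).val (ZMod.val_coe_unit_coprime u)
  rwa [ZMod.natCast_zmod_val] at this

lemma TC_one {W : ℕ} (hW0 : 0 < W) {prn : ι → ℕ} (hpr : ∀ p, (prn p).Prime)
    (hinj : Function.Injective prn) (hW : ∀ p, ¬ prn p ∣ W) (S : Finset ι) (ξ : DirichletCharacter ℂ W)
    (η : ∀ p, DirichletCharacter ℂ (prn p)) (h : TC S ξ η = 1) : ξ = 1 ∧ ∀ p ∈ S, η p = 1 := by
  classical
  haveI : NeZero W := ⟨hW0.ne'⟩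
  have key : ∀ m : ℕ, m.Coprime W → (∀ p ∈ S, m.Coprime (prn p)) → ξ m * ∏ p ∈ S, η p m = 1 := by
    intro m h1 h2
    rw [← TC_apply, h, MulChar.one_apply]
    rw [ZMod.isUnit_iff_coprime]
    exact Nat.Coprime.mul_right h1 (Nat.Coprime.prod_right h2)
  have cop : ∀ {a b n : ℕ}, a ≡ b [MOD n] → b.Coprime n → a.Coprime n := by
    intro a b n hab hb
    rw [Nat.coprime_iff_gcd_eq_one, Nat.ModEq.gcd_eq hab]; exact hb
  constructor
  · refine char_ext_nat ξ fun a ha => ?_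
    obtain ⟨x, hx⟩ := crt_res prn hpr hinj W hW a (fun _ => 1) S
    obtain ⟨h1, h2⟩ := (hx x).2 rfl
    have := key x (cop h1 ha) (fun p hp => cop (h2 p hp) (by simp))
    rw [(ZMod.natCast_eq_natCast_iff _ _ _).2 h1] at this
    rw [Finset.prod_eq_one (fun p hp => ?_), mul_one] at this
    · exact this
    · rw [(ZMod.natCast_eq_natCast_iff _ _ _).2 (h2 p hp)]; simp
  · intro q hq
    haveI : NeZero (prn q) := ⟨(hpr q).ne_zero⟩
    refine char_ext_nat (η q) fun a ha => ?_
    obtain ⟨x, hx⟩ := crt_res prn hpr hinj W hW 1 (fun p => if p = q then a else 1) S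
    obtain ⟨h1, h2⟩ := (hx x).2 rfl
    have := key x (cop h1 (by simp)) (fun p hp => cop (h2 p hp) (by
      split_ifs with h
      · rw [h]; exact ha
      · simp))
    rw [(ZMod.natCast_eq_natCast_iff _ _ _).2 h1] at this
    rw [Finset.prod_eq_single q (fun p hp hne => ?_) (fun h => absurd hq h)] at this
    · rw [(ZMod.natCast_eq_natCast_iff _ _ _).2 (h2 q hq)] at this
      simpa using this
    · have := h2 p hp
      rw [if_neg hne] at this
      rw [(ZMod.natCast_eq_natCast_iff _ _ _).2 this]; simp

lemma chi_TC {W : ℕ} {prn : ι → ℕ} (ψ : ChT W prn) (n : ℕ) :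
    chi ψ n = TC (Sc ψ) ψ.1 ψ.2 (n : ZMod (W * ∏ p ∈ Sc ψ, prn p)) := by
  rw [TC_apply]; rfl

lemma TC_ne_one {W : ℕ} (hW0 : 0 < W) {prn : ι → ℕ} (hpr : ∀ p, (prn p).Prime)
    (hinj : Function.Injective prn) (hW : ∀ p, ¬ prn p ∣ W) (ψ : ChT W prn) (hψ : ψ ≠ 1) :
    TC (Sc ψ) ψ.1 ψ.2 ≠ 1 := by
  intro h
  obtain ⟨h1, h2⟩ := TC_one hW0 hpr hinj hW _ _ _ h
  apply hψ
  refine Prod.ext h1 (funext fun p => ?_)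
  by_contra hp
  exact hp (h2 p (mem_Sc.2 hp))

lemma chi_le {W : ℕ} {prn : ι → ℕ} (ψ : ChT W prn) (n : ℕ) : ‖chi ψ n‖ ≤ 1 := by
  rw [chi_TC]; exact DirichletCharacter.norm_le_one _ _

lemma chi_fam {W : ℕ} (hW0 : 0 < W) {prn : ι → ℕ} (hpr : ∀ p, (prn p).Prime)
    (hinj : Function.Injective prn) (hW : ∀ p, ¬ prn p ∣ W) (Q : ℕ) (s : Finset (ChT W prn))
    (hs : ∀ ψ ∈ s, ψ ≠ 1 ∧ qc ψ ≤ Q) :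
    Fam (fun i : {ψ // ψ ∈ s} => chi i.1) ((Q:ℝ) ^ 2) := by
  classical
  haveI : NeZero W := ⟨hW0.ne'⟩
  haveI : ∀ p, NeZero (prn p) := fun p => ⟨(hpr p).ne_zero⟩
  have hpos : ∀ S : Finset ι, 0 < W * ∏ p ∈ S, prn p := fun S =>
    Nat.mul_pos hW0 (Finset.prod_pos fun p _ => (hpr p).pos)
  have hnz : ∀ S : Finset ι, NeZero (W * ∏ p ∈ S, prn p) := fun S => ⟨(hpos S).ne'⟩
  have hsum : ∀ (S : Finset ι) ξ η, TC (prn := prn) (W := W) S ξ η ≠ 1 → ∀ t : ℕ,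
      ‖∑ m ∈ Ioc 0 t, (ξ m * ∏ p ∈ S, η p m)‖ ≤ ((W * ∏ p ∈ S, prn p : ℕ) : ℝ) := by
    intro S ξ η hne t
    have := hnz S
    have h := char_Ioc_le (TC S ξ η) hne t
    simp_rw [TC_apply] at h
    exact h
  refine ⟨?_, ?_, ?_, ?_⟩
  · intro i m n
    simp only [chi]
    push_cast
    simp only [map_mul, Finset.prod_mul_distrib]
    ring
  · intro i n; exact chi_le _ _
  · intro i t
    obtain ⟨h1, h2⟩ := hs i.1 i.2
    refine (hsum (Sc i.1) i.1.1 i.1.2 (TC_ne_one hW0 hpr hinj hW _ h1) t).trans ?_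
    have h3 : ((W * ∏ p ∈ Sc i.1, prn p : ℕ) : ℝ) ≤ Q := by exact_mod_cast h2
    have h4 : (1:ℝ) ≤ Q := le_trans (by exact_mod_cast hpos (Sc i.1)) h3
    nlinarith
  · intro i j hij t
    obtain ⟨⟨ξ, η⟩, hi⟩ := i
    obtain ⟨⟨ξ', η'⟩, hj⟩ := j
    have hi2 := (hs _ hi).2
    have hj2 := (hs _ hj).2
    simp only at hi2 hj2 ⊢
    set S := Sc (W := W) (prn := prn) (ξ, η) with hS
    set S' := Sc (W := W) (prn := prn) (ξ', η') with hS'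
    have e : ∀ m : ℕ, chi (W := W) (prn := prn) (ξ, η) m * (starRingEnd ℂ) (chi (W := W) (prn := prn) (ξ', η') m)
        = (ξ * ξ'⁻¹) m * ∏ p ∈ S ∪ S', (η p * (η' p)⁻¹) m := by
      intro m
      simp only [chi, map_mul, map_prod, ← hS, ← hS', MulChar.mul_apply]
      have e1 : (starRingEnd ℂ) (ξ' m) = ξ'⁻¹ m := MulChar.star_apply' ξ' _
      have e2 : ∀ p, (starRingEnd ℂ) (η' p m) = (η' p)⁻¹ m := fun p => MulChar.star_apply' (η' p) _
      rw [e1]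
      simp_rw [e2]
      have e3 : ∏ p ∈ S ∪ S', η p m * (η' p)⁻¹ m =
          ∏ p ∈ S ∪ S', ((if p ∈ S then η p m else 1) * (if p ∈ S' then (η' p)⁻¹ m else 1)) := by
        refine Finset.prod_congr rfl fun p hp => ?_
        by_cases h1 : p ∈ S <;> by_cases h2 : p ∈ S'
        · simp [h1, h2]
        · have : η' p = 1 := by by_contra h; exact h2 (mem_Sc.2 h)
          rw [if_pos h1, if_neg h2, this, inv_one, ← MulChar.mul_apply, mul_one, mul_one]
        · have : η p = 1 := by by_contra h; exact h1 (mem_Sc.2 h)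
          rw [if_neg h1, if_pos h2, this, ← MulChar.mul_apply, one_mul, one_mul]
        · simp [h1, h2] at hp
      rw [e3, Finset.prod_mul_distrib, Finset.prod_ite_mem, Finset.prod_ite_mem,
        Finset.union_inter_cancel_left, Finset.union_inter_cancel_right]
      ring
    simp_rw [e]
    refine (hsum (S ∪ S') (ξ * ξ'⁻¹) (fun p => η p * (η' p)⁻¹) (fun h => ?_) t).trans ?_
    · obtain ⟨h1, h2⟩ := TC_one hW0 hpr hinj hW _ _ _ h
      apply hij
      refine Subtype.ext (Prod.ext (mul_inv_eq_one.1 h1) (funext fun p => ?_))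
      by_cases hp : p ∈ S ∪ S'
      · exact mul_inv_eq_one.1 (h2 p hp)
      · simp only [mem_union, hS, hS', mem_Sc, not_or, not_not] at hp
        show η p = η' p
        rw [hp.1, hp.2]
    · have h3 : W * ∏ p ∈ S ∪ S', prn p ≤ (W * ∏ p ∈ S, prn p) * (W * ∏ p ∈ S', prn p) := by
        have h4 : ∏ p ∈ S ∪ S', prn p ≤ (∏ p ∈ S, prn p) * ∏ p ∈ S', prn p := by
          rw [← Finset.prod_union_inter]
          exact Nat.le_mul_of_pos_right _ (Finset.prod_pos fun p _ => (hpr p).pos)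
        calc _ ≤ W * ((∏ p ∈ S, prn p) * ∏ p ∈ S', prn p) * W := by
              refine (Nat.mul_le_mul_left W h4).trans (Nat.le_mul_of_pos_right _ hW0)
          _ = _ := by ring
      have h5 : W * ∏ p ∈ S ∪ S', prn p ≤ Q ^ 2 := by
        rw [sq]; exact h3.trans (Nat.mul_le_mul hi2 hj2)
      exact_mod_cast h5

lemma chi_card {W : ℕ} (hW0 : 0 < W) {prn : ι → ℕ} (hpr : ∀ p, (prn p).Prime) {Q Z : ℝ} (hQ0 : 0 ≤ Q)
    (hZ : ∏ p, (1 + (1 / (prn p : ℝ))) ≤ Z) (s : Finset (ChT W prn)) (hs : ∀ ψ ∈ s, (qc ψ : ℝ) ≤ Q) :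
    (s.card : ℝ) ≤ Q ^ 2 * Z := by
  classical
  haveI : NeZero W := ⟨hW0.ne'⟩
  haveI : ∀ p, NeZero (prn p) := fun p => ⟨(hpr p).ne_zero⟩
  have hcard : ∀ (n : ℕ) [NeZero n], (Fintype.card (DirichletCharacter ℂ n) : ℝ) ≤ n := by
    intro n _
    rw [← Nat.card_eq_fintype_card, DirichletCharacter.card_eq_totient_of_hasEnoughRootsOfUnity]
    exact_mod_cast Nat.totient_le n
  have hloc : ∀ p, ∑ η : DirichletCharacter ℂ (prn p), (if η = 1 then (1:ℝ) else 1 / (prn p : ℝ) ^ 2) ≤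
      1 + 1 / (prn p : ℝ) := by
    intro p
    have hp0 : (0:ℝ) < prn p := by exact_mod_cast (hpr p).pos
    rw [← Finset.add_sum_erase _ _ (mem_univ (1 : DirichletCharacter ℂ (prn p))), if_pos rfl]
    gcongr
    rw [Finset.sum_congr rfl (fun η hη => if_neg (Finset.ne_of_mem_erase hη)), Finset.sum_const,
      nsmul_eq_mul]
    have : (((univ : Finset (DirichletCharacter ℂ (prn p))).erase 1).card : ℝ) ≤ prn p :=
      le_trans (by exact_mod_cast (Finset.card_erase_le).trans (by simp)) (hcard (prn p))
    calc _ ≤ (prn p : ℝ) * (1 / (prn p : ℝ) ^ 2) := by gcongr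
      _ = _ := by field_simp
  have hq : ∀ ψ : ChT W prn, 1 / (qc ψ : ℝ) ^ 2 = 1 / (W:ℝ) ^ 2 *
      ∏ p, (if ψ.2 p = 1 then (1:ℝ) else 1 / (prn p : ℝ) ^ 2) := by
    intro ψ
    rw [qc]; push_cast
    rw [mul_pow, ← Finset.prod_pow, one_div, mul_inv, one_div, ← Finset.prod_inv_distrib]
    congr 1
    rw [Sc, Finset.prod_filter]
    refine Finset.prod_congr rfl fun p _ => ?_
    by_cases h : ψ.2 p = 1 <;> simp [h]
  calc (s.card : ℝ) = ∑ ψ ∈ s, 1 := by simp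
    _ ≤ ∑ ψ ∈ s, Q ^ 2 * (1 / (qc ψ : ℝ) ^ 2) := by
        refine Finset.sum_le_sum fun ψ hψ => ?_
        have h0 : (0:ℝ) < qc ψ := by
          exact_mod_cast Nat.mul_pos hW0 (Finset.prod_pos fun p _ => (hpr p).pos)
        rw [mul_one_div, one_le_div (by positivity)]
        gcongr
        exact hs ψ hψ
    _ ≤ ∑ ψ : ChT W prn, Q ^ 2 * (1 / (qc ψ : ℝ) ^ 2) :=
        Finset.sum_le_sum_of_subset_of_nonneg (Finset.subset_univ _) fun _ _ _ => by positivity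
    _ = Q ^ 2 * (1 / (W:ℝ) ^ 2 * (Fintype.card (DirichletCharacter ℂ W) *
          ∏ p, ∑ η : DirichletCharacter ℂ (prn p), (if η = 1 then (1:ℝ) else 1 / (prn p : ℝ) ^ 2))) := by
        rw [← Finset.mul_sum]
        congr 1
        simp_rw [hq]
        rw [← Finset.mul_sum, Fintype.sum_prod_type]
        congr 1
        rw [Fintype.prod_sum, ← nsmul_eq_mul, ← Finset.card_univ, ← Finset.sum_const]
    _ ≤ Q ^ 2 * (1 * Z) := by
        refine mul_le_mul_of_nonneg_left ?_ (by positivity)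
        rw [← mul_assoc]
        have hP : ∏ p, ∑ η : DirichletCharacter ℂ (prn p), (if η = 1 then (1:ℝ) else 1 / (prn p : ℝ) ^ 2) ≤ Z := by
          refine le_trans (Finset.prod_le_prod (fun p _ => Finset.sum_nonneg fun η _ => ?_) fun p _ => hloc p) hZ
          split_ifs <;> positivity
        have hP0 : 0 ≤ ∏ p, ∑ η : DirichletCharacter ℂ (prn p), (if η = 1 then (1:ℝ) else 1 / (prn p : ℝ) ^ 2) := by
          refine Finset.prod_nonneg fun p _ => Finset.sum_nonneg fun η _ => ?_
          split_ifs <;> positivity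
        refine mul_le_mul ?_ hP hP0 zero_le_one
        have hW1 : (1:ℝ) ≤ W := by exact_mod_cast hW0
        rw [one_div, inv_mul_le_iff₀ (by positivity), mul_one]
        refine (hcard W).trans ?_
        nlinarith
    _ = _ := by ring

end glob

end PD

namespace PD
open Finset

section glob
variable {ι κ : Type} [Fintype ι] [DecidableEq ι] [Fintype κ] [DecidableEq κ]

/-- residues -/
def uu (h : κ → ℕ) (i0 : κ) (q : ℕ) (i : κ) : ZMod q := (h i0 : ZMod q) - (h i : ZMod q)

open scoped Classical in
/-- local coefficient -/
noncomputable def kap {q : ℕ} (u : κ → ZMod q) (x y : Option κ) (η : DirichletCharacter ℂ q) : ℂ :=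
  x.elim (y.elim (if η = 1 then 1 else 0) (fun i => η (u i)⁻¹ / ((q:ℂ) - 1)))
    (fun i => y.elim (η (u i)⁻¹ / ((q:ℂ) - 1)) (fun i' => if i = i' then η (u i)⁻¹ / ((q:ℂ) - 1) else 0))

lemma dvd_char {q : ℕ} (hq : q.Prime) {u : ZMod q} (hu : u ≠ 0) (n : ZMod q) :
    (if u = n then (1:ℂ) else 0) = ∑ η : DirichletCharacter ℂ q, η u⁻¹ / ((q:ℂ) - 1) * η n := by
  haveI : NeZero q := ⟨hq.ne_zero⟩
  haveI : Fact q.Prime := ⟨hq⟩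
  have h := DirichletCharacter.sum_char_inv_mul_char_eq ℂ (IsUnit.mk0 u hu) n
  rw [Nat.totient_prime hq, Nat.cast_sub hq.one_le, Nat.cast_one] at h
  have hq1 : (q:ℂ) - 1 ≠ 0 := by
    rw [sub_ne_zero]; exact_mod_cast hq.one_lt.ne'
  calc _ = (if u = n then (q:ℂ) - 1 else 0) / ((q:ℂ) - 1) := by
        split_ifs
        · rw [div_self hq1]
        · simp
    _ = _ := by
        rw [← h, Finset.sum_div]
        refine Finset.sum_congr rfl fun η _ => by ring

lemma kap_expand (h : κ → ℕ) (i0 : κ) {q : ℕ} (hq : q.Prime) (hh : ∀ i, i ≠ i0 → ¬ h i0 ≡ h i [MOD q])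
    (m : ℕ) (hn : (m + h i0).Coprime q) (x y : Option κ) (hx : x ≠ some i0) (hy : y ≠ some i0)
    (hc : ∀ i i', i ≠ i' → ¬ h i ≡ h i' [MOD q]) :
    ((al h q m x * al h q m y : ℝ) : ℂ) =
      ∑ η : DirichletCharacter ℂ q, kap (uu h i0 q) x y η * η ((m + h i0 : ℕ) : ZMod q) := by
  classical
  have hu : ∀ i, i ≠ i0 → (h i0 : ZMod q) - h i ≠ 0 := by
    intro i hi h0
    rw [sub_eq_zero, ZMod.natCast_eq_natCast_iff] at h0
    exact hh i hi h0
  have hd : ∀ i, q ∣ m + h i ↔ (h i0 : ZMod q) - h i = ((m + h i0 : ℕ) : ZMod q) := by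
    intro i
    rw [← ZMod.natCast_eq_zero_iff]
    push_cast
    constructor
    · intro h0
      linear_combination -h0
    · intro h0
      linear_combination -h0
  have hal : ∀ i, ((al h q m (some i) : ℝ) : ℂ) =
      if (h i0 : ZMod q) - h i = ((m + h i0 : ℕ) : ZMod q) then (1:ℂ) else 0 := by
    intro i
    simp only [al, Option.elim, hd]
    split_ifs <;> simp
  have hsome : ∀ i, some i ≠ some i0 → ((al h q m (some i) : ℝ) : ℂ) = ∑ η : DirichletCharacter ℂ q,
      η ((h i0 : ZMod q) - h i)⁻¹ / ((q:ℂ) - 1) * η ((m + h i0 : ℕ) : ZMod q) := by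
    intro i hi
    rw [hal, dvd_char hq (hu i (by simpa using hi))]
  rcases x with _ | i <;> rcases y with _ | i'
  · simp only [al, kap, Option.elim, mul_one, ite_mul, zero_mul, one_mul, Finset.sum_ite_eq', mem_univ, if_true]
    rw [MulChar.one_apply]
    · simp
    · rwa [ZMod.isUnit_iff_coprime]
  · rw [Complex.ofReal_mul, hsome i' hy]
    simp [al, kap, uu]
  · rw [Complex.ofReal_mul, hsome i hx]
    simp [al, kap, uu]
  · by_cases hii : i = i'
    · subst hii
      have : al h q m (some i) * al h q m (some i) = al h q m (some i) := by
        simp only [al, Option.elim]; split_ifs <;> simp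
      rw [this, hsome i hx]
      simp [kap, uu]
    · rw [al_prod_zero h hc _ _ ⟨by simp, by simp, by simpa using hii⟩]
      simp [kap, hii]

lemma kap_one {h : κ → ℕ} {i0 : κ} {q : ℕ} (hq : q.Prime) (hh : ∀ i, i ≠ i0 → ¬ h i0 ≡ h i [MOD q])
    (x y : Option κ) (hx : x ≠ some i0) (hy : y ≠ some i0) :
    kap (uu h i0 q) x y 1 = ((Kl (1 / ((q:ℝ) - 1)) x y : ℝ) : ℂ) := by
  haveI : Fact q.Prime := ⟨hq⟩
  have hu : ∀ i, i ≠ i0 → (1 : DirichletCharacter ℂ q) ((h i0 : ZMod q) - h i)⁻¹ = 1 := by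
    intro i hi
    rw [MulChar.one_apply]
    refine IsUnit.mk0 _ (inv_ne_zero ?_)
    intro h0
    rw [sub_eq_zero, ZMod.natCast_eq_natCast_iff] at h0
    exact hh i hi h0
  rcases x with _ | i <;> rcases y with _ | i'
  · simp [kap, Kl]
  · simp [kap, Kl, uu, hu i' (by simpa using hy)]
  · simp [kap, Kl, uu, hu i (by simpa using hx)]
  · by_cases hii : i = i'
    · subst hii
      simp [kap, Kl, uu, hu i (by simpa using hx)]
    · simp [kap, Kl, hii]

open scoped Classical in
lemma kap_sum {q : ℕ} (hq : q.Prime) (u : κ → ZMod q) (η : DirichletCharacter ℂ q) :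
    ∑ x : Option κ, ∑ y : Option κ, ‖kap u x y η‖ ≤
      (if η = 1 then 1 else 0) + 3 * Fintype.card κ * (1 / ((q:ℝ) - 1)) := by
  have hq1 : (0:ℝ) < (q:ℝ) - 1 := by
    rw [sub_pos]; exact_mod_cast hq.one_lt
  have hb : ∀ i, ‖η (u i)⁻¹ / ((q:ℂ) - 1)‖ ≤ 1 / ((q:ℝ) - 1) := by
    intro i
    have e : (q:ℂ) - 1 = (((q:ℝ) - 1 : ℝ) : ℂ) := by push_cast; rfl
    rw [norm_div, e, Complex.norm_real, Real.norm_of_nonneg hq1.le]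
    gcongr
    exact η.norm_le_one _
  simp only [Fintype.sum_option, kap, Option.elim]
  have e1 : ‖(if η = 1 then (1:ℂ) else 0)‖ = if η = 1 then (1:ℝ) else 0 := by split_ifs <;> simp
  rw [e1]
  have e2 : ∑ i : κ, ‖η (u i)⁻¹ / ((q:ℂ) - 1)‖ ≤ Fintype.card κ * (1 / ((q:ℝ) - 1)) := by
    refine (Finset.sum_le_card_nsmul _ _ _ fun i _ => hb i).trans ?_
    simp
  have e3 : ∀ i : κ, ∑ i' : κ, ‖(if i = i' then η (u i)⁻¹ / ((q:ℂ) - 1) else 0)‖ = ‖η (u i)⁻¹ / ((q:ℂ) - 1)‖ := by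
    intro i
    rw [Finset.sum_eq_single i]
    · simp
    · intro b _ hbb; simp [Ne.symm hbb]
    · simp
  rw [Finset.sum_add_distrib]
  simp_rw [e3]
  linarith

/-- character coefficients -/
noncomputable def cpsi (prn : ι → ℕ) (h : κ → ℕ) (i0 : κ) (W b : ℕ) (l : (ι → Option κ) → ℝ)
    (ψ : ChT W prn) : ℂ :=
  1 / (W.totient : ℂ) * ψ.1 ((b + h i0 : ℕ) : ZMod W)⁻¹ *
    ∑ D, ∑ E, ((l D * l E : ℝ) : ℂ) * ∏ p, kap (uu h i0 (prn p)) (D p) (E p) (ψ.2 p)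

lemma S2_expand (prn : ι → ℕ) (hpr : ∀ p, (prn p).Prime) {W : ℕ} (hW0 : 0 < W) (b : ℕ) (h : κ → ℕ) (i0 : κ)
    (hh : ∀ p i i', i ≠ i' → ¬ h i ≡ h i' [MOD prn p]) (hb : (b + h i0).Coprime W)
    (l : (ι → Option κ) → ℝ) (hl : ∀ D p, D p = some i0 → l D = 0) (m : ℕ)
    (hn : ∀ p, (m + h i0).Coprime (prn p)) :
    (((if m ≡ b [MOD W] then Asum prn h l m ^ 2 else 0 : ℝ)) : ℂ) =
      ∑ ψ : ChT W prn, cpsi prn h i0 W b l ψ * chi ψ (m + h i0) := by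
  classical
  haveI : NeZero W := ⟨hW0.ne'⟩
  have hchi : ∀ ψ : ChT W prn, chi ψ (m + h i0) =
      ψ.1 ((m + h i0 : ℕ) : ZMod W) * ∏ p, ψ.2 p ((m + h i0 : ℕ) : ZMod (prn p)) := by
    intro ψ
    rw [chi]
    congr 1
    refine Finset.prod_subset (Finset.subset_univ _) fun p _ hp => ?_
    have : ψ.2 p = 1 := by by_contra hc; exact hp (mem_Sc.2 hc)
    rw [this, MulChar.one_apply]
    rw [ZMod.isUnit_iff_coprime]; exact hn p
  have hA : ((Asum prn h l m ^ 2 : ℝ) : ℂ) = ∑ D, ∑ E, ((l D * l E : ℝ) : ℂ) *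
      ∏ p, ∑ η : DirichletCharacter ℂ (prn p), kap (uu h i0 (prn p)) (D p) (E p) η *
        η ((m + h i0 : ℕ) : ZMod (prn p)) := by
    rw [Asum, sq, Finset.sum_mul_sum]
    push_cast
    refine Finset.sum_congr rfl fun D _ => Finset.sum_congr rfl fun E _ => ?_
    by_cases hD : ∃ p, D p = some i0
    · obtain ⟨p, hp⟩ := hD; simp [hl D p hp]
    by_cases hE : ∃ p, E p = some i0
    · obtain ⟨p, hp⟩ := hE; simp [hl E p hp]
    push Not at hD hE
    rw [mul_mul_mul_comm, ← Finset.prod_mul_distrib]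
    congr 1
    refine Finset.prod_congr rfl fun p _ => ?_
    have := kap_expand h i0 (hpr p) (fun i hi => hh p i0 i (Ne.symm hi)) m (hn p) (D p) (E p) (hD p) (hE p) (hh p)
    rw [← Complex.ofReal_mul, this]
    push_cast
    rfl
  have hWc : (if m ≡ b [MOD W] then (1:ℂ) else 0) = ∑ ξ : DirichletCharacter ℂ W,
      1 / (W.totient : ℂ) * ξ ((b + h i0 : ℕ) : ZMod W)⁻¹ * ξ ((m + h i0 : ℕ) : ZMod W) := by
    have h1 := DirichletCharacter.sum_char_inv_mul_char_eq ℂ ((ZMod.isUnit_iff_coprime (b + h i0) W).2 hb)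
      ((m + h i0 : ℕ) : ZMod W)
    simp_rw [mul_assoc]
    rw [← Finset.mul_sum, h1]
    have ht : (W.totient : ℂ) ≠ 0 := by exact_mod_cast (Nat.totient_pos.2 hW0).ne'
    have : ((b + h i0 : ℕ) : ZMod W) = ((m + h i0 : ℕ) : ZMod W) ↔ m ≡ b [MOD W] := by
      rw [ZMod.natCast_eq_natCast_iff]
      exact ⟨fun h => (Nat.ModEq.add_right_cancel' _ h).symm, fun h => (h.add_right _).symm⟩
    simp only [this]
    split_ifs
    · field_simp
    · simp
  have e0 : (((if m ≡ b [MOD W] then Asum prn h l m ^ 2 else 0 : ℝ)) : ℂ) =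
      (if m ≡ b [MOD W] then (1:ℂ) else 0) * ((Asum prn h l m ^ 2 : ℝ) : ℂ) := by
    split_ifs <;> simp
  rw [e0, hWc, hA, Fintype.sum_prod_type, Finset.sum_mul]
  refine Finset.sum_congr rfl fun ξ _ => ?_
  simp_rw [hchi, cpsi]
  have e1 : ∀ η : ∀ p, DirichletCharacter ℂ (prn p),
      1 / (W.totient : ℂ) * ξ ((b + h i0 : ℕ) : ZMod W)⁻¹ *
      (∑ D, ∑ E, ((l D * l E : ℝ) : ℂ) * ∏ p, kap (uu h i0 (prn p)) (D p) (E p) (η p)) *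
      (ξ ((m + h i0 : ℕ) : ZMod W) * ∏ p, η p ((m + h i0 : ℕ) : ZMod (prn p))) =
      1 / (W.totient : ℂ) * ξ ((b + h i0 : ℕ) : ZMod W)⁻¹ * ξ ((m + h i0 : ℕ) : ZMod W) *
      ∑ D, ∑ E, ((l D * l E : ℝ) : ℂ) * ∏ p, (kap (uu h i0 (prn p)) (D p) (E p) (η p) *
        η p ((m + h i0 : ℕ) : ZMod (prn p))) := by
    intro η
    simp_rw [Finset.prod_mul_distrib, ← mul_assoc, ← Finset.sum_mul]
    ring
  simp_rw [e1]
  rw [← Finset.mul_sum]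
  refine congrArg _ ?_
  symm
  rw [Finset.sum_comm]
  refine Finset.sum_congr rfl fun D _ => ?_
  rw [Finset.sum_comm]
  refine Finset.sum_congr rfl fun E _ => ?_
  rw [← Finset.mul_sum, Fintype.prod_sum]

lemma cpsi_one (prn : ι → ℕ) (hpr : ∀ p, (prn p).Prime) {W : ℕ} (hW0 : 0 < W) (b : ℕ) (h : κ → ℕ) (i0 : κ)
    (hh : ∀ p i i', i ≠ i' → ¬ h i ≡ h i' [MOD prn p]) (hb : (b + h i0).Coprime W)
    (l : (ι → Option κ) → ℝ) (hl : ∀ D p, D p = some i0 → l D = 0) :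
    cpsi prn h i0 W b l 1 = ((1 / (W.totient : ℝ) *
      ∑ D, ∑ E, l D * l E * ∏ p, Kl (1 / ((prn p : ℝ) - 1)) (D p) (E p) : ℝ) : ℂ) := by
  haveI : NeZero W := ⟨hW0.ne'⟩
  rw [cpsi]
  have h1 : (1 : DirichletCharacter ℂ W) ((b + h i0 : ℕ) : ZMod W)⁻¹ = 1 := by
    rw [MulChar.one_apply]
    refine IsUnit.of_mul_eq_one ((b + h i0 : ℕ) : ZMod W) ?_
    rw [mul_comm]; exact ZMod.coe_mul_inv_eq_one _ hb
  have h2 : (1 : ChT W prn).1 = 1 := rfl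
  have h3 : ∀ p, (1 : ChT W prn).2 p = 1 := fun _ => rfl
  simp_rw [h3]
  rw [h2, h1]
  push_cast
  rw [mul_one]
  congr 1
  refine Finset.sum_congr rfl fun D _ => Finset.sum_congr rfl fun E _ => ?_
  by_cases hD : ∃ p, D p = some i0
  · obtain ⟨p, hp⟩ := hD; simp [hl D p hp]
  by_cases hE : ∃ p, E p = some i0
  · obtain ⟨p, hp⟩ := hE; simp [hl E p hp]
  push Not at hD hE
  congr 1
  refine Finset.prod_congr rfl fun p _ => ?_
  exact kap_one (hpr p) (fun i hi => hh p i0 i (Ne.symm hi)) _ _ (hD p) (hE p)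

lemma cpsi_zero (prn : ι → ℕ) (hpr : ∀ p, (prn p).Prime) {W : ℕ} (b : ℕ) (h : κ → ℕ) (i0 : κ)
    (l : (ι → Option κ) → ℝ) {R : ℕ} (h0 : ∀ D, R < nN prn D → l D = 0) (ψ : ChT W prn)
    (hψ : R ^ 2 < ∏ p ∈ Sc ψ, prn p) : cpsi prn h i0 W b l ψ = 0 := by
  rw [cpsi, Finset.sum_eq_zero, mul_zero]
  intro D _
  refine Finset.sum_eq_zero fun E _ => ?_
  by_cases hD : R < nN prn D
  · simp [h0 D hD]
  by_cases hE : R < nN prn E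
  · simp [h0 E hE]
  push Not at hD hE
  have : ¬ Sc ψ ⊆ supp D ∪ supp E := by
    intro hc
    have h1 : ∏ p ∈ Sc ψ, prn p ≤ ∏ p ∈ supp D ∪ supp E, prn p :=
      Finset.prod_le_prod_of_subset_of_one_le' hc fun p _ _ => (hpr p).one_le
    have h2 := supp_union_le prn (fun p => (hpr p).pos) D E
    have h3 : nN prn D * nN prn E ≤ R ^ 2 := by rw [sq]; exact Nat.mul_le_mul hD hE
    omega
  rw [Finset.not_subset] at this
  obtain ⟨p, hp, hp2⟩ := this
  simp only [mem_union, supp, mem_filter, mem_univ, true_and, not_or, not_not] at hp2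
  rw [Finset.prod_eq_zero (mem_univ p), mul_zero]
  simp [kap, hp2.1, hp2.2, mem_Sc.1 hp]

lemma cpsi_bound (prn : ι → ℕ) (hpr : ∀ p, (prn p).Prime)
    (hbig : ∀ p, (3 * (Fintype.card κ : ℝ) + 1) ^ 2 ≤ prn p) {W : ℕ} (hW0 : 0 < W) (b : ℕ) (h : κ → ℕ) (i0 : κ)
    (l : (ι → Option κ) → ℝ) {Z : ℝ} (h1 : ∀ D, |l D| ≤ Z)
    (hZ : ∏ p, (1 + 3 * Fintype.card κ * (1 / ((prn p : ℝ) - 1))) ≤ Z) (ψ : ChT W prn) :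
    ‖cpsi prn h i0 W b l ψ‖ ≤ Z ^ 3 / Real.sqrt (∏ p ∈ Sc ψ, prn p : ℕ) := by
  classical
  have hZ0 : 0 ≤ Z := (abs_nonneg _).trans (h1 (fun _ => none))
  set k : ℝ := (Fintype.card κ : ℝ) with hk
  have hk0 : 0 ≤ k := by positivity
  have hq1 : ∀ p, (0:ℝ) < (prn p:ℝ) - 1 := fun p => by
    rw [sub_pos]; exact_mod_cast (hpr p).one_lt
  rw [cpsi, norm_mul, norm_mul]
  have e1 : ‖(1:ℂ) / (W.totient : ℂ)‖ ≤ 1 := by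
    rw [norm_div, norm_one, Complex.norm_natCast]
    have : (1:ℝ) ≤ W.totient := by exact_mod_cast Nat.totient_pos.2 hW0
    rw [div_le_one (by linarith)]; exact this
  have e2 := ψ.1.norm_le_one (((b + h i0 : ℕ) : ZMod W)⁻¹)
  have e3 : ‖∑ D, ∑ E, ((l D * l E : ℝ) : ℂ) * ∏ p, kap (uu h i0 (prn p)) (D p) (E p) (ψ.2 p)‖
      ≤ Z ^ 2 * (Z / Real.sqrt (∏ p ∈ Sc ψ, prn p : ℕ)) := by
    calc _ ≤ ∑ D : ι → Option κ, ∑ E : ι → Option κ, Z ^ 2 * ∏ p, ‖kap (uu h i0 (prn p)) (D p) (E p) (ψ.2 p)‖ := by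
          refine (norm_sum_le _ _).trans (Finset.sum_le_sum fun D _ => ?_)
          refine (norm_sum_le _ _).trans (Finset.sum_le_sum fun E _ => ?_)
          rw [norm_mul, norm_prod, Complex.norm_real, Real.norm_eq_abs, abs_mul, sq]
          gcongr
          · exact h1 D
          · exact h1 E
      _ = Z ^ 2 * ∏ p, ∑ x, ∑ y, ‖kap (uu h i0 (prn p)) x y (ψ.2 p)‖ := by
          simp_rw [← Finset.mul_sum]
          congr 1
          rw [Fintype.prod_sum]
          refine Finset.sum_congr rfl fun D _ => ?_
          rw [Fintype.prod_sum]
      _ ≤ Z ^ 2 * ∏ p, ((1 + 3 * k * (1 / ((prn p : ℝ) - 1))) *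
            (if ψ.2 p = 1 then 1 else 1 / Real.sqrt (prn p))) := by
          gcongr with p
          refine (kap_sum (hpr p) _ _).trans ?_
          rw [← hk]
          by_cases hp : ψ.2 p = 1
          · simp [hp]
          · rw [if_neg hp, if_neg hp, zero_add]
            have hs : 3 * k + 1 ≤ Real.sqrt (prn p) := Real.le_sqrt_of_sq_le (hbig p)
            have hs2 : Real.sqrt (prn p) ^ 2 = prn p := Real.sq_sqrt (by positivity)
            have h2 : 3 * k * (1 / ((prn p : ℝ) - 1)) ≤ 1 / Real.sqrt (prn p) := by
              rw [mul_one_div, div_le_div_iff₀ (hq1 p) (by linarith)]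
              nlinarith
            have h3 : (0:ℝ) ≤ 3 * k * (1 / ((prn p : ℝ) - 1)) := by
              have := hq1 p; positivity
            have h4 : (0:ℝ) ≤ 1 / Real.sqrt (prn p) := by positivity
            nlinarith
      _ ≤ Z ^ 2 * (Z / Real.sqrt (∏ p ∈ Sc ψ, prn p : ℕ)) := by
          rw [Finset.prod_mul_distrib]
          have : ∏ p, (if ψ.2 p = 1 then (1:ℝ) else 1 / Real.sqrt (prn p)) =
              1 / Real.sqrt (∏ p ∈ Sc ψ, prn p : ℕ) := by
            push_cast
            rw [Real.sqrt_prod _ (fun _ _ => by positivity), one_div, ← Finset.prod_inv_distrib, Sc, Finset.prod_filter]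
            refine Finset.prod_congr rfl fun p _ => ?_
            by_cases h : ψ.2 p = 1 <;> simp [h]
          rw [this, mul_one_div]
          gcongr
  calc _ ≤ 1 * 1 * (Z ^ 2 * (Z / Real.sqrt (∏ p ∈ Sc ψ, prn p : ℕ))) := by gcongr
    _ = _ := by ring

end glob

end PD

namespace PD
open Finset ArithmeticFunction

lemma wt_summable {ε : ℝ} (hε : 0 < ε) (j : ℕ) : Summable fun n : ℕ => vonMangoldt n * wt ε j n := by
  set δ : ℝ := ε / (2 * (j + 1)) with hδ
  have hδ0 : 0 < δ := by positivity
  have hs := (summable_zeta (half_pos hε)).mul_left ((1 / δ) ^ (j + 1))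
  refine Summable.of_nonneg_of_le (fun n => ?_) (fun n => ?_) hs
  · unfold wt
    exact mul_nonneg vonMangoldt_nonneg (mul_nonneg (pow_nonneg (Real.log_natCast_nonneg n) _) (by positivity))
  · rcases Nat.eq_zero_or_pos n with rfl | hn
    · simp; positivity
    have hn0 : (0:ℝ) < n := by exact_mod_cast hn
    have h1 : Real.log n ≤ (n:ℝ) ^ δ / δ := Real.log_le_rpow_div hn0.le hδ0
    have h0 := Real.log_natCast_nonneg n
    have h2 : Real.log n ^ (j + 1) ≤ (1 / δ) ^ (j + 1) * (n:ℝ) ^ (ε / 2) := by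
      calc Real.log n ^ (j + 1) ≤ ((n:ℝ) ^ δ / δ) ^ (j + 1) := by gcongr
        _ = (1 / δ) ^ (j + 1) * ((n:ℝ) ^ δ) ^ (j + 1) := by rw [← mul_pow]; congr 1; ring
        _ = _ := by
          rw [← Real.rpow_natCast ((n:ℝ) ^ δ), ← Real.rpow_mul hn0.le]
          congr 2; rw [hδ]; push_cast; field_simp
    calc vonMangoldt n * wt ε j n ≤ Real.log n * wt ε j n := by
          gcongr
          · unfold wt; positivity
          · exact vonMangoldt_le_log
      _ = Real.log n ^ (j + 1) * (n:ℝ) ^ (-(1 + ε)) := by unfold wt; ring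
      _ ≤ (1 / δ) ^ (j + 1) * (n:ℝ) ^ (ε / 2) * (n:ℝ) ^ (-(1 + ε)) := by gcongr
      _ = _ := by rw [mul_assoc, ← Real.rpow_add hn0]; congr 2; ring

lemma small_char {α : ℝ} {B j : ℕ} (hε : 0 < sE α j) (hg : GoodAt α B j) {q : ℕ} (hq : 0 < q)
    (χ : DirichletCharacter ℂ q) (hχ : χ ≠ 1) (hqB : (q:ℝ) ≤ sL α j ^ B) {U : ℝ} {y T : ℕ} (hy : 1 ≤ y) (hyT : y ≤ T)
    (hU : Real.log y ≤ U) (hT : ∑' n : ℕ, vonMangoldt (n + T) * wt (sE α j) j ((n + T : ℕ) : ℝ) ≤ 1) :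
    ‖∑ n ∈ Ico y T, ((vonMangoldt n * wt (sE α j) j n : ℝ) : ℂ) * χ n‖ ≤
      j.factorial / sE α j ^ (j + 1) * (1 / 2) ^ j * sL α j + U ^ (j + 1) * (1 + U) + 1 := by
  haveI : NeZero q := ⟨hq.ne'⟩
  have h1 := hg q χ hχ hqB
  set f : ℕ → ℂ := fun n => ((vonMangoldt n * wt (sE α j) j n : ℝ) : ℂ) * χ n with hf
  have hv : vS χ j (sE α j) = ∑' n, f n := rfl
  have hfn : ∀ n, ‖f n‖ ≤ vonMangoldt n * wt (sE α j) j n := by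
    intro n
    have h0 : 0 ≤ vonMangoldt n * wt (sE α j) j n := by
      unfold wt
      exact mul_nonneg vonMangoldt_nonneg (mul_nonneg (pow_nonneg (Real.log_natCast_nonneg n) _) (by positivity))
    rw [hf]; simp only
    rw [norm_mul, Complex.norm_real, Real.norm_of_nonneg h0]
    exact mul_le_of_le_one_right h0 (DirichletCharacter.norm_le_one _ _)
  have hs := wt_summable hε j
  have hfs : Summable f := Summable.of_norm_bounded hs hfn
  have e1 := hfs.sum_add_tsum_nat_add T
  have e2 := Finset.sum_range_add_sum_Ico f hyT
  have e3 : ∑ n ∈ Ico y T, f n = vS χ j (sE α j) - ∑ n ∈ range y, f n - ∑' n, f (n + T) := by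
    rw [hv, ← e1, ← e2]; ring
  rw [e3]
  have h2 : ‖∑ n ∈ range y, f n‖ ≤ U ^ (j + 1) * (1 + U) :=
    (norm_sum_le _ _).trans ((Finset.sum_le_sum fun n _ => hfn n).trans (small_le hε hy hU))
  have h3 : ‖∑' n, f (n + T)‖ ≤ 1 := by
    refine (tsum_of_norm_bounded ((summable_nat_add_iff T).2 hs).hasSum fun n => hfn (n + T)).trans hT
  calc _ ≤ ‖vS χ j (sE α j)‖ + ‖∑ n ∈ range y, f n‖ + ‖∑' n, f (n + T)‖ :=
        (norm_sub_le _ _).trans (by gcongr; exact norm_sub_le _ _)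
    _ ≤ _ := by gcongr

lemma T_exists {ε : ℝ} (hε : 0 < ε) (j a : ℕ) : ∀ᶠ T : ℕ in Filter.atTop,
    ∑' n : ℕ, vonMangoldt (n + T) * wt ε j ((n + T : ℕ) : ℝ) ≤ 1 ∧ T * wt ε a T ≤ 1 := by
  have h1 := tendsto_sum_nat_add (fun n : ℕ => vonMangoldt n * wt ε j n)
  have h2 : Filter.Tendsto (fun x : ℝ => Real.log x ^ a * x ^ (-ε)) Filter.atTop (nhds 0) := by
    have := (isLittleO_log_rpow_rpow_atTop (s := ε) (a : ℝ) hε).tendsto_div_nhds_zero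
    refine this.congr' ?_
    filter_upwards [Filter.eventually_gt_atTop 0] with x hx
    rw [Real.rpow_natCast, Real.rpow_neg hx.le, div_eq_mul_inv]
  have h2' := h2.comp tendsto_natCast_atTop_atTop (α := ℕ)
  filter_upwards [h1.eventually_le_const (by norm_num : (0:ℝ) < 1), h2'.eventually_le_const (by norm_num : (0:ℝ) < 1),
    Filter.eventually_gt_atTop 0] with T ha hb hT
  refine ⟨ha, le_trans (le_of_eq ?_) hb⟩
  have hT0 : (0:ℝ) < T := by exact_mod_cast hT
  simp only [Function.comp]
  unfold wt
  rw [show -(1 + ε) = -1 + -ε by ring, Real.rpow_add hT0, Real.rpow_neg_one]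
  field_simp

section glob
variable {ι : Type} [Fintype ι]

lemma big_char {ε : ℝ} (hε : 0 < ε) (hε1 : ε ≤ 1) {j : ℕ} {W : ℕ} (hW0 : 0 < W) {prn : ι → ℕ} (hpr : ∀ p, (prn p).Prime)
    (hinj : Function.Injective prn) (hW : ∀ p, ¬ prn p ∣ W) {Q : ℕ} (hQ : 2 ≤ Q) (hZ : ∏ p, (1 + (1 / (prn p : ℝ))) ≤ Q)
    (s : Finset (ChT W prn)) (hs : ∀ ψ ∈ s, ψ ≠ 1 ∧ qc ψ ≤ Q) {η : ℝ} (hη : 0 ≤ η) (c : ChT W prn → ℂ)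
    (hc : ∀ ψ ∈ s, ‖c ψ‖ ≤ η) {y T : ℕ} (hy : Q ^ 21 < y) (hyT : y < T)
    (ha : ((j + 4 : ℕ) : ℝ) ≤ Real.log ((y - 1 : ℕ) : ℝ)) (hT : T * wt ε (j + 4) T ≤ 1) :
    ‖∑ ψ ∈ s, c ψ * ∑ n ∈ Ico y T, ((vonMangoldt n * wt ε j n : ℝ) : ℂ) * chi ψ n‖ ≤
      448 * η * (1 + (j + 4).factorial / ε ^ (j + 5)) := by
  classical
  have hcard : (s.card : ℝ) ≤ (Q:ℝ) ^ 3 := by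
    have := chi_card hW0 hpr (Q := (Q:ℝ)) (by positivity) hZ s (fun ψ hψ => by exact_mod_cast (hs ψ hψ).2)
    calc _ ≤ _ := this
      _ = _ := by ring
  have hQ1 : (1:ℝ) ≤ Q := by exact_mod_cast (by omega : 1 ≤ Q)
  have hQ21 : 2 ^ 21 ≤ Q ^ 21 := Nat.pow_le_pow_left hQ 21
  have hfam := chi_fam hW0 hpr hinj hW Q s hs
  have hpart : ∀ x : ℕ, Q ^ 21 ≤ x → ‖∑ ψ ∈ s, c ψ * ∑ n ∈ Ioc 0 x, (vonMangoldt n : ℂ) * chi ψ n‖ ≤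
      7 * η * x * (1 + Real.log x) ^ 4 := by
    intro x hx
    have h := lemmaC hfam (one_le_pow₀ hQ1) (c := fun i : {ψ // ψ ∈ s} => c i.1) hη (fun i => hc i.1 i.2) x (Q ^ 8)
      (Nat.one_le_pow _ _ (by omega)) (by
        rw [Fintype.card_coe]; push_cast
        calc (s.card:ℝ) ^ 2 * (Q:ℝ) ^ 2 ≤ ((Q:ℝ) ^ 3) ^ 2 * (Q:ℝ) ^ 2 := by gcongr
          _ = (Q:ℝ) ^ 8 := by ring) (by
        rw [Fintype.card_coe]; push_cast
        calc (s.card:ℝ) * (Q:ℝ) ^ 2 * ((Q:ℝ) ^ 8) ^ 2 ≤ ((Q:ℝ) ^ 3) * (Q:ℝ) ^ 2 * ((Q:ℝ) ^ 8) ^ 2 := by gcongr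
          _ = (Q:ℝ) ^ 21 := by ring
          _ ≤ x := by exact_mod_cast hx)
    rw [← Finset.sum_coe_sort s (fun ψ => c ψ * ∑ n ∈ Ioc 0 x, (vonMangoldt n : ℂ) * chi ψ n)]
    exact h
  set cc : ℕ → ℂ := fun n => ∑ ψ ∈ s, c ψ * ((vonMangoldt n : ℂ) * chi ψ n) with hcc
  have hsum : ∑ ψ ∈ s, c ψ * ∑ n ∈ Ico y T, ((vonMangoldt n * wt ε j n : ℝ) : ℂ) * chi ψ n =
      ∑ n ∈ Ico y T, wt ε j n • cc n := by
    simp only [hcc, Finset.mul_sum, Finset.smul_sum]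
    rw [Finset.sum_comm]
    refine Finset.sum_congr rfl fun n _ => Finset.sum_congr rfl fun ψ _ => ?_
    rw [Complex.real_smul]; push_cast; ring
  have hlogm : ∀ n m : ℕ, 1 ≤ n → n ≤ m → Real.log n ≤ Real.log m := fun n m h1 h2 =>
    Real.log_le_log (by exact_mod_cast h1) (by exact_mod_cast h2)
  have ha' : ((j + 4 : ℕ) : ℝ) ≤ Real.log y := ha.trans (hlogm _ _ (by omega) (by omega))
  rw [hsum]
  have key := abel_wt hε hε1 (a := j) (by omega : 2 ≤ y) hyT (le_trans (by push_cast; linarith) ha') cc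
    (fun x => 14 * η * x * (1 + Real.log x) ^ 4) (by
      intro x hx
      have e : ∀ x : ℕ, ∑ n ∈ Ioc 0 x, cc n = ∑ ψ ∈ s, c ψ * ∑ n ∈ Ioc 0 x, (vonMangoldt n : ℂ) * chi ψ n := by
        intro x
        simp only [hcc, Finset.mul_sum]
        rw [Finset.sum_comm]
      have e2 : ∑ n ∈ Ico y (x + 1), cc n = ∑ n ∈ Ioc 0 x, cc n - ∑ n ∈ Ioc 0 (y - 1), cc n := by
        have e3 : Ico y (x + 1) = Ioc (y - 1) x := by ext n; simp; omega
        rw [e3, eq_sub_iff_add_eq, add_comm]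
        exact Finset.sum_Ioc_consecutive cc (by omega) (by omega)
      rw [e2, e, e]
      have h1 := hpart x (by omega)
      have h2 := hpart (y - 1) (by omega)
      have h3 : 7 * η * ((y - 1 : ℕ) : ℝ) * (1 + Real.log ((y - 1 : ℕ) : ℝ)) ^ 4 ≤ 7 * η * x * (1 + Real.log x) ^ 4 := by
        have h4 := hlogm (y - 1) x (by omega) (by omega)
        have h5 : 0 ≤ Real.log ((y - 1 : ℕ) : ℝ) := Real.log_natCast_nonneg _
        have h6 : ((y - 1 : ℕ) : ℝ) ≤ x := by exact_mod_cast (by omega : y - 1 ≤ x)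
        gcongr
      calc _ ≤ _ := norm_sub_le _ _
        _ ≤ _ := by linarith)
  refine key.trans ?_
  have hwlog : ∀ n : ℕ, y ≤ n → wt ε j n * (1 + Real.log n) ^ 4 ≤ 16 * wt ε (j + 4) n := by
    intro n hn
    have h1 : 1 ≤ Real.log n := by
      have := hlogm y n (by omega) hn
      have h4 : (4:ℝ) ≤ ((j + 4 : ℕ) : ℝ) := by push_cast; linarith [(Nat.cast_nonneg j : (0:ℝ) ≤ j)]
      linarith
    have h0 : 0 ≤ wt ε j n := wt_nonneg j (by exact_mod_cast (by omega : 1 ≤ n))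
    calc wt ε j n * (1 + Real.log n) ^ 4 ≤ wt ε j n * (2 * Real.log n) ^ 4 := by gcongr; linarith
      _ = 16 * wt ε (j + 4) n := by unfold wt; ring
  have hA : wt ε j T * (14 * η * ((T - 1 : ℕ) : ℝ) * (1 + Real.log ((T - 1 : ℕ) : ℝ)) ^ 4) ≤ 224 * η := by
    have h1 : ((T - 1 : ℕ) : ℝ) ≤ T := by exact_mod_cast Nat.sub_le T 1
    have h2 : Real.log ((T - 1 : ℕ) : ℝ) ≤ Real.log T := hlogm _ _ (by omega) (by omega)
    have h5 : 0 ≤ Real.log ((T - 1 : ℕ) : ℝ) := Real.log_natCast_nonneg _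
    have h0 : 0 ≤ wt ε j T := wt_nonneg j (by exact_mod_cast (by omega : 1 ≤ T))
    calc _ ≤ wt ε j T * (14 * η * (T : ℝ) * (1 + Real.log T) ^ 4) := by gcongr
      _ = 14 * η * T * (wt ε j T * (1 + Real.log T) ^ 4) := by ring
      _ ≤ 14 * η * T * (16 * wt ε (j + 4) T) := mul_le_mul_of_nonneg_left (hwlog T hyT.le) (by positivity)
      _ = 224 * η * (T * wt ε (j + 4) T) := by ring
      _ ≤ 224 * η * 1 := by gcongr
      _ = _ := by ring
  have hB : ∑ n ∈ Ico y T, 2 * wt ε j n / n * (14 * η * n * (1 + Real.log n) ^ 4) ≤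
      448 * η * ((j + 4).factorial / ε ^ (j + 5)) := by
    calc _ ≤ ∑ n ∈ Ico y T, 448 * η * wt ε (j + 4) n := by
          refine Finset.sum_le_sum fun n hn => ?_
          rw [mem_Ico] at hn
          have hn0 : (n:ℝ) ≠ 0 := by exact_mod_cast (by omega : n ≠ 0)
          have := hwlog n hn.1
          calc _ = 28 * η * (wt ε j n * (1 + Real.log n) ^ 4) := by field_simp; ring
            _ ≤ 28 * η * (16 * wt ε (j + 4) n) := by gcongr
            _ = _ := by ring
      _ = 448 * η * ∑ n ∈ Ico y T, wt ε (j + 4) n := by rw [Finset.mul_sum]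
      _ ≤ _ := by
        gcongr
        exact wt_sum_le hε (j + 4) (by omega) ha
  nlinarith

open scoped Classical in
lemma err_total [DecidableEq ι] {α : ℝ} {B j : ℕ} (hε : 0 < sE α j) (hε1 : sE α j ≤ 1) (hg : GoodAt α B j) (hsL : 0 ≤ sL α j)
    {W : ℕ} (hW0 : 0 < W) {prn : ι → ℕ} (hpr : ∀ p, (prn p).Prime)
    (hinj : Function.Injective prn) (hW : ∀ p, ¬ prn p ∣ W) {Q : ℕ} (hQ : 2 ≤ Q) {Z : ℝ}
    (hZ : ∏ p, (1 + (1 / (prn p : ℝ))) ≤ Z) (hZQ : Z ≤ Q) {η C : ℝ} (hη : 0 ≤ η) (c : ChT W prn → ℂ)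
    (hC : ∀ ψ, ‖c ψ‖ ≤ C) (hc0 : ∀ ψ, Q < qc ψ → c ψ = 0) (hcη : ∀ ψ, sL α j ^ B < qc ψ → ‖c ψ‖ ≤ η)
    {U : ℝ} {y T : ℕ} (hy : Q ^ 21 < y) (hyT : y < T) (hU : Real.log y ≤ U)
    (ha : ((j + 4 : ℕ) : ℝ) ≤ Real.log ((y - 1 : ℕ) : ℝ)) (hT : T * wt (sE α j) (j + 4) T ≤ 1)
    (hT2 : ∑' n : ℕ, vonMangoldt (n + T) * wt (sE α j) j ((n + T : ℕ) : ℝ) ≤ 1) :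
    ‖∑ ψ ∈ univ.filter (fun ψ : ChT W prn => ψ ≠ 1), c ψ * ∑ n ∈ Ico y T,
        (((if n.Prime then Real.log n * wt (sE α j) j n else 0 : ℝ)) : ℂ) * chi ψ n‖ ≤
      sL α j ^ (2 * B) * Z * C * (j.factorial / sE α j ^ (j + 1) * (1 / 2) ^ j * sL α j + U ^ (j + 1) * (1 + U) + 1)
      + 448 * η * (1 + (j + 4).factorial / sE α j ^ (j + 5))
      + (Q:ℝ) ^ 3 * C * ((y:ℝ) ^ (-(1:ℝ) / 4) * (16 * (j.factorial / sE α j ^ (j + 1)) + 8)) := by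
  have hC0 : 0 ≤ C := (norm_nonneg _).trans (hC 1)
  have hQ21 : 2 ^ 21 ≤ Q ^ 21 := Nat.pow_le_pow_left hQ 21
  have hQ1 : (1:ℝ) ≤ Q := by exact_mod_cast (by omega : 1 ≤ Q)
  have hlogm : ∀ n m : ℕ, 1 ≤ n → n ≤ m → Real.log n ≤ Real.log m := fun n m h1 h2 =>
    Real.log_le_log (by exact_mod_cast h1) (by exact_mod_cast h2)
  have hU0 : 0 ≤ U := (Real.log_natCast_nonneg y).trans hU
  have hZ0 : 0 ≤ Z := le_trans (Finset.prod_nonneg fun p _ => by positivity) hZ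
  set ε := sE α j with hεd
  set Lf : ChT W prn → ℂ := fun ψ => ∑ n ∈ Ico y T, ((vonMangoldt n * wt ε j n : ℝ) : ℂ) * chi ψ n with hLf
  set Nf : ChT W prn → ℂ := fun ψ => ∑ n ∈ Ico y T, (((if n.Prime then 0 else vonMangoldt n * wt ε j n : ℝ)) : ℂ) * chi ψ n with hNf
  have hsplit : ∀ ψ : ChT W prn, ∑ n ∈ Ico y T, (((if n.Prime then Real.log n * wt ε j n else 0 : ℝ)) : ℂ) * chi ψ n
      = Lf ψ - Nf ψ := by
    intro ψ
    rw [hLf, hNf]; simp only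
    rw [← Finset.sum_sub_distrib]
    refine Finset.sum_congr rfl fun n _ => ?_
    rw [← sub_mul, ← Complex.ofReal_sub]
    congr 2
    split_ifs with h
    · rw [vonMangoldt_apply_prime h]; ring
    · ring
  set s : Finset (ChT W prn) := univ.filter (fun ψ => ψ ≠ 1 ∧ qc ψ ≤ Q) with hs
  set sa := s.filter (fun ψ => (qc ψ : ℝ) ≤ sL α j ^ B) with hsa
  set sb := s.filter (fun ψ => ¬ (qc ψ : ℝ) ≤ sL α j ^ B) with hsb
  have hred : ∑ ψ ∈ univ.filter (fun ψ : ChT W prn => ψ ≠ 1), c ψ * ∑ n ∈ Ico y T,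
        (((if n.Prime then Real.log n * wt ε j n else 0 : ℝ)) : ℂ) * chi ψ n =
      ∑ ψ ∈ sa, c ψ * Lf ψ + ∑ ψ ∈ sb, c ψ * Lf ψ - ∑ ψ ∈ s, c ψ * Nf ψ := by
    rw [hsa, hsb, Finset.sum_filter_add_sum_filter_not, ← Finset.sum_sub_distrib]
    symm
    refine (Finset.sum_subset_zero_on_sdiff (fun ψ => ?_) ?_ ?_)
    · simp only [hs, mem_filter]; tauto
    · intro ψ hψ
      simp only [hs, mem_sdiff, mem_filter, mem_univ, true_and] at hψ
      rw [hc0 ψ (by by_contra hcon; exact hψ.2 ⟨hψ.1, by omega⟩), zero_mul]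
    · intro ψ _
      rw [hsplit, mul_sub]
  rw [hred]
  have hcardS : (s.card : ℝ) ≤ (Q:ℝ) ^ 3 := by
    have := chi_card hW0 hpr (Q := (Q:ℝ)) (by positivity) (hZ.trans hZQ) s
      (fun ψ hψ => by exact_mod_cast (mem_filter.1 hψ).2.2)
    calc _ ≤ _ := this
      _ = _ := by ring
  have hcardA : (sa.card : ℝ) ≤ sL α j ^ (2 * B) * Z := by
    have := chi_card hW0 hpr (Q := sL α j ^ B) (by positivity) hZ sa (fun ψ hψ => (mem_filter.1 hψ).2)
    calc _ ≤ _ := this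
      _ = _ := by ring
  have h1 : ‖∑ ψ ∈ sa, c ψ * Lf ψ‖ ≤ sL α j ^ (2 * B) * Z * C *
      (j.factorial / ε ^ (j + 1) * (1 / 2) ^ j * sL α j + U ^ (j + 1) * (1 + U) + 1) := by
    have hb : ∀ ψ ∈ sa, ‖c ψ * Lf ψ‖ ≤ C * (j.factorial / ε ^ (j + 1) * (1 / 2) ^ j * sL α j + U ^ (j + 1) * (1 + U) + 1) := by
      intro ψ hψ
      rw [norm_mul]
      have hψs := mem_filter.1 (mem_filter.1 hψ).1
      have hsm := small_char hε hg (Nat.mul_pos hW0 (Finset.prod_pos fun p _ => (hpr p).pos)) (TC (Sc ψ) ψ.1 ψ.2)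
        (TC_ne_one hW0 hpr hinj hW ψ hψs.2.1) (mem_filter.1 hψ).2 (by omega : 1 ≤ y) hyT.le hU hT2
      gcongr
      · exact hC ψ
      · rw [hLf]; simp only [chi_TC]; exact hsm
    calc _ ≤ ∑ ψ ∈ sa, ‖c ψ * Lf ψ‖ := norm_sum_le _ _
      _ ≤ sa.card • _ := Finset.sum_le_card_nsmul _ _ _ hb
      _ = sa.card * (C * (j.factorial / ε ^ (j + 1) * (1 / 2) ^ j * sL α j + U ^ (j + 1) * (1 + U) + 1)) := by rw [nsmul_eq_mul]
      _ ≤ (sL α j ^ (2 * B) * Z) * (C * (j.factorial / ε ^ (j + 1) * (1 / 2) ^ j * sL α j + U ^ (j + 1) * (1 + U) + 1)) := by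
        gcongr
      _ = _ := by ring
  have h2 : ‖∑ ψ ∈ sb, c ψ * Lf ψ‖ ≤ 448 * η * (1 + (j + 4).factorial / ε ^ (j + 5)) :=
    big_char hε hε1 hW0 hpr hinj hW hQ (hZ.trans hZQ) sb (fun ψ hψ => (mem_filter.1 (mem_filter.1 hψ).1).2) hη c
      (fun ψ hψ => hcη ψ (not_le.1 (mem_filter.1 hψ).2)) hy hyT ha hT
  have h3 : ‖∑ ψ ∈ s, c ψ * Nf ψ‖ ≤ (Q:ℝ) ^ 3 * C * ((y:ℝ) ^ (-(1:ℝ) / 4) * (16 * (j.factorial / ε ^ (j + 1)) + 8)) := by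
    have hpp := PP_le hε hε1 (a := j) (by omega : 3 ≤ y) hyT (le_trans (by push_cast; linarith) ha)
    have hlogT : 1 ≤ Real.log T := by
      have := hlogm (y - 1) T (by omega) (by omega)
      have h4 : (4:ℝ) ≤ ((j + 4 : ℕ) : ℝ) := by push_cast; linarith [(Nat.cast_nonneg j : (0:ℝ) ≤ j)]
      linarith
    have hT1 : T * wt ε j T ≤ 1 := by
      refine le_trans ?_ hT
      unfold wt
      gcongr
      omega
    have hb : ∀ ψ ∈ s, ‖c ψ * Nf ψ‖ ≤ C * ((y:ℝ) ^ (-(1:ℝ) / 4) * (16 * (j.factorial / ε ^ (j + 1)) + 8)) := by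
      intro ψ _
      rw [norm_mul]
      have hN : ‖Nf ψ‖ ≤ (y:ℝ) ^ (-(1:ℝ) / 4) * (16 * (j.factorial / ε ^ (j + 1)) + 8) := by
        refine (norm_sum_le _ _).trans ?_
        calc _ ≤ ∑ n ∈ Ico y T, (if n.Prime then 0 else vonMangoldt n * wt ε j n) := by
              refine Finset.sum_le_sum fun n hn => ?_
              have h0 : 0 ≤ (if n.Prime then 0 else vonMangoldt n * wt ε j n) := by
                split_ifs
                · exact le_rfl
                · exact mul_nonneg vonMangoldt_nonneg (wt_nonneg j (by
                    rw [mem_Ico] at hn; exact_mod_cast (by omega : 1 ≤ n)))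
              rw [norm_mul, Complex.norm_real, Real.norm_of_nonneg h0]
              exact mul_le_of_le_one_right h0 (chi_le ψ n)
          _ ≤ _ := hpp
          _ ≤ (y:ℝ) ^ (-(1:ℝ) / 4) * (16 * (j.factorial / ε ^ (j + 1)) + 8 * 1) := by gcongr
          _ = _ := by ring
      gcongr
      exact hC ψ
    calc _ ≤ ∑ ψ ∈ s, ‖c ψ * Nf ψ‖ := norm_sum_le _ _
      _ ≤ s.card • _ := Finset.sum_le_card_nsmul _ _ _ hb
      _ = s.card * (C * ((y:ℝ) ^ (-(1:ℝ) / 4) * (16 * (j.factorial / ε ^ (j + 1)) + 8))) := by rw [nsmul_eq_mul]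
      _ ≤ (Q:ℝ) ^ 3 * (C * ((y:ℝ) ^ (-(1:ℝ) / 4) * (16 * (j.factorial / ε ^ (j + 1)) + 8))) := by gcongr
      _ = _ := by ring
  calc _ ≤ ‖∑ ψ ∈ sa, c ψ * Lf ψ‖ + ‖∑ ψ ∈ sb, c ψ * Lf ψ‖ + ‖∑ ψ ∈ s, c ψ * Nf ψ‖ :=
        (norm_sub_le _ _).trans (by gcongr; exact norm_add_le _ _)
    _ ≤ _ := by gcongr

end glob
end PD

namespace PD
open Finset

section glob
variable {ι κ : Type} [Fintype ι] [DecidableEq ι] [Fintype κ] [DecidableEq κ]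

lemma chi_one {W : ℕ} {prn : ι → ℕ} {n : ℕ} (hn : n.Coprime W) : chi (1 : ChT W prn) n = 1 := by
  have : Sc (1 : ChT W prn) = ∅ := by
    ext p; simp [mem_Sc]
  unfold chi
  rw [this, Finset.prod_empty, mul_one]
  exact MulChar.one_apply ((ZMod.isUnit_iff_coprime n W).2 hn)

/-- the prime sum -/
noncomputable def S2s (prn : ι → ℕ) (h : κ → ℕ) (i0 : κ) (W b : ℕ) (l : (ι → Option κ) → ℝ) (f : ℕ → ℝ) (y T : ℕ) : ℝ :=
  ∑ n ∈ Ico y T, (if n.Prime then f n else 0) * (if n - h i0 ≡ b [MOD W] then Asum prn h l (n - h i0) ^ 2 else 0)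

open scoped Classical in
lemma S2_char (prn : ι → ℕ) (hpr : ∀ p, (prn p).Prime) {W : ℕ} (hW0 : 0 < W) (b : ℕ) (h : κ → ℕ) (i0 : κ)
    (hh : ∀ p i i', i ≠ i' → ¬ h i ≡ h i' [MOD prn p]) (hb : (b + h i0).Coprime W)
    (l : (ι → Option κ) → ℝ) (hl : ∀ D p, D p = some i0 → l D = 0) (f : ℕ → ℝ) {y T : ℕ}
    (hyW : W < y) (hyp : ∀ p, prn p < y) (hyh : h i0 ≤ y) :
    (1 / (W.totient : ℝ) * ∑ D, ∑ E, l D * l E * ∏ p, Kl (1 / ((prn p : ℝ) - 1)) (D p) (E p)) *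
      (∑ n ∈ Ico y T, if n.Prime then f n else 0) -
      ‖∑ ψ ∈ univ.filter (fun ψ : ChT W prn => ψ ≠ 1), cpsi prn h i0 W b l ψ * ∑ n ∈ Ico y T,
        (((if n.Prime then f n else 0 : ℝ)) : ℂ) * chi ψ n‖ ≤ S2s prn h i0 W b l f y T := by
  set err := ∑ ψ ∈ univ.filter (fun ψ : ChT W prn => ψ ≠ 1), cpsi prn h i0 W b l ψ * ∑ n ∈ Ico y T,
        (((if n.Prime then f n else 0 : ℝ)) : ℂ) * chi ψ n with herr
  have hcop : ∀ n, y ≤ n → n.Prime → ∀ q, 0 < q → q < y → n.Coprime q := by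
    intro n hn hp q hq0 hq
    rw [Nat.Prime.coprime_iff_not_dvd hp]
    intro hd
    have := Nat.le_of_dvd hq0 hd
    omega
  have hS : ((S2s prn h i0 W b l f y T : ℝ) : ℂ) =
      (((1 / (W.totient : ℝ) * ∑ D, ∑ E, l D * l E * ∏ p, Kl (1 / ((prn p : ℝ) - 1)) (D p) (E p)) *
      (∑ n ∈ Ico y T, if n.Prime then f n else 0) : ℝ) : ℂ) + err := by
    have e1 : ((S2s prn h i0 W b l f y T : ℝ) : ℂ) = ∑ ψ : ChT W prn, cpsi prn h i0 W b l ψ * ∑ n ∈ Ico y T,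
        (((if n.Prime then f n else 0 : ℝ)) : ℂ) * chi ψ n := by
      rw [S2s, Complex.ofReal_sum]
      simp only [Finset.mul_sum]
      rw [Finset.sum_comm]
      refine Finset.sum_congr rfl fun n hn => ?_
      rw [mem_Ico] at hn
      rw [Complex.ofReal_mul]
      by_cases hp : n.Prime
      · have hm : n - h i0 + h i0 = n := by omega
        rw [S2_expand prn hpr hW0 b h i0 hh hb l hl (n - h i0)
          (fun p => by rw [hm]; exact hcop n hn.1 hp _ (hpr p).pos (hyp p)), hm, Finset.mul_sum]
        refine Finset.sum_congr rfl fun ψ _ => ?_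
        ring
      · simp [hp]
    have e2 := Finset.sum_filter_add_sum_filter_not (s := (univ : Finset (ChT W prn))) (M := ℂ)
      (p := fun ψ : ChT W prn => ψ = 1)
      (f := fun ψ => cpsi prn h i0 W b l ψ * ∑ n ∈ Ico y T, (((if n.Prime then f n else 0 : ℝ)) : ℂ) * chi ψ n)
    rw [e1, ← e2, Finset.filter_eq' univ (1 : ChT W prn), if_pos (mem_univ _), Finset.sum_singleton,
      cpsi_one prn hpr hW0 b h i0 hh hb l hl]
    congr 1
    rw [Complex.ofReal_mul (1 / (W.totient : ℝ) * _)]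
    congr 1
    rw [Complex.ofReal_sum]
    refine Finset.sum_congr rfl fun n hn => ?_
    rw [mem_Ico] at hn
    by_cases hp : n.Prime
    · rw [chi_one (hcop n hn.1 hp W hW0 hyW), mul_one]
    · simp [hp]
  have hre := congrArg Complex.re hS
  rw [Complex.add_re, Complex.ofReal_re, Complex.ofReal_re] at hre
  have := (abs_le.1 (Complex.abs_re_le_norm err)).1
  rw [hre]; linarith

lemma Asum_nol (prn : ι → ℕ) (h : κ → ℕ) (i0 : κ) (l : (ι → Option κ) → ℝ) (m : ℕ) (hm : ∀ p, ¬ prn p ∣ m + h i0) :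
    Asum prn h (fun D => l D * ∏ p, nol i0 (D p)) m = Asum prn h l m := by
  unfold Asum
  refine Finset.sum_congr rfl fun D _ => ?_
  rw [mul_assoc, ← Finset.prod_mul_distrib]
  congr 1
  refine Finset.prod_congr rfl fun p _ => ?_
  unfold nol
  split_ifs with hD
  · rw [hD]; simp [al, hm p]
  · rw [one_mul]

lemma S2_sum_le (prn : ι → ℕ) (hpr : ∀ p, (prn p).Prime) (h : κ → ℕ) (W b : ℕ) (l : (ι → Option κ) → ℝ) {ε : ℝ}
    (hε : 0 < ε) {j Y H T : ℕ} (hY : 2 ≤ Y) (ha : ((j + 1 : ℕ) : ℝ) ≤ Real.log Y) (hp : ∀ p, prn p < Y) (hH : ∀ i, h i ≤ H)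
    (hone : ∀ m, Y ≤ m → ∀ i i', (m + h i).Prime → (m + h i').Prime → i = i') :
    ∑ i, S2s prn h i W b (fun D => l D * ∏ p, nol i (D p)) (fun n => Real.log n * wt ε j n) (Y + H) T ≤
      ∑ m ∈ Ico Y T, (if m ≡ b [MOD W] then wt ε (j + 1) m * Asum prn h l m ^ 2 else 0) := by
  have hlogm : ∀ n m : ℕ, 1 ≤ n → n ≤ m → Real.log n ≤ Real.log m := fun n m h1 h2 =>
    Real.log_le_log (by exact_mod_cast h1) (by exact_mod_cast h2)
  have hw0 : ∀ m, Y ≤ m → 0 ≤ wt ε (j + 1) m := fun m hm => wt_nonneg _ (by exact_mod_cast (by omega : 1 ≤ m))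
  set F : ℕ → ℝ := fun m => if m ≡ b [MOD W] then wt ε (j + 1) m * Asum prn h l m ^ 2 else 0 with hF
  have hF0 : ∀ m, Y ≤ m → 0 ≤ F m := by
    intro m hm
    simp only [hF]
    split_ifs
    · exact mul_nonneg (hw0 m hm) (sq_nonneg _)
    · exact le_rfl
  have h1 : ∀ i, S2s prn h i W b (fun D => l D * ∏ p, nol i (D p)) (fun n => Real.log n * wt ε j n) (Y + H) T ≤
      ∑ m ∈ Ico Y T, if (m + h i).Prime then F m else 0 := by
    intro i
    have hi := hH i
    have e1 : ∑ n ∈ Ico (Y + H) T, (fun m => if (m + h i).Prime then F m else 0) (n - h i) ≤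
        ∑ m ∈ Ico Y T, if (m + h i).Prime then F m else 0 := by
      have hinj : Set.InjOn (fun n => n - h i) (Ico (Y + H) T : Finset ℕ) := by
        intro a ha b hb hab
        simp only [coe_Ico, Set.mem_Ico] at ha hb hab
        omega
      rw [← Finset.sum_image hinj (f := fun m => if (m + h i).Prime then F m else 0)]
      refine Finset.sum_le_sum_of_subset_of_nonneg ?_ ?_
      · intro m hm
        simp only [mem_image, mem_Ico] at hm ⊢
        obtain ⟨n, hn, rfl⟩ := hm
        omega
      · intro m hm _
        rw [mem_Ico] at hm
        split_ifs
        · exact hF0 m hm.1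
        · exact le_rfl
    refine le_trans ?_ e1
    unfold S2s
    refine Finset.sum_le_sum fun n hn => ?_
    rw [mem_Ico] at hn
    have hm : n - h i + h i = n := by omega
    simp only [hm]
    by_cases hpn : n.Prime
    · simp only [hpn, if_true, hF]
      split_ifs with hb
      · rw [Asum_nol prn h i l (n - h i) (by
          intro p hd
          rw [hm] at hd
          have := (Nat.prime_dvd_prime_iff_eq (hpr p) hpn).1 hd
          have := hp p
          omega)]
        have hwt : Real.log n * wt ε j n = wt ε (j + 1) n := by unfold wt; ring
        rw [hwt]
        gcongr
        refine wt_anti hε (by exact_mod_cast (by omega : 1 < n - h i)) (by exact_mod_cast Nat.sub_le _ _) ?_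
        exact ha.trans (hlogm _ _ (by omega) (by omega))
      · simp
    · simp [hpn]
  refine (Finset.sum_le_sum fun i _ => h1 i).trans ?_
  rw [Finset.sum_comm]
  refine Finset.sum_le_sum fun m hm => ?_
  rw [mem_Ico] at hm
  by_cases hex : ∃ i, (m + h i).Prime
  · obtain ⟨i, hi⟩ := hex
    rw [Finset.sum_eq_single i]
    · simp [hi, hF]
    · intro i' _ hne
      rw [if_neg]
      intro hi'
      exact hne (hone m hm.1 i' i hi' hi)
    · simp
  · push Not at hex
    rw [Finset.sum_eq_zero (fun i _ => by simp [hex i])]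
    exact hF0 m hm.1

end glob
end PD

namespace PD
open Finset

section glob
variable {ι κ : Type} [Fintype ι] [DecidableEq ι] [Fintype κ] [DecidableEq κ]

/-- the error term -/
noncomputable def Err (L ε Z U : ℝ) (B j W Q y : ℕ) : ℝ :=
  L ^ (2 * (2 * B)) * Z * Z ^ 3 * (j.factorial / ε ^ (j + 1) * (1 / 2) ^ j * L + U ^ (j + 1) * (1 + U) + 1)
      + 448 * (Z ^ 3 * W / L ^ B) * (1 + (j + 4).factorial / ε ^ (j + 5))
      + (Q:ℝ) ^ 3 * Z ^ 3 * ((y:ℝ) ^ (-(1:ℝ) / 4) * (16 * (j.factorial / ε ^ (j + 1)) + 8))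

lemma master (prn : ι → ℕ) (hpr : ∀ p, (prn p).Prime) (hinj : Function.Injective prn) {W : ℕ}
    (hW0 : 0 < W) (hW : ∀ p, ¬ prn p ∣ W) (b : ℕ) (h : κ → ℕ)
    (hh : ∀ p i i', i ≠ i' → ¬ h i ≡ h i' [MOD prn p]) (hb : ∀ i, (b + h i).Coprime W)
    (hbig : ∀ p, (3 * (Fintype.card κ : ℝ) + 1) ^ 2 ≤ prn p) (hκ : 1 ≤ Fintype.card κ)
    (l : (ι → Option κ) → ℝ) {R : ℕ} (h0 : ∀ D, R < nN prn D → l D = 0) {Z : ℝ} (h1 : ∀ D, |l D| ≤ Z)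
    (hZ : ∏ p, (1 + 3 * Fintype.card κ * (1 / ((prn p : ℝ) - 1))) ≤ Z) (hZQ : Z ≤ (W * R ^ 2 : ℕ)) (hQ : 2 ≤ W * R ^ 2)
    (hpR : ∀ p, prn p ≤ R)
    {α : ℝ} {B j : ℕ} (hε : 0 < sE α j) (hε1 : sE α j ≤ 1) (hg : GoodAt α (2 * B) j)
    {Y H T : ℕ} {U : ℝ} (hY : (W * R ^ 2) ^ 21 < Y) (hYT : Y + H < T) (hH : ∀ i, h i ≤ H) (hU : Real.log (Y + H : ℕ) ≤ U)
    (ha : ((j + 4 : ℕ) : ℝ) ≤ Real.log ((Y - 1 : ℕ) : ℝ)) (hT : T * wt (sE α j) (j + 4) T ≤ 1)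
    (hT2 : ∑' n : ℕ, ArithmeticFunction.vonMangoldt (n + T) * wt (sE α j) j ((n + T : ℕ) : ℝ) ≤ 1)
    (hone : ∀ m i i', (m + h i).Prime → (m + h i').Prime → i = i')
    {V c2 Θ : ℝ} (hV : ∑ D, ∑ E, l D * l E * ∏ p, Kl (1 / (prn p : ℝ)) (D p) (E p) ≤ V) (hV0 : 0 ≤ V)
    (hc20 : 0 ≤ c2) (hΘ0 : 0 ≤ Θ)
    (hc2 : ∀ i, c2 ≤ 1 / (W.totient : ℝ) * ∑ D, ∑ E, (l D * ∏ p, nol i (D p)) * (l E * ∏ p, nol i (E p)) *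
      ∏ p, Kl (1 / ((prn p : ℝ) - 1)) (D p) (E p))
    (hΘ : Θ ≤ ∑ n ∈ Ico (Y + H) T, if n.Prime then Real.log n * wt (sE α j) j n else 0) :
    Fintype.card κ * (c2 * Θ - Err (sL α j) (sE α j) Z U B j W (W * R ^ 2) (Y + H)) ≤
      1 / W * ((j + 1).factorial / sE α j ^ (j + 2)) * V
      + 2 * (W * R ^ 2 : ℕ) * wt (sE α j) (j + 1) Y * (R * Z ^ 2) ^ 2 := by
  classical
  set Q := W * R ^ 2 with hQd
  have hQ21 : 2 ^ 21 ≤ Q ^ 21 := Nat.pow_le_pow_left hQ 21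
  have hQle : Q ≤ Q ^ 21 := Nat.le_self_pow (by norm_num) Q
  have hR0 : 0 < R := by
    rcases Nat.eq_zero_or_pos R with h | h
    · rw [h] at hQd; simp at hQd; omega
    · exact h
  have hRQ : R ≤ Q := by rw [hQd]; nlinarith [Nat.mul_le_mul hW0 (Nat.le_self_pow two_ne_zero R)]
  have hWQ : W ≤ Q := by rw [hQd]; exact Nat.le_mul_of_pos_right _ (by positivity)
  have hlogm : ∀ n m : ℕ, 1 ≤ n → n ≤ m → Real.log n ≤ Real.log m := fun n m h1 h2 =>
    Real.log_le_log (by exact_mod_cast h1) (by exact_mod_cast h2)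
  have hZ0 : 0 ≤ Z := (abs_nonneg _).trans (h1 (fun _ => none))
  have hp2 : ∀ p, (2:ℝ) ≤ prn p := fun p => by exact_mod_cast (hpr p).two_le
  have hκ1 : (1:ℝ) ≤ Fintype.card κ := by exact_mod_cast hκ
  have hloc : ∀ p, 1 / (prn p : ℝ) ≤ 1 / ((prn p : ℝ) - 1) := fun p => by
    have := hp2 p
    exact one_div_le_one_div_of_le (by linarith) (by linarith)
  have hloc0 : ∀ p, 0 ≤ 1 / (prn p : ℝ) := fun p => by positivity
  have hZ1 : ∏ p, (1 + (1 / (prn p : ℝ))) ≤ Z := by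
    refine le_trans (Finset.prod_le_prod (fun p _ => by positivity) fun p _ => ?_) hZ
    have := hloc p; have := hloc0 p
    nlinarith
  have hZ2 : ∏ p, (1 + Fintype.card κ * (1 / (prn p : ℝ))) ≤ Z := by
    refine le_trans (Finset.prod_le_prod (fun p _ => by positivity) fun p _ => ?_) hZ
    have := hloc p; have := hloc0 p
    nlinarith
  have hsL := sL_pos α j
  have hS1 := S1_upper prn hpr hinj hW0 hW b h hh (f := fun n => wt (sE α j) (j + 1) n) (Y := Y) (T := T)
    (fun n hn => wt_nonneg _ (by exact_mod_cast (by omega : 1 ≤ n)))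
    (fun n hn => wt_anti hε (by exact_mod_cast (by omega : 1 < n)) (by push_cast; linarith) (by
      have := hlogm (Y - 1) n (by omega) (by omega)
      push_cast at ha ⊢; linarith)) l h0
  have hS2 := S2_sum_le prn hpr h W b l hε (j := j) (Y := Y) (H := H) (T := T) (by omega) (by
      have := hlogm (Y - 1) Y (by omega) (by omega)
      push_cast at ha ⊢; linarith) (fun p => by have := hpR p; omega) hH (fun m _ => hone m)
  have hM1 : ∑ m ∈ Ico Y T, wt (sE α j) (j + 1) m ≤ (j + 1).factorial / sE α j ^ (j + 2) :=
    wt_sum_le hε (j + 1) (by omega) (le_trans (by push_cast; linarith) ha)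
  have hwY : 0 ≤ wt (sE α j) (j + 1) Y := wt_nonneg _ (by exact_mod_cast (by omega : 1 ≤ Y))
  have hM0 : 0 ≤ ∑ m ∈ Ico Y T, wt (sE α j) (j + 1) m := Finset.sum_nonneg fun m hm => by
    rw [mem_Ico] at hm; exact wt_nonneg _ (by exact_mod_cast (by omega : 1 ≤ m))
  have hup : ∑ m ∈ Ico Y T, (if m ≡ b [MOD W] then wt (sE α j) (j + 1) m * Asum prn h l m ^ 2 else 0) ≤
      1 / W * ((j + 1).factorial / sE α j ^ (j + 2)) * V
      + 2 * (Q : ℕ) * wt (sE α j) (j + 1) Y * (R * Z ^ 2) ^ 2 := by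
    refine hS1.trans ?_
    have hls := lam_sum prn (fun p => (hpr p).pos) l h0 h1 hZ2
    have hls0 : 0 ≤ ∑ D, |l D| := Finset.sum_nonneg fun D _ => abs_nonneg _
    have e : ((Q:ℕ):ℝ) = W * R ^ 2 := by rw [hQd]; push_cast; ring
    rw [e]
    apply add_le_add
    · calc _ ≤ 1 / (W:ℝ) * (∑ m ∈ Ico Y T, wt (sE α j) (j + 1) m) * V := by gcongr
        _ ≤ _ := by gcongr
    · gcongr
  have hlow : ∀ i, c2 * Θ - Err (sL α j) (sE α j) Z U B j W Q (Y + H) ≤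
      S2s prn h i W b (fun D => l D * ∏ p, nol i (D p)) (fun n => Real.log n * wt (sE α j) j n) (Y + H) T := by
    intro i
    set l' : (ι → Option κ) → ℝ := fun D => l D * ∏ p, nol i (D p) with hl'
    have hno : ∀ D : ι → Option κ, |∏ p, nol i (D p)| ≤ 1 := by
      intro D
      rw [Finset.abs_prod]
      refine Finset.prod_le_one (fun _ _ => abs_nonneg _) fun p _ => ?_
      unfold nol; split_ifs <;> simp
    have h1' : ∀ D, |l' D| ≤ Z := by
      intro D
      rw [hl']; simp only; rw [abs_mul]
      exact (mul_le_of_le_one_right (abs_nonneg _) (hno D)).trans (h1 D)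
    have h0' : ∀ D, R < nN prn D → l' D = 0 := by
      intro D hD; rw [hl']; simp only; rw [h0 D hD, zero_mul]
    have hl0 : ∀ D p, D p = some i → l' D = 0 := by
      intro D p hD
      rw [hl']; simp only
      rw [Finset.prod_eq_zero (mem_univ p) (by simp [nol, hD]), mul_zero]
    have key := S2_char prn hpr hW0 b h i hh (hb i) l' hl0 (fun n => Real.log n * wt (sE α j) j n) (y := Y + H) (T := T)
      (by omega) (fun p => by have := hpR p; omega) (by have := hH i; omega)
    refine le_trans ?_ key
    have hbd := cpsi_bound prn hpr hbig hW0 b h i l' h1' hZ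
    have hS1' : ∀ ψ : ChT W prn, 1 ≤ Real.sqrt (∏ p ∈ Sc ψ, prn p : ℕ) := fun ψ => by
      rw [Real.one_le_sqrt]
      exact_mod_cast (Finset.prod_pos fun p _ => (hpr p).pos)
    have herr := err_total hε hε1 hg hsL.le hW0 hpr hinj hW hQ hZ1 hZQ (η := Z ^ 3 * W / sL α j ^ B) (C := Z ^ 3)
      (by positivity) (cpsi prn h i W b l')
      (fun ψ => (hbd ψ).trans (div_le_self (by positivity) (hS1' ψ)))
      (fun ψ hψ => cpsi_zero prn hpr b h i l' h0' ψ (by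
        rw [qc, hQd] at hψ
        exact lt_of_mul_lt_mul_left hψ (Nat.zero_le _)))
      (fun ψ hψ => (hbd ψ).trans (by
        have hs := hS1' ψ
        have hW1 : (1:ℝ) ≤ W := by exact_mod_cast hW0
        have hq : sL α j ^ B ≤ W * Real.sqrt (∏ p ∈ Sc ψ, prn p : ℕ) := by
          refine abs_le_of_sq_le_sq' ?_ (by positivity) |>.2
          rw [mul_pow, Real.sq_sqrt (by positivity), ← pow_mul, mul_comm B 2]
          refine hψ.le.trans ?_
          rw [qc]; push_cast
          gcongr
          nlinarith
        rw [div_le_div_iff₀ (by linarith) (by positivity)]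
        calc Z ^ 3 * sL α j ^ B ≤ Z ^ 3 * (W * Real.sqrt (∏ p ∈ Sc ψ, prn p : ℕ)) := by gcongr
          _ = _ := by ring))
      (y := Y + H) (T := T) (U := U) (by omega) hYT hU
      (ha.trans (hlogm _ _ (by omega) (by omega))) hT hT2
    have hmain : c2 * Θ ≤ (1 / (W.totient : ℝ) * ∑ D, ∑ E, l' D * l' E * ∏ p, Kl (1 / ((prn p : ℝ) - 1)) (D p) (E p)) *
        (∑ n ∈ Ico (Y + H) T, if n.Prime then Real.log n * wt (sE α j) j n else 0) :=
      mul_le_mul (hc2 i) hΘ hΘ0 (hc20.trans (hc2 i))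
    exact sub_le_sub hmain herr
  calc _ = ∑ i : κ, (c2 * Θ - Err (sL α j) (sE α j) Z U B j W Q (Y + H)) := by
        rw [Finset.sum_const, Finset.card_univ, nsmul_eq_mul]
    _ ≤ _ := Finset.sum_le_sum fun i _ => hlow i
    _ ≤ _ := hS2
    _ ≤ _ := hup

end glob
end PD

namespace PD
open Finset

lemma Psi_tendsto {ε : ℝ} (hε : 0 < ε) (a : ℕ) : Filter.Tendsto (Psi ε a) Filter.atTop (nhds 0) := by
  have hpe : ∀ d : ℕ, Filter.Tendsto (fun u : ℝ => u ^ d * Real.exp (-ε * u)) Filter.atTop (nhds 0) := by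
    intro d
    have := (isLittleO_pow_exp_pos_mul_atTop d hε).tendsto_div_nhds_zero
    refine this.congr fun u => ?_
    rw [neg_mul, Real.exp_neg, div_eq_mul_inv]
  induction a with
  | zero =>
    have := (hpe 0).div_const ε
    simp only [pow_zero, one_mul, zero_div] at this
    exact this
  | succ a ih =>
    have := ((hpe (a + 1)).add (ih.const_mul ((a:ℝ) + 1))).div_const ε
    simp only [mul_zero, add_zero, zero_div] at this
    exact this

section est
variable {L ε : ℝ} {j : ℕ}

lemma gam_eq (hL : 0 < L) (hj : 1 ≤ j) (hε : ε = j / L) :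
    (j.factorial : ℝ) / ε ^ (j + 1) = j.factorial * L ^ (j + 1) / (j:ℝ) ^ (j + 1) := by
  have : (0:ℝ) < j := by exact_mod_cast hj
  rw [hε, div_pow]; field_simp

lemma gam_pow (hL : 0 < L) (hj : 1 ≤ j) (hε : ε = j / L) :
    (L / 7) ^ (j + 1) ≤ (j.factorial : ℝ) / ε ^ (j + 1) * (j * (1 / 2) ^ j) := by
  have hj0 : (0:ℝ) < j := by exact_mod_cast hj
  rw [gam_eq hL hj hε]
  have h1 : (j:ℝ) ^ j ≤ j.factorial * Real.exp j := by
    have := Real.pow_div_factorial_le_exp (j:ℝ) hj0.le j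
    rw [div_le_iff₀ (by positivity)] at this
    linarith
  have h2 : Real.exp j ≤ (7 / 2) ^ j := by
    have : Real.exp j = Real.exp 1 ^ j := by rw [← Real.exp_nat_mul, mul_one]
    rw [this]
    gcongr
    linarith [Real.exp_one_lt_d9]
  have h3 : (j:ℝ) ^ j ≤ j.factorial * (7 / 2) ^ j := h1.trans (by gcongr)
  have e : (j.factorial : ℝ) * L ^ (j + 1) / (j:ℝ) ^ (j + 1) * (j * (1 / 2) ^ j) =
      L ^ (j + 1) * (j.factorial * (1 / 2) ^ j / (j:ℝ) ^ j) := by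
    rw [pow_succ (j:ℝ)]; field_simp
  rw [e, div_pow, div_eq_mul_one_div]
  refine mul_le_mul_of_nonneg_left ?_ (by positivity)
  rw [div_le_div_iff₀ (by positivity) (by positivity), one_mul]
  have h7 : (7:ℝ) ^ (j + 1) = 7 * ((7 / 2) ^ j * 2 ^ j) := by rw [← mul_pow]; norm_num; ring
  have h8 : (1 / 2 : ℝ) ^ j * 2 ^ j = 1 := by rw [← mul_pow]; norm_num
  calc (j:ℝ) ^ j ≤ j.factorial * (7 / 2) ^ j := h3
    _ ≤ 7 * (j.factorial * (7 / 2) ^ j) := by nlinarith [show 0 ≤ (j.factorial : ℝ) * (7 / 2) ^ j by positivity]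
    _ = j.factorial * ((1 / 2) ^ j * 2 ^ j) * (7 * (7 / 2) ^ j) := by rw [h8]; ring
    _ = _ := by rw [h7]; ring

lemma gam_two (hL : 0 < L) (hj : 1 ≤ j) (hε : ε = j / L) (h2 : 2 * j ≤ L) :
    (2:ℝ) ^ j ≤ (j.factorial : ℝ) / ε ^ (j + 1) := by
  have hj0 : (0:ℝ) < j := by exact_mod_cast hj
  have e : (j.factorial : ℝ) / ε ^ (j + 1) = j.factorial * (L / j) ^ (j + 1) := by
    rw [gam_eq hL hj hε, div_pow]; ring
  rw [e]
  have h3 : 2 ≤ L / j := by rw [le_div_iff₀ hj0]; exact h2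
  have h4 : (1:ℝ) ≤ j.factorial := by exact_mod_cast Nat.factorial_pos j
  calc (2:ℝ) ^ j ≤ 2 ^ (j + 1) := by gcongr <;> norm_num
    _ ≤ (L / j) ^ (j + 1) := by gcongr
    _ ≤ _ := by nlinarith [show 0 ≤ (L / j) ^ (j + 1) by positivity]

lemma gam_one (hL : 0 < L) (hj : 1 ≤ j) (hε : ε = j / L) :
    ((j + 1).factorial : ℝ) / ε ^ (j + 2) ≤ 2 * L * ((j.factorial : ℝ) / ε ^ (j + 1)) := by
  have hj0 : (0:ℝ) < j := by exact_mod_cast hj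
  have hj1 : (1:ℝ) ≤ j := by exact_mod_cast hj
  have hε0 : 0 < ε := by rw [hε]; positivity
  have e : ((j + 1).factorial : ℝ) / ε ^ (j + 2) = ((j + 1) / ε) * ((j.factorial : ℝ) / ε ^ (j + 1)) := by
    rw [Nat.factorial_succ]; push_cast; field_simp; ring
  rw [e]
  gcongr
  rw [hε, div_div_eq_mul_div, div_le_iff₀ hj0]
  nlinarith

lemma gam_four (hL : 0 < L) (hj : 1 ≤ j) (hε : ε = j / L) :
    ((j + 4).factorial : ℝ) / ε ^ (j + 5) ≤ 625 * L ^ 4 * ((j.factorial : ℝ) / ε ^ (j + 1)) := by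
  have hj0 : (0:ℝ) < j := by exact_mod_cast hj
  have hj1 : (1:ℝ) ≤ j := by exact_mod_cast hj
  have hε0 : 0 < ε := by rw [hε]; positivity
  have e : ((j + 4).factorial : ℝ) / ε ^ (j + 5) =
      (((j + 4) / ε) * ((j + 3) / ε) * ((j + 2) / ε) * ((j + 1) / ε)) * ((j.factorial : ℝ) / ε ^ (j + 1)) := by
    rw [Nat.factorial_succ, Nat.factorial_succ, Nat.factorial_succ, Nat.factorial_succ]; push_cast; field_simp; ring
  have hb : ∀ c : ℝ, 0 ≤ c → c ≤ 4 → (j + c) / ε ≤ 5 * L := by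
    intro c _ hc
    rw [hε, div_div_eq_mul_div, div_le_iff₀ hj0]
    nlinarith
  rw [e]
  refine mul_le_mul_of_nonneg_right ?_ (by positivity)
  calc ((j + 4) / ε) * ((j + 3) / ε) * ((j + 2) / ε) * ((j + 1) / ε) ≤ (5 * L) * (5 * L) * (5 * L) * (5 * L) := by
        gcongr
        · exact hb 4 (by norm_num) (by norm_num)
        · exact hb 3 (by norm_num) (by norm_num)
        · exact hb 2 (by norm_num) (by norm_num)
        · exact hb 1 (by norm_num) (by norm_num)
    _ = _ := by ring

lemma Err_le (hL : 2 ≤ L) (hj : 1 ≤ j) (hε : ε = j / L) (h2 : 2 * j ≤ L) {A W Q y : ℕ}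
    (hM : L ^ (16 * A + 18) = 2 ^ j) (hQ : (L ^ A) ^ 3 ≤ Q) (hQ0 : 1 ≤ Q) (hy : Q ^ 21 ≤ y) (hW : 1 ≤ W) :
    Err L ε (L ^ A) (L / 7) (3 * A + 4) j W Q y ≤ 300000 * W * ((j.factorial : ℝ) / ε ^ (j + 1)) := by
  have hL0 : 0 < L := by linarith
  have hj0 : (0:ℝ) < j := by exact_mod_cast hj
  have hG2 := gam_two hL0 hj hε h2
  have hG7 := gam_pow hL0 hj hε
  have hG4 := gam_four hL0 hj hε
  have hG1 : (1:ℝ) ≤ (j.factorial : ℝ) / ε ^ (j + 1) := le_trans (one_le_pow₀ (by norm_num)) hG2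
  unfold Err
  generalize (j.factorial : ℝ) / ε ^ (j + 1) = G at *
  generalize ((j + 4).factorial : ℝ) / ε ^ (j + 5) = G' at *
  have h12 : (2:ℝ) ^ j * (1 / 2) ^ j = 1 := by rw [← mul_pow]; norm_num
  have hx0 : (0:ℝ) < (1 / 2) ^ j := by positivity
  have hW1 : (1:ℝ) ≤ W := by exact_mod_cast hW
  have hA : L ^ (2 * (2 * (3 * A + 4))) * L ^ A * (L ^ A) ^ 3 *
      (G * (1 / 2) ^ j * L + (L / 7) ^ (j + 1) * (1 + L / 7) + 1) ≤ 3 * G := by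
    have e : L ^ (2 * (2 * (3 * A + 4))) * L ^ A * (L ^ A) ^ 3 = L ^ (16 * A + 16) := by
      rw [← pow_mul, ← pow_add, ← pow_add]; congr 1; ring
    rw [e]
    have hj2 : (j:ℝ) * (1 + L / 7) ≤ L ^ 2 := by nlinarith
    have hin : G * (1 / 2) ^ j * L + (L / 7) ^ (j + 1) * (1 + L / 7) + 1 ≤ L ^ 2 * (2 * (G * (1 / 2) ^ j) + 1) := by
      have t1 : G * (1 / 2) ^ j * L ≤ G * (1 / 2) ^ j * L ^ 2 := by gcongr; nlinarith
      have t2 : (L / 7) ^ (j + 1) * (1 + L / 7) ≤ G * (1 / 2) ^ j * L ^ 2 := by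
        calc _ ≤ G * (j * (1 / 2) ^ j) * (1 + L / 7) := by gcongr
          _ = G * (1 / 2) ^ j * (j * (1 + L / 7)) := by ring
          _ ≤ _ := by gcongr
      nlinarith
    calc _ ≤ L ^ (16 * A + 16) * (L ^ 2 * (2 * (G * (1 / 2) ^ j) + 1)) := by gcongr
      _ = L ^ (16 * A + 18) * (2 * (G * (1 / 2) ^ j) + 1) := by ring
      _ = 2 * G * (2 ^ j * (1 / 2) ^ j) + 2 ^ j := by rw [hM]; ring
      _ ≤ _ := by rw [h12]; linarith
  have hB : 448 * ((L ^ A) ^ 3 * W / L ^ (3 * A + 4)) * (1 + G') ≤ 448 * W * (626 * G) := by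
    have e : (L ^ A) ^ 3 * W / L ^ (3 * A + 4) = W / L ^ 4 := by
      rw [← pow_mul, pow_add, mul_comm A 3]; field_simp
    rw [e]
    have h4 : (1:ℝ) ≤ L ^ 4 := one_le_pow₀ (by linarith)
    calc 448 * (W / L ^ 4) * (1 + G') ≤ 448 * (W / L ^ 4) * (1 * (L ^ 4 * G) + 625 * L ^ 4 * G) := by
          gcongr
          nlinarith
      _ = _ := by field_simp; ring
  have hC : (Q:ℝ) ^ 3 * (L ^ A) ^ 3 * ((y:ℝ) ^ (-(1:ℝ) / 4) * (16 * G + 8)) ≤ 24 * G := by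
    have hQ1 : (1:ℝ) ≤ Q := by exact_mod_cast hQ0
    have hyq : (Q:ℝ) ^ 16 ≤ y := by
      have : (Q:ℝ) ^ 21 ≤ y := by exact_mod_cast hy
      exact (pow_le_pow_right₀ hQ1 (by norm_num)).trans this
    have h1 : (y:ℝ) ^ (-(1:ℝ) / 4) ≤ 1 / (Q:ℝ) ^ 4 := by
      calc (y:ℝ) ^ (-(1:ℝ) / 4) ≤ ((Q:ℝ) ^ 16) ^ (-(1:ℝ) / 4) :=
            Real.rpow_le_rpow_of_nonpos (by positivity) hyq (by norm_num)
        _ = _ := by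
          rw [← Real.rpow_natCast, ← Real.rpow_mul (by positivity)]
          norm_num
    calc _ ≤ (Q:ℝ) ^ 3 * Q * (1 / (Q:ℝ) ^ 4 * (16 * G + 8)) := by gcongr
      _ = 16 * G + 8 := by field_simp
      _ ≤ _ := by linarith
  nlinarith [mul_le_mul hW1 hG1 (by norm_num) (by linarith), mul_le_mul_of_nonneg_right hW1 (by linarith : 0 ≤ G)]

lemma Theta_final (hL : 7 ≤ L) (hj : 1 ≤ j) (hε : ε = j / L) (hjj : (j:ℝ) * (1 / 2) ^ j ≤ 1 / 100) {y T : ℕ}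
    (hy : 10 ^ 8 ≤ y) (hT : y ≤ T) (ha : (j:ℝ) ≤ Real.log y) (hU : Real.log y ≤ L / 7)
    (hPsi : Psi ε j (Real.log T) ≤ 1 / 100 * ((j.factorial : ℝ) / ε ^ (j + 1))) :
    1 / 4 * ((j.factorial : ℝ) / ε ^ (j + 1)) ≤ ∑ n ∈ Ico y T, if n.Prime then Real.log n * wt ε j n else 0 := by
  have hj0 : (0:ℝ) < j := by exact_mod_cast hj
  have hε0 : 0 < ε := by rw [hε]; positivity
  have h1 := Theta_lower hε0 hy hT ha
  have h2 := wt_sum_ge hε0 j (by omega : 2 < y) hT ha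
  have hlog : 0 < Real.log y := by linarith [(by exact_mod_cast hj : (1:ℝ) ≤ j)]
  have h3 := Psi_lower hε0 hlog j
  have hG0 : 0 ≤ (j.factorial : ℝ) / ε ^ (j + 1) := by positivity
  have h4 : (L / 7) ^ (j + 1) ≤ 1 / 100 * ((j.factorial : ℝ) / ε ^ (j + 1)) := by
    have := gam_pow (by linarith : 0 < L) hj hε
    nlinarith
  have h5 : Real.log y ^ (j + 1) ≤ (L / 7) ^ (j + 1) := by gcongr
  have hy0 : (1:ℝ) ≤ y := by exact_mod_cast (by omega : 1 ≤ y)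
  have h6 : y * wt ε j y ≤ (L / 7) ^ (j + 1) := by
    unfold wt
    have e : (y:ℝ) * (Real.log y ^ j * (y:ℝ) ^ (-(1 + ε))) = Real.log y ^ j * (y:ℝ) ^ (-ε) := by
      rw [show -(1 + ε) = -1 + -ε by ring, Real.rpow_add (by linarith), Real.rpow_neg_one]; field_simp
    rw [e]
    calc Real.log y ^ j * (y:ℝ) ^ (-ε) ≤ (L / 7) ^ j * 1 := by
          gcongr
          exact Real.rpow_le_one_of_one_le_of_nonpos hy0 (by linarith)
      _ ≤ _ := by rw [mul_one]; exact pow_le_pow_right₀ (by linarith) (by omega)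
  linarith

end est
end PD

namespace PD
open Finset

lemma harm_large (C : ℝ) : ∃ k : ℕ, 1 ≤ k ∧ C < harm k := by
  have h := Real.tendsto_sum_range_one_div_nat_succ_atTop
  obtain ⟨k, hk, hk1⟩ := ((h.eventually (Filter.eventually_gt_atTop C)).and (Filter.eventually_ge_atTop 1)).exists
  refine ⟨k, hk1, ?_⟩
  have e : harm k = ∑ i ∈ range k, (1 / ((i:ℝ) + 1)) := Finset.sum_congr rfl fun l _ => by rw [add_comm]
  rw [e]; exact hk

lemma residue_avoid {k : ℕ} (h : Fin k → ℕ) (hd : ∀ i, k.factorial ∣ h i) {p : ℕ} (hp : p.Prime) :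
    ∃ a : ℕ, ∀ i, ¬ p ∣ a + h i := by
  rcases le_or_gt p k with hpk | hpk
  · refine ⟨1, fun i hi => ?_⟩
    have h1 : p ∣ h i := ((Nat.dvd_factorial hp.pos hpk).trans (hd i))
    exact hp.one_lt.ne' (Nat.dvd_one.1 ((Nat.dvd_add_left h1).1 hi))
  · by_contra hcon
    push Not at hcon
    have : ∀ a : Fin p, ∃ i, p ∣ a.1 + h i := fun a => hcon a.1
    choose f hf using this
    have hinj : Function.Injective f := by
      intro a a' haa
      have h1 := hf a
      have h2 := hf a'
      rw [haa] at h1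
      have h3 : a.1 ≡ a'.1 [MOD p] := by
        have : a.1 + h (f a') ≡ a'.1 + h (f a') [MOD p] :=
          ((Nat.modEq_zero_iff_dvd.2 h1)).trans (Nat.modEq_zero_iff_dvd.2 h2).symm
        exact Nat.ModEq.add_right_cancel' _ this
      exact Fin.ext (Nat.ModEq.eq_of_lt_of_lt h3 a.2 a'.2)
    have := Fintype.card_le_of_injective f hinj
    simp at this
    omega

lemma Wb_exists {k : ℕ} (D0 : ℕ) (h : Fin k → ℕ) (hinj : Function.Injective h) (hd : ∀ i, k.factorial ∣ h i) :
    ∃ W b : ℕ, 0 < W ∧ (∀ p : ℕ, p.Prime → ¬ p ∣ W → D0 < p ∧ ∀ i i', i ≠ i' → ¬ h i ≡ h i' [MOD p]) ∧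
      ∀ i, (b + h i).Coprime W := by
  classical
  set W := D0.factorial * ∏ x ∈ (univ : Finset (Fin k × Fin k)).filter (fun x => h x.1 ≠ h x.2),
    ((h x.1 : ℤ) - h x.2).natAbs with hW
  have hW0 : 0 < W := by
    refine Nat.mul_pos (Nat.factorial_pos _) (Finset.prod_pos fun x hx => ?_)
    have := (mem_filter.1 hx).2
    omega
  have hres : ∀ p : ℕ, ∃ a : ℕ, p.Prime → ∀ i, ¬ p ∣ a + h i := by
    intro p
    by_cases hp : p.Prime
    · obtain ⟨a, ha⟩ := residue_avoid h hd hp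
      exact ⟨a, fun _ => ha⟩
    · exact ⟨0, fun h => absurd h hp⟩
  choose a ha using hres
  obtain ⟨b, hb⟩ := Nat.chineseRemainderOfFinset a id W.primeFactors
    (fun p hp => (Nat.prime_of_mem_primeFactors hp).ne_zero)
    (fun p hp q hq hpq => (Nat.coprime_primes (Nat.prime_of_mem_primeFactors hp) (Nat.prime_of_mem_primeFactors hq)).2 hpq)
  refine ⟨W, b, hW0, fun p hp hpW => ⟨?_, fun i i' hii hmod => hpW ?_⟩, fun i => ?_⟩
  · by_contra hc
    exact hpW ((hp.dvd_factorial.2 (not_lt.1 hc)).trans (Dvd.intro _ rfl))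
  · have hm : (i, i') ∈ (univ : Finset (Fin k × Fin k)).filter (fun x => h x.1 ≠ h x.2) := by
      simp [hinj.ne hii]
    have h1 : p ∣ ((h i : ℤ) - h i').natAbs := by
      have := (Nat.modEq_iff_dvd.1 hmod.symm)
      exact Int.natCast_dvd.1 this
    exact (h1.trans (Finset.dvd_prod_of_mem (fun x : Fin k × Fin k => ((h x.1 : ℤ) - h x.2).natAbs) hm)).trans
      (Dvd.intro_left _ rfl)
  · refine Nat.coprime_of_dvd fun p hp h1 h2 => ?_
    have hbp : b ≡ a p [MOD p] := hb p (Nat.mem_primeFactors.2 ⟨hp, h2, hW0.ne'⟩)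
    exact ha p hp i (((hbp.add_right (h i)).dvd_iff dvd_rfl).1 h1)

lemma E1_le {L ε : ℝ} {j : ℕ} (hL : 0 < L) (hj : 1 ≤ j) (hε : ε = j / L) (hjj : (j:ℝ) * (1 / 2) ^ j ≤ 1 / 100)
    {W R Y : ℕ} {Z : ℝ} (hZ0 : 0 ≤ Z) (hW : 1 ≤ W) (hR : 1 ≤ R) (hZ : Z ≤ (W * R ^ 2 : ℕ)) (hY : (W * R ^ 2) ^ 21 < Y)
    (hU : Real.log Y ≤ L / 7) :
    2 * (W * R ^ 2 : ℕ) * wt ε (j + 1) Y * (R * Z ^ 2) ^ 2 ≤ 2 * ((j.factorial : ℝ) / ε ^ (j + 1)) := by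
  have hj0 : (0:ℝ) < j := by exact_mod_cast hj
  have hε0 : 0 < ε := by rw [hε]; positivity
  set Γ := (j.factorial : ℝ) / ε ^ (j + 1) with hΓ
  have hΓ0 : 0 ≤ Γ := by positivity
  have hG := gam_pow hL hj hε
  rw [← hΓ] at hG
  set Q := W * R ^ 2 with hQ
  have hQ1 : 1 ≤ Q := Nat.mul_pos hW (by positivity)
  have hQr : (1:ℝ) ≤ Q := by exact_mod_cast hQ1
  have hY1 : (1:ℝ) ≤ Y := by exact_mod_cast (Nat.one_le_iff_ne_zero.2 (by omega))
  have hYQ : (Q:ℝ) ^ 21 ≤ Y := by exact_mod_cast hY.le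
  have hwt : wt ε (j + 1) Y ≤ Γ / Y := by
    unfold wt
    have h1 : Real.log Y ^ (j + 1) ≤ Γ := by
      calc Real.log Y ^ (j + 1) ≤ (L / 7) ^ (j + 1) := by
            gcongr
        _ ≤ Γ * (j * (1 / 2) ^ j) := hG
        _ ≤ Γ * (1 / 100) := by gcongr
        _ ≤ Γ := by linarith
    have h2 : (Y:ℝ) ^ (-(1 + ε)) ≤ 1 / Y := by
      calc (Y:ℝ) ^ (-(1 + ε)) ≤ (Y:ℝ) ^ (-1 : ℝ) := Real.rpow_le_rpow_of_exponent_le hY1 (by linarith)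
        _ = _ := by rw [Real.rpow_neg_one, one_div]
    calc _ ≤ Γ * (1 / Y) := by gcongr
      _ = _ := by ring
  have hRQ : (R:ℝ) ^ 2 ≤ Q := by
    have : R ^ 2 ≤ Q := by rw [hQ]; exact Nat.le_mul_of_pos_left _ hW
    exact_mod_cast this
  have hwt0 : 0 ≤ wt ε (j + 1) Y := wt_nonneg _ hY1
  calc 2 * (Q:ℝ) * wt ε (j + 1) Y * (R * Z ^ 2) ^ 2 = 2 * (Q:ℝ) * wt ε (j + 1) Y * (R ^ 2 * Z ^ 4) := by ring
    _ ≤ 2 * (Q:ℝ) * (Γ / Y) * (Q * Q ^ 4) := by gcongr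
    _ = 2 * Γ * (Q ^ 6 / Y) := by ring
    _ ≤ 2 * Γ * 1 := by
        gcongr
        rw [div_le_one (by linarith)]
        exact (pow_le_pow_right₀ hQr (by norm_num)).trans hYQ
    _ = _ := by ring

lemma params (E W H A : ℕ) (hE : 1 ≤ E) (hW : 1 ≤ W) : ∀ᶠ L : ℝ in Filter.atTop, ∃ z Y : ℕ, 2 ≤ z ∧
    1 / 512 * L / (4 * E) ≤ Real.log z ∧ (z:ℝ) ^ (2 * E) ≤ Real.exp (1 / 512 * L) ∧
    4 * (2 * (W:ℝ) + 1) * W ≤ Real.log z ∧ (L ^ A) ^ 3 ≤ z ∧ (W * (z ^ (2 * E)) ^ 2) ^ 21 < Y ∧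
    Real.log (Y + H : ℕ) ≤ L / 7 ∧ L / 16 ≤ Real.log ((Y - 1 : ℕ) : ℝ) ∧ 10 ^ 8 ≤ Y := by
  have hEr : (1:ℝ) ≤ E := by exact_mod_cast hE
  have hexp : ∀ (c C : ℝ), 0 < c → ∀ᶠ L : ℝ in Filter.atTop, C ≤ Real.exp (c * L) := fun c C hc =>
    (Real.tendsto_exp_atTop.comp (Filter.tendsto_id.const_mul_atTop hc)).eventually (Filter.eventually_ge_atTop C)
  have hpoly : ∀ᶠ L : ℝ in Filter.atTop, L ^ (A * 3) ≤ Real.exp (1 / (2048 * E) * L) := by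
    have := (isLittleO_pow_exp_pos_mul_atTop (A * 3) (b := 1 / (2048 * E)) (by positivity)).bound (c := 1) one_pos
    filter_upwards [this] with L hL
    rw [one_mul, Real.norm_eq_abs, Real.norm_eq_abs, abs_of_pos (Real.exp_pos _)] at hL
    exact (le_abs_self _).trans hL
  filter_upwards [hexp (1 / (2048 * E)) 2 (by positivity), hpoly, hexp (1 / 32) (W ^ 21) (by norm_num),
    hexp (1 / 128) 4 (by norm_num), hexp (1 / 8) (H + 2 * 10 ^ 8) (by norm_num), hexp (1 / 56) 2 (by norm_num),
    Filter.eventually_ge_atTop (2048 * E * (4 * (2 * (W:ℝ) + 1) * W)), Filter.eventually_ge_atTop 0,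
    hexp (1 / 16) 4 (by norm_num)] with L h2 hp hW21 h4 hH h56 hLW hL0 h16
  set x := Real.exp (1 / (2048 * E) * L) with hx
  have hx2 : Real.exp (1 / (1024 * E) * L) = x ^ 2 := by
    rw [hx, ← Real.exp_nat_mul]; congr 1; field_simp; norm_num; ring
  set z := ⌊x ^ 2⌋₊ with hz
  have hxz : x ≤ z := by
    have := Nat.lt_floor_add_one (x ^ 2)
    rw [← hz] at this
    nlinarith
  have hz2 : (2:ℝ) ≤ z := h2.trans hxz
  have hzx : (z:ℝ) ≤ x ^ 2 := Nat.floor_le (by positivity)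
  have hlz : 1 / (2048 * E) * L ≤ Real.log z := by
    rw [Real.le_log_iff_exp_le (by linarith)]; exact hxz
  have hzE : (z:ℝ) ^ (2 * E) ≤ Real.exp (1 / 512 * L) := by
    calc (z:ℝ) ^ (2 * E) ≤ (x ^ 2) ^ (2 * E) := by gcongr
      _ = _ := by
        rw [← hx2, ← Real.exp_nat_mul]; congr 1; push_cast; field_simp; norm_num; ring
  set w := Real.exp (1 / 8 * L) with hw
  set Y := ⌊w⌋₊ with hY
  have hYw : (Y:ℝ) ≤ w := Nat.floor_le (Real.exp_pos _).le
  have hwY : w < Y + 1 := Nat.lt_floor_add_one w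
  have hH0 : (0:ℝ) ≤ H := Nat.cast_nonneg _
  have hY8 : (10:ℝ) ^ 8 ≤ Y := by linarith
  have hY1 : 1 ≤ Y := by
    have : (1:ℝ) ≤ Y := by linarith
    exact_mod_cast this
  refine ⟨z, Y, by exact_mod_cast hz2, ?_, hzE, ?_, ?_, ?_, ?_, ?_, by exact_mod_cast hY8⟩
  · refine le_trans (le_of_eq ?_) hlz
    field_simp; norm_num; ring
  · refine le_trans ?_ hlz
    rw [div_mul_eq_mul_div, one_mul, le_div_iff₀ (by positivity)]
    linarith
  · rw [← pow_mul]; exact hp.trans hxz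
  · have e : ((W * (z ^ (2 * E)) ^ 2) ^ 21 : ℝ) ≤ Real.exp (1 / 32 * L) * Real.exp (1 / 512 * L) ^ 42 := by
      calc ((W * (z ^ (2 * E)) ^ 2) ^ 21 : ℝ) = W ^ 21 * ((z:ℝ) ^ (2 * E)) ^ 42 := by ring
        _ ≤ _ := by gcongr
    have e2 : Real.exp (1 / 32 * L) * Real.exp (1 / 512 * L) ^ 42 * Real.exp (1 / 128 * L) ≤ w := by
      rw [← Real.exp_nat_mul, ← Real.exp_add, ← Real.exp_add, hw]
      apply Real.exp_le_exp.2
      push_cast; linarith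
    have e3 : 1 ≤ Real.exp (1 / 32 * L) * Real.exp (1 / 512 * L) ^ 42 :=
      one_le_mul_of_one_le_of_one_le (Real.one_le_exp (by positivity)) (one_le_pow₀ (Real.one_le_exp (by positivity)))
    have : ((W * (z ^ (2 * E)) ^ 2) ^ 21 : ℝ) < Y := by nlinarith
    exact_mod_cast this
  · have hYH : ((Y + H : ℕ) : ℝ) ≤ Real.exp (L / 7) := by
      have : Real.exp (L / 7) = w * Real.exp (1 / 56 * L) := by
        rw [hw, ← Real.exp_add]; congr 1; ring
      rw [this]; push_cast
      nlinarith
    rw [Real.log_le_iff_le_exp (by exact_mod_cast (by omega))]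
    exact hYH
  · have e : Real.exp (L / 16) ^ 2 = w := by
      rw [hw, ← Real.exp_nat_mul]; congr 1; push_cast; ring
    rw [show 1 / 16 * L = L / 16 by ring] at h16
    rw [Nat.cast_sub hY1, Nat.cast_one, Real.le_log_iff_exp_le (by linarith)]
    nlinarith

end PD

namespace PD
open Finset

lemma Z_le {k W R : ℕ} {L : ℝ} (hL : Real.exp (30 * k) * 2 ^ (24 * k) ≤ L) (hL1 : 1 ≤ L)
    (hR : (R:ℝ) ≤ Real.exp (1 / 512 * L)) :
    ∏ p : ↥(Pset W R), (1 + ((3 * k : ℕ) : ℝ) * (1 / (((p : ℕ) : ℝ) - 1))) ≤ L ^ (24 * k + 1) := by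
  have hm1 : L ≤ ⌈L⌉₊ := Nat.le_ceil L
  have hm2 : (⌈L⌉₊ : ℝ) ≤ 2 * L := by linarith [Nat.ceil_lt_add_one (by linarith : 0 ≤ L)]
  have hm : 1 ≤ ⌈L⌉₊ := by
    have : (1:ℝ) ≤ ⌈L⌉₊ := hL1.trans hm1
    exact_mod_cast this
  have hRm : R ≤ 2 ^ ⌈L⌉₊ := by
    have : (R:ℝ) ≤ 2 ^ ⌈L⌉₊ := by
      refine hR.trans ?_
      rw [← Real.rpow_natCast, Real.rpow_def_of_pos two_pos]
      apply Real.exp_le_exp.2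
      nlinarith [Real.log_two_gt_d9]
    exact_mod_cast this
  refine (Z_polylog W R ⌈L⌉₊ (3 * k) hm hRm).trans ?_
  calc Real.exp (10 * (3 * k : ℕ)) * (⌈L⌉₊ : ℝ) ^ (8 * (3 * k)) ≤ Real.exp (30 * k) * (2 * L) ^ (24 * k) := by
        rw [show 8 * (3 * k) = 24 * k by ring]
        push_cast
        rw [show (10 * (3 * (k:ℝ))) = 30 * k by ring]
        gcongr
    _ = Real.exp (30 * k) * 2 ^ (24 * k) * L ^ (24 * k) := by rw [mul_pow]; ring
    _ ≤ L * L ^ (24 * k) := by gcongr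
    _ = _ := by ring

/-- the final numerical contradiction -/
lemma final_num {k W E : ℕ} {L Hk lz V Γ F S Er : ℝ} (hk : 1 ≤ k) (hW : 1 ≤ W) (hHk : 512 * 22528 * 3 < Hk)
    (hE0 : 1 ≤ E) (hE : (E:ℝ) ≤ 11 * k * Hk) (hlz : 1 / 512 * L / (4 * E) ≤ lz) (hV : 1 ≤ V) (hΓ : 0 < Γ)
    (hL : 1 + W * (300000 * k * W + 2) ≤ L) (hEr : Er ≤ 300000 * W * Γ) (hF : F ≤ 2 * L * Γ) (hS : S ≤ 2 * Γ)
    (hm : k * ((1 / W * lz * Hk ^ 2 / 128 * V) * (1 / 4 * Γ) - Er) ≤ 1 / W * F * V + S) : False := by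
  have hWr : (1:ℝ) ≤ W := by exact_mod_cast hW
  have hkr : (1:ℝ) ≤ k := by exact_mod_cast hk
  have hEr1 : (1:ℝ) ≤ E := by exact_mod_cast hE0
  have hH0 : 0 < Hk := by linarith
  have hL0 : 0 < L := by
    have : (0:ℝ) ≤ W * (300000 * k * W + 2) := by positivity
    linarith
  have h1 : 3 * L < k * (lz * Hk ^ 2 / 128 * (1 / 4)) := by
    have a1 : 1 / 512 * L ≤ lz * (4 * E) := by
      rwa [div_le_iff₀ (by positivity)] at hlz
    have hlz0 : 0 ≤ lz := le_trans (by positivity) hlz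
    have a2 : 1 / 512 * L ≤ lz * (4 * (11 * k * Hk)) := a1.trans (by gcongr)
    have a3 : L * Hk ≤ lz * (4 * (11 * k * Hk)) * 512 * Hk := by nlinarith
    have a4 : 512 * 22528 * 3 * L < Hk * L := by gcongr
    nlinarith
  have h2 : k * ((1 / W * lz * Hk ^ 2 / 128 * V) * (1 / 4 * Γ)) = (k * (lz * Hk ^ 2 / 128 * (1 / 4))) * (Γ * V / W) := by
    ring
  have h3 : 3 * L * (Γ * V / W) ≤ (k * (lz * Hk ^ 2 / 128 * (1 / 4))) * (Γ * V / W) := by gcongr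
  have h4 : 1 / W * F * V ≤ 2 * L * (Γ * V / W) := by
    calc 1 / W * F * V ≤ 1 / W * (2 * L * Γ) * V := by gcongr
      _ = _ := by ring
  have h5 : (k:ℝ) * Er ≤ k * (300000 * W * Γ) := by gcongr
  have h6 : L * (Γ * V / W) ≤ k * (300000 * W * Γ) + 2 * Γ := by nlinarith
  have h7 : L * (Γ / W) ≤ L * (Γ * V / W) := by
    gcongr
    nlinarith
  have h8 : L * Γ ≤ (k * (300000 * W * Γ) + 2 * Γ) * W := by
    have := h7.trans h6
    rw [mul_div_assoc', div_le_iff₀ (by linarith)] at this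
    exact this
  have h9 : (1 + W * (300000 * k * W + 2)) * Γ ≤ L * Γ := by gcongr
  nlinarith

set_option maxHeartbeats 1000000 in
theorem dhl : DHL := by
  classical
  obtain ⟨k, hk, hHk⟩ := harm_large (512 * 22528 * 3)
  refine ⟨k, k.factorial, Nat.factorial_pos _, fun h hinj hd => ?_⟩
  by_contra hcon
  push Not at hcon
  have hone : ∀ m i i', (m + h i).Prime → (m + h i').Prime → i = i' := by
    have key : ∀ m i i', (m + h i).Prime → (m + h i').Prime → ¬ h i' < h i := fun m i i' hi hi' hlt =>
      hcon i i' hlt ⟨m + h i, m + h i', hi, hi', by omega, by omega⟩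
    intro m i i' hi hi'
    have h1 := key m i i' hi hi'
    have h2 := key m i' i hi' hi
    exact hinj (by omega)
  obtain ⟨W, b, hW0, hWp, hb⟩ := Wb_exists (64 * (k + 1) ^ 2) h hinj hd
  set Hk := harm k with hHkd
  have hkr : (1:ℝ) ≤ k := by exact_mod_cast hk
  have hWr : (1:ℝ) ≤ W := by exact_mod_cast hW0
  set H := ∑ i, h i with hHd
  have hH : ∀ i, h i ≤ H := fun i => Finset.single_le_sum (f := h) (fun _ _ => Nat.zero_le _) (mem_univ i)
  set E := ⌈10 * k * Hk⌉₊ with hEd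
  have hE1 : 10 * k * Hk ≤ E := Nat.le_ceil _
  have hE2 : (E:ℝ) ≤ 11 * k * Hk := by
    have := Nat.ceil_lt_add_one (a := 10 * k * Hk) (by positivity)
    rw [← hEd] at this
    nlinarith
  have hE0 : 1 ≤ E := by
    have : (1:ℝ) ≤ E := by nlinarith
    exact_mod_cast this
  clear_value E H
  set A := 24 * k + 1 with hA
  set α : ℝ := (16 * A + 18 : ℕ) / Real.log 2 with hα
  have hα0 : 0 < α := by
    have := Real.log_pos one_lt_two
    rw [hα]; positivity
  have hsLtend : Filter.Tendsto (fun j : ℕ => sL α j) Filter.atTop Filter.atTop := by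
    unfold sL
    exact Real.tendsto_exp_atTop.comp (tendsto_natCast_atTop_atTop.atTop_div_const hα0)
  have hhalf : ∀ᶠ j : ℕ in Filter.atTop, (j:ℝ) * (1 / 2) ^ j ≤ 1 / 100 :=
    (tendsto_self_mul_const_pow_of_lt_one (by norm_num : (0:ℝ) ≤ 1 / 2) (by norm_num)).eventually
      (eventually_le_nhds (by norm_num))
  have hev := (hsLtend.eventually (params E W H A hE0 hW0)).and
    ((hsLtend.eventually (Filter.eventually_ge_atTop (Real.exp (30 * k) * 2 ^ (24 * k)))).and
    ((hsLtend.eventually (Filter.eventually_ge_atTop (1 + (W:ℝ) * (300000 * k * W + 2)))).and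
    ((hsLtend.eventually (Filter.eventually_ge_atTop (7:ℝ))).and
    ((poly_le_sL hα0 80 1).and (hhalf.and (Filter.eventually_ge_atTop 1))))))
  obtain ⟨J, hJ⟩ := Filter.eventually_atTop.1 hev
  obtain ⟨j, hjJ, hgood⟩ := goodScale hα0 (2 * (3 * A + 4)) J
  obtain ⟨⟨z, Y, hz2, hlz, hzE, hzW, hLz, hY, hlYH, hlY, hY8⟩, hL1, hL2, hL7, hLj, hjj, hj⟩ := hJ j hjJ
  rw [pow_one] at hLj
  set L := sL α j with hLd
  set ε := sE α j with hεd
  have hε : ε = j / L := rfl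
  have hj1 : (1:ℝ) ≤ j := by exact_mod_cast hj
  have hε0 : 0 < ε := sE_pos α hj
  have hL0 : 0 < L := by linarith
  have hε1 : ε ≤ 1 := by rw [hε, div_le_one hL0]; linarith
  have hLM : L ^ (16 * A + 18) = 2 ^ j := by
    rw [hLd, sL, ← Real.exp_nat_mul, hα]
    have h2 : (2:ℝ) ^ j = Real.exp (j * Real.log 2) := by
      rw [Real.exp_nat_mul, Real.exp_log two_pos]
    rw [h2]; congr 1
    have := Real.log_pos one_lt_two
    field_simp
  set Γ := (j.factorial : ℝ) / ε ^ (j + 1) with hΓ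
  have hΓ0 : 0 < Γ := by positivity
  obtain ⟨T, ⟨hT2, hT⟩, hTP, hTY⟩ := ((T_exists hε0 j (j + 4)).and
    ((((Psi_tendsto hε0 j).comp (Real.tendsto_log_atTop.comp tendsto_natCast_atTop_atTop)).eventually
      (eventually_le_nhds (by positivity : (0:ℝ) < 1 / 100 * Γ))).and
      (Filter.eventually_gt_atTop (Y + H)))).exists
  have hφ : 1 ≤ W.totient := Nat.totient_pos.2 hW0
  have hφr : (1:ℝ) ≤ W.totient := by exact_mod_cast hφ
  have hlz0 : 0 ≤ Real.log z := le_trans (by positivity) hlz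
  obtain ⟨V, hV1, hVT, hV2⟩ := sieve_main (k := k) (W := W) (z := z) (D0 := 64 * (k + 1) ^ 2) (E := E) hk hW0 hz2 le_rfl
    (fun p hp hpW => (hWp p hp hpW).1) hE1 (by
      rw [div_mul_eq_mul_div, le_div_iff₀ (by linarith)]
      nlinarith only [hφr, hlz0, hzW])
  set R := z ^ (2 * E) with hRd
  have hR1 : 1 ≤ R := Nat.one_le_pow _ _ (by omega)
  have hzR : z ≤ R := Nat.le_self_pow (by omega) z
  have hzQ : z ≤ W * R ^ 2 := by
    calc z ≤ R := hzR
      _ ≤ R ^ 2 := Nat.le_self_pow (by omega) R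
      _ ≤ _ := Nat.le_mul_of_pos_left _ hW0
  have hRL : (R:ℝ) ≤ Real.exp (1 / 512 * L) := by rw [hRd]; push_cast; exact hzE
  clear_value R
  have hPm : ∀ p : ↥(Pset W R), (p : ℕ).Prime ∧ ¬ (p : ℕ) ∣ W := fun p => (mem_Pset.1 p.2).2
  have hZ := Z_le (W := W) hL1 (by linarith) hRL
  rw [← hA] at hZ
  have hLA1 : 1 ≤ L ^ A := one_le_pow₀ (by linarith)
  have hLAz : L ^ A ≤ z := (le_self_pow₀ hLA1 (by norm_num)).trans hLz
  have hLAQ : L ^ A ≤ (W * R ^ 2 : ℕ) := hLAz.trans (by exact_mod_cast hzQ)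
  have hl1 : ∀ D, |lamS k W z R D| ≤ L ^ A := by
    intro D
    refine (lam_abs_le (fun p : ↥(Pset W R) => (p:ℕ)) (fun p => (hPm p).1.pos) (gz_nonneg z k) (gz_le_one z k) R D).trans
      (le_trans ?_ hZ)
    refine Finset.prod_le_prod (fun p _ => by positivity) fun p _ => ?_
    have hp2 : (2:ℝ) ≤ ((p:ℕ):ℝ) := by exact_mod_cast (hPm p).1.two_le
    have : 1 / ((p:ℕ):ℝ) ≤ 1 / (((p:ℕ):ℝ) - 1) := one_div_le_one_div_of_le (by linarith) (by linarith)
    have h0 : 0 ≤ 1 / ((p:ℕ):ℝ) := by positivity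
    rw [Fintype.card_fin]; push_cast
    have h3 := mul_le_mul_of_nonneg_left this (by linarith : (0:ℝ) ≤ k)
    have h4 : 0 ≤ (k:ℝ) * (1 / ((p:ℕ):ℝ)) := by positivity
    rw [mul_assoc]
    linarith only [h3, h4]
  have hlogY : Real.log Y ≤ Real.log (Y + H : ℕ) :=
    Real.log_le_log (by exact_mod_cast (by omega)) (by exact_mod_cast (by omega))
  have hlogY1 : Real.log ((Y - 1 : ℕ) : ℝ) ≤ Real.log (Y + H : ℕ) :=
    Real.log_le_log (by exact_mod_cast (by omega)) (by exact_mod_cast (by omega))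
  have hTheta := Theta_final (L := L) (y := Y + H) (T := T) hL7 hj hε hjj (by omega) hTY.le (by linarith) hlYH hTP
  have hErr := Err_le (L := L) (A := A) (W := W) (Q := W * R ^ 2) (y := Y + H) (by linarith) hj hε (by linarith) hLM
    (hLz.trans (by exact_mod_cast hzQ)) (by omega) (by omega) hW0
  have hE1' := E1_le (W := W) (R := R) (Y := Y) (Z := L ^ A) hL0 hj hε hjj (by linarith) hW0 hR1 hLAQ hY (by linarith)
  have hm := master (κ := Fin k) (fun p : ↥(Pset W R) => (p:ℕ)) (fun p => (hPm p).1) Subtype.val_injective hW0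
    (fun p => (hPm p).2) b h (fun p => (hWp p (hPm p).1 (hPm p).2).2) hb
    (fun p => by
      have h1 := (hWp p (hPm p).1 (hPm p).2).1
      have h2 : (64 * ((k:ℝ) + 1) ^ 2) ≤ ((p:ℕ):ℝ) := by exact_mod_cast h1.le
      rw [Fintype.card_fin]
      nlinarith only [h2, hkr])
    (by rw [Fintype.card_fin]; exact hk) (lamS k W z R) (R := R)
    (fun D hD => lam_zero (fun p : ↥(Pset W R) => (p:ℕ)) (fun p => (hPm p).1.pos) (gz z k) R D hD)
    (Z := L ^ A) hl1 (by
      rw [Fintype.card_fin]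
      push_cast at hZ
      exact hZ) hLAQ (by omega) (fun p => (mem_Pset.1 p.2).1) hε0 hε1 hgood hY hTY hH hlYH
    (by push_cast; linarith) hT hT2 hone hVT (by linarith) (c2 := 1 / W * Real.log z * Hk ^ 2 / 128 * V) (Θ := 1 / 4 * Γ)
    (by positivity) (by positivity) (fun i => by
      refine le_trans (le_of_eq ?_) (mul_le_mul_of_nonneg_left (hV2 i) (by positivity))
      rw [hHkd]; field_simp) hTheta
  rw [Fintype.card_fin] at hm
  exact final_num hk hW0 hHk hE0 hE2 hlz hV1 hΓ0 hL2 hErr (gam_one hL0 hj hε) hE1' hm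

end PD

/-- There is a natural number `k ∈ ℙ − ℙ` such that
`k·ℕ ⊆ (ℙ − ℙ)·(ℙ − ℙ)`: every positive multiple of `k` is a product of
two differences of primes. -/
theorem exists_primeDiff_mulN_subset_primeDiff_mul_primeDiff :
    ∃ k ∈ primeDiff, ∀ n : ℕ, 0 < n →
      ∃ a ∈ primeDiff, ∃ b ∈ primeDiff, k * n = a * b := by
  exact PD.final_of_DHL PD.dhl
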